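/- If α ≠ pβ, then π(α) (resp. π(β)) possesses GL₂(ℚ_p)-stable 𝒪_L-lattices, and any two GL₂(ℚ_p)-stable 𝒪_L-lattices Λ₁, Λ₂ of π(α) (resp. of π(β)) are commensurable: there exist c₁, c₂ ∈ L^× with Λ₁ ⊆ c₁Λ₂ and Λ₂ ⊆ c₂Λ₁. If α = pβ, the same holds for π(α). -/

import Mathlib

open Filter Topology Classical

noncomputable section

namespace Paper

variable (p : ℕ) [Fact p.Prime]
variable (L : Type) [NontriviallyNormedField L] [NormedAlgebra ℚ_[p] L]

/-- The canonical embedding `ℚ_p → L`. -/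
noncomputable def iotaL : ℚ_[p] → L := algebraMap ℚ_[p] L

/-- The binomial coefficient `binom(z, n) = z(z-1)⋯(z-n+1)/n!` of a `p`-adic
integer, computed in `ℚ_p`. -/
noncomputable def binomQ (z : ℤ_[p]) (n : ℕ) : ℚ_[p] :=
  (∏ i ∈ Finset.range n, ((z : ℚ_[p]) - (i : ℚ_[p]))) / (n.factorial : ℚ_[p])

/-- The Mahler coefficients `a_n(f) = ∑_{i=0}^n (-1)^i binom(n,i) f(n-i)`. -/
noncomputable def mahlerCoeff (f : ℤ_[p] → L) (n : ℕ) : L :=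
  ∑ i ∈ Finset.range (n + 1), (-1 : L) ^ i * (n.choose i : L) * f (((n - i : ℕ) : ℤ_[p]))

/-- `f : ℤ_p → L` is of class `C^r` : the scaled Mahler coefficients
`n^r a_n(f)` tend to `0`, and `f` is the sum of its Mahler expansion. -/
def IsCr (r : ℝ) (f : ℤ_[p] → L) : Prop :=
  Tendsto (fun n : ℕ => (n : ℝ) ^ r * ‖mahlerCoeff p L f n‖) atTop (nhds 0) ∧
  ∀ z : ℤ_[p], HasSum (fun n : ℕ => mahlerCoeff p L f n * iotaL p L (binomQ p z n)) (f z)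

/-- The norm `‖f‖_r = sup_n (n+1)^r ‖a_n(f)‖` on `C^r(ℤ_p, L)`. -/
noncomputable def crNorm (r : ℝ) (f : ℤ_[p] → L) : ℝ :=
  ⨆ n : ℕ, ((n : ℝ) + 1) ^ r * ‖mahlerCoeff p L f n‖

/-- A continuous (= bounded) linear functional on `C^r(ℤ_p, L)`, i.e. a tempered
distribution of order `r`. -/
structure CrDual (r : ℝ) where
  toFun : (ℤ_[p] → L) → L
  map_add' : ∀ f g : ℤ_[p] → L, IsCr p L r f → IsCr p L r g →
    toFun (f + g) = toFun f + toFun g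
  map_smul' : ∀ (c : L) (f : ℤ_[p] → L), IsCr p L r f → toFun (c • f) = c * toFun f
  bound' : ∃ C : ℝ, ∀ f : ℤ_[p] → L, IsCr p L r f → ‖toFun f‖ ≤ C * crNorm p L r f

/-- The function `z ↦ 1_{a + pⁿℤ_p}(z) (z - a)^j`. -/
noncomputable def indPoly (a : ℤ_[p]) (n : ℕ) (j : ℕ) : ℤ_[p] → L := fun z =>
  if ‖z - a‖ ≤ (p : ℝ) ^ (-(n : ℤ)) then (iotaL p L ((z : ℚ_[p]) - (a : ℚ_[p]))) ^ j else 0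

/-- The norm `‖μ‖_{r,d} = sup_{a, 0 ≤ j ≤ d, n} p^{n(j-r)} ‖∫_{a+pⁿℤ_p} (z-a)^j dμ‖`. -/
noncomputable def dualNormRD (r : ℝ) (d : ℕ) (μ : CrDual p L r) : ℝ :=
  ⨆ (a : ℤ_[p]) (j : Fin (d + 1)) (n : ℕ),
    (p : ℝ) ^ ((n : ℝ) * (((j : ℕ) : ℝ) - r)) * ‖μ.toFun (indPoly p L a n j)‖

/-- `f : ℤ_p → L` is locally polynomial of local degree at most `d`. -/
def IsLocPoly (d : ℕ) (f : ℤ_[p] → L) : Prop :=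
  ∃ n : ℕ, ∀ a : ℤ_[p], ∃ P : Polynomial L, P.natDegree ≤ d ∧
    ∀ z : ℤ_[p], ‖z - a‖ ≤ (p : ℝ) ^ (-(n : ℤ)) → f z = Polynomial.eval (iotaL p L (z : ℚ_[p])) P

/-- A linear functional on `Pol^d(ℤ_p, L)`. -/
structure PolDual (d : ℕ) where
  toFun : (ℤ_[p] → L) → L
  map_add' : ∀ f g : ℤ_[p] → L, IsLocPoly p L d f → IsLocPoly p L d g →
    toFun (f + g) = toFun f + toFun g
  map_smul' : ∀ (c : L) (f : ℤ_[p] → L), IsLocPoly p L d f → toFun (c • f) = c * toFun f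

/-- The valuation `val(x) = -log_p ‖x‖` on `L`, normalized by `val(p) = 1`. -/
noncomputable def valL (x : L) : ℝ := -Real.logb p ‖x‖

/-- `g : ℤ_p → L` is a class-`C^{val α}` extension of
`z ↦ (αp/β)^{val z} z^{k-2} f(1/z)` from `ℤ_p ∖ {0}` to `ℤ_p`. -/
def Ext2 (k : ℕ) (α β : L) (f : ℚ_[p] → L) (g : ℤ_[p] → L) : Prop :=
  IsCr p L (valL p L α) g ∧ ∀ z : ℤ_[p], z ≠ 0 →
    g z = (α * (p : L) / β) ^ ((z : ℚ_[p]).valuation) *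
      (iotaL p L (z : ℚ_[p])) ^ (k - 2) * f (((z : ℚ_[p]))⁻¹)

/-- Membership in the Banach space `B(α)`. -/
def MemB (k : ℕ) (α β : L) (f : ℚ_[p] → L) : Prop :=
  IsCr p L (valL p L α) (fun z : ℤ_[p] => f ((p : ℚ_[p]) * (z : ℚ_[p]))) ∧
  ∃ g : ℤ_[p] → L, Ext2 p L k α β f g

/-- The extension `f₂` of `z ↦ (αp/β)^{val z} z^{k-2} f(1/z)` to `ℤ_p`
(it is unique when it exists). -/
noncomputable def ext2 (k : ℕ) (α β : L) (f : ℚ_[p] → L) : ℤ_[p] → L :=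
  if h : ∃ g : ℤ_[p] → L, Ext2 p L k α β f g then h.choose else 0

/-- The norm `‖f‖ = max(‖f₁‖_{val α}, ‖f₂‖_{val α})` on `B(α)`. -/
noncomputable def bNorm (k : ℕ) (α β : L) (f : ℚ_[p] → L) : ℝ :=
  max (crNorm p L (valL p L α) (fun z : ℤ_[p] => f ((p : ℚ_[p]) * (z : ℚ_[p]))))
      (crNorm p L (valL p L α) (ext2 p L k α β f))

/-- Determinant of a 2×2 matrix. -/
noncomputable def det2 (m : Matrix (Fin 2) (Fin 2) ℚ_[p]) : ℚ_[p] :=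
  m 0 0 * m 1 1 - m 0 1 * m 1 0

/-- The action of `g = (a b; c d) ∈ GL₂(ℚ_p)` on `B(α)`:
`(g·f)(z) = α^{-val(ad-bc)} (αp/β)^{val(-cz+a)} (-cz+a)^{k-2} f((dz-b)/(-cz+a))`,
the value at the pole `-cz+a = 0` being the one prescribed by the extension `f₂`. -/
noncomputable def gAct (k : ℕ) (α β : L) (m : Matrix (Fin 2) (Fin 2) ℚ_[p])
    (f : ℚ_[p] → L) : ℚ_[p] → L := fun z =>
  if -(m 1 0) * z + m 0 0 = 0 then
    α ^ (-(det2 p m).valuation) * (α * (p : L) / β) ^ ((det2 p m / m 1 0).valuation) *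
      (iotaL p L (det2 p m / m 1 0)) ^ (k - 2) * ext2 p L k α β f 0
  else
    α ^ (-(det2 p m).valuation) * (α * (p : L) / β) ^ ((-(m 1 0) * z + m 0 0).valuation) *
      (iotaL p L (-(m 1 0) * z + m 0 0)) ^ (k - 2) *
      f ((m 1 1 * z - m 0 1) / (-(m 1 0) * z + m 0 0))

/-- The monomial function `z ↦ z^j` on `ℚ_p`. -/
noncomputable def monomialFun (j : ℕ) : ℚ_[p] → L := fun z => (iotaL p L z) ^ j

/-- The function `z ↦ (αp/β)^{val(z-a)} (z-a)^{k-2-j}` (extended by `0` at `z = a`). -/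
noncomputable def specFun (k : ℕ) (α β : L) (a : ℚ_[p]) (j : ℕ) : ℚ_[p] → L := fun z =>
  if z = a then 0 else
    (α * (p : L) / β) ^ ((z - a).valuation) * (iotaL p L (z - a)) ^ (k - 2 - j)

/-- The generators of `L(α)` : the functions `z^j` and
`(αp/β)^{val(z-a)}(z-a)^{k-2-j}` for `0 ≤ j < val(α)` and `a ∈ ℚ_p`. -/
def lGen (k : ℕ) (α β : L) : Set (ℚ_[p] → L) :=
  {f | ∃ j : ℕ, (j : ℝ) < valL p L α ∧
    (f = monomialFun p L j ∨ ∃ a : ℚ_[p], f = specFun p L k α β a j)}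

/-- Membership in `L(α)`, the closure in `B(α)` of the span of the special
functions. -/
def MemLalpha (k : ℕ) (α β : L) (f : ℚ_[p] → L) : Prop :=
  MemB p L k α β f ∧ ∀ ε : ℝ, 0 < ε →
    ∃ g ∈ Submodule.span L (lGen p L k α β), bNorm p L k α β (f - g) < ε

/-- The quotient (semi)norm on `Π(V) = B(α)/L(α)`. -/
noncomputable def qNorm (k : ℕ) (α β : L) (f : ℚ_[p] → L) : ℝ :=
  sInf {x : ℝ | ∃ g : ℚ_[p] → L, MemLalpha p L k α β g ∧ x = bNorm p L k α β (f - g)}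

/-- `h : ℚ_p → L` is locally constant. -/
def LocConst (h : ℚ_[p] → L) : Prop :=
  ∀ x : ℚ_[p], ∃ n : ℕ, ∀ y : ℚ_[p], ‖y - x‖ ≤ (p : ℝ) ^ (-(n : ℤ)) → h y = h x

/-- `h` belongs to the smooth induced representation: `h` is locally constant and
`z ↦ (αp/β)^{val z} h(1/z)` extends to a locally constant function on `ℚ_p`. -/
def IndCond (α β : L) (h : ℚ_[p] → L) : Prop :=
  LocConst p L h ∧ ∃ h' : ℚ_[p] → L, LocConst p L h' ∧
    ∀ z : ℚ_[p], z ≠ 0 → h' z = (α * (p : L) / β) ^ z.valuation * h z⁻¹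

/-- The generators `z ↦ P(z) h(z)` of the locally algebraic representation `π(α)`. -/
def piGen (k : ℕ) (α β : L) : Set (ℚ_[p] → L) :=
  {f | ∃ (P : Polynomial L) (h : ℚ_[p] → L), P.natDegree ≤ k - 2 ∧ IndCond p L α β h ∧
    f = fun z => Polynomial.eval (iotaL p L z) P * h z}

/-- The locally algebraic representation `π(α)`, as a subspace of functions
`ℚ_p → L`. -/
noncomputable def piRep (k : ℕ) (α β : L) : Submodule L (ℚ_[p] → L) :=
  Submodule.span L (piGen p L k α β)

/-- The standing hypotheses on `(k, α, β)` coming from an absolutely irreducible,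
`φ`-semisimple crystalline representation: `k ≥ 2`, `α ≠ β`,
`0 < val(β) ≤ val(α)` and `val(α) + val(β) = k - 1`. -/
def Hyps (k : ℕ) (α β : L) : Prop :=
  2 ≤ k ∧ α ≠ β ∧ 0 < valL p L α ∧ 0 < valL p L β ∧
    valL p L α + valL p L β = (k : ℝ) - 1 ∧ valL p L β ≤ valL p L α

/-- `Λ` is a `GL₂(ℚ_p)`-stable `𝒪_L`-lattice in `π(α)`: an `𝒪_L`-submodule of
`π(α)` generating it over `L`, containing no `L`-line and stable by the action. -/
def IsLatticeStable (k : ℕ) (α β : L) (Λ : Set (ℚ_[p] → L)) : Prop :=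
  (∀ f ∈ Λ, f ∈ piRep p L k α β) ∧ ((0 : ℚ_[p] → L) ∈ Λ) ∧
  (∀ f ∈ Λ, ∀ g ∈ Λ, f + g ∈ Λ) ∧
  (∀ c : L, ‖c‖ ≤ 1 → ∀ f ∈ Λ, c • f ∈ Λ) ∧
  (∀ f ∈ piRep p L k α β, ∃ c : L, c ≠ 0 ∧ c • f ∈ Λ) ∧
  (∀ f, f ∈ piRep p L k α β → f ≠ 0 → ¬ ∀ c : L, c • f ∈ Λ) ∧
  (∀ m : Matrix (Fin 2) (Fin 2) ℚ_[p], det2 p m ≠ 0 → ∀ f ∈ Λ, gAct p L k α β m f ∈ Λ)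

/-- `Λ₁` and `Λ₂` are commensurable lattices: `Λ₁ ⊆ c₁Λ₂` and `Λ₂ ⊆ c₂Λ₁` for
some `c₁, c₂ ∈ L^×`. -/
def Commensurable' (Λ₁ Λ₂ : Set (ℚ_[p] → L)) : Prop :=
  ∃ c₁ : L, c₁ ≠ 0 ∧ (∀ f ∈ Λ₁, ∃ g ∈ Λ₂, f = c₁ • g) ∧
  ∃ c₂ : L, c₂ ≠ 0 ∧ ∀ f ∈ Λ₂, ∃ g ∈ Λ₁, f = c₂ • g

end Paper

set_option linter.unusedSectionVars false

namespace PadicPi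

open Paper Polynomial Finset Submodule Padic IsUltrametricDist
open LinearMap (mulRight comp_apply mk₂ funLeft comp_id)
open Module (End Dual algebraMap_end_apply)
open PowerSeries (coeff_mk trunc coeff_zero_eq_constantCoeff_apply coeff_trunc)
open Module.End (one_eq_id)
open PowerSeries.WithPiTopology (tendsto_iff_coeff_tendsto)
open scoped PowerSeries PowerSeries.WithPiTopology

variable {p : ℕ} [Fact p.Prime] {L : Type} [NontriviallyNormedField L] [NormedAlgebra ℚ_[p] L]
variable {m : ℕ} {α β : L}

local notation "η" => algebraMap ℚ_[p] L
local notation "𝔭" => (p : ℚ_[p])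

/-- The number `q = αp/β`. -/
def qq (p : ℕ) (α β : L) : L := α * p / β

local notation "𝔮" => qq p α β

/-- Families indexed by a level, a residue and a degree. -/
abbrev Arr (V : Type*) := ℕ → ℕ → ℕ → V

section Bounds

/-- The `i`-th coefficient of `f` has norm at most `c * θ ^ i`, for all `i`. -/
def Bd (c θ : ℝ) (f : L⟦X⟧) : Prop := ∀ i, ‖PowerSeries.coeff i f‖ ≤ c * θ ^ i

lemma Bd.mono {c c' θ θ' : ℝ} {f : L⟦X⟧} (h : Bd c θ f) (hc : c ≤ c') (hc0 : 0 ≤ c')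
    (hθ0 : 0 ≤ θ) (hθ : θ ≤ θ') : Bd c' θ' f := fun i =>
  (h i).trans (by gcongr)

lemma Bd.const_nonneg {c θ : ℝ} {f : L⟦X⟧} (h : Bd c θ f) : 0 ≤ c := by
  have := (norm_nonneg _).trans (h 0); simpa using this

lemma Bd.zero {c θ : ℝ} (hc : 0 ≤ c) (hθ : 0 ≤ θ) : Bd c θ (0 : L⟦X⟧) := fun i => by
  simp; positivity

lemma Bd.neg {c θ : ℝ} {f : L⟦X⟧} (h : Bd c θ f) : Bd c θ (-f) := fun i => by
  simpa using h i

lemma Bd.smul {c θ : ℝ} {f : L⟦X⟧} (h : Bd c θ f) (a : L) : Bd (‖a‖ * c) θ (a • f) := fun i => by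
  simp only [map_smul, norm_smul, mul_assoc]
  gcongr; exact h i

lemma Bd.one {θ : ℝ} (hθ : 0 ≤ θ) : Bd 1 θ (1 : L⟦X⟧) := fun i => by
  rw [PowerSeries.coeff_one]
  split_ifs with h
  · simp [h]
  · simp; positivity

lemma Bd.X {θ : ℝ} (hθ : 1 ≤ θ) : Bd 1 θ (PowerSeries.X : L⟦X⟧) := fun i => by
  rw [PowerSeries.coeff_X]
  split_ifs with h
  · simpa [h] using hθ
  · simp; positivity

lemma Bd.C {θ : ℝ} (hθ : 0 ≤ θ) (a : L) : Bd ‖a‖ θ (PowerSeries.C a) := fun i => by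
  rw [PowerSeries.coeff_C]
  split_ifs with h
  · simp [h]
  · simp; positivity

variable [IsUltrametricDist L]

lemma Bd.add {c θ : ℝ} {f g : L⟦X⟧} (hf : Bd c θ f) (hg : Bd c θ g) : Bd c θ (f + g) := fun i => by
  rw [map_add]
  exact (norm_add_le_max _ _).trans (max_le (hf i) (hg i))

lemma Bd.sub {c θ : ℝ} {f g : L⟦X⟧} (hf : Bd c θ f) (hg : Bd c θ g) : Bd c θ (f - g) := by
  rw [sub_eq_add_neg]; exact hf.add hg.neg

lemma Bd.sum {ι : Type*} {c θ : ℝ} (hc : 0 ≤ c) (hθ : 0 ≤ θ) (s : Finset ι)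
    {f : ι → L⟦X⟧} (hf : ∀ i ∈ s, Bd c θ (f i)) : Bd c θ (∑ i ∈ s, f i) := by
  classical
  induction s using Finset.induction_on with
  | empty => simpa using Bd.zero hc hθ
  | insert a s ha ih =>
    rw [sum_insert ha]
    exact (hf a (by simp)).add (ih fun i hi => hf i (by simp [hi]))

lemma Bd.mul {c d θ : ℝ} {f g : L⟦X⟧} (hθ : 0 ≤ θ) (hf : Bd c θ f) (hg : Bd d θ g) :
    Bd (c * d) θ (f * g) := fun i => by
  have hc := hf.const_nonneg
  have hd := hg.const_nonneg
  rw [PowerSeries.coeff_mul]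
  refine norm_sum_le_of_forall_le_of_nonneg (by positivity) fun x hx => ?_
  rw [norm_mul, ← HasAntidiagonal.mem_antidiagonal.1 hx, pow_add]
  calc _ ≤ (c * θ ^ x.1) * (d * θ ^ x.2) := by gcongr; exacts [hf _, hg _]
    _ = _ := by ring

lemma Bd.pow {c θ : ℝ} {f : L⟦X⟧} (hθ : 0 ≤ θ) (hf : Bd c θ f) (n : ℕ) : Bd (c ^ n) θ (f ^ n) := by
  induction n with
  | zero => simpa using Bd.one hθ
  | succ n ih => rw [pow_succ, pow_succ]; exact ih.mul hθ hf

lemma Bd.prod {ι : Type*} {c θ : ℝ} (hθ : 0 ≤ θ) (s : Finset ι)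
    {f : ι → L⟦X⟧} (hf : ∀ i ∈ s, Bd c θ (f i)) : Bd (c ^ s.card) θ (∏ i ∈ s, f i) := by
  classical
  induction s using Finset.induction_on with
  | empty => simpa using Bd.one hθ
  | insert a s ha ih =>
    rw [prod_insert ha, card_insert_of_notMem ha, pow_succ']
    exact (hf a (by simp)).mul hθ (ih fun i hi => hf i (by simp [hi]))

lemma bd_natCast {θ : ℝ} (hθ : 0 ≤ θ) (n : ℕ) : Bd 1 θ ((n : L⟦X⟧)) := by
  have : (n : L⟦X⟧) = PowerSeries.C (n : L) := by simp
  rw [this]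
  exact (Bd.C hθ _).mono (norm_natCast_le_one L n) zero_le_one hθ le_rfl

/-- Division by a monic polynomial with integral coefficients does not increase the Gauss norm. -/
lemma bd_of_monic_mul {Q D : L[X]} (hQ : Q.Monic)
    (hQ1 : Bd 1 1 (Q : L⟦X⟧)) {c : ℝ} (h : Bd c 1 ((Q * D : L[X]) : L⟦X⟧)) : Bd c 1 (D : L⟦X⟧) := by
  have hc := h.const_nonneg
  by_contra hD
  simp only [Bd, not_forall, one_pow, mul_one, coeff_coe, not_le] at hD h hQ1
  have hfin : ∃ i, c < ‖D.coeff i‖ ∧ ∀ j, i < j → ‖D.coeff j‖ ≤ c := by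
    let s := D.support.filter fun i => c < ‖D.coeff i‖
    have hs : s.Nonempty := by
      obtain ⟨i, hi⟩ := hD
      refine ⟨i, mem_filter.2 ⟨?_, hi⟩⟩
      rw [mem_support_iff]
      intro h0; rw [h0, norm_zero] at hi; linarith
    refine ⟨s.max' hs, (mem_filter.1 (s.max'_mem hs)).2, fun j hj => ?_⟩
    by_contra hj'
    push Not at hj'
    have : j ∈ s := by
      refine mem_filter.2 ⟨?_, hj'⟩
      rw [mem_support_iff]
      intro h0; rw [h0, norm_zero] at hj'; linarith
    exact absurd (s.le_max' j this) (not_le.2 hj)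
  obtain ⟨i, hi, hmax⟩ := hfin
  have hk := h (Q.natDegree + i)
  rw [coeff_mul] at hk
  have hmem : (Q.natDegree, i) ∈ HasAntidiagonal.antidiagonal (Q.natDegree + i) := by simp
  rw [← add_sum_erase _ _ hmem] at hk
  set R := ∑ x ∈ (HasAntidiagonal.antidiagonal (Q.natDegree + i)).erase (Q.natDegree, i),
    Q.coeff x.1 * D.coeff x.2 with hR
  have hRc : ‖R‖ ≤ c := by
    refine norm_sum_le_of_forall_le_of_nonneg hc fun x hx => ?_
    obtain ⟨hne, hx⟩ := mem_erase.1 hx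
    rw [HasAntidiagonal.mem_antidiagonal] at hx
    rw [norm_mul]
    rcases lt_trichotomy x.1 Q.natDegree with h1 | h1 | h1
    · calc _ ≤ 1 * c := by
            gcongr
            · exact hQ1 _
            · exact hmax _ (by omega)
        _ = c := one_mul c
    · exact absurd (Prod.ext h1 (by simp; omega)) hne
    · rw [coeff_eq_zero_of_natDegree_lt h1]; simpa using hc
  have h1 : Q.coeff Q.natDegree * D.coeff i = (Q.coeff Q.natDegree * D.coeff i + R) - R := by ring
  have h2 : ‖D.coeff i‖ ≤ c := by
    have : D.coeff i = (Q.coeff Q.natDegree * D.coeff i + R) - R := by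
      rw [← h1, hQ.coeff_natDegree, one_mul]
    rw [this, sub_eq_add_neg]
    refine (norm_add_le_max _ _).trans (max_le hk (by rwa [norm_neg]))
  linarith

/-- If the leading term of the monic polynomial `Q` dominates for the `θ`-Gauss norm, then
reduction modulo `Q` does not increase the `θ`-Gauss norm. -/
lemma bd_modByMonic {Q : L[X]} (hQ : Q.Monic) {θ : ℝ} (hθ : 0 < θ)
    (hQb : ∀ i, ‖Q.coeff i‖ * θ ^ Q.natDegree ≤ θ ^ i) {c : ℝ} (G : L[X])
    (h : Bd c θ (G : L⟦X⟧)) : Bd c θ ((G %ₘ Q : L[X]) : L⟦X⟧) := by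
  have hc := h.const_nonneg
  induction hn : G.natDegree using Nat.strong_induction_on generalizing G with
  | _ n ih =>
    subst hn
    by_cases hlt : G.degree < Q.degree
    · rwa [(modByMonic_eq_self_iff hQ).2 hlt]
    · push Not at hlt
      by_cases hG0 : G = 0
      · subst hG0; simpa using h
      set G' := G - Q * (C G.leadingCoeff * X ^ (G.natDegree - Q.natDegree))
        with hG'
      have hdeg := natDegree_le_natDegree hlt
      have hG'b : Bd c θ (G' : L⟦X⟧) := by
        intro i
        rw [coeff_coe, hG', coeff_sub]
        rw [sub_eq_add_neg]
        refine (norm_add_le_max _ _).trans (max_le ?_ ?_)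
        · simpa using h i
        · rw [norm_neg, mul_left_comm, coeff_C_mul, norm_mul,
            coeff_mul_X_pow']
          split_ifs with hi
          · have h1 := h G.natDegree
            rw [coeff_coe] at h1
            have h2 := hQb (i - (G.natDegree - Q.natDegree))
            have e1 : θ ^ G.natDegree = θ ^ Q.natDegree * θ ^ (G.natDegree - Q.natDegree) := by
              rw [← pow_add]; congr 1; omega
            have e2 : θ ^ i = θ ^ (i - (G.natDegree - Q.natDegree)) *
                θ ^ (G.natDegree - Q.natDegree) := by
              rw [← pow_add]; congr 1; omega
            rw [e2]
            calc _ ≤ (c * θ ^ G.natDegree) * ‖Q.coeff (i - (G.natDegree - Q.natDegree))‖ := by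
                  gcongr; exact h1
              _ = c * ((‖Q.coeff (i - (G.natDegree - Q.natDegree))‖ * θ ^ Q.natDegree) *
                  θ ^ (G.natDegree - Q.natDegree)) := by rw [e1]; ring
              _ ≤ _ := by gcongr
          · simp; positivity
      have hmod : G %ₘ Q = G' %ₘ Q := by rw [hG', sub_modByMonic, self_mul_modByMonic hQ, sub_zero]
      rw [hmod]
      by_cases hG'0 : G' = 0
      · rw [hG'0, zero_modByMonic]; simpa using Bd.zero hc hθ.le
      by_cases hG'deg : G'.natDegree < G.natDegree
      · exact ih _ hG'deg G' hG'b rfl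
      · exfalso
        have hlt' := div_wf_lemma ⟨hlt, hG0⟩ hQ
        rw [← hG'] at hlt'
        have h3 := hlt'
        rw [degree_eq_natDegree hG'0, degree_eq_natDegree hG0] at h3
        exact hG'deg (by exact_mod_cast h3)

end Bounds

section Cyclotomic

variable (p L)

/-- The polynomial `(1 + X) ^ (p ^ n) - 1`. -/
def om (n : ℕ) : L[X] := (1 + X) ^ p ^ n - 1

/-- The quotient of `om (l + 1)` by `om l`. -/
def Om (l : ℕ) : L[X] := ∑ i ∈ range p, ((1 + X) ^ p ^ l) ^ i

/-- The quotient of `om n` by `X`. -/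
def chi (n : ℕ) : L[X] := ∏ l ∈ range n, Om p L l

lemma om_zero : om p L 0 = X := by simp [om]

lemma om_succ (l : ℕ) : om p L (l + 1) = om p L l * Om p L l := by
  rw [om, om, Om, mul_comm, geom_sum_mul, ← pow_mul, pow_succ]

lemma om_eq_mul_prod {n N : ℕ} (h : n ≤ N) : om p L N = om p L n * ∏ l ∈ Ico n N, Om p L l := by
  induction N, h using Nat.le_induction with
  | base => simp
  | succ N hN ih => rw [om_succ, ih, prod_Ico_succ_top hN, mul_assoc]

lemma om_eq_X_mul_chi (n : ℕ) : om p L n = X * chi p L n := by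
  rw [om_eq_mul_prod p L (Nat.zero_le n), om_zero, chi, Finset.range_eq_Ico]

lemma coeff_om_succ (n i : ℕ) : (om p L n).coeff (i + 1) = ((p ^ n).choose (i + 1) : L) := by
  rw [om, coeff_sub, add_comm, coeff_X_add_one_pow]
  simp [coeff_one]

lemma coeff_om_zero (n : ℕ) : (om p L n).coeff 0 = 0 := by
  rw [om, coeff_sub, add_comm, coeff_X_add_one_pow]
  simp

lemma coeff_chi (n i : ℕ) : (chi p L n).coeff i = ((p ^ n).choose (i + 1) : L) := by
  rw [← coeff_om_succ, om_eq_X_mul_chi, coeff_X_mul]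

lemma one_add_X_monic : (1 + X : L[X]).Monic := by rw [add_comm]; exact monic_X_add_C 1

lemma natDegree_one_add_X : (1 + X : L[X]).natDegree = 1 := by
  rw [add_comm]; exact natDegree_X_add_C 1

lemma om_degree_lt (n : ℕ) : (1 : L[X]).degree < ((1 + X : L[X]) ^ p ^ n).degree := by
  rw [degree_eq_natDegree ((one_add_X_monic L).pow _).ne_zero,
    (one_add_X_monic L).natDegree_pow, natDegree_one_add_X, degree_one]
  have : 0 < p ^ n := pow_pos (Fact.out : p.Prime).pos n
  exact_mod_cast (by omega : 0 < p ^ n * 1)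

lemma om_monic (n : ℕ) : (om p L n).Monic :=
  ((one_add_X_monic L).pow _).sub_of_left (om_degree_lt p L n)

lemma natDegree_om (n : ℕ) : (om p L n).natDegree = p ^ n := by
  rw [om, natDegree_sub_eq_left_of_natDegree_lt, (one_add_X_monic L).natDegree_pow,
    natDegree_one_add_X, mul_one]
  rw [(one_add_X_monic L).natDegree_pow, natDegree_one_add_X, mul_one, natDegree_one]
  exact pow_pos (Fact.out : p.Prime).pos n

lemma Om_monic (l : ℕ) : (Om p L l).Monic :=
  (om_monic p L l).of_mul_monic_left (om_succ p L l ▸ om_monic p L (l + 1))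

lemma chi_monic (n : ℕ) : (chi p L n).Monic :=
  monic_prod_of_monic _ _ fun l _ => Om_monic p L l

lemma om_dvd_Om_sub (l : ℕ) : om p L l ∣ Om p L l - (p : L[X]) := by
  have : Om p L l - (p : L[X]) =
      ∑ i ∈ range p, (((1 + X) ^ p ^ l) ^ i - 1) := by
    simp [Om]
  rw [this]
  refine dvd_sum fun i _ => ?_
  simpa [om] using sub_dvd_pow_sub_pow ((1 + X : L[X]) ^ p ^ l) 1 i

lemma Om_dvd_om {l n : ℕ} (h : l < n) : Om p L l ∣ om p L n := by
  rw [om_eq_mul_prod p L (show l + 1 ≤ n from h), om_succ]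
  exact dvd_mul_of_dvd_left (dvd_mul_left _ _) _

end Cyclotomic

section Padic

variable (p L)

lemma norm_p : ‖(p : L)‖ = (p : ℝ)⁻¹ := by
  have : (p : L) = η 𝔭 := by simp
  rw [this, norm_algebraMap', Padic.norm_p]

lemma natCast_ne_zero' (p : ℕ) [Fact p.Prime] (L : Type) [NontriviallyNormedField L]
    [NormedAlgebra ℚ_[p] L] {n : ℕ} (h : n ≠ 0) : (n : L) ≠ 0 := by
  have : (n : L) = (algebraMap ℚ_[p] L) (n : ℚ_[p]) := by simp
  rw [this, Ne, FaithfulSMul.algebraMap_eq_zero_iff]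
  exact_mod_cast h

lemma charZero_of_padic (p : ℕ) [Fact p.Prime] (L : Type) [NontriviallyNormedField L]
    [NormedAlgebra ℚ_[p] L] : CharZero L :=
  charZero_of_inj_zero fun n h => by by_contra hn; exact natCast_ne_zero' p L hn h

lemma p_pos : (0 : ℝ) < p := by exact_mod_cast (Fact.out : p.Prime).pos
lemma one_lt_p : (1 : ℝ) < p := by exact_mod_cast (Fact.out : p.Prime).one_lt

variable [IsUltrametricDist L]

lemma norm_natCast_le_of_dvd {n : ℕ} (h : p ∣ n) : ‖(n : L)‖ ≤ (p : ℝ)⁻¹ := by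
  obtain ⟨k, rfl⟩ := h
  rw [Nat.cast_mul, norm_mul, norm_p]
  exact mul_le_of_le_one_right (by positivity) (norm_natCast_le_one L k)

lemma isCoprime_om_Om (l : ℕ) : IsCoprime (om p L l) (Om p L l) := by
  obtain ⟨k, hk⟩ := om_dvd_Om_sub p L l
  have hp : (p : L) ≠ 0 := natCast_ne_zero' p L (Fact.out : p.Prime).ne_zero
  refine ⟨-C (p : L)⁻¹ * k, C (p : L)⁻¹, ?_⟩
  have h1 : Om p L l = om p L l * k + C (p : L) := by rw [← hk]; simp
  have h2 : C (p : L)⁻¹ * C (p : L) = 1 := by rw [← C_mul, inv_mul_cancel₀ hp, C_1]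
  rw [h1]; linear_combination h2

lemma isCoprime_Om {l n : ℕ} (h : l < n) : IsCoprime (Om p L l) (Om p L n) :=
  (isCoprime_om_Om p L n).of_isCoprime_of_dvd_left (Om_dvd_om p L h)

/-- The radius `p ^ (1 / p ^ n)`. -/
def theta (n : ℕ) : ℝ := (p : ℝ) ^ (((p : ℝ) ^ n)⁻¹)

lemma one_le_theta (n : ℕ) : 1 ≤ theta p n :=
  Real.one_le_rpow (one_lt_p p).le (by have := p_pos p; positivity)

lemma theta_nonneg (n : ℕ) : 0 ≤ theta p n := zero_le_one.trans (one_le_theta p n)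

lemma theta_pow (n : ℕ) : theta p n ^ p ^ n = p := by
  have := p_pos p
  rw [theta, ← Real.rpow_natCast, ← Real.rpow_mul this.le]
  push_cast
  rw [inv_mul_cancel₀ (by positivity), Real.rpow_one]

lemma theta_anti {n N : ℕ} (h : n ≤ N) : theta p N ≤ theta p n := by
  have h1 := one_lt_p p
  refine Real.rpow_le_rpow_of_exponent_le h1.le ?_
  gcongr
  exact h1.le

lemma tendsto_theta : Tendsto (theta p) atTop (𝓝 1) := by
  have h1 := one_lt_p p
  have h : Tendsto (fun n : ℕ => ((p : ℝ) ^ n)⁻¹) atTop (𝓝 0) :=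
    (tendsto_pow_atTop_atTop_of_one_lt h1).inv_tendsto_atTop
  have := (Real.continuous_const_rpow (p_pos p).ne').tendsto 0 |>.comp h
  simp only [Real.rpow_zero] at this
  exact this

lemma norm_coeff_om_le {n i : ℕ} (hi : i < p ^ n) : ‖(om p L n).coeff i‖ ≤ (p : ℝ)⁻¹ := by
  rcases i with _ | i
  · rw [coeff_om_zero, norm_zero]; positivity
  · rw [coeff_om_succ]
    exact norm_natCast_le_of_dvd p L
      ((Fact.out : p.Prime).dvd_choose_pow (Nat.succ_ne_zero i) hi.ne)

lemma om_bd_one (n : ℕ) {θ : ℝ} (hθ : 1 ≤ θ) : Bd 1 θ (om p L n : L⟦X⟧) := fun i => by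
  rw [coeff_coe]
  have h1 : 1 ≤ 1 * θ ^ i := by rw [one_mul]; exact one_le_pow₀ hθ
  refine le_trans ?_ h1
  rcases i with _ | i
  · rw [coeff_om_zero, norm_zero]; positivity
  · rw [coeff_om_succ]; exact norm_natCast_le_one L _

lemma one_add_X_bd {θ : ℝ} (hθ : 1 ≤ θ) : Bd 1 θ ((1 + X : L[X]) : L⟦X⟧) := by
  rw [Polynomial.coe_add, Polynomial.coe_one, coe_X]
  exact (Bd.one (by positivity)).add (Bd.X hθ)

lemma om_bd (n : ℕ) : Bd (p : ℝ)⁻¹ (theta p n) (om p L n : L⟦X⟧) := fun i => by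
  rw [coeff_coe]
  have hp := p_pos p
  rcases lt_trichotomy i (p ^ n) with h | h | h
  · refine (norm_coeff_om_le p L h).trans ?_
    have := one_le_pow₀ (one_le_theta p n) (n := i)
    nlinarith [inv_pos.2 hp]
  · rw [h, theta_pow, inv_mul_cancel₀ hp.ne']
    have := om_monic p L n
    rw [Monic, leadingCoeff, natDegree_om] at this
    rw [this, norm_one]
  · rw [coeff_eq_zero_of_natDegree_lt (by rwa [natDegree_om]), norm_zero]
    have := theta_nonneg p n
    positivity

lemma om_bd_of_le {n l : ℕ} (h : n ≤ l) : Bd (p : ℝ)⁻¹ (theta p n) (om p L l : L⟦X⟧) :=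
  (om_bd p L l).mono le_rfl (by positivity) (theta_nonneg p l) (theta_anti p h)

lemma Om_eq_sum (l : ℕ) : Om p L l =
    ∑ i ∈ range p, (p.choose (i + 1) : L[X]) * om p L l ^ i := by
  have hne : om p L l ≠ 0 := (om_monic p L l).ne_zero
  apply mul_left_cancel₀ hne
  rw [← om_succ, mul_sum]
  have h1 : om p L (l + 1) = (om p L l + 1) ^ p - 1 := by
    simp only [om]; rw [sub_add_cancel, ← pow_mul, pow_succ]
  rw [h1, add_pow, sum_range_succ']
  simp only [one_pow, mul_one, pow_zero, Nat.choose_zero_right, Nat.cast_one,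
    add_sub_cancel_right]
  refine sum_congr rfl fun i _ => ?_
  ring

lemma coe_natCast (n : ℕ) : ((n : L[X]) : L⟦X⟧) = (n : L⟦X⟧) :=
  map_natCast (coeToPowerSeries.ringHom (R := L)) n

lemma coe_sum {ι : Type*} (s : Finset ι) (f : ι → L[X]) :
    ((∑ i ∈ s, f i : L[X]) : L⟦X⟧) = ∑ i ∈ s, (f i : L⟦X⟧) :=
  map_sum (coeToPowerSeries.ringHom (R := L)) f s

lemma coe_prod {ι : Type*} (s : Finset ι) (f : ι → L[X]) :
    ((∏ i ∈ s, f i : L[X]) : L⟦X⟧) = ∏ i ∈ s, (f i : L⟦X⟧) :=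
  map_prod (coeToPowerSeries.ringHom (R := L)) f s

lemma Om_bd {n l : ℕ} (h : n ≤ l) : Bd (p : ℝ)⁻¹ (theta p n) (Om p L l : L⟦X⟧) := by
  have hp := p_pos p
  have hθ := theta_nonneg p n
  have hpi : (p : ℝ)⁻¹ ≤ 1 := inv_le_one_of_one_le₀ (one_lt_p p).le
  rw [Om_eq_sum, coe_sum]
  refine Bd.sum (by positivity) hθ _ fun i hi => ?_
  rw [Polynomial.coe_mul, Polynomial.coe_pow, coe_natCast]
  have hom := (om_bd_of_le p L h).pow hθ i
  have hi' := mem_range.1 hi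
  by_cases hip : i + 1 = p
  · have h1 := (bd_natCast (L := L) hθ (p.choose (i + 1))).mul hθ hom
    refine h1.mono ?_ (by positivity) hθ le_rfl
    rw [one_mul]
    have : i ≠ 0 := by
      have := (Fact.out : p.Prime).two_le
      omega
    exact pow_le_of_le_one (by positivity) hpi this
  · have h1 : Bd (p : ℝ)⁻¹ (theta p n) ((p.choose (i + 1) : L⟦X⟧)) := by
      have : (p.choose (i + 1) : L⟦X⟧) = PowerSeries.C (p.choose (i + 1) : L) := by simp
      rw [this]
      refine (Bd.C hθ _).mono ?_ (by positivity) hθ le_rfl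
      exact norm_natCast_le_of_dvd p L
        ((Fact.out : p.Prime).dvd_choose_self (Nat.succ_ne_zero i) (by omega))
    refine (h1.mul hθ hom).mono ?_ (by positivity) hθ le_rfl
    exact mul_le_of_le_one_right (by positivity) (pow_le_one₀ (by positivity) hpi)

lemma prod_Om_bd {n N : ℕ} : Bd ((p : ℝ)⁻¹ ^ (N - n)) (theta p n)
      ((∏ l ∈ Ico n N, Om p L l : L[X]) : L⟦X⟧) := by
  rw [coe_prod]
  have := Bd.prod (theta_nonneg p n) (Ico n N)
    (f := fun l => (Om p L l : L⟦X⟧)) (c := (p : ℝ)⁻¹)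
    fun l hl => Om_bd p L (mem_Ico.1 hl).1
  simpa using this

lemma om_bd_pow {n N : ℕ} (h : n ≤ N) :
    Bd ((p : ℝ)⁻¹ ^ (N - n + 1)) (theta p n) (om p L N : L⟦X⟧) := by
  rw [om_eq_mul_prod p L h, Polynomial.coe_mul, pow_succ']
  exact (om_bd p L n).mul (theta_nonneg p n) (prod_Om_bd p L)

lemma norm_choose_le (n i : ℕ) :
    ‖((p ^ n).choose (i + 1) : L)‖ ≤ (p : ℝ)⁻¹ ^ n * ‖((i + 1 : ℕ) : L)‖⁻¹ := by
  have hi : 0 < ‖((i + 1 : ℕ) : L)‖ := norm_pos_iff.2 (natCast_ne_zero' p L (Nat.succ_ne_zero i))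
  rw [← div_eq_mul_inv, le_div_iff₀ hi, ← norm_mul]
  obtain ⟨k, hk⟩ : ∃ k, p ^ n = k + 1 :=
    Nat.exists_eq_succ_of_ne_zero (pow_pos (Fact.out : p.Prime).pos n).ne'
  have h := Nat.add_one_mul_choose_eq k i
  rw [← hk] at h
  rw [← Nat.cast_mul, ← h, Nat.cast_mul, norm_mul, Nat.cast_pow, norm_pow, norm_p]
  exact mul_le_of_le_one_right (by positivity) (norm_natCast_le_one L _)

end Padic

lemma exists_tendsto_hyperfilter [ProperSpace L] {f : ℕ → L} {C : ℝ} (h : ∀ N, ‖f N‖ ≤ C) :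
    ∃ x, Tendsto f (hyperfilter ℕ) (𝓝 x) := by
  obtain ⟨x, -, hx⟩ := (isCompact_closedBall (0 : L) C).ultrafilter_le_nhds
    ((hyperfilter ℕ).map f) (by
      simp only [Ultrafilter.coe_map, le_principal_iff, Filter.mem_map]
      exact Filter.univ_mem' fun N => by simpa using h N)
  exact ⟨x, hx⟩

lemma exists_tendsto_powerSeries [ProperSpace L] {F : ℕ → L⟦X⟧} {C θ : ℝ}
    (h : ∀ N, Bd C θ (F N)) : ∃ G, Tendsto F (hyperfilter ℕ) (𝓝 G) := by
  have (i : ℕ) := exists_tendsto_hyperfilter fun N => h N i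
  choose g hg using this
  refine ⟨PowerSeries.mk g, (tendsto_iff_coeff_tendsto L _ _ _).2 fun i => ?_⟩
  rw [coeff_mk]; exact hg i

lemma Bd.of_tendsto {F : ℕ → L⟦X⟧} {G : L⟦X⟧} {U : Filter ℕ} [U.NeBot]
    (hF : Tendsto F U (𝓝 G)) {C θ : ℝ} (h : ∀ᶠ N in U, Bd C θ (F N)) : Bd C θ G := fun i =>
  le_of_tendsto (((tendsto_iff_coeff_tendsto L _ _ _).1 hF i).norm)
    (h.mono fun _ hN => hN i)

lemma sum_range_mul_eq {M : Type*} [AddCommMonoid M] (F : ℕ → M) (N k : ℕ) :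
    ∑ b ∈ range (N * k), F b = ∑ i ∈ range k, ∑ a ∈ range N, F (a + i * N) := by
  induction k with
  | zero => simp
  | succ k ih =>
    rw [Nat.mul_succ, sum_range_add, ih, sum_range_succ]
    congr 1
    refine sum_congr rfl fun a _ => ?_
    rw [add_comm, mul_comm]

lemma eq_zero_of_sum_monic {B : ℕ} {q : ℕ → L[X]} {g : ℕ → L}
    (hq : ∀ b, b < B → (q b).Monic ∧ (q b).natDegree = b)
    (h : ∑ b ∈ range B, C (g b) * q b = 0) : ∀ b, b < B → g b = 0 := by
  induction B with
  | zero => intro b hb; omega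
  | succ B ih =>
    have hlow : (∑ b ∈ range B, C (g b) * q b).coeff B = 0 := by
      rw [finsetSum_coeff]
      refine sum_eq_zero fun b hb => ?_
      have hb := mem_range.1 hb
      rw [coeff_C_mul, coeff_eq_zero_of_natDegree_lt, mul_zero]
      rw [(hq b (by omega)).2]; exact hb
    have hB : g B = 0 := by
      have h1 := congrArg (fun P => coeff P B) h
      simp only [sum_range_succ, coeff_add, hlow, coeff_C_mul,
        coeff_zero, zero_add] at h1
      obtain ⟨h2, h3⟩ := hq B (by omega)
      rw [Monic, leadingCoeff, h3] at h2
      rwa [h2, mul_one] at h1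
    rw [sum_range_succ, hB, C_0, zero_mul, add_zero] at h
    intro b hb
    rcases Nat.lt_succ_iff_lt_or_eq.1 hb with hb | rfl
    · exact ih (fun b hb => hq b (by omega)) h b hb
    · exact hB

lemma pow_dvd_aeval_sub (G : Polynomial ℤ) (y : L[X]) (k : ℕ) : y ^ k ∣ aeval y G -
      ∑ j ∈ range k, C ((G.coeff j : ℤ) : L) * y ^ j := by
  have h1 : X ^ k ∣
      G - ∑ j ∈ range k, C (G.coeff j) * X ^ j := by
    rw [X_pow_dvd_iff]
    intro d hd
    simp [finsetSum_coeff, coeff_X_pow, hd]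
  have h2 := map_dvd (aeval y) h1
  simpa using h2

section Arrays

/-- Coefficients of `(1 + X) ^ i * ((1 + X) ^ p - 1) ^ l`; they also express the polynomial
`binom (i + p * t) j` in `t` in terms of the polynomials `binom t l`. -/
def cc (p i j l : ℕ) : ℤ :=
  ((1 + X : Polynomial ℤ) ^ i * ((1 + X) ^ p - 1) ^ l).coeff j

variable (p)

/-- The compatibility satisfied by the values of a functional on a family of locally polynomial
functions indexed by balls. -/
def Refines (m : ℕ) (f : Arr L) : Prop := ∀ n a j, a < p ^ n → j ≤ m →
  f n a j = ∑ i ∈ range p, ∑ l ∈ range (m + 1),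
    (cc p i j l : L) * f (n + 1) (a + i * p ^ n) l

/-- The polynomial encoding the values at level `n`. -/
def Apol (m : ℕ) (f : Arr L) (n : ℕ) : L[X] :=
  ∑ a ∈ range (p ^ n), ∑ j ∈ range (m + 1),
    C (f n a j) * ((1 + X) ^ a * om p L n ^ j)

/-- Growth condition on arrays. -/
def Grow (m : ℕ) (s c : ℝ) (f : Arr L) : Prop :=
  ∀ n a j, a < p ^ n → j ≤ m → ‖f n a j‖ ≤ c * s ^ n

/-- The power series attached to an array. -/
def hat (m : ℕ) (f : Arr L) : L⟦X⟧ :=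
  limUnder (hyperfilter ℕ : Filter ℕ) fun N => (Apol p m f N : L⟦X⟧)

lemma Apol_zero (m : ℕ) (f : Arr L) : (Apol p m f 0).coeff 0 = f 0 0 0 := by
  simp [Apol, om_zero, finsetSum_coeff, coeff_X_pow]

lemma Apol_add (m : ℕ) (f g : Arr L) (n : ℕ) :
    Apol p m (f + g) n = Apol p m f n + Apol p m g n := by
  simp [Apol, add_mul, sum_add_distrib]

lemma Apol_smul (m : ℕ) (c : L) (f : Arr L) (n : ℕ) : Apol p m (c • f) n = C c * Apol p m f n := by
  simp [Apol, mul_sum, mul_assoc]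

lemma Apol_succ_sub_dvd {f : Arr L} (hf : Refines p m f) (n : ℕ) :
    om p L n ^ (m + 1) ∣ Apol p m f (n + 1) - Apol p m f n := by
  have h1 : Apol p m f (n + 1) = ∑ i ∈ range p, ∑ a ∈ range (p ^ n),
      ∑ l ∈ range (m + 1), C (f (n + 1) (a + i * p ^ n) l) *
        ((1 + X) ^ (a + i * p ^ n) * om p L (n + 1) ^ l) := by
    rw [Apol, pow_succ, sum_range_mul_eq]
  have h2 : Apol p m f n = ∑ i ∈ range p, ∑ a ∈ range (p ^ n),
      ∑ l ∈ range (m + 1), C (f (n + 1) (a + i * p ^ n) l) *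
        ((1 + X) ^ a * ∑ j ∈ range (m + 1),
          C ((cc p i j l : ℤ) : L) * om p L n ^ j) := by
    rw [Apol, sum_comm (s := range p)]
    refine sum_congr rfl fun a ha => ?_
    have h3 : ∀ j ∈ range (m + 1),
        C (f n a j) * ((1 + X) ^ a * om p L n ^ j) =
        ∑ i ∈ range p, ∑ l ∈ range (m + 1),
          C (f (n + 1) (a + i * p ^ n) l) * ((1 + X) ^ a *
            (C ((cc p i j l : ℤ) : L) * om p L n ^ j)) := by
      intro j hj
      rw [hf n a j (mem_range.1 ha) (Nat.lt_succ_iff.1 (mem_range.1 hj))]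
      simp only [map_sum, sum_mul, map_mul]
      refine sum_congr rfl fun i _ => sum_congr rfl fun l _ => ?_
      ring
    rw [sum_congr rfl h3, sum_comm]
    refine sum_congr rfl fun i _ => ?_
    rw [sum_comm]
    refine sum_congr rfl fun l _ => ?_
    rw [mul_sum, mul_sum]
  rw [h1, h2, ← sum_sub_distrib]
  refine dvd_sum fun i _ => ?_
  rw [← sum_sub_distrib]
  refine dvd_sum fun a _ => ?_
  rw [← sum_sub_distrib]
  refine dvd_sum fun l _ => ?_
  have h4 := pow_dvd_aeval_sub (L := L)
    ((1 + X : Polynomial ℤ) ^ i * ((1 + X) ^ p - 1) ^ l) (om p L n) (m + 1)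
  have h5 : aeval (om p L n)
      ((1 + X : Polynomial ℤ) ^ i * ((1 + X) ^ p - 1) ^ l) =
      (1 + X) ^ (i * p ^ n) * om p L (n + 1) ^ l := by
    simp only [map_mul, map_pow, map_sub, map_add, map_one, aeval_X]
    simp only [om]
    rw [add_sub_cancel, ← pow_mul, ← pow_mul, pow_succ, mul_comm i]
  rw [h5] at h4
  have h6 : C (f (n + 1) (a + i * p ^ n) l) *
        ((1 + X) ^ (a + i * p ^ n) * om p L (n + 1) ^ l) -
      C (f (n + 1) (a + i * p ^ n) l) *
        ((1 + X) ^ a * ∑ j ∈ range (m + 1),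
          C ((cc p i j l : ℤ) : L) * om p L n ^ j) =
      (C (f (n + 1) (a + i * p ^ n) l) * (1 + X) ^ a) *
      ((1 + X) ^ (i * p ^ n) * om p L (n + 1) ^ l - ∑ j ∈ range (m + 1),
          C ((cc p i j l : ℤ) : L) * om p L n ^ j) := by
    rw [pow_add]; ring
  rw [h6]
  exact dvd_mul_of_dvd_right h4 _

lemma Apol_eq_sum (m : ℕ) (f : Arr L) (n : ℕ) : Apol p m f n = ∑ b ∈ range (p ^ n * (m + 1)),
      C (f n (b % p ^ n) (b / p ^ n)) * ((1 + X) ^ (b % p ^ n) * om p L n ^ (b / p ^ n)) := by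
  rw [sum_range_mul_eq, Apol, sum_comm]
  refine sum_congr rfl fun j _ => sum_congr rfl fun a ha => ?_
  have ha := mem_range.1 ha
  have hp : 0 < p ^ n := by omega
  rw [Nat.add_mul_mod_self_right, Nat.mod_eq_of_lt ha, Nat.add_mul_div_right _ _ hp,
    Nat.div_eq_of_lt ha, zero_add]

lemma basis_monic (n b : ℕ) : ((1 + X) ^ (b % p ^ n) * om p L n ^ (b / p ^ n)).Monic ∧
    ((1 + X) ^ (b % p ^ n) * om p L n ^ (b / p ^ n)).natDegree = b := by
  have h1 := (one_add_X_monic L).pow (b % p ^ n)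
  have h2 := (om_monic p L n).pow (b / p ^ n)
  refine ⟨h1.mul h2, ?_⟩
  rw [h1.natDegree_mul h2, (one_add_X_monic L).natDegree_pow, (om_monic p L n).natDegree_pow,
    natDegree_one_add_X, natDegree_om, mul_one, mul_comm, Nat.mod_add_div]

lemma eq_zero_of_Apol_eq_zero {f : Arr L} {n : ℕ} (h : Apol p m f n = 0)
    {a j : ℕ} (ha : a < p ^ n) (hj : j ≤ m) : f n a j = 0 := by
  rw [Apol_eq_sum] at h
  have h1 := eq_zero_of_sum_monic (B := p ^ n * (m + 1))
    (q := fun b => (1 + X) ^ (b % p ^ n) * om p L n ^ (b / p ^ n))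
    (g := fun b => f n (b % p ^ n) (b / p ^ n)) (fun b _ => basis_monic p n b) h
    (a + j * p ^ n) (by nlinarith)
  have hp : 0 < p ^ n := by omega
  simpa only [Nat.add_mul_mod_self_right, Nat.mod_eq_of_lt ha, Nat.add_mul_div_right _ _ hp,
    Nat.div_eq_of_lt ha, zero_add] using h1

lemma natDegree_om_pow (n k : ℕ) : (om p L n ^ k).natDegree = p ^ n * k := by
  rw [(om_monic p L n).natDegree_pow, natDegree_om, mul_comm]

lemma degree_Apol_lt (m : ℕ) (f : Arr L) (n : ℕ) :
    (Apol p m f n).degree < (om p L n ^ (m + 1)).degree := by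
  rw [degree_eq_natDegree ((om_monic p L n).pow _).ne_zero, natDegree_om_pow,
    Apol_eq_sum, ← mem_degreeLT]
  refine Submodule.sum_mem _ fun b hb => ?_
  rw [mem_degreeLT]
  rw [← smul_eq_C_mul]
  refine lt_of_le_of_lt (degree_smul_le _ _) ?_
  obtain ⟨h1, h2⟩ := basis_monic p (L := L) n b
  rw [degree_eq_natDegree h1.ne_zero, h2]
  exact_mod_cast mem_range.1 hb

variable [IsUltrametricDist L]

variable {p}

variable {s c : ℝ} {f : Arr L}

lemma Apol_bd (hc : 0 ≤ c) (hs : 0 ≤ s)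
    (hf : Grow p m s c f) (n : ℕ) {θ : ℝ} (hθ : 1 ≤ θ) :
    Bd (c * s ^ n) θ (Apol p m f n : L⟦X⟧) := by
  have hθ0 : 0 ≤ θ := zero_le_one.trans hθ
  rw [Apol, coe_sum]
  refine Bd.sum (by positivity) hθ0 _ fun a ha => ?_
  rw [coe_sum]
  refine Bd.sum (by positivity) hθ0 _ fun j hj => ?_
  rw [Polynomial.coe_mul, Polynomial.coe_mul, Polynomial.coe_pow, Polynomial.coe_pow,
    coe_C]
  have h1 := ((one_add_X_bd L hθ).pow hθ0 a).mul hθ0 ((om_bd_one p L n hθ).pow hθ0 j)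
  refine ((Bd.C hθ0 (f n a j)).mul hθ0 h1).mono ?_ (by positivity) hθ0 le_rfl
  simpa using hf n a j (mem_range.1 ha) (Nat.lt_succ_iff.1 (mem_range.1 hj))

/-- The difference of consecutive levels, with a bound on the quotient. -/
lemma exists_quotient (hc : 0 ≤ c) (hs : 1 ≤ s)
    (hr : Refines p m f) (hf : Grow p m s c f) (n : ℕ) :
    ∃ E : L[X], Apol p m f (n + 1) = Apol p m f n + om p L n ^ (m + 1) * E ∧
      Bd (c * s ^ (n + 1)) 1 (E : L⟦X⟧) := by
  obtain ⟨E, hE⟩ := Apol_succ_sub_dvd p hr n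
  refine ⟨E, by rw [← hE]; ring, ?_⟩
  refine bd_of_monic_mul ((om_monic p L n).pow (m + 1)) ?_ (Q := om p L n ^ (m + 1)) ?_
  · rw [Polynomial.coe_pow]
    simpa using (om_bd_one p L n le_rfl).pow zero_le_one (m + 1)
  · rw [← hE, Polynomial.coe_sub]
    refine (Apol_bd hc (by positivity) hf (n + 1) le_rfl).sub
      ((Apol_bd hc (by positivity) hf n le_rfl).mono ?_ (by positivity) zero_le_one le_rfl)
    gcongr
    omega

lemma exists_remainder (hc : 0 ≤ c) (hs : 1 ≤ s)
    (hsp : s ≤ (p : ℝ) ^ (m + 1)) (hr : Refines p m f) (hf : Grow p m s c f) {n N : ℕ} (h : n ≤ N) :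
    ∃ R : L[X], Apol p m f N = Apol p m f n + om p L n ^ (m + 1) * R ∧
      Bd (c * s ^ (n + 1)) (theta p n) (R : L⟦X⟧) := by
  have hθ := theta_nonneg p n
  induction N, h using Nat.le_induction with
  | base => exact ⟨0, by simp, by simpa using Bd.zero (by positivity) hθ⟩
  | succ N hN ih =>
    obtain ⟨R, hR, hRb⟩ := ih
    obtain ⟨E, hE, hEb⟩ := exists_quotient hc hs hr hf N
    refine ⟨R + (∏ l ∈ Ico n N, Om p L l) ^ (m + 1) * E, ?_, ?_⟩
    · rw [hE, hR, om_eq_mul_prod p L hN, mul_pow]; ring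
    · rw [Polynomial.coe_add, Polynomial.coe_mul, Polynomial.coe_pow]
      refine hRb.add ((((prod_Om_bd p L).pow hθ (m + 1)).mul hθ
        (hEb.mono le_rfl hEb.const_nonneg zero_le_one (one_le_theta p n))).mono
        ?_ (by positivity) hθ le_rfl)
      obtain ⟨d, rfl⟩ := Nat.exists_eq_add_of_le hN
      have hp := p_pos p
      rw [Nat.add_sub_cancel_left]
      have h1 : ((p : ℝ)⁻¹ ^ d) ^ (m + 1) * s ^ d ≤ 1 := by
        rw [← pow_mul, mul_comm d, pow_mul, ← mul_pow]
        refine pow_le_one₀ (by positivity) ?_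
        rw [inv_pow, inv_mul_le_iff₀ (by positivity), mul_one]
        exact hsp
      calc _ = (((p : ℝ)⁻¹ ^ d) ^ (m + 1) * s ^ d) * (c * s ^ (n + 1)) := by
            rw [show n + d + 1 = d + (n + 1) by omega, pow_add]; ring
        _ ≤ 1 * (c * s ^ (n + 1)) := by gcongr
        _ = _ := one_mul _

variable [ProperSpace L]

lemma tendsto_hat (hc : 0 ≤ c) (hs : 1 ≤ s)
    (hsp : s ≤ (p : ℝ) ^ (m + 1)) (hr : Refines p m f) (hf : Grow p m s c f) :
    Tendsto (fun N => (Apol p m f N : L⟦X⟧)) (hyperfilter ℕ) (𝓝 (hat p m f)) := by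
  refine tendsto_nhds_limUnder (exists_tendsto_powerSeries (C := c * s) (θ := theta p 0) fun N => ?_)
  have hθ := theta_nonneg p 0
  obtain ⟨R, hR, hRb⟩ := exists_remainder hc hs hsp hr hf (Nat.zero_le N)
  rw [hR, Polynomial.coe_add, Polynomial.coe_mul, Polynomial.coe_pow]
  refine ((Apol_bd hc (by positivity) hf 0 (one_le_theta p 0)).mono ?_ (by positivity)
    hθ le_rfl).add ?_
  · rw [pow_zero, mul_one]; exact le_mul_of_one_le_right hc hs
  · refine ((((om_bd_one p L 0 (one_le_theta p 0)).pow hθ (m + 1)).mul hθ hRb)).mono ?_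
      (by positivity) hθ le_rfl
    simp

lemma exists_hat_remainder (hc : 0 ≤ c) (hs : 1 ≤ s)
    (hsp : s ≤ (p : ℝ) ^ (m + 1)) (hr : Refines p m f) (hf : Grow p m s c f) (n : ℕ) :
    ∃ R : L⟦X⟧, hat p m f = Apol p m f n + (om p L n : L⟦X⟧) ^ (m + 1) * R ∧
      Bd (c * s ^ (n + 1)) (theta p n) R := by
  have h1 : ∀ N, ∃ R : L⟦X⟧, (n ≤ N → (Apol p m f N : L⟦X⟧) =
      Apol p m f n + (om p L n : L⟦X⟧) ^ (m + 1) * R) ∧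
      Bd (c * s ^ (n + 1)) (theta p n) R := by
    intro N
    by_cases h : n ≤ N
    · obtain ⟨R, hR, hRb⟩ := exists_remainder hc hs hsp hr hf h
      exact ⟨R, fun _ => by rw [hR]; simp, hRb⟩
    · exact ⟨0, fun h' => absurd h' h, Bd.zero (by positivity) (theta_nonneg p n)⟩
  choose R hR hRb using h1
  obtain ⟨R', hR'⟩ := exists_tendsto_powerSeries hRb
  refine ⟨R', ?_, Bd.of_tendsto hR' (Eventually.of_forall hRb)⟩
  refine tendsto_nhds_unique (tendsto_hat hc hs hsp hr hf) ?_
  have h2 : Tendsto (fun N => (Apol p m f n : L⟦X⟧) +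
      (om p L n : L⟦X⟧) ^ (m + 1) * R N) (hyperfilter ℕ)
      (𝓝 (Apol p m f n + (om p L n : L⟦X⟧) ^ (m + 1) * R')) :=
    tendsto_const_nhds.add (tendsto_const_nhds.mul hR')
  refine h2.congr' ?_
  filter_upwards [Nat.hyperfilter_le_atTop (eventually_ge_atTop n)] with N hN
  exact (hR N hN).symm

lemma hat_add {s c : ℝ} {f g : Arr L} (hc : 0 ≤ c) (hs : 1 ≤ s)
    (hsp : s ≤ (p : ℝ) ^ (m + 1)) (hr : Refines p m f) (hf : Grow p m s c f)
    (hrg : Refines p m g) (hg : Grow p m s c g) : hat p m (f + g) = hat p m f + hat p m g := by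
  refine Tendsto.limUnder_eq (((tendsto_hat hc hs hsp hr hf).add
    (tendsto_hat hc hs hsp hrg hg)).congr fun N => ?_)
  rw [Apol_add, Polynomial.coe_add]

lemma hat_smul (hc : 0 ≤ c) (hs : 1 ≤ s)
    (hsp : s ≤ (p : ℝ) ^ (m + 1)) (hr : Refines p m f) (hf : Grow p m s c f) (a : L) :
    hat p m (a • f) = PowerSeries.C a * hat p m f := by
  refine Tendsto.limUnder_eq ((tendsto_const_nhds.mul (tendsto_hat hc hs hsp hr hf)).congr
    fun N => ?_)
  rw [Apol_smul, Polynomial.coe_mul, coe_C]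

lemma coeff_zero_hat (hc : 0 ≤ c) (hs : 1 ≤ s)
    (hsp : s ≤ (p : ℝ) ^ (m + 1)) (hr : Refines p m f) (hf : Grow p m s c f) :
    PowerSeries.coeff 0 (hat p m f) = f 0 0 0 := by
  obtain ⟨R, hR, -⟩ := exists_hat_remainder hc hs hsp hr hf 0
  rw [hR, om_zero, ← Apol_zero p m f]
  simp

/-- The truncation error at level `n`, measured for the largest radius. -/
lemma hat_sub_Apol_bd (hc : 0 ≤ c) (hs : 1 ≤ s)
    (hsp : s ≤ (p : ℝ) ^ (m + 1)) (hr : Refines p m f) (hf : Grow p m s c f) {n N : ℕ} (h : n ≤ N) :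
    Bd (((p : ℝ)⁻¹ ^ (N - n + 1)) ^ (m + 1) * (c * s ^ (N + 1))) (theta p n)
      (hat p m f - (Apol p m f N : L⟦X⟧)) := by
  obtain ⟨R, hR, hRb⟩ := exists_hat_remainder hc hs hsp hr hf N
  rw [hR, add_sub_cancel_left]
  have hθ := theta_nonneg p n
  exact ((om_bd_pow p L h).pow hθ (m + 1)).mul hθ
    (hRb.mono le_rfl hRb.const_nonneg (theta_nonneg p N) (theta_anti p h))

lemma tendsto_error {s : ℝ} (c : ℝ) (hs : 1 ≤ s) (hsp : s < (p : ℝ) ^ (m + 1)) (n : ℕ) :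
    Tendsto (fun N => ((p : ℝ)⁻¹ ^ (N - n + 1)) ^ (m + 1) * (c * s ^ (N + 1))) atTop (𝓝 0) := by
  have hp := p_pos p
  have h1 : Tendsto (fun N : ℕ => (c * ((p : ℝ) ^ n) ^ (m + 1)) *
      (((p : ℝ) ^ (m + 1))⁻¹ * s) ^ (N + 1)) atTop (𝓝 ((c * ((p : ℝ) ^ n) ^ (m + 1)) * 0)) := by
    refine Tendsto.const_mul _ ((tendsto_add_atTop_iff_nat 1).2
      (tendsto_pow_atTop_nhds_zero_of_lt_one (by positivity) ?_))
    rwa [inv_mul_lt_iff₀ (by positivity), mul_one]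
  rw [mul_zero] at h1
  refine h1.congr' ?_
  filter_upwards [eventually_ge_atTop n] with N hN
  obtain ⟨d, rfl⟩ := Nat.exists_eq_add_of_le hN
  rw [Nat.add_sub_cancel_left, mul_pow, inv_pow, inv_pow, inv_pow, ← pow_mul, ← pow_mul, ← pow_mul]
  have e : (p : ℝ) ^ ((m + 1) * (n + d + 1)) = (p : ℝ) ^ (n * (m + 1)) * (p : ℝ) ^ ((d + 1) * (m + 1)) := by
    rw [← pow_add]; ring_nf
  rw [e]
  field_simp

/-- An array is determined by its power series. -/
lemma eq_zero_of_hat_eq_zero (hc : 0 ≤ c) (hs : 1 ≤ s)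
    (hsp : s < (p : ℝ) ^ (m + 1)) (hr : Refines p m f) (hf : Grow p m s c f)
    (h : hat p m f = 0) {n a j : ℕ} (ha : a < p ^ n) (hj : j ≤ m) : f n a j = 0 := by
  refine eq_zero_of_Apol_eq_zero p ?_ ha hj
  have hp := p_pos p
  have hθ := theta_nonneg p n
  have hmon := (om_monic p L n).pow (m + 1)
  have hQ : ∀ i, ‖(om p L n ^ (m + 1)).coeff i‖ * theta p n ^ (om p L n ^ (m + 1)).natDegree ≤
      theta p n ^ i := by
    intro i
    have h1 := (om_bd p L n).pow hθ (m + 1) i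
    rw [← Polynomial.coe_pow, coeff_coe] at h1
    rw [natDegree_om_pow, pow_mul, theta_pow]
    calc _ ≤ ((p : ℝ)⁻¹ ^ (m + 1) * theta p n ^ i) * (p : ℝ) ^ (m + 1) := by gcongr
      _ = _ := by rw [inv_pow]; field_simp
  have hbd : ∀ N, n ≤ N → Bd (((p : ℝ)⁻¹ ^ (N - n + 1)) ^ (m + 1) * (c * s ^ (N + 1))) (theta p n)
      (Apol p m f n : L⟦X⟧) := by
    intro N hN
    have h1 := hat_sub_Apol_bd hc hs hsp.le hr hf hN
    rw [h, zero_sub] at h1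
    have h2 := h1.neg
    rw [neg_neg] at h2
    have h3 := bd_modByMonic hmon (by linarith [one_le_theta p n]) hQ _ h2
    obtain ⟨R, hR, -⟩ := exists_remainder hc hs hsp.le hr hf hN
    rwa [hR, add_modByMonic, self_mul_modByMonic hmon, add_zero,
      (modByMonic_eq_self_iff hmon).2 (degree_Apol_lt p m f n)] at h3
  ext i
  rw [coeff_zero, ← norm_le_zero_iff]
  have h4 := (tendsto_error c hs hsp n).mul_const (theta p n ^ i)
  rw [zero_mul] at h4
  refine ge_of_tendsto h4 ?_
  filter_upwards [eventually_ge_atTop n] with N hN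
  simpa using hbd N hN i

end Arrays

section Shift

/-- The relation between the values of `λ ∘ S` and those of `λ`, where `S` is the unit shift. -/
def ShiftRel (p m : ℕ) (f' f : Arr L) : Prop := ∀ n,
  (∀ a j, a + 1 < p ^ n → j ≤ m → f' n (a + 1) j = f n a j) ∧
  f' n 0 0 = f n (p ^ n - 1) 0 ∧
  ∀ j, j < m → f' n 0 (j + 1) = f n (p ^ n - 1) (j + 1) + f n (p ^ n - 1) j

lemma Apol_shift {f' f : Arr L} (h : ShiftRel p m f' f) (n : ℕ) :
    Apol p m f' n = (1 + X) * Apol p m f n - om p L n ^ (m + 1) * C (f n (p ^ n - 1) m) := by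
  obtain ⟨h1, h2, h3⟩ := h n
  obtain ⟨k, hk⟩ : ∃ k, p ^ n = k + 1 :=
    Nat.exists_eq_succ_of_ne_zero (pow_pos (Fact.out : p.Prime).pos n).ne'
  have hom : (1 + X : L[X]) ^ (k + 1) = 1 + om p L n := by rw [om, hk]; ring
  rw [hk, Nat.add_sub_cancel] at h2 h3
  rw [Apol, Apol, hk, sum_range_succ', mul_sum, sum_range_succ _ k,
    Nat.add_sub_cancel]
  have e1 : ∑ a ∈ range k, ∑ j ∈ range (m + 1),
      C (f' n (a + 1) j) * ((1 + X) ^ (a + 1) * om p L n ^ j) =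
      ∑ a ∈ range k, (1 + X) * ∑ j ∈ range (m + 1),
      C (f n a j) * ((1 + X) ^ a * om p L n ^ j) := by
    refine sum_congr rfl fun a ha => ?_
    rw [mul_sum]
    refine sum_congr rfl fun j hj => ?_
    rw [h1 a j (by have := mem_range.1 ha; omega)
      (Nat.lt_succ_iff.1 (mem_range.1 hj))]
    ring
  have e2 : (1 + X) * ∑ j ∈ range (m + 1),
      C (f n k j) * ((1 + X) ^ k * om p L n ^ j) =
      ∑ j ∈ range (m + 1), C (f n k j) * om p L n ^ j +
      ∑ j ∈ range (m + 1), C (f n k j) * om p L n ^ (j + 1) := by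
    rw [mul_sum, ← sum_add_distrib]
    refine sum_congr rfl fun j _ => ?_
    linear_combination (C (f n k j) * om p L n ^ j) * hom
  have e3 : ∑ j ∈ range (m + 1), C (f' n 0 j) *
      ((1 + X) ^ 0 * om p L n ^ j) =
      ∑ j ∈ range m, C (f n k (j + 1)) * om p L n ^ (j + 1) +
      ∑ j ∈ range m, C (f n k j) * om p L n ^ (j + 1) +
      C (f n k 0) := by
    rw [sum_range_succ', h2, ← sum_add_distrib]
    simp only [pow_zero, one_mul, mul_one]
    congr 1
    refine sum_congr rfl fun j hj => ?_
    rw [h3 j (mem_range.1 hj), map_add, add_mul]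
  rw [e1, e2, e3, sum_range_succ', sum_range_succ _ m]
  simp only [pow_zero, mul_one]
  ring

lemma tendsto_powerSeries_zero {F : ℕ → L⟦X⟧} {U : Filter ℕ} {ε : ℕ → ℝ} {θ : ℝ}
    (hε : Tendsto ε U (𝓝 0)) (h : ∀ᶠ N in U, Bd (ε N) θ (F N)) : Tendsto F U (𝓝 0) := by
  refine (tendsto_iff_coeff_tendsto L _ _ _).2 fun i => ?_
  rw [map_zero]
  refine squeeze_zero_norm' (h.mono fun N hN => hN i) ?_
  simpa using hε.mul_const (θ ^ i)

variable [IsUltrametricDist L] [ProperSpace L]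

lemma hat_shift {s c : ℝ} {f f' : Arr L} (hc : 0 ≤ c) (hs : 1 ≤ s)
    (hsp : s < (p : ℝ) ^ (m + 1)) (hr : Refines p m f) (hf : Grow p m s c f)
    (h : ShiftRel p m f' f) : hat p m f' = (1 + PowerSeries.X) * hat p m f := by
  have hp := p_pos p
  have h0 : Tendsto (fun N => ((om p L N ^ (m + 1) * C (f N (p ^ N - 1) m) :
      L[X]) : L⟦X⟧)) atTop (𝓝 0) := by
    refine tendsto_powerSeries_zero (tendsto_error c hs hsp 0) (θ := theta p 0)
      (Eventually.of_forall fun N => ?_)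
    have hθ := theta_nonneg p 0
    rw [Polynomial.coe_mul, Polynomial.coe_pow, coe_C]
    refine ((om_bd_pow p L (Nat.zero_le N)).pow hθ (m + 1)).mul hθ
      ((Bd.C hθ _).mono ?_ (by positivity) hθ le_rfl)
    refine (hf N _ m (Nat.sub_lt (pow_pos (Fact.out : p.Prime).pos N) one_pos) le_rfl).trans ?_
    gcongr
    omega
  refine Tendsto.limUnder_eq ?_
  have h1 := ((tendsto_hat hc hs hsp.le hr hf).const_mul (1 + PowerSeries.X)).sub
    (h0.mono_left Nat.hyperfilter_le_atTop)
  rw [sub_zero] at h1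
  refine h1.congr fun N => ?_
  rw [Apol_shift h, Polynomial.coe_sub, Polynomial.coe_mul (1 + X), Polynomial.coe_add,
    Polynomial.coe_one, coe_X]

lemma Refines.of_tendsto {F : ℕ → Arr L} {f : Arr L} (hr : ∀ d, Refines p m (F d))
    (h : ∀ n a j, Tendsto (fun d => F d n a j) (hyperfilter ℕ) (𝓝 (f n a j))) :
    Refines p m f := fun n a j ha hj => by
  refine tendsto_nhds_unique (h n a j) ?_
  have : Tendsto (fun d => ∑ i ∈ range p, ∑ l ∈ range (m + 1),
    (cc p i j l : L) * F d (n + 1) (a + i * p ^ n) l) (hyperfilter ℕ)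
    (𝓝 (∑ i ∈ range p, ∑ l ∈ range (m + 1),
      (cc p i j l : L) * f (n + 1) (a + i * p ^ n) l)) :=
    tendsto_finsetSum _ fun i _ => tendsto_finsetSum _ fun l _ => (h _ _ _).const_mul _
  exact this.congr fun d => (hr d n a j ha hj).symm

/-- The power series depends continuously on the array, on uniformly bounded sets. -/
lemma tendsto_hat_of_tendsto {s c : ℝ} {F : ℕ → Arr L} {f : Arr L}
    (hc : 0 ≤ c) (hs : 1 ≤ s) (hsp : s < (p : ℝ) ^ (m + 1)) (hr : ∀ d, Refines p m (F d))
    (hF : ∀ d, Grow p m s c (F d))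
    (h : ∀ n a j, Tendsto (fun d => F d n a j) (hyperfilter ℕ) (𝓝 (f n a j))) :
    Tendsto (fun d => hat p m (F d)) (hyperfilter ℕ) (𝓝 (hat p m f)) := by
  have hfr := Refines.of_tendsto hr h
  have hfg : Grow p m s c f := fun n a j ha hj =>
    le_of_tendsto (h n a j).norm (Eventually.of_forall fun d => hF d n a j ha hj)
  refine (tendsto_iff_coeff_tendsto L _ _ _).2 fun i => ?_
  rw [Metric.tendsto_nhds]
  intro ε hε
  have h4 := (tendsto_error c hs hsp 0).mul_const (theta p 0 ^ i)
  rw [zero_mul] at h4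
  obtain ⟨N, hN⟩ := (h4.eventually (gt_mem_nhds hε)).exists
  have hA : Tendsto (fun d => (Apol p m (F d) N).coeff i) (hyperfilter ℕ)
      (𝓝 ((Apol p m f N).coeff i)) := by
    simp only [Apol, finsetSum_coeff, coeff_C_mul]
    exact tendsto_finsetSum _ fun a _ => tendsto_finsetSum _ fun j _ => (h _ _ _).mul_const _
  filter_upwards [(Metric.tendsto_nhds.1 hA) ε hε] with d hd
  have h1 := (hat_sub_Apol_bd hc hs hsp.le (hr d) (hF d) (Nat.zero_le N) i).trans_lt hN
  have h2 := (hat_sub_Apol_bd hc hs hsp.le hfr hfg (Nat.zero_le N) i).trans_lt hN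
  rw [dist_eq_norm] at hd ⊢
  rw [map_sub, coeff_coe] at h1 h2
  have e : PowerSeries.coeff i (hat p m (F d)) - PowerSeries.coeff i (hat p m f) =
      ((PowerSeries.coeff i (hat p m (F d)) - (Apol p m (F d) N).coeff i) +
      ((Apol p m (F d) N).coeff i - (Apol p m f N).coeff i)) +
      -(PowerSeries.coeff i (hat p m f) - (Apol p m f N).coeff i) := by ring
  rw [e]
  refine (norm_add_le_max _ _).trans_lt (max_lt
    ((norm_add_le_max _ _).trans_lt (max_lt h1 hd)) (by rwa [norm_neg]))

end Shift

section Determinant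

variable (p L)
  [IsUltrametricDist L]

/-- The normalized polynomial `p⁻ⁿ χ_n`, with constant term `1`. -/
def uPol (n : ℕ) : L[X] := C ((p : L) ^ n)⁻¹ * chi p L n

/-- A limit of the polynomials `uPol n` (the series `log (1 + X) / X`). -/
def uSer : L⟦X⟧ := limUnder (hyperfilter ℕ : Filter ℕ) fun n => (uPol p L n : L⟦X⟧)

variable [ProperSpace L]

lemma tendsto_uSer : Tendsto (fun n => (uPol p L n : L⟦X⟧)) (hyperfilter ℕ) (𝓝 (uSer p L)) := by
  refine tendsto_nhds_limUnder ?_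
  have hb : ∀ n i, ‖(uPol p L n).coeff i‖ ≤ ‖((i + 1 : ℕ) : L)‖⁻¹ := by
    intro n i
    have hp := p_pos p
    rw [uPol, coeff_C_mul, coeff_chi, norm_mul, norm_inv, norm_pow, norm_p, inv_pow,
      inv_inv]
    calc _ ≤ (p : ℝ) ^ n * ((p : ℝ)⁻¹ ^ n * ‖((i + 1 : ℕ) : L)‖⁻¹) := by
          gcongr; exact norm_choose_le p L n i
      _ = _ := by rw [inv_pow, mul_inv_cancel_left₀ (by positivity)]
  have (i : ℕ) := exists_tendsto_hyperfilter fun n => hb n i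
  choose g hg using this
  refine ⟨PowerSeries.mk g, (tendsto_iff_coeff_tendsto L _ _ _).2
    fun i => ?_⟩
  simpa using hg i

lemma coeff_zero_uSer : PowerSeries.coeff 0 (uSer p L) = 1 := by
  refine tendsto_nhds_unique
    ((tendsto_iff_coeff_tendsto L _ _ _).1 (tendsto_uSer p L) 0) ?_
  refine tendsto_const_nhds.congr fun n => ?_
  have hp : (p : L) ≠ 0 := natCast_ne_zero' p L (Fact.out : p.Prime).ne_zero
  rw [coeff_coe, uPol, coeff_C_mul, coeff_chi]
  simp [hp]

lemma uSer_ne_zero : uSer p L ≠ 0 := fun h => by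
  have := coeff_zero_uSer p L
  simp [h] at this

variable {p L}

/-- Conditions on the pair of arrays attached to a functional. -/
structure PairOK (p m : ℕ) (s t : ℝ) (e : ℕ → L) (c : ℝ) (f g : Arr L) : Prop where
  ref_left : Refines p m f
  ref_right : Refines p m g
  grow_left : Grow p m s c f
  grow_right : Grow p m t c g
  link : ∀ n, Om p L n ^ (m + 1) ∣ Apol p m g (n + 1) - C (e n) * Apol p m f (n + 1)

lemma PairOK.link_of_lt {s t : ℝ} {e : ℕ → L} {c : ℝ} {f g : Arr L} (hc : 0 ≤ c)
    (hs : 1 ≤ s) (ht : 1 ≤ t) (hsp : s ≤ (p : ℝ) ^ (m + 1)) (htp : t ≤ (p : ℝ) ^ (m + 1))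
    (h : PairOK p m s t e c f g) {l n : ℕ} (hl : l < n) :
    Om p L l ^ (m + 1) ∣ Apol p m g n - C (e l) * Apol p m f n := by
  obtain ⟨R, hR, -⟩ := exists_remainder hc hs hsp h.ref_left h.grow_left hl
  obtain ⟨R', hR', -⟩ := exists_remainder hc ht htp h.ref_right h.grow_right hl
  have h1 : Om p L l ^ (m + 1) ∣ om p L (l + 1) ^ (m + 1) :=
    pow_dvd_pow_of_dvd (Om_dvd_om p L (Nat.lt_succ_self l)) _
  have h2 : Apol p m g n - C (e l) * Apol p m f n =
      (Apol p m g (l + 1) - C (e l) * Apol p m f (l + 1)) +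
      om p L (l + 1) ^ (m + 1) * (R' - C (e l) * R) := by
    rw [hR, hR']; ring
  rw [h2]
  exact dvd_add (h.link l) (dvd_mul_of_dvd_left h1 _)

lemma chi_pow_dvd {s t : ℝ} {e : ℕ → L} {c c' : ℝ} {f g f' g' : Arr L}
    (hc : 0 ≤ c) (hc' : 0 ≤ c')
    (hs : 1 ≤ s) (ht : 1 ≤ t) (hsp : s ≤ (p : ℝ) ^ (m + 1)) (htp : t ≤ (p : ℝ) ^ (m + 1))
    (h : PairOK p m s t e c f g) (h' : PairOK p m s t e c' f' g') (n : ℕ) : chi p L n ^ (m + 1) ∣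
      Apol p m f n * Apol p m g' n - Apol p m g n * Apol p m f' n := by
  rw [chi, ← prod_pow]
  refine prod_dvd_of_coprime (fun l _ l' _ hne => ?_) fun l hl => ?_
  · rcases lt_or_gt_of_ne hne with hlt | hlt
    · exact (isCoprime_Om p L hlt).pow
    · exact (isCoprime_Om p L hlt).symm.pow
  · have hl := mem_range.1 hl
    have h1 := h.link_of_lt hc hs ht hsp htp hl
    have h2 := h'.link_of_lt hc' hs ht hsp htp hl
    have e1 : Apol p m f n * Apol p m g' n - Apol p m g n * Apol p m f' n =
        Apol p m f n * (Apol p m g' n - C (e l) * Apol p m f' n) -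
        (Apol p m g n - C (e l) * Apol p m f n) * Apol p m f' n := by ring
    rw [e1]
    exact dvd_sub (dvd_mul_of_dvd_right h2 _) (dvd_mul_of_dvd_left h1 _)

/-- The determinant of two functionals is `uSer ^ (m + 1)` times a bounded series. -/
lemma exists_det {s t : ℝ} {e : ℕ → L} {c c' : ℝ} {f g f' g' : Arr L}
    (hc : 0 ≤ c) (hc' : 0 ≤ c')
    (hs : 1 ≤ s) (ht : 1 ≤ t) (hsp : s ≤ (p : ℝ) ^ (m + 1)) (htp : t ≤ (p : ℝ) ^ (m + 1))
    (hst : s * t = (p : ℝ) ^ (m + 1))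
    (h : PairOK p m s t e c f g) (h' : PairOK p m s t e c' f' g') :
    ∃ D : L⟦X⟧, hat p m f * hat p m g' - hat p m g * hat p m f' =
      uSer p L ^ (m + 1) * D ∧ Bd (c * c' * (s * t)) 1 D := by
  have hp := p_pos p
  have hpL : (p : L) ≠ 0 := natCast_ne_zero' p L (Fact.out : p.Prime).ne_zero
  have hs0 : 0 ≤ s := zero_le_one.trans hs
  have ht0 : 0 ≤ t := zero_le_one.trans ht
  set W := hat p m f * hat p m g' - hat p m g * hat p m f' with hW
  have key : ∀ n, ∃ D : L⟦X⟧, W = (uPol p L n : L⟦X⟧) ^ (m + 1) * D ∧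
      Bd (c * c' * (s * t)) (theta p n) D := by
    intro n
    have hθ := theta_nonneg p n
    have hθ1 := one_le_theta p n
    obtain ⟨D, hD⟩ := chi_pow_dvd hc hc' hs ht hsp htp h h' n
    obtain ⟨R1, e1, b1⟩ := exists_hat_remainder hc hs hsp h.ref_left h.grow_left n
    obtain ⟨R2, e2, b2⟩ := exists_hat_remainder hc ht htp h.ref_right h.grow_right n
    obtain ⟨R3, e3, b3⟩ := exists_hat_remainder hc' hs hsp h'.ref_left h'.grow_left n
    obtain ⟨R4, e4, b4⟩ := exists_hat_remainder hc' ht htp h'.ref_right h'.grow_right n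
    have a1 := Apol_bd hc hs0 h.grow_left n hθ1
    have a2 := Apol_bd hc ht0 h.grow_right n hθ1
    have a3 := Apol_bd hc' hs0 h'.grow_left n hθ1
    have a4 := Apol_bd hc' ht0 h'.grow_right n hθ1
    have o := (om_bd_one p L n hθ1).pow hθ (m + 1)
    rw [one_pow] at o
    set ω : L⟦X⟧ := (om p L n : L⟦X⟧) ^ (m + 1) with hω
    set A1 : L⟦X⟧ := (Apol p m f n : L⟦X⟧) with hA1
    set A2 : L⟦X⟧ := (Apol p m g n : L⟦X⟧) with hA2
    set A3 : L⟦X⟧ := (Apol p m f' n : L⟦X⟧) with hA3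
    set A4 : L⟦X⟧ := (Apol p m g' n : L⟦X⟧) with hA4
    set Z := ((R1 * A4 + A1 * R4) + ω * (R1 * R4)) - ((R2 * A3 + A2 * R3) + ω * (R2 * R3)) with hZ
    have hWeq : W = (A1 * A4 - A2 * A3) + ω * Z := by rw [hW, e1, e2, e3, e4, hZ]; ring
    set K := c * c' * (s * t) * (s * t) ^ n with hK
    have hK0 : 0 ≤ K := by positivity
    have hsn := pow_nonneg hs0 n
    have htn := pow_nonneg ht0 n
    have i1 : c * s ^ (n + 1) * (c' * t ^ n) ≤ K := by
      rw [hK, mul_pow]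
      calc _ = (c * c' * s * s ^ n * t ^ n) * 1 := by ring
        _ ≤ (c * c' * s * s ^ n * t ^ n) * t := by gcongr
        _ = _ := by ring
    have i2 : c * s ^ n * (c' * t ^ (n + 1)) ≤ K := by
      rw [hK, mul_pow]
      calc _ = (c * c' * t * s ^ n * t ^ n) * 1 := by ring
        _ ≤ (c * c' * t * s ^ n * t ^ n) * s := by gcongr
        _ = _ := by ring
    have i3 : 1 * (c * s ^ (n + 1) * (c' * t ^ (n + 1))) ≤ K := by
      rw [hK, mul_pow]; exact le_of_eq (by ring)
    have hZb : Bd K (theta p n) Z := by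
      refine Bd.sub (Bd.add (Bd.add ?_ ?_) ?_) (Bd.add (Bd.add ?_ ?_) ?_)
      · exact (b1.mul hθ a4).mono i1 hK0 hθ le_rfl
      · exact (a1.mul hθ b4).mono i2 hK0 hθ le_rfl
      · exact (o.mul hθ (b1.mul hθ b4)).mono i3 hK0 hθ le_rfl
      · exact (b2.mul hθ a3).mono (le_of_eq_of_le (by ring) i2) hK0 hθ le_rfl
      · exact (a2.mul hθ b3).mono (le_of_eq_of_le (by ring) i1) hK0 hθ le_rfl
      · exact (o.mul hθ (b2.mul hθ b3)).mono (le_of_eq_of_le (by ring) i3) hK0 hθ le_rfl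
    have hDb : Bd K 1 (D : L⟦X⟧) := by
      refine bd_of_monic_mul (Q := chi p L n ^ (m + 1)) ((chi_monic p L n).pow _) ?_ ?_
      · rw [Polynomial.coe_pow]
        have hchi : Bd 1 1 (chi p L n : L⟦X⟧) := fun i => by
          rw [coeff_coe, coeff_chi, one_pow, one_mul]
          exact norm_natCast_le_one L _
        simpa using hchi.pow zero_le_one (m + 1)
      · rw [← hD, Polynomial.coe_sub, Polynomial.coe_mul, Polynomial.coe_mul]
        have i0 : c * s ^ n * (c' * t ^ n) ≤ K := by
          refine le_trans ?_ i2
          gcongr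
          omega
        refine Bd.sub (((Apol_bd hc hs0 h.grow_left n le_rfl).mul zero_le_one
            (Apol_bd hc' ht0 h'.grow_right n le_rfl)).mono i0 hK0 zero_le_one le_rfl)
          (((Apol_bd hc ht0 h.grow_right n le_rfl).mul zero_le_one
            (Apol_bd hc' hs0 h'.grow_left n le_rfl)).mono (le_of_eq_of_le (by ring) i0) hK0
              zero_le_one le_rfl)
    refine ⟨((p : L) ^ n) ^ (m + 1) • ((D : L⟦X⟧) + PowerSeries.X ^ (m + 1) * Z), ?_, ?_⟩
    · have hD' : A1 * A4 - A2 * A3 = (chi p L n : L⟦X⟧) ^ (m + 1) * D := by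
        rw [hA1, hA2, hA3, hA4, ← Polynomial.coe_mul, ← Polynomial.coe_mul, ← Polynomial.coe_sub,
          hD, Polynomial.coe_mul, Polynomial.coe_pow]
      have hu : ((p : L) ^ n) ^ (m + 1) • (uPol p L n : L⟦X⟧) ^ (m + 1) =
          (chi p L n : L⟦X⟧) ^ (m + 1) := by
        rw [← _root_.smul_pow, uPol, Polynomial.coe_mul, coe_C, PowerSeries.smul_eq_C_mul,
          ← mul_assoc, ← map_mul, mul_inv_cancel₀ (pow_ne_zero _ hpL), map_one, one_mul]
      rw [mul_smul_comm, ← smul_mul_assoc, hu, hWeq, hD', hω, om_eq_X_mul_chi, Polynomial.coe_mul,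
        coe_X, mul_pow]
      ring
    · have hsum : Bd K (theta p n) ((D : L⟦X⟧) + PowerSeries.X ^ (m + 1) * Z) := by
        refine (hDb.mono le_rfl hK0 zero_le_one hθ1).add ?_
        have := ((Bd.X (L := L) hθ1).pow hθ (m + 1)).mul hθ hZb
        rwa [one_pow, one_mul] at this
      refine (hsum.smul (((p : L) ^ n) ^ (m + 1))).mono (le_of_eq ?_) (by positivity) hθ le_rfl
      rw [hK, hst, norm_pow, norm_pow, norm_p, ← pow_mul, ← pow_mul, inv_pow, mul_comm (m + 1) n]
      field_simp
  choose D hD hDb using key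
  have hDb0 : ∀ n, Bd (c * c' * (s * t)) (theta p 0) (D n) := fun n =>
    (hDb n).mono le_rfl (hDb n).const_nonneg (theta_nonneg p n) (theta_anti p (Nat.zero_le n))
  obtain ⟨D', hD'⟩ := exists_tendsto_powerSeries hDb0
  refine ⟨D', ?_, fun i => ?_⟩
  · have h1 := ((tendsto_uSer p L).pow (m + 1)).mul hD'
    exact tendsto_nhds_unique (tendsto_const_nhds.congr hD) h1
  · have h1 := ((tendsto_iff_coeff_tendsto L _ _ _).1 hD' i).norm
    have h2 : Tendsto (fun n => c * c' * (s * t) * theta p n ^ i) (hyperfilter ℕ)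
        (𝓝 (c * c' * (s * t) * 1 ^ i)) :=
      (((tendsto_theta p).pow i).const_mul _).mono_left Nat.hyperfilter_le_atTop
    exact le_of_tendsto_of_tendsto h1 h2 (Eventually.of_forall fun n => hDb n i)

end Determinant

section Division

variable [IsUltrametricDist L]

lemma bd_inv {U : L⟦X⟧} (hU : Bd 1 1 U) (h0 : ‖PowerSeries.constantCoeff U‖ = 1) :
    Bd 1 1 U⁻¹ := fun i => by
  induction i using Nat.strong_induction_on with
  | _ i ih =>
    rw [PowerSeries.coeff_inv]
    split_ifs with h
    · simp [h0]
    · rw [norm_mul, norm_neg, norm_inv, h0, inv_one, one_mul]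
      refine norm_sum_le_of_forall_le_of_nonneg (by simp) fun x _ => ?_
      split_ifs with hx
      · rw [norm_mul]
        have h1 := hU x.1
        have h2 := ih x.2 hx
        simp only [one_pow, mul_one] at h1 h2 ⊢
        exact mul_le_one₀ h1 (norm_nonneg _) h2
      · simp

variable [ProperSpace L]

lemma exists_gap (L : Type) [NontriviallyNormedField L] [IsUltrametricDist L] [ProperSpace L] :
    ∃ ρ : ℝ, 0 < ρ ∧ ρ < 1 ∧ ∀ x : L, ‖x‖ < 1 → ‖x‖ ≤ ρ := by
  have hc : IsCompact (Metric.ball (0 : L) 1) :=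
    Metric.isCompact_of_isClosed_isBounded (isClosed_ball _ _)
      Metric.isBounded_ball
  obtain ⟨y, hy, hmax⟩ := hc.exists_isMaxOn ⟨0, by simp⟩ continuous_norm.continuousOn
  obtain ⟨z, hz, hz1⟩ := NormedField.exists_norm_lt_one L
  have hyy : ∀ x : L, ‖x‖ < 1 → ‖x‖ ≤ ‖y‖ := fun x hx => hmax (by simpa using hx)
  exact ⟨‖y‖, hz.trans_le (hyy z hz1), by simpa using hy, hyy⟩

/-- A nonzero bounded series has a first coefficient of maximal norm. -/
lemma exists_first_max {c : ℝ} {C : L⟦X⟧} (hC : Bd c 1 C) (h0 : C ≠ 0) :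
    ∃ (d : ℕ) (ρ : ℝ), ρ < 1 ∧ 0 < ρ ∧ PowerSeries.coeff d C ≠ 0 ∧
      (∀ i, ‖PowerSeries.coeff i C‖ ≤ ‖PowerSeries.coeff d C‖) ∧
      ∀ i, i < d → ‖PowerSeries.coeff i C‖ ≤ ρ * ‖PowerSeries.coeff d C‖ := by
  obtain ⟨ρ, hρ0, hρ1, hρ⟩ := exists_gap L
  have hbdd : BddAbove (Set.range fun i => ‖PowerSeries.coeff i C‖) :=
    ⟨c, by rintro _ ⟨i, rfl⟩; simpa using hC i⟩
  set S := ⨆ i, ‖PowerSeries.coeff i C‖ with hS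
  have hle : ∀ i, ‖PowerSeries.coeff i C‖ ≤ S := fun i => le_ciSup hbdd i
  obtain ⟨i0, hi0⟩ : ∃ i, PowerSeries.coeff i C ≠ 0 := by
    by_contra! hne
    exact h0 (PowerSeries.ext fun i => by simp [hne i])
  have hSpos : 0 < S := (norm_pos_iff.2 hi0).trans_le (hle i0)
  obtain ⟨i, hi⟩ : ∃ i, ρ * S < ‖PowerSeries.coeff i C‖ :=
    exists_lt_of_lt_ciSup (by rw [← hS]; nlinarith)
  have hipos : 0 < ‖PowerSeries.coeff i C‖ := lt_trans (by positivity) hi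
  have hmax : ∀ j, ‖PowerSeries.coeff j C‖ ≤ ‖PowerSeries.coeff i C‖ := by
    intro j
    by_contra! hlt
    have hjpos := hipos.trans hlt
    have h1 := hρ (PowerSeries.coeff i C / PowerSeries.coeff j C)
      (by rw [norm_div, div_lt_one hjpos]; exact hlt)
    rw [norm_div, div_le_iff₀ hjpos] at h1
    nlinarith [hle j]
  have hex : ∃ d, ‖PowerSeries.coeff d C‖ = ‖PowerSeries.coeff i C‖ := ⟨i, rfl⟩
  have hd := Nat.find_spec hex
  refine ⟨Nat.find hex, ρ, hρ1, hρ0, ?_, fun j => ?_, fun j hj => ?_⟩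
  · rw [← norm_pos_iff, hd]; exact hipos
  · rw [hd]; exact hmax j
  · have hlt := lt_of_le_of_ne (hmax j) (Nat.find_min hex hj)
    have h1 := hρ (PowerSeries.coeff j C / PowerSeries.coeff i C)
      (by rw [norm_div, div_lt_one hipos]; exact hlt)
    rw [norm_div, div_le_iff₀ hipos] at h1
    rw [hd]; exact h1

/-- Weierstrass division. -/
lemma exists_weierstrass {C : L⟦X⟧} {d : ℕ} {ρ : ℝ} (hρ0 : 0 ≤ ρ) (hρ1 : ρ < 1)
    (hC : Bd 1 1 C) (hd : ‖PowerSeries.coeff d C‖ = 1)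
    (hlow : ∀ i, i < d → ‖PowerSeries.coeff i C‖ ≤ ρ) {c : ℝ} (hc : 0 ≤ c) (f : L⟦X⟧)
    (hf : Bd c 1 f) :
    ∃ h r : L⟦X⟧, f = h * C + r ∧ Bd c 1 h ∧ ∀ i, d ≤ i → PowerSeries.coeff i r = 0 := by
  set U : L⟦X⟧ := PowerSeries.mk fun i => PowerSeries.coeff (i + d) C with hU
  have hCU : C = PowerSeries.X ^ d * U + (trunc d C : L⟦X⟧) :=
    PowerSeries.eq_X_pow_mul_shift_add_trunc d C
  have hUc : ‖PowerSeries.constantCoeff U‖ = 1 := by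
    rw [← coeff_zero_eq_constantCoeff_apply, hU, coeff_mk, zero_add, hd]
  have hUinv : Bd 1 1 U⁻¹ := bd_inv (fun i => by
    have := hC (i + d)
    simpa [hU] using this) hUc
  have hUne : PowerSeries.constantCoeff U ≠ 0 := by rw [← norm_pos_iff, hUc]; exact one_pos
  have htr : Bd ρ 1 (trunc d C : L⟦X⟧) := fun i => by
    rw [coeff_coe, coeff_trunc]
    split_ifs with hi
    · simpa using hlow i hi
    · simpa using hρ0
  have step : ∀ (e : ℝ) (g : L⟦X⟧), Bd e 1 g → ∃ h r : L⟦X⟧,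
      Bd e 1 h ∧ Bd e 1 r ∧ (∀ i, d ≤ i → PowerSeries.coeff i r = 0) ∧
        Bd (e * ρ) 1 (g - (h * C + r)) := by
    intro e g hg
    have he := hg.const_nonneg
    have hsh : Bd e 1 (PowerSeries.mk fun i => PowerSeries.coeff (i + d) g) := fun i => by
      simpa using hg (i + d)
    have hh := hsh.mul zero_le_one hUinv
    rw [mul_one] at hh
    refine ⟨_, (trunc d g : L⟦X⟧), hh, fun i => ?_, fun i hi => ?_, ?_⟩
    · rw [coeff_coe, coeff_trunc]
      split_ifs
      · exact hg i
      · simpa using he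
    · rw [coeff_coe, coeff_trunc, if_neg (by omega)]
    · have e1 : g - ((PowerSeries.mk fun i => PowerSeries.coeff (i + d) g) * U⁻¹ * C +
          (trunc d g : L⟦X⟧)) =
          -(((PowerSeries.mk fun i => PowerSeries.coeff (i + d) g) * U⁻¹) *
            (trunc d C : L⟦X⟧)) := by
        have e2 := PowerSeries.eq_X_pow_mul_shift_add_trunc d g
        have e3 := PowerSeries.inv_mul_cancel U hUne
        linear_combination e2 - ((PowerSeries.mk fun i => PowerSeries.coeff (i + d) g) * U⁻¹) * hCU
          - PowerSeries.X ^ d * (PowerSeries.mk fun i => PowerSeries.coeff (i + d) g) * e3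
      rw [e1]
      exact (hh.mul zero_le_one htr).neg
  have iter : ∀ n : ℕ, ∃ h r : L⟦X⟧, Bd c 1 h ∧ Bd c 1 r ∧
      (∀ i, d ≤ i → PowerSeries.coeff i r = 0) ∧ Bd (c * ρ ^ n) 1 (f - (h * C + r)) := by
    intro n
    induction n with
    | zero => exact ⟨0, 0, Bd.zero hc zero_le_one, Bd.zero hc zero_le_one, by simp, by simpa⟩
    | succ n ih =>
      obtain ⟨h, r, h1, h2, h3, h4⟩ := ih
      obtain ⟨h', r', h1', h2', h3', h4'⟩ := step _ _ h4
      have hle : c * ρ ^ n ≤ c := mul_le_of_le_one_right hc (pow_le_one₀ hρ0 hρ1.le)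
      refine ⟨h + h', r + r', h1.add (h1'.mono hle hc zero_le_one le_rfl),
        h2.add (h2'.mono hle hc zero_le_one le_rfl), fun i hi => by
          rw [map_add, h3 i hi, h3' i hi, add_zero], ?_⟩
      rw [pow_succ, ← mul_assoc]
      convert h4' using 1
      ring
  choose h r h1 h2 h3 h4 using iter
  obtain ⟨h', hh'⟩ := exists_tendsto_powerSeries h1
  obtain ⟨r', hr'⟩ := exists_tendsto_powerSeries h2
  refine ⟨h', r', ?_, Bd.of_tendsto hh' (Eventually.of_forall h1), fun i hi => ?_⟩
  · have t1 : Tendsto (fun n => f - (h n * C + r n)) (hyperfilter ℕ) (𝓝 0) := by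
      refine tendsto_powerSeries_zero (ε := fun n => c * ρ ^ n) ?_ (Eventually.of_forall h4)
      have := (tendsto_pow_atTop_nhds_zero_of_lt_one hρ0 hρ1).const_mul c
      rw [mul_zero] at this
      exact this.mono_left Nat.hyperfilter_le_atTop
    have t2 : Tendsto (fun n => f - (h n * C + r n)) (hyperfilter ℕ) (𝓝 (f - (h' * C + r'))) :=
      tendsto_const_nhds.sub ((hh'.mul_const C).add hr')
    exact sub_eq_zero.1 (tendsto_nhds_unique t2 t1)
  · refine tendsto_nhds_unique
      ((tendsto_iff_coeff_tendsto L _ _ _).1 hr' i) ?_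
    exact tendsto_const_nhds.congr fun n => (h3 n i hi).symm

/-- The distinguished polynomial attached to a series by Weierstrass preparation. -/
lemma exists_distinguished {C : L⟦X⟧} {d : ℕ} {ρ : ℝ} (hρ0 : 0 ≤ ρ) (hρ1 : ρ < 1)
    (hC : Bd 1 1 C) (hd : ‖PowerSeries.coeff d C‖ = 1)
    (hlow : ∀ i, i < d → ‖PowerSeries.coeff i C‖ ≤ ρ) (hC0 : PowerSeries.coeff 0 C ≠ 0) :
    ∃ (h : L⟦X⟧) (r : L[X]), Bd 1 1 h ∧ r.degree < d ∧
      ((X ^ d - r : L[X]) : L⟦X⟧) = h * C ∧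
      (∀ i, ‖r.coeff i‖ ≤ ρ) ∧ (X ^ d - r).coeff 0 ≠ 0 := by
  have hX := (Bd.X (L := L) (le_refl (1 : ℝ))).pow zero_le_one d
  rw [one_pow] at hX
  obtain ⟨h, r, e, hh, hr⟩ := exists_weierstrass hρ0 hρ1 hC hd hlow zero_le_one _ hX
  have er : ((trunc d r : L[X]) : L⟦X⟧) = r := by
    ext i
    rw [coeff_coe, coeff_trunc]
    split_ifs with hi
    · rfl
    · rw [hr i (by omega)]
  have hP : ((X ^ d - trunc d r : L[X]) : L⟦X⟧) =
      h * C := by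
    rw [Polynomial.coe_sub, er, Polynomial.coe_pow, coe_X, e]; ring
  refine ⟨h, trunc d r, hh, PowerSeries.degree_trunc_lt r d, hP, fun i => ?_, ?_⟩
  · rw [coeff_trunc]
    split_ifs with hi
    · have e1 := congrArg (PowerSeries.coeff i) e
      rw [map_add, PowerSeries.coeff_X_pow, if_neg hi.ne] at e1
      rw [← norm_neg, neg_eq_of_add_eq_zero_left e1.symm, PowerSeries.coeff_mul]
      refine norm_sum_le_of_forall_le_of_nonneg hρ0 fun x hx => ?_
      have hx := HasAntidiagonal.mem_antidiagonal.1 hx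
      rw [norm_mul]
      have h1 := hh x.1
      simp only [one_pow, mul_one] at h1
      calc _ ≤ 1 * ρ := mul_le_mul h1 (hlow _ (by omega)) (norm_nonneg _) zero_le_one
        _ = ρ := one_mul _
    · simpa using hρ0
  · rw [← coeff_coe, hP, coeff_zero_eq_constantCoeff_apply, map_mul,
      ← coeff_zero_eq_constantCoeff_apply,
      ← coeff_zero_eq_constantCoeff_apply]
    refine mul_ne_zero (fun h0 => ?_) hC0
    have e1 := congrArg (PowerSeries.coeff d) e
    rw [map_add, PowerSeries.coeff_X_pow_self, hr d le_rfl, add_zero, PowerSeries.coeff_mul] at e1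
    have : ‖(1 : L)‖ ≤ ρ := by
      rw [e1]
      refine norm_sum_le_of_forall_le_of_nonneg hρ0 fun x hx => ?_
      have hx := HasAntidiagonal.mem_antidiagonal.1 hx
      rw [norm_mul]
      rcases Nat.eq_zero_or_pos x.1 with hx0 | hx0
      · rw [hx0, h0]; simpa using hρ0
      have h1 := hh x.1
      simp only [one_pow, mul_one] at h1
      calc _ ≤ 1 * ρ := mul_le_mul h1 (hlow _ (by omega)) (norm_nonneg _) zero_le_one
        _ = ρ := one_mul _
    rw [norm_one] at this
    linarith

end Division

section Operator

variable (p)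
  [IsUltrametricDist L] {Q : Type*} [AddCommGroup Q] [Module L Q]

lemma exists_recurrence_bound {d : ℕ} {ρ : ℝ} (hρ0 : 0 ≤ ρ) (hρ1 : ρ < 1) {r : ℕ → L}
    (hr : ∀ i, ‖r i‖ ≤ ρ) {b : ℕ → L} (hb : ∀ j, b (j + d) = ∑ i ∈ range d, r i * b (j + i)) :
    ∃ B : ℝ, 0 ≤ B ∧ ∀ k j, k * d ≤ j → ‖b j‖ ≤ B * ρ ^ k := by
  refine ⟨∑ i ∈ range d, ‖b i‖, by positivity, fun k => ?_⟩
  set B := ∑ i ∈ range d, ‖b i‖ with hB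
  have hB0 : 0 ≤ B := by positivity
  have hstep : ∀ (e : ℝ) j, 0 ≤ e → d ≤ j → (∀ i, i < d → ‖b (j - d + i)‖ ≤ e) →
      ‖b j‖ ≤ e * ρ := by
    intro e j he hj h
    obtain ⟨j, rfl⟩ := Nat.exists_eq_add_of_le' hj
    rw [hb]
    refine norm_sum_le_of_forall_le_of_nonneg (by positivity) fun i hi => ?_
    rw [norm_mul, mul_comm]
    have := h i (mem_range.1 hi)
    rw [Nat.add_sub_cancel] at this
    exact mul_le_mul this (hr i) (norm_nonneg _) he
  induction k with
  | zero =>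
    intro j _
    rw [pow_zero, mul_one]
    induction j using Nat.strong_induction_on with
    | _ j ih =>
      rcases lt_or_ge j d with hj | hj
      · exact single_le_sum (f := fun i => ‖b i‖) (fun i _ => norm_nonneg _)
          (mem_range.2 hj)
      · refine (hstep B j hB0 hj fun i hi => ih _ (by omega) (by simp)).trans ?_
        exact mul_le_of_le_one_right hB0 hρ1.le
  | succ k ih =>
    intro j hj
    rw [Nat.succ_mul] at hj
    rw [pow_succ, ← mul_assoc]
    exact hstep _ j (by positivity) (by omega) fun i _ => ih _ (by omega)

/-- A module on which a distinguished polynomial with nonzero constant term kills all the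
operators `(1 + N) ^ pⁿ - 1` vanishes. -/
lemma subsingleton_of_distinguished (N : End L Q) {d : ℕ} {ρ : ℝ} (hρ0 : 0 ≤ ρ)
    (hρ1 : ρ < 1) {r : L[X]} (hdeg : r.degree < d) (hr : ∀ i, ‖r.coeff i‖ ≤ ρ)
    (h0 : (X ^ d - r).coeff 0 ≠ 0) (hN : ∀ n, aeval N ((X ^ d - r).comp (om p L n)) = 0) :
    Subsingleton Q := by
  by_contra hns
  rw [not_subsingleton_iff_nontrivial] at hns
  obtain ⟨q, hq⟩ := exists_ne (0 : Q)
  obtain ⟨ξ, hξ⟩ : ∃ ξ : Dual L Q, ξ q ≠ 0 := by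
    by_contra! hall
    exact hq ((Module.forall_dual_apply_eq_zero_iff L q).1 hall)
  set b : ℕ → L := fun i => ξ ((N ^ i) q) with hb
  have hr1 : ∀ i, ‖r.coeff i‖ ≤ 1 := fun i => (hr i).trans hρ1.le
  have hsum : ∀ G : L[X], ξ (aeval N G q) =
      ∑ i ∈ range (G.natDegree + 1), G.coeff i * b i := by
    intro G
    rw [aeval_eq_sum_range, LinearMap.sum_apply, map_sum]
    refine sum_congr rfl fun i _ => ?_
    rw [LinearMap.smul_apply, map_smul, smul_eq_mul]
  have hrec : ∀ j, b (j + d) = ∑ i ∈ range d, r.coeff i * b (j + i) := by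
    intro j
    have h1 := hN 0
    rw [om_zero, comp_X, map_sub, map_pow, aeval_X, sub_eq_zero] at h1
    have h2 : aeval N r = ∑ i ∈ range d, r.coeff i • N ^ i := by
      rcases eq_or_ne r 0 with rfl | hr0
      · simp
      · exact aeval_eq_sum_range' ((natDegree_lt_iff_degree_lt hr0).2 hdeg) N
    rw [h2] at h1
    simp only [hb]
    rw [pow_add, h1, mul_sum, LinearMap.sum_apply, map_sum]
    refine sum_congr rfl fun i _ => ?_
    rw [mul_smul_comm, LinearMap.smul_apply, map_smul, smul_eq_mul, pow_add]
  obtain ⟨B, hB0, hB⟩ := exists_recurrence_bound hρ0 hρ1 hr hrec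
  set P := X ^ d - r with hP
  have hPint : Bd 1 1 (P.divX : L⟦X⟧) := fun i => by
    rw [coeff_coe, coeff_divX, hP, coeff_sub,
      coeff_X_pow, one_pow, mul_one, sub_eq_add_neg]
    refine (norm_add_le_max _ _).trans (max_le ?_ ?_)
    · split_ifs <;> simp
    · rw [norm_neg]; exact hr1 _
  have hp := p_pos p
  have hkey : ∀ n K, ‖P.coeff 0 * ξ q‖ ≤ max (B * ρ ^ K)
      (B * ((p : ℝ)⁻¹ ^ (n + 1) * theta p 0 ^ (K * d))) := by
    intro n K
    have hθ := theta_nonneg p 0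
    have hθ1 := one_le_theta p 0
    set H := P.divX.comp (om p L n) with hH
    have hcompBd : ∀ θ : ℝ, 1 ≤ θ → Bd 1 θ (H : L⟦X⟧) := by
      intro θ hθ1
      have hθ0 : 0 ≤ θ := zero_le_one.trans hθ1
      rw [hH, comp_eq_sum_left, sum, coe_sum]
      refine Bd.sum zero_le_one hθ0 _ fun i _ => ?_
      rw [Polynomial.coe_mul, coe_C, Polynomial.coe_pow]
      have h2 := (Bd.C hθ0 (P.divX.coeff i)).mul hθ0 ((om_bd_one p L n hθ1).pow hθ0 i)
      refine h2.mono ?_ zero_le_one hθ0 le_rfl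
      rw [one_pow, mul_one]
      simpa using hPint i
    have e1 : P.comp (om p L n) = om p L n * H + C (P.coeff 0) := by
      have h := congrArg (fun F : L[X] => F.comp (om p L n)) (X_mul_divX_add P)
      simp only [add_comp, mul_comp, X_comp,
        C_comp] at h
      exact h.symm
    have e2 := hN n
    rw [e1, map_add, aeval_C] at e2
    have e3 := congrArg (fun F : End L Q => ξ (F q)) e2
    simp only [LinearMap.add_apply, map_add, algebraMap_end_apply, map_smul, smul_eq_mul,
      LinearMap.zero_apply, map_zero, hsum] at e3
    rw [← norm_neg, neg_eq_of_add_eq_zero_left e3]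
    refine norm_sum_le_of_forall_le_of_nonneg
      (le_max_of_le_left (by positivity)) fun i _ => ?_
    have g1 := ((om_bd_one p L n le_rfl).mul zero_le_one (hcompBd 1 le_rfl)) i
    have g2 := ((om_bd_pow p L (Nat.zero_le n)).mul hθ (hcompBd _ hθ1)) i
    rw [← Polynomial.coe_mul, coeff_coe] at g1 g2
    simp only [one_pow, mul_one] at g1
    rw [mul_one, Nat.sub_zero] at g2
    rw [norm_mul, mul_comm]
    rcases le_or_gt (K * d) i with hi | hi
    · refine le_max_of_le_left ?_
      calc _ ≤ (B * ρ ^ K) * 1 := mul_le_mul (hB K i hi) g1 (norm_nonneg _) (by positivity)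
        _ = _ := mul_one _
    · refine le_max_of_le_right ?_
      have hb0 := hB 0 i (by simp)
      rw [pow_zero, mul_one] at hb0
      refine mul_le_mul hb0 (g2.trans ?_) (norm_nonneg _) hB0
      gcongr
  have hpos : 0 < ‖P.coeff 0 * ξ q‖ := norm_pos_iff.2 (mul_ne_zero h0 hξ)
  obtain ⟨K, hK⟩ : ∃ K : ℕ, B * ρ ^ K < ‖P.coeff 0 * ξ q‖ := by
    have := (tendsto_pow_atTop_nhds_zero_of_lt_one hρ0 hρ1).const_mul B
    rw [mul_zero] at this
    exact (this.eventually (gt_mem_nhds hpos)).exists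
  obtain ⟨n, hn⟩ : ∃ n : ℕ, B * ((p : ℝ)⁻¹ ^ (n + 1) * theta p 0 ^ (K * d)) <
      ‖P.coeff 0 * ξ q‖ := by
    have h1 := (tendsto_pow_atTop_nhds_zero_of_lt_one (r := (p : ℝ)⁻¹) (by positivity)
      (inv_lt_one_of_one_lt₀ (one_lt_p p)))
    have := (((tendsto_add_atTop_iff_nat 1).2 h1).mul_const (theta p 0 ^ (K * d))).const_mul B
    rw [zero_mul, mul_zero] at this
    exact (this.eventually (gt_mem_nhds hpos)).exists
  exact absurd (hkey n K) (not_le.2 (max_lt hK hn))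

end Operator

section Bounded

variable [IsUltrametricDist L]
  {V : Type*} [AddCommGroup V] [Module L V]

/-- The functional `lam` is bounded by `c` on `Θ`. -/
def BddOn (Θ : AddSubgroup V) (c : ℝ) (lam : Dual L V) : Prop := ∀ x ∈ Θ, ‖lam x‖ ≤ c

lemma BddOn.nonneg {Θ : AddSubgroup V} {c : ℝ} {lam : Dual L V} (h : BddOn Θ c lam) :
    0 ≤ c := (norm_nonneg _).trans (h 0 Θ.zero_mem)

lemma BddOn.mono {Θ : AddSubgroup V} {c c' : ℝ} {lam : Dual L V} (h : BddOn Θ c lam)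
    (hc : c ≤ c') : BddOn Θ c' lam := fun x hx => (h x hx).trans hc

lemma BddOn.add {Θ : AddSubgroup V} {c : ℝ} {lam lam' : Dual L V} (h : BddOn Θ c lam)
    (h' : BddOn Θ c lam') : BddOn Θ c (lam + lam') := fun x hx =>
  (norm_add_le_max _ _).trans (max_le (h x hx) (h' x hx))

lemma BddOn.smul {Θ : AddSubgroup V} {c : ℝ} {lam : Dual L V} (h : BddOn Θ c lam) (a : L) :
    BddOn Θ (‖a‖ * c) (a • lam) := fun x hx => by
  rw [LinearMap.smul_apply, norm_smul]
  exact mul_le_mul_of_nonneg_left (h x hx) (norm_nonneg a)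

variable (L) in
/-- The functionals which are bounded on `Θ`. -/
def bddDual (Θ : AddSubgroup V) : Submodule L (Dual L V) where
  carrier := {lam | ∃ c, BddOn Θ c lam}
  add_mem' := by
    rintro a b ⟨c, hc⟩ ⟨c', hc'⟩
    exact ⟨max c c', (hc.mono (le_max_left _ _)).add (hc'.mono (le_max_right _ _))⟩
  zero_mem' := ⟨0, fun x _ => by simp⟩
  smul_mem' := by
    rintro a b ⟨c, hc⟩
    exact ⟨_, hc.smul a⟩

/-- The transpose of `S - 1`. -/
def nilT (S : V →ₗ[L] V) : End L (Dual L V) := S.dualMap - 1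

lemma nilT_apply (S : V →ₗ[L] V) (lam : Dual L V) (x : V) : nilT S lam x = lam (S x) - lam x := rfl

lemma BddOn.nilT {Θ : AddSubgroup V} {S : V →ₗ[L] V} (hS : ∀ x ∈ Θ, S x ∈ Θ) {c : ℝ}
    {lam : Dual L V} (h : BddOn Θ c lam) : BddOn Θ c (nilT S lam) := fun x hx => by
  rw [nilT_apply, sub_eq_add_neg]
  refine (norm_add_le_max _ _).trans (max_le (h _ (hS x hx)) ?_)
  rw [norm_neg]; exact h x hx

lemma BddOn.aeval_nilT {Θ : AddSubgroup V} {S : V →ₗ[L] V} (hS : ∀ x ∈ Θ, S x ∈ Θ) {c e : ℝ}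
    {lam : Dual L V} (h : BddOn Θ c lam) {P : L[X]} (he : 0 ≤ e) (hP : ∀ i, ‖P.coeff i‖ ≤ e) :
    BddOn Θ (e * c) (aeval (PadicPi.nilT S) P lam) := fun x hx => by
  have hpow : ∀ i : ℕ, BddOn Θ c ((PadicPi.nilT S ^ i) lam) := by
    intro i
    induction i with
    | zero => simpa using h
    | succ i ih =>
      rw [pow_succ', End.mul_apply]
      exact ih.nilT hS
  rw [aeval_eq_sum_range, LinearMap.sum_apply, LinearMap.sum_apply]
  refine norm_sum_le_of_forall_le_of_nonneg (mul_nonneg he h.nonneg)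
    fun i _ => ?_
  rw [LinearMap.smul_apply, LinearMap.smul_apply, norm_smul]
  exact mul_le_mul (hP i) (hpow i x hx) (norm_nonneg _) he

end Bounded

section Hats

variable [IsUltrametricDist L] [ProperSpace L] {V : Type*} [AddCommGroup V] [Module L V]

/-- The array of values of a functional. -/
def arr (x : Arr V) (lam : Dual L V) : Arr L := fun n a j => lam (x n a j)

/-- The family `x` defines bounded distributions on the functionals bounded on `Θ`. -/
structure Good (p m : ℕ) [Fact p.Prime] (s K : ℝ) (S : V →ₗ[L] V) (Θ : AddSubgroup V)
    (x : Arr V) : Prop where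
  one_le : 1 ≤ s
  lt_pow : s < (p : ℝ) ^ (m + 1)
  nonneg : 0 ≤ K
  stable : ∀ y ∈ Θ, S y ∈ Θ
  refines : ∀ lam : Dual L V, Refines p m (arr x lam)
  grow : ∀ (lam : Dual L V) (c : ℝ), BddOn Θ c lam → Grow p m s (K * c) (arr x lam)
  shift : ∀ lam : Dual L V, ShiftRel p m (arr x (lam ∘ₗ S)) (arr x lam)

variable {s K : ℝ} {S : V →ₗ[L] V} {Θ : AddSubgroup V} {x : Arr V}

/-- The power series attached to a functional. -/
def hatP (p m : ℕ) (x : Arr V) (lam : Dual L V) : L⟦X⟧ :=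
  hat p m (arr x lam)

lemma Good.hatP_add (h : Good p m s K S Θ x) {lam lam' : Dual L V}
    (hl : lam ∈ bddDual L Θ) (hl' : lam' ∈ bddDual L Θ) :
    hatP p m x (lam + lam') = hatP p m x lam + hatP p m x lam' := by
  obtain ⟨c, hc⟩ := hl
  obtain ⟨c', hc'⟩ := hl'
  have h1 := hc.mono (le_max_left c c')
  have h2 := hc'.mono (le_max_right c c')
  exact hat_add (mul_nonneg h.nonneg h1.nonneg) h.one_le h.lt_pow.le (h.refines _) (h.grow _ _ h1)
    (h.refines _) (h.grow _ _ h2)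

lemma Good.hatP_smul (h : Good p m s K S Θ x) {lam : Dual L V} (hl : lam ∈ bddDual L Θ) (a : L) :
    hatP p m x (a • lam) = a • hatP p m x lam := by
  obtain ⟨c, hc⟩ := hl
  rw [PowerSeries.smul_eq_C_mul]
  exact hat_smul (mul_nonneg h.nonneg hc.nonneg) h.one_le h.lt_pow.le (h.refines _) (h.grow _ _ hc) a

/-- `hatP` as a linear map. -/
def Good.hatM (h : Good p m s K S Θ x) : bddDual L Θ →ₗ[L] L⟦X⟧ where
  toFun lam := hatP p m x lam.1
  map_add' a b := h.hatP_add a.2 b.2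
  map_smul' a b := h.hatP_smul b.2 a

lemma Good.hatP_sub (h : Good p m s K S Θ x) {lam lam' : Dual L V}
    (hl : lam ∈ bddDual L Θ) (hl' : lam' ∈ bddDual L Θ) :
    hatP p m x (lam - lam') = hatP p m x lam - hatP p m x lam' :=
  map_sub h.hatM (⟨lam, hl⟩ : bddDual L Θ) ⟨lam', hl'⟩

lemma Good.coeff_zero_hatP (h : Good p m s K S Θ x) {lam : Dual L V}
    (hl : lam ∈ bddDual L Θ) : PowerSeries.coeff 0 (hatP p m x lam) = lam (x 0 0 0) := by
  obtain ⟨c, hc⟩ := hl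
  exact coeff_zero_hat (mul_nonneg h.nonneg hc.nonneg) h.one_le h.lt_pow.le (h.refines _)
    (h.grow _ _ hc)

lemma Good.eq_zero (h : Good p m s K S Θ x) {lam : Dual L V}
    (hl : lam ∈ bddDual L Θ) (h0 : hatP p m x lam = 0) {n a j : ℕ} (ha : a < p ^ n) (hj : j ≤ m) :
    lam (x n a j) = 0 := by
  obtain ⟨c, hc⟩ := hl
  exact eq_zero_of_hat_eq_zero (mul_nonneg h.nonneg hc.nonneg) h.one_le h.lt_pow (h.refines _)
    (h.grow _ _ hc) h0 ha hj

lemma nilT_mem (hS : ∀ y ∈ Θ, S y ∈ Θ) {lam : Dual L V} (hl : lam ∈ bddDual L Θ) :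
    nilT S lam ∈ bddDual L Θ := by
  obtain ⟨c, hc⟩ := hl
  exact ⟨c, hc.nilT hS⟩

lemma aeval_mem_of_stable {W : Type*} [AddCommGroup W] [Module L W] {M : Submodule L W}
    {N : End L W} (hN : ∀ y ∈ M, N y ∈ M) (P : L[X]) {y : W} (hy : y ∈ M) : aeval N P y ∈ M := by
  have hpow : ∀ i : ℕ, (N ^ i) y ∈ M := by
    intro i
    induction i with
    | zero => simpa using hy
    | succ i ih => rw [pow_succ', End.mul_apply]; exact hN _ ih
  rw [aeval_eq_sum_range, LinearMap.sum_apply]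
  exact M.sum_mem fun i _ => M.smul_mem _ (hpow i)

lemma Good.hatP_nilT (h : Good p m s K S Θ x) {lam : Dual L V}
    (hl : lam ∈ bddDual L Θ) : hatP p m x (nilT S lam) = PowerSeries.X * hatP p m x lam := by
  obtain ⟨c, hc⟩ := id hl
  have hS : lam ∘ₗ S ∈ bddDual L Θ := ⟨c, fun y hy => hc _ (h.stable y hy)⟩
  have h1 : hatP p m x (lam ∘ₗ S) = (1 + PowerSeries.X) * hatP p m x lam :=
    hat_shift (mul_nonneg h.nonneg hc.nonneg) h.one_le h.lt_pow (h.refines _) (h.grow _ _ hc)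
      (h.shift lam)
  have h2 : nilT S lam = lam ∘ₗ S - lam := rfl
  rw [h2, h.hatP_sub hS hl, h1]; ring

lemma Good.hatP_aeval (h : Good p m s K S Θ x) (P : L[X]) {lam : Dual L V}
    (hl : lam ∈ bddDual L Θ) : hatP p m x (aeval (nilT S) P lam) = (P : L⟦X⟧) * hatP p m x lam := by
  have hst : ∀ y ∈ bddDual L Θ, nilT S y ∈ bddDual L Θ := fun y hy => nilT_mem h.stable hy
  induction P using Polynomial.induction_on' with
  | add P Q hP hQ =>
    rw [map_add, LinearMap.add_apply, h.hatP_add (aeval_mem_of_stable hst P hl)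
      (aeval_mem_of_stable hst Q hl), hP, hQ, Polynomial.coe_add, add_mul]
  | monomial n a =>
    rw [← C_mul_X_pow_eq_monomial]
    induction n with
    | zero =>
      rw [pow_zero, mul_one, aeval_C, algebraMap_end_apply, h.hatP_smul hl,
        coe_C, PowerSeries.smul_eq_C_mul]
    | succ n ih =>
      rw [pow_succ, ← mul_assoc, mul_comm _ X, map_mul, End.mul_apply,
        aeval_X, h.hatP_nilT (aeval_mem_of_stable hst _ hl), ih,
        Polynomial.coe_mul X, coe_X, mul_assoc]

lemma tendsto_trunc_hyperfilter (f : L⟦X⟧) :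
    Tendsto (fun d => (trunc d f : L⟦X⟧)) (hyperfilter ℕ) (𝓝 f) := by
  refine (tendsto_iff_coeff_tendsto L _ _ _).2 fun i => ?_
  refine Tendsto.mono_left ?_ Nat.hyperfilter_le_atTop
  refine tendsto_const_nhds.congr' ?_
  filter_upwards [eventually_gt_atTop i] with d hd
  rw [coeff_coe, coeff_trunc, if_pos hd]

/-- Bounded power series act on the functionals bounded on an absorbing stable subgroup. -/
lemma exists_mul_functional {Λ : AddSubgroup V} (hΛ : ∀ y ∈ Λ, S y ∈ Λ) (hΘ : Θ ≤ Λ)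
    (habs : ∀ v : V, ∃ c : L, c ≠ 0 ∧ c • v ∈ Λ) {e : ℝ} {f : L⟦X⟧} (hf : Bd e 1 f)
    {mu : Dual L V} (hmu : mu ∈ bddDual L Λ) :
    ∃ mu' ∈ bddDual L Λ, ∀ (s K : ℝ) (x : Arr V), Good p m s K S Θ x →
      hatP p m x mu' = f * hatP p m x mu := by
  obtain ⟨c, hc⟩ := hmu
  have he := hf.const_nonneg
  have hec : 0 ≤ e * c := mul_nonneg he hc.nonneg
  set F : ℕ → Dual L V := fun d => aeval (nilT S) (trunc d f) mu
    with hF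
  have hFb : ∀ d, BddOn Λ (e * c) (F d) := fun d => hc.aeval_nilT hΛ he fun i => by
    rw [coeff_trunc]
    split_ifs
    · simpa using hf i
    · simpa using he
  have hlim : ∀ v : V, ∃ y : L, Tendsto (fun d => F d v) (hyperfilter ℕ) (𝓝 y) := by
    intro v
    obtain ⟨a, ha, hav⟩ := habs v
    refine exists_tendsto_hyperfilter (C := ‖a‖⁻¹ * (e * c)) fun d => ?_
    have h1 := hFb d _ hav
    rw [map_smul, norm_smul] at h1
    rw [inv_mul_eq_div, le_div_iff₀ (norm_pos_iff.2 ha), mul_comm]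
    exact h1
  choose g hg using hlim
  let mu' : Dual L V :=
    { toFun := g
      map_add' := fun a b => tendsto_nhds_unique (hg (a + b))
        (((hg a).add (hg b)).congr fun d => ((F d).map_add a b).symm)
      map_smul' := fun a b => tendsto_nhds_unique (hg (a • b))
        (((hg b).const_smul a).congr fun d => ((F d).map_smul a b).symm) }
  refine ⟨mu', ⟨e * c, fun y hy => le_of_tendsto (hg y).norm
    (Eventually.of_forall fun d => hFb d y hy)⟩, fun s K x hx => ?_⟩
  have hmuΘ : mu ∈ bddDual L Θ := ⟨c, fun y hy => hc y (hΘ hy)⟩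
  have t1 : Tendsto (fun d => hatP p m x (F d)) (hyperfilter ℕ) (𝓝 (hatP p m x mu')) :=
    tendsto_hat_of_tendsto (mul_nonneg hx.nonneg hec) hx.one_le hx.lt_pow
      (fun d => hx.refines (F d)) (fun d => hx.grow _ _ fun y hy => hFb d y (hΘ hy))
      fun n a j => hg (x n a j)
  have t2 : Tendsto (fun d => hatP p m x (F d)) (hyperfilter ℕ) (𝓝 (f * hatP p m x mu)) :=
    ((tendsto_trunc_hyperfilter f).mul_const _).congr fun d => (hx.hatP_aeval _ hmuΘ).symm
  exact tendsto_nhds_unique t1 t2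

end Hats

section LinearAlgebra

variable {L : Type} [Field L]

lemma finite_quotient {M Z : Type*} [AddCommGroup M] [Module L M] [AddCommGroup Z] [Module L Z]
    (Φ₁ Φ₂ : M →ₗ[L] Z) {F : Submodule L Z} [Module.Finite L F] (h₁ : ∀ y, Φ₁ y ∈ F)
    (h₂ : ∀ y, Φ₂ y ∈ F) {K : Submodule L M} (hK : ∀ y, Φ₁ y = 0 → Φ₂ y = 0 → y ∈ K) :
    Module.Finite L (M ⧸ K) := by
  set Φ : M →ₗ[L] F × F := (Φ₁.codRestrict F h₁).prod (Φ₂.codRestrict F h₂) with hΦ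
  have hker : LinearMap.ker Φ ≤ K := by
    intro y hy
    have hy : (Φ₁.codRestrict F h₁ y, Φ₂.codRestrict F h₂ y) = 0 := hy
    rw [Prod.mk_eq_zero] at hy
    exact hK y (congrArg Subtype.val hy.1) (congrArg Subtype.val hy.2)
  have : Module.Finite L (M ⧸ LinearMap.ker Φ) :=
    Module.Finite.equiv Φ.quotKerEquivRange.symm
  exact Module.Finite.of_surjective (Submodule.factor hker) (factor_surjective hker)

lemma aeval_mul_of_mul_eq {Q : Type*} [AddCommGroup Q] [Module L Q] {A B C : End L Q}
    (h : A * B = B * C) (F : L[X]) : aeval A F * B = B * aeval C F := by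
  induction F using Polynomial.induction_on' with
  | add P Q hP hQ => rw [map_add, map_add, add_mul, mul_add, hP, hQ]
  | monomial n a =>
    rw [aeval_monomial, aeval_monomial, mul_assoc, ← mul_assoc B,
      ← Algebra.commutes a B, mul_assoc]
    congr 1
    induction n with
    | zero => simp
    | succ n ih => rw [pow_succ', mul_assoc, ih, ← mul_assoc, h, mul_assoc, ← pow_succ']

lemma pow_mul_of_mul_eq {R : Type*} [Monoid R] {T ψ : R} {k : ℕ} (h : T * ψ = ψ * T ^ k)
    (n : ℕ) : T * ψ ^ n = ψ ^ n * T ^ k ^ n := by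
  have hpow : ∀ i : ℕ, T ^ i * ψ = ψ * (T ^ k) ^ i := by
    intro i
    induction i with
    | zero => simp
    | succ i ih => rw [pow_succ', mul_assoc, ih, ← mul_assoc, h, mul_assoc, ← pow_succ']
  induction n with
  | zero => simp
  | succ n ih =>
    rw [pow_succ, ← mul_assoc, ih, mul_assoc, hpow, ← mul_assoc, ← pow_mul, ← pow_succ']

end LinearAlgebra

section Main

variable [IsUltrametricDist L] [ProperSpace L] {V : Type*} [AddCommGroup V] [Module L V]

/-- The span of two families. -/
def spanPair (L : Type) [NontriviallyNormedField L] {V : Type*} [AddCommGroup V] [Module L V]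
    (p m : ℕ) (xa xb : Arr V) : Submodule L V :=
  span L {v | ∃ n a j, a < p ^ n ∧ j ≤ m ∧ (v = xa n a j ∨ v = xb n a j)}

/-- The data used to compare two stable lattices. -/
structure Sys (p m : ℕ) [Fact p.Prime] (s t K : ℝ) (e : ℕ → L) (S : V →ₗ[L] V) (G : V ≃ₗ[L] V)
    (xa xb : Arr V) (Θ : AddSubgroup V) : Prop where
  good_left : Good p m s K S Θ xa
  good_right : Good p m t K S Θ xb
  mul_eq : s * t = (p : ℝ) ^ (m + 1)
  link : ∀ (lam : Dual L V) n, Om p L n ^ (m + 1) ∣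
    Apol p m (arr xb lam) (n + 1) - C (e n) * Apol p m (arr xa lam) (n + 1)
  indep : ∀ a b : L, a • xa 0 0 0 + b • xb 0 0 0 = 0 → a = 0 ∧ b = 0
  comm : ∀ v, G (S v) = (S ^ p) (G v)
  S_span : ∀ v ∈ spanPair L p m xa xb, S v ∈ spanPair L p m xa xb
  G_span : ∀ v ∈ spanPair L p m xa xb, G v ∈ spanPair L p m xa xb
  G_mem : ∀ v ∈ Θ, G v ∈ Θ
  G_symm_mem : ∀ v ∈ Θ, G.symm v ∈ Θ

variable {s t K : ℝ} {e : ℕ → L} {S : V →ₗ[L] V} {G : V ≃ₗ[L] V}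
  {xa xb : Arr V} {Θ Λ : AddSubgroup V}

lemma Sys.pairOK (h : Sys p m s t K e S G xa xb Θ) {lam : Dual L V} {c : ℝ}
    (hc : BddOn Θ c lam) : PairOK p m s t e (K * c) (arr xa lam) (arr xb lam) :=
  ⟨h.good_left.refines _, h.good_right.refines _, h.good_left.grow _ _ hc, h.good_right.grow _ _ hc,
    h.link lam⟩

lemma Sys.exists_det (h : Sys p m s t K e S G xa xb Θ) {lam mu : Dual L V}
    (hl : lam ∈ bddDual L Θ) (hm : mu ∈ bddDual L Θ) :
    ∃ (D : L⟦X⟧) (c : ℝ), hatP p m xa lam * hatP p m xb mu -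
      hatP p m xb lam * hatP p m xa mu = uSer p L ^ (m + 1) * D ∧ Bd c 1 D := by
  obtain ⟨c, hc⟩ := hl
  obtain ⟨c', hc'⟩ := hm
  obtain ⟨D, h1, h2⟩ := PadicPi.exists_det (mul_nonneg h.good_left.nonneg hc.nonneg)
    (mul_nonneg h.good_left.nonneg hc'.nonneg) h.good_left.one_le h.good_right.one_le
    h.good_left.lt_pow.le h.good_right.lt_pow.le h.mul_eq (h.pairOK hc) (h.pairOK hc')
  exact ⟨D, _, h1, h2⟩

lemma Sys.mem_annihilator (h : Sys p m s t K e S G xa xb Θ) {lam : Dual L V}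
    (hl : lam ∈ bddDual L Θ) (ha : hatP p m xa lam = 0) (hb : hatP p m xb lam = 0) :
    lam ∈ (spanPair L p m xa xb).dualAnnihilator := by
  rw [mem_dualAnnihilator]
  intro v hv
  refine span_induction ?_ (map_zero _) (fun a b _ _ h1 h2 => by
    rw [map_add, h1, h2, add_zero]) (fun a b _ h1 => by rw [map_smul, h1, smul_zero]) hv
  rintro _ ⟨n, a, j, hn, hj, rfl | rfl⟩
  · exact h.good_left.eq_zero hl ha hn hj
  · exact h.good_right.eq_zero hl hb hn hj

lemma bddDual_mono (hΘ : Θ ≤ Λ) : bddDual L Λ ≤ bddDual L Θ := by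
  rintro a ⟨c, hc⟩
  exact ⟨c, fun y hy => hc y (hΘ hy)⟩

/-- The submodule of functionals agreeing on the span with one bounded on `Λ`. -/
def plusDual (L : Type) [NontriviallyNormedField L] [IsUltrametricDist L]
    {V : Type*} [AddCommGroup V] [Module L V] (p m : ℕ) (xa xb : Arr V)
    (Λ : AddSubgroup V) : Submodule L (Dual L V) :=
  bddDual L Λ ⊔ (spanPair L p m xa xb).dualAnnihilator

lemma plusDual_stable {A : V →ₗ[L] V} (h1 : ∀ y ∈ Λ, A y ∈ Λ)
    (h2 : ∀ v ∈ spanPair L p m xa xb, A v ∈ spanPair L p m xa xb) :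
    ∀ lam ∈ plusDual L p m xa xb Λ, A.dualMap lam ∈ plusDual L p m xa xb Λ := by
  intro lam hl
  obtain ⟨a, ⟨c, hc⟩, b, hb, rfl⟩ := Submodule.mem_sup.1 hl
  rw [map_add]
  refine add_mem_sup ⟨c, fun y hy => hc _ (h1 y hy)⟩ ?_
  rw [mem_dualAnnihilator] at hb ⊢
  exact fun w hw => hb _ (h2 w hw)

/-- Solving for a functional by Cramer's rule. -/
lemma Sys.cramer {u D D1 D2 a1 b1 a2 b2 a b : L⟦X⟧} (hu : u ≠ 0)
    (h0 : a1 * b2 - b1 * a2 = u * D) (h1 : a * b2 - b * a2 = u * D1)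
    (h2 : a1 * b - b1 * a = u * D2) : D * a = D1 * a1 + D2 * a2 ∧ D * b = D1 * b1 + D2 * b2 := by
  constructor
  · refine mul_left_cancel₀ hu ?_
    linear_combination (-a) * h0 + a1 * h1 + a2 * h2
  · refine mul_left_cancel₀ hu ?_
    linear_combination (-b) * h0 + b1 * h1 + b2 * h2

/-- A submodule stable under operators satisfying the commutation of a Frobenius is everything. -/
lemma eq_top_of_frobenius {M Z : Type*} [AddCommGroup M] [Module L M] [AddCommGroup Z] [Module L Z]
    (Φ₁ Φ₂ : M →ₗ[L] Z) {F : Submodule L Z} [Module.Finite L F] (h₁ : ∀ y, Φ₁ y ∈ F)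
    (h₂ : ∀ y, Φ₂ y ∈ F) {Kq : Submodule L M} (hK : ∀ y, Φ₁ y = 0 → Φ₂ y = 0 → y ∈ Kq) {N Ψ : End L M}
    (hNK : ∀ y ∈ Kq, N y ∈ Kq) (hΨK : ∀ y ∈ Kq, Ψ y ∈ Kq) {ρ : ℝ} (hρ0 : 0 < ρ) (hρ1 : ρ < 1)
    {d : ℕ} {r : L[X]} (hrdeg : r.degree < d) (hr : ∀ i, ‖r.coeff i‖ ≤ ρ)
    (hP0 : (X ^ d - r).coeff 0 ≠ 0)
    (hPN' : ∀ y, aeval N (X ^ d - r) y ∈ Kq) (hsurj : Function.Surjective Ψ)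
    (hcomm : ∀ y, Ψ y + N (Ψ y) = Ψ ((fun x => x + N x)^[p] y)) : ∀ y, y ∈ Kq := by
  set NQ : End L (M ⧸ Kq) := Kq.mapQ Kq N hNK with hNQ
  set ΨQ : End L (M ⧸ Kq) := Kq.mapQ Kq Ψ hΨK with hΨQ
  have hfin : Module.Finite L (M ⧸ Kq) := finite_quotient Φ₁ Φ₂ h₁ h₂ hK
  have haevalQ : ∀ (F : L[X]) (lam : M),
      aeval NQ F (Kq.mkQ lam) = Kq.mkQ (aeval N F lam) := by
    intro F lam
    induction F using Polynomial.induction_on' with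
    | add P Q hP hQ => simp only [map_add, LinearMap.add_apply, hP, hQ]
    | monomial n a =>
      rw [aeval_monomial, aeval_monomial, End.mul_apply,
        End.mul_apply, algebraMap_end_apply, algebraMap_end_apply, map_smul]
      congr 1
      induction n with
      | zero => rfl
      | succ n ih => rw [pow_succ', pow_succ', End.mul_apply, End.mul_apply, ih]; rfl
  have hPN : aeval NQ (X ^ d - r) = 0 := by
    refine LinearMap.ext fun q => ?_
    obtain ⟨lam, rfl⟩ := Kq.mkQ_surjective q
    rw [haevalQ, LinearMap.zero_apply, mkQ_apply, Submodule.Quotient.mk_eq_zero]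
    exact hPN' lam
  have hΨsurj : Function.Surjective ΨQ := by
    intro q
    obtain ⟨lam, rfl⟩ := Kq.mkQ_surjective q
    obtain ⟨mu, rfl⟩ := hsurj lam
    exact ⟨Kq.mkQ mu, rfl⟩
  have hΨinj : Function.Injective ΨQ := LinearMap.injective_iff_surjective.2 hΨsurj
  have hTΨ : (1 + NQ) * ΨQ = ΨQ * (1 + NQ) ^ p := by
    have hT : ∀ (i : ℕ) (lam : M), ((1 + NQ) ^ i) (Kq.mkQ lam) = Kq.mkQ ((fun x => x + N x)^[i] lam) := by
      intro i
      induction i with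
      | zero => exact fun lam => rfl
      | succ i ih =>
        intro lam
        rw [pow_succ', End.mul_apply, ih, Function.iterate_succ_apply', map_add]
        rfl
    refine LinearMap.ext fun q => ?_
    obtain ⟨lam, rfl⟩ := Kq.mkQ_surjective q
    rw [End.mul_apply, End.mul_apply, hT]
    exact congrArg Kq.mkQ (hcomm lam)
  have hsub : Subsingleton (M ⧸ Kq) := by
    refine subsingleton_of_distinguished p NQ hρ0.le hρ1 hrdeg hr hP0 fun n => ?_
    have e1 : NQ * ΨQ ^ n = ΨQ ^ n * aeval NQ (om p L n) := by
      have := pow_mul_of_mul_eq hTΨ n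
      simp only [om, map_sub, map_pow, map_add, map_one, aeval_X, mul_sub, mul_one]
      rw [← this, add_mul, one_mul, add_sub_cancel_left]
    have e2 := aeval_mul_of_mul_eq e1 (X ^ d - r)
    rw [hPN, zero_mul, ← aeval_comp] at e2
    refine LinearMap.ext fun q => ?_
    have hinj : Function.Injective (ΨQ ^ n) := by rw [End.coe_pow]; exact hΨinj.iterate n
    refine hinj ?_
    rw [LinearMap.zero_apply, map_zero]
    exact (congrArg (fun F : End L (M ⧸ Kq) => F q) e2).symm
  intro y
  have h1 : Kq.mkQ y = 0 := Subsingleton.elim _ _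
  rwa [mkQ_apply, Submodule.Quotient.mk_eq_zero] at h1

set_option maxHeartbeats 800000 in
/-- Every functional bounded on `Θ` agrees on the span with one bounded on `Λ`. -/
lemma Sys.bddDual_le (h : Sys p m s t K e S G xa xb Θ) (hΘ : Θ ≤ Λ)
    (habs : ∀ v : V, ∃ c : L, c ≠ 0 ∧ c • v ∈ Λ) (hSΛ : ∀ y ∈ Λ, S y ∈ Λ)
    (hGΛ : ∀ y ∈ Λ, G y ∈ Λ) (hsep : ∀ y : V, y ≠ 0 → ∃ lam ∈ bddDual L Λ, lam y ≠ 0) :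
    bddDual L Θ ≤ plusDual L p m xa xb Λ := by
  have hmono : bddDual L Λ ≤ bddDual L Θ := bddDual_mono hΘ
  have hu : uSer p L ^ (m + 1) ≠ 0 := pow_ne_zero _ (uSer_ne_zero p L)
  -- a pair of functionals with nonzero determinant
  obtain ⟨mu, hmu, nu, hnu, C, d, ρ, hρ1, hρ0, hW, hC, hCd, hClow, hC0⟩ :
      ∃ mu ∈ bddDual L Λ, ∃ nu ∈ bddDual L Λ, ∃ (C : L⟦X⟧) (d : ℕ) (ρ : ℝ), ρ < 1 ∧ 0 < ρ ∧
        hatP p m xa mu * hatP p m xb nu - hatP p m xb mu * hatP p m xa nu =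
          uSer p L ^ (m + 1) * C ∧ Bd 1 1 C ∧ ‖PowerSeries.coeff d C‖ = 1 ∧
        (∀ i, i < d → ‖PowerSeries.coeff i C‖ ≤ ρ) ∧ PowerSeries.coeff 0 C ≠ 0 := by
    have hxa : xa 0 0 0 ≠ 0 := fun h0 => by
      have := (h.indep 1 0 (by simp [h0])).1
      exact one_ne_zero this
    obtain ⟨mu, hmu, hmu0⟩ := hsep _ hxa
    have hy : xb 0 0 0 - (mu (xb 0 0 0) / mu (xa 0 0 0)) • xa 0 0 0 ≠ 0 := fun h0 => by
      have := (h.indep (-(mu (xb 0 0 0) / mu (xa 0 0 0))) 1 (by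
        rw [neg_smul, one_smul, neg_add_eq_sub, h0])).2
      exact one_ne_zero this
    obtain ⟨nu, hnu, hnu0⟩ := hsep _ hy
    obtain ⟨C, c, hW, hC⟩ := h.exists_det (hmono hmu) (hmono hnu)
    have hC0 : PowerSeries.coeff 0 C ≠ 0 := by
      intro h0
      have h1 := congrArg (PowerSeries.constantCoeff (R := L)) hW
      rw [coeff_zero_eq_constantCoeff_apply] at h0
      simp only [map_sub, map_mul, h0, mul_zero] at h1
      simp only [← coeff_zero_eq_constantCoeff_apply,
        h.good_left.coeff_zero_hatP (hmono hmu), h.good_left.coeff_zero_hatP (hmono hnu),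
        h.good_right.coeff_zero_hatP (hmono hmu), h.good_right.coeff_zero_hatP (hmono hnu)] at h1
      apply hnu0
      rw [map_sub, map_smul, smul_eq_mul]
      field_simp
      linear_combination h1
    obtain ⟨d, ρ, hρ1, hρ0, hd0, hdmax, hdlow⟩ := exists_first_max hC
      (fun h0 => hC0 (by rw [h0, map_zero]))
    set a := (PowerSeries.coeff d C)⁻¹ with ha
    have hd0' : 0 < ‖PowerSeries.coeff d C‖ := norm_pos_iff.2 hd0
    have hna : ‖a‖ = ‖PowerSeries.coeff d C‖⁻¹ := by rw [ha, norm_inv]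
    refine ⟨a • mu, smul_mem _ a hmu, nu, hnu, a • C, d, ρ, hρ1, hρ0, ?_, fun i => ?_, ?_,
      fun i hi => ?_, ?_⟩
    · rw [h.good_left.hatP_smul (hmono hmu), h.good_right.hatP_smul (hmono hmu), smul_mul_assoc,
        smul_mul_assoc, ← smul_sub, hW, mul_smul_comm]
    · rw [one_pow, mul_one, PowerSeries.coeff_smul, norm_smul, hna, inv_mul_le_iff₀ hd0', mul_one]
      exact hdmax i
    · rw [PowerSeries.coeff_smul, norm_smul, hna, inv_mul_cancel₀ hd0'.ne']
    · rw [PowerSeries.coeff_smul, norm_smul, hna, inv_mul_le_iff₀ hd0', mul_comm]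
      exact hdlow i hi
    · rw [PowerSeries.coeff_smul]
      exact smul_ne_zero (inv_ne_zero hd0) hC0
  -- combinations of `mu` and `nu` realize bounded coefficients
  have hcomb : ∀ lam ∈ bddDual L Θ, ∀ (h1 h2 : L⟦X⟧) (c1 c2 : ℝ), Bd c1 1 h1 → Bd c2 1 h2 →
      hatP p m xa lam = h1 * hatP p m xa mu + h2 * hatP p m xa nu →
      hatP p m xb lam = h1 * hatP p m xb mu + h2 * hatP p m xb nu →
      lam ∈ plusDual L p m xa xb Λ := by
    intro lam hl h1 h2 c1 c2 hb1 hb2 ea eb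
    obtain ⟨m1, hm1, em1⟩ := exists_mul_functional (p := p) (m := m) hSΛ hΘ habs hb1 hmu
    obtain ⟨m2, hm2, em2⟩ := exists_mul_functional (p := p) (m := m) hSΛ hΘ habs hb2 hnu
    have hsum : m1 + m2 ∈ bddDual L Λ := Submodule.add_mem _ hm1 hm2
    have hz : lam - (m1 + m2) ∈ (spanPair L p m xa xb).dualAnnihilator := by
      refine h.mem_annihilator (Submodule.sub_mem _ hl (hmono hsum)) ?_ ?_
      · rw [h.good_left.hatP_sub hl (hmono hsum), h.good_left.hatP_add (hmono hm1) (hmono hm2), ea,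
          em1 _ _ _ h.good_left, em2 _ _ _ h.good_left, sub_self]
      · rw [h.good_right.hatP_sub hl (hmono hsum), h.good_right.hatP_add (hmono hm1) (hmono hm2), eb,
          em1 _ _ _ h.good_right, em2 _ _ _ h.good_right, sub_self]
    have := add_mem_sup hsum hz
    rwa [add_sub_cancel] at this
  obtain ⟨H, r, hH, hrdeg, hPH, hr, hP0⟩ := exists_distinguished hρ0.le hρ1 hC hCd hClow hC0
  -- the transposed operators on bounded functionals
  have hSst : ∀ lam ∈ bddDual L Θ, nilT S lam ∈ bddDual L Θ := fun lam hl =>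
    nilT_mem h.good_left.stable hl
  have hGst : ∀ lam ∈ bddDual L Θ, (G : V →ₗ[L] V).dualMap lam ∈ bddDual L Θ := by
    rintro lam ⟨c, hc⟩
    exact ⟨c, fun y hy => hc _ (h.G_mem y hy)⟩
  set N : End L (bddDual L Θ) := (nilT S).restrict hSst with hN
  set Ψ : End L (bddDual L Θ) := (G : V →ₗ[L] V).dualMap.restrict hGst with hΨ
  set Kq : Submodule L (bddDual L Θ) := (plusDual L p m xa xb Λ).comap (bddDual L Θ).subtype with hKq
  have hNK : Kq ≤ Kq.comap N := by
    intro lam hl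
    exact Submodule.sub_mem _ (plusDual_stable hSΛ h.S_span _ hl) hl
  have hΨK : Kq ≤ Kq.comap Ψ := by
    intro lam hl
    exact plusDual_stable (A := (G : V →ₗ[L] V)) hGΛ h.G_span _ hl
  have haevalN : ∀ (F : L[X]) (lam : bddDual L Θ),
      ((aeval N F lam : bddDual L Θ) : Dual L V) =
        aeval (nilT S) F lam.1 := by
    intro F lam
    induction F using Polynomial.induction_on' with
    | add P Q hP hQ =>
      rw [map_add, map_add, LinearMap.add_apply, LinearMap.add_apply, Submodule.coe_add, hP, hQ]
    | monomial n a =>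
      rw [aeval_monomial, aeval_monomial, End.mul_apply,
        End.mul_apply, algebraMap_end_apply, algebraMap_end_apply,
        Submodule.coe_smul]
      congr 1
      induction n with
      | zero => rfl
      | succ n ih => rw [pow_succ', pow_succ', End.mul_apply, End.mul_apply, ← ih]; rfl
  -- the distinguished polynomial kills the quotient
  have hPN : ∀ lam, aeval N (X ^ d - r) lam ∈ Kq := by
    intro lam
    rw [hKq, Submodule.mem_comap, subtype_apply, haevalN]
    obtain ⟨D1, c1, e1, b1⟩ := h.exists_det lam.2 (hmono hnu)
    obtain ⟨D2, c2, e2, b2⟩ := h.exists_det (hmono hmu) lam.2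
    obtain ⟨ea, eb⟩ := Sys.cramer hu hW e1 e2
    refine hcomb _ (aeval_mem_of_stable hSst _ lam.2) (H * D1) (H * D2) _ _
      (hH.mul zero_le_one b1) (hH.mul zero_le_one b2) ?_ ?_
    · rw [h.good_left.hatP_aeval _ lam.2, hPH, mul_assoc, ea]; ring
    · rw [h.good_right.hatP_aeval _ lam.2, hPH, mul_assoc, eb]; ring
  have hΨsurj : Function.Surjective Ψ := by
    intro lam
    obtain ⟨c, hc⟩ := lam.2
    refine ⟨⟨(G.symm : V →ₗ[L] V).dualMap lam.1,
      ⟨c, fun y hy => hc _ (h.G_symm_mem y hy)⟩⟩, ?_⟩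
    refine Subtype.ext (LinearMap.ext fun v => ?_)
    change lam.1 (G.symm (G v)) = lam.1 v
    rw [LinearEquiv.symm_apply_apply]
  have hTΨ : ∀ lam, Ψ lam + N (Ψ lam) = Ψ ((fun x => x + N x)^[p] lam) := by
    have hT : ∀ (i : ℕ) (lam : bddDual L Θ) v, ((fun x => x + N x)^[i] lam).1 v = lam.1 ((S ^ i) v) := by
      intro i
      induction i with
      | zero => exact fun lam v => rfl
      | succ i ih =>
        intro lam v
        rw [Function.iterate_succ_apply', pow_succ, End.mul_apply, ← ih]
        set mu := (fun x => x + N x)^[i] lam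
        change mu.1 v + (mu.1 (S v) - mu.1 v) = _
        rw [add_sub_cancel]
    intro lam
    refine Subtype.ext (LinearMap.ext fun v => ?_)
    have h1 := hT 1 (Ψ lam) v
    rw [Function.iterate_one, pow_one] at h1
    rw [h1]
    change lam.1 (G (S v)) = ((fun x => x + N x)^[p] lam).1 (G v)
    rw [hT, h.comm]
  -- the quotient is finite dimensional
  have hall : ∀ lam, lam ∈ Kq := by
    set w : L⟦X⟧ := (uSer p L ^ (m + 1))⁻¹ with hw
    have huw : uSer p L ^ (m + 1) * w = 1 := by
      refine PowerSeries.mul_inv_cancel _ ?_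
      rw [map_pow, ← coeff_zero_eq_constantCoeff_apply, coeff_zero_uSer, one_pow]
      exact one_ne_zero
    let I : Submodule L L⟦X⟧ :=
      { carrier := {f | ∃ (g : L⟦X⟧) (c : ℝ), Bd c 1 g ∧ f = g * C}
        add_mem' := by
          rintro _ _ ⟨g, c, hg, rfl⟩ ⟨g', c', hg', rfl⟩
          exact ⟨g + g', max c c', (hg.mono (le_max_left _ _) (le_max_of_le_left hg.const_nonneg)
            zero_le_one le_rfl).add (hg'.mono (le_max_right _ _)
            (le_max_of_le_left hg.const_nonneg) zero_le_one le_rfl), by ring⟩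
        zero_mem' := ⟨0, 0, Bd.zero le_rfl zero_le_one, by simp⟩
        smul_mem' := by
          rintro a _ ⟨g, c, hg, rfl⟩
          exact ⟨a • g, _, hg.smul a, by rw [smul_mul_assoc]⟩ }
    let D1 : bddDual L Θ →ₗ[L] L⟦X⟧ :=
      mulRight L (hatP p m xb nu * w) ∘ₗ h.good_left.hatM -
        mulRight L (hatP p m xa nu * w) ∘ₗ h.good_right.hatM
    let D2 : bddDual L Θ →ₗ[L] L⟦X⟧ :=
      mulRight L (hatP p m xa mu * w) ∘ₗ h.good_right.hatM -
        mulRight L (hatP p m xb mu * w) ∘ₗ h.good_left.hatM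
    have hD1 : ∀ lam : bddDual L Θ, D1 lam = (hatP p m xa lam.1 * hatP p m xb nu -
        hatP p m xb lam.1 * hatP p m xa nu) * w := fun lam => by
      change hatP p m xa lam.1 * (hatP p m xb nu * w) - hatP p m xb lam.1 * (hatP p m xa nu * w) = _
      ring
    have hD2 : ∀ lam : bddDual L Θ, D2 lam = (hatP p m xa mu * hatP p m xb lam.1 -
        hatP p m xb mu * hatP p m xa lam.1) * w := fun lam => by
      change hatP p m xb lam.1 * (hatP p m xa mu * w) - hatP p m xa lam.1 * (hatP p m xb mu * w) = _
      ring
    let R : Submodule L L⟦X⟧ := span L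
      ((fun i : ℕ => (PowerSeries.X : L⟦X⟧) ^ i) '' (range d : Set ℕ))
    have hRfin : Module.Finite L R :=
      FiniteDimensional.span_of_finite L ((finite_toSet _).image _)
    have hbd : ∀ (f : L⟦X⟧) (c : ℝ), Bd c 1 f → I.mkQ f ∈ R.map I.mkQ := by
      intro f c hf
      obtain ⟨g, r', e, hg, hr'⟩ := exists_weierstrass hρ0.le hρ1 hC hCd hClow hf.const_nonneg f hf
      refine ⟨r', ?_, ?_⟩
      · have : r' = ∑ i ∈ range d, PowerSeries.coeff i r' • (PowerSeries.X : L⟦X⟧) ^ i := by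
          ext i
          rw [map_sum]
          simp only [PowerSeries.coeff_smul, PowerSeries.coeff_X_pow, smul_eq_mul, mul_ite, mul_one,
            mul_zero]
          rw [sum_ite_eq]
          split_ifs with hi
          · rfl
          · exact hr' i (by simpa using hi)
        rw [this]
        exact Submodule.sum_mem _ fun i hi => smul_mem _ _
          (subset_span ⟨i, hi, rfl⟩)
      · rw [← sub_eq_zero, ← map_sub, mkQ_apply, Submodule.Quotient.mk_eq_zero]
        exact ⟨-g, c, hg.neg, by rw [e]; ring⟩
    have hmapfin : Module.Finite L (R.map I.mkQ) := Module.Finite.map R I.mkQ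
    refine eq_top_of_frobenius (p := p) (M := bddDual L Θ) (N := N) (Ψ := Ψ) (Kq := Kq) (I.mkQ ∘ₗ D1) (I.mkQ ∘ₗ D2) (F := R.map I.mkQ) (fun lam => ?_)
      (fun lam => ?_) (fun lam hl1 hl2 => ?_) hNK hΨK hρ0 hρ1 hrdeg hr hP0 hPN hΨsurj hTΨ
    · obtain ⟨E1, c1, e1, b1⟩ := h.exists_det lam.2 (hmono hnu)
      have f1 : D1 lam = E1 := by rw [hD1, e1, mul_right_comm, huw, one_mul]
      rw [comp_apply, f1]
      exact hbd _ _ b1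
    · obtain ⟨E2, c2, e2, b2⟩ := h.exists_det (hmono hmu) lam.2
      have f2 : D2 lam = E2 := by rw [hD2, e2, mul_right_comm, huw, one_mul]
      rw [comp_apply, f2]
      exact hbd _ _ b2
    · rw [comp_apply, mkQ_apply, Submodule.Quotient.mk_eq_zero] at hl1 hl2
      obtain ⟨g1, c1, b1, f1⟩ := hl1
      obtain ⟨g2, c2, b2, f2⟩ := hl2
      have e1 : hatP p m xa lam.1 * hatP p m xb nu - hatP p m xb lam.1 * hatP p m xa nu =
          uSer p L ^ (m + 1) * (g1 * C) := by
        rw [← f1, hD1, mul_comm _ w, ← mul_assoc, huw, one_mul]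
      have e2 : hatP p m xa mu * hatP p m xb lam.1 - hatP p m xb mu * hatP p m xa lam.1 =
          uSer p L ^ (m + 1) * (g2 * C) := by
        rw [← f2, hD2, mul_comm _ w, ← mul_assoc, huw, one_mul]
      obtain ⟨ea, eb⟩ := Sys.cramer hu hW e1 e2
      have hCne : C ≠ 0 := fun h0 => hC0 (by rw [h0, map_zero])
      refine hcomb lam.1 lam.2 g1 g2 c1 c2 b1 b2 (mul_left_cancel₀ hCne ?_)
        (mul_left_cancel₀ hCne ?_)
      · rw [ea]; ring
      · rw [eb]; ring
  exact fun lam hl => hall ⟨lam, hl⟩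

end Main

section HahnBanach

variable [IsUltrametricDist L] [ProperSpace L]
  {V : Type*} [AddCommGroup V] [Module L V] {Θ : AddSubgroup V}

/-- One step of the extension of an integral functional. -/
lemma exists_extension_step (hO : ∀ c : L, ‖c‖ ≤ 1 → ∀ y ∈ Θ, c • y ∈ Θ) {f : V →ₗ.[L] L}
    (hf : ∀ x : f.domain, (x : V) ∈ Θ → ‖f x‖ ≤ 1) (hdom : f.domain ≠ ⊤) :
    ∃ g, f < g ∧ ∀ x : g.domain, (x : V) ∈ Θ → ‖g x‖ ≤ 1 := by
  obtain ⟨y, -, hy⟩ : ∃ y ∈ ⊤, y ∉ f.domain := SetLike.exists_of_lt (lt_top_iff_ne_top.2 hdom)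
  obtain ⟨a, ha⟩ : ∃ a : L, ∀ (w : f.domain) (t : L), t ≠ 0 → (w : V) + t • y ∈ Θ →
      ‖f w + t * a‖ ≤ 1 := by
    set ι := {q : f.domain × L // q.2 ≠ 0 ∧ (q.1 : V) + q.2 • y ∈ Θ} with hι
    rcases isEmpty_or_nonempty ι with he | hne
    · exact ⟨0, fun w t ht hw => (he.false ⟨(w, t), ht, hw⟩).elim⟩
    set B : ι → Set L := fun q => Metric.closedBall (-(f q.1.1 / q.1.2)) ‖q.1.2‖⁻¹ with hB
    have hBmem : ∀ (q : ι) (a : L), a ∈ B q ↔ ‖f q.1.1 + q.1.2 * a‖ ≤ 1 := by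
      intro q a
      have hq := q.2.1
      have hq' : 0 < ‖q.1.2‖ := norm_pos_iff.2 hq
      rw [hB, Metric.mem_closedBall, dist_eq_norm, sub_neg_eq_add,
        show f q.1.1 + q.1.2 * a = q.1.2 * (a + f q.1.1 / q.1.2) by field_simp; ring, norm_mul,
        ← one_div, le_div_iff₀' hq']
    have hsub : ∀ q q' : ι, ‖q.1.2‖ ≤ ‖q'.1.2‖ → B q' ⊆ B q := by
      intro q q' hle a ha
      rw [hBmem] at ha ⊢
      have hq' : 0 < ‖q'.1.2‖ := norm_pos_iff.2 q'.2.1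
      have hr : ‖q.1.2 / q'.1.2‖ ≤ 1 := by rw [norm_div, div_le_one hq']; exact hle
      have hm : ((q.1.1 - (q.1.2 / q'.1.2) • q'.1.1 : f.domain) : V) ∈ Θ := by
        have := Θ.sub_mem q.2.2 (hO _ hr _ q'.2.2)
        rwa [smul_add, smul_smul, div_mul_cancel₀ _ q'.2.1, add_sub_add_right_eq_sub] at this
      have h1 := hf _ hm
      rw [f.map_sub, f.map_smul, smul_eq_mul] at h1
      have e : f q.1.1 + q.1.2 * a = (f q.1.1 - q.1.2 / q'.1.2 * f q'.1.1) +
          q.1.2 / q'.1.2 * (f q'.1.1 + q'.1.2 * a) := by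
        have := q'.2.1
        field_simp
        ring
      rw [e]
      refine (norm_add_le_max _ _).trans (max_le h1 ?_)
      rw [norm_mul]
      exact mul_le_one₀ hr (norm_nonneg _) ha
    obtain ⟨a, ha⟩ := IsCompact.nonempty_iInter_of_directed_nonempty_isCompact_isClosed B
      (fun q q' => by
        rcases le_total ‖q.1.2‖ ‖q'.1.2‖ with h | h
        · exact ⟨q', hsub _ _ h, le_rfl⟩
        · exact ⟨q, le_rfl, hsub _ _ h⟩)
      (fun q => ⟨_, Metric.mem_closedBall_self (inv_nonneg.2 (norm_nonneg _))⟩)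
      (fun q => isCompact_closedBall _ _) (fun q => Metric.isClosed_closedBall)
    exact ⟨a, fun w t ht hw => (hBmem ⟨(w, t), ht, hw⟩ a).1 (Set.mem_iInter.1 ha _)⟩
  refine ⟨f.supSpanSingleton y a hy, ?_, ?_⟩
  · refine lt_iff_le_not_ge.2 ⟨f.left_le_sup _ _, fun H => ?_⟩
    replace H := LinearPMap.domain_mono.monotone H
    rw [LinearPMap.domain_supSpanSingleton, sup_le_iff, span_le,
      Set.singleton_subset_iff] at H
    exact hy H.2
  · rintro ⟨z, hz⟩ hzs
    rcases Submodule.mem_sup.1 hz with ⟨x, hx, y', hy', rfl⟩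
    rcases mem_span_singleton.1 hy' with ⟨r, rfl⟩
    simp only at hzs
    rw [LinearPMap.supSpanSingleton_apply_mk _ _ _ _ _ hx]
    by_cases hr : r = 0
    · subst hr
      rw [zero_smul, add_zero] at hzs
      simpa using hf ⟨x, hx⟩ hzs
    · exact ha ⟨x, hx⟩ r hr hzs

/-- An integral functional on a subspace extends to an integral functional. -/
lemma exists_integral_extension (hO : ∀ c : L, ‖c‖ ≤ 1 → ∀ y ∈ Θ, c • y ∈ Θ) (f : V →ₗ.[L] L)
    (hf : ∀ x : f.domain, (x : V) ∈ Θ → ‖f x‖ ≤ 1) :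
    ∃ g : Dual L V, (∀ x : f.domain, g x = f x) ∧ ∀ x ∈ Θ, ‖g x‖ ≤ 1 := by
  set S := {f : V →ₗ.[L] L | ∀ x : f.domain, (x : V) ∈ Θ → ‖f x‖ ≤ 1}
  have hSc : ∀ c, c ⊆ S → IsChain (· ≤ ·) c → ∀ y ∈ c, ∃ ub ∈ S, ∀ z ∈ c, z ≤ ub := by
    intro c hcs c_chain y hy
    have cne : c.Nonempty := ⟨y, hy⟩
    have hcd : DirectedOn (· ≤ ·) c := c_chain.directedOn
    refine ⟨LinearPMap.sSup c hcd, ?_, fun _ ↦ LinearPMap.le_sSup hcd⟩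
    rintro ⟨x, hx⟩ hxs
    have hdir : DirectedOn (· ≤ ·) (LinearPMap.domain '' c) :=
      directedOn_image.2 (hcd.mono LinearPMap.domain_mono.monotone)
    rcases (mem_sSup_of_directed (cne.image _) hdir).1 hx with ⟨_, ⟨f, hfc, rfl⟩, hfx⟩
    have h1 : f ≤ LinearPMap.sSup c hcd := LinearPMap.le_sSup _ hfc
    have h2 : f ⟨x, hfx⟩ = LinearPMap.sSup c hcd ⟨x, hx⟩ := h1.2 rfl
    rw [← h2]
    exact hcs hfc ⟨x, hfx⟩ hxs
  obtain ⟨q, hpq, hqs, hq⟩ := zorn_le_nonempty₀ S hSc f hf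
  have htop : q.domain = ⊤ := by
    by_contra hne
    obtain ⟨r, hqr, hr⟩ := exists_extension_step hO hqs hne
    exact hqr.not_ge (hq hr hqr.le)
  have hmem : ∀ x : V, x ∈ q.domain := fun x => htop ▸ Submodule.mem_top
  refine ⟨q.toFun ∘ₗ LinearMap.codRestrict q.domain LinearMap.id hmem, fun x => ?_, fun x hx => ?_⟩
  · exact (hpq.2 (x := x) (y := ⟨x, hmem x⟩) rfl).symm
  · exact hqs ⟨x, hmem x⟩ hx

/-- Separation of a point from a multiple of an integral submodule. -/
lemma exists_functional_of_not_mem (hO : ∀ c : L, ‖c‖ ≤ 1 → ∀ y ∈ Θ, c • y ∈ Θ) {y : V} {c : L}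
    (hc : c ≠ 0) (hy : ∀ x ∈ Θ, y ≠ c • x) : ∃ g : Dual L V, g y = c ∧ ∀ x ∈ Θ, ‖g x‖ ≤ 1 := by
  have hy0 : y ≠ 0 := fun h => hy 0 Θ.zero_mem (by rw [h, smul_zero])
  obtain ⟨g, h1, h2⟩ := exists_integral_extension hO (LinearPMap.mkSpanSingleton y c hy0) (by
    rintro ⟨x, hx⟩ hxΘ
    obtain ⟨t, rfl⟩ := mem_span_singleton.1 hx
    have e : LinearPMap.mkSpanSingleton y c hy0 ⟨t • y, hx⟩ = t • c :=
      LinearPMap.mkSpanSingleton'_apply _ _ _ _ _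
    rw [e, smul_eq_mul]
    by_contra! hlt
    have ht : t ≠ 0 := by rintro rfl; simp at hlt; linarith
    have hle : ‖(t * c)⁻¹‖ ≤ 1 := by rw [norm_inv]; exact inv_le_one_of_one_le₀ hlt.le
    refine hy _ (hO _ hle _ hxΘ) ?_
    simp only
    rw [smul_smul, smul_smul, mul_inv, show c * (t⁻¹ * c⁻¹) * t = 1 by field_simp, one_smul])
  refine ⟨g, ?_, h2⟩
  have := h1 ⟨y, mem_span_singleton_self y⟩
  rw [this]
  exact LinearPMap.mkSpanSingleton'_apply_self _ _ _ _

end HahnBanach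

section BanachSteinhaus

variable [IsUltrametricDist L] [ProperSpace L]
  {V : Type*} [AddCommGroup V] [Module L V] {Θ Λ : AddSubgroup V} {V0 : Submodule L V}

/-- If every functional bounded on `Θ` is bounded on `Λ ∩ V0`, then `Λ ∩ V0` lies in a multiple
of `Θ`. -/
lemma exists_subset_smul (hO : ∀ c : L, ‖c‖ ≤ 1 → ∀ y ∈ Θ, c • y ∈ Θ)
    (habs : ∀ v : V, ∃ c : L, c ≠ 0 ∧ c • v ∈ Θ)
    (hbd : ∀ lam ∈ bddDual L Θ, ∃ C : ℝ, ∀ v ∈ Λ, v ∈ V0 → ‖lam v‖ ≤ C) :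
    ∃ c : L, c ≠ 0 ∧ ∀ v ∈ Λ, v ∈ V0 → ∃ x ∈ Θ, v = c • x := by
  by_contra! hcon
  obtain ⟨ϖ, hϖ⟩ := NormedField.exists_one_lt_norm L
  have hϖ0 : ϖ ≠ 0 := by rintro rfl; simp at hϖ; linarith
  have hex : ∀ s : ℕ, ∃ v, v ∈ Λ ∧ v ∈ V0 ∧ ∃ lam : Dual L V, lam v = ϖ ^ s ∧
      ∀ x ∈ Θ, ‖lam x‖ ≤ 1 := by
    intro s
    obtain ⟨v, h1, h2, h3⟩ := hcon (ϖ ^ s) (pow_ne_zero _ hϖ0)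
    exact ⟨v, h1, h2, exists_functional_of_not_mem hO (pow_ne_zero _ hϖ0) h3⟩
  choose v hvΛ hvV lam hlv hlΘ using hex
  have hpt : ∀ w : V, ∃ C : ℝ, 0 ≤ C ∧ ∀ s, ‖lam s w‖ ≤ C := by
    intro w
    obtain ⟨c, hc, hcw⟩ := habs w
    refine ⟨‖c‖⁻¹, inv_nonneg.2 (norm_nonneg _), fun s => ?_⟩
    have h1 := hlΘ s _ hcw
    rw [map_smul, smul_eq_mul, norm_mul] at h1
    rwa [← one_div, le_div_iff₀' (norm_pos_iff.2 hc)]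
  let E := lp (fun _ : ℕ => L) 1
  have hsn : ∀ x : E, Summable fun i => ‖x i‖ := fun x => by
    have := (lp.memℓp x).summable (p := 1) (by simp)
    simpa using this
  have hnorm : ∀ x : E, ‖x‖ = ∑' i, ‖x i‖ := fun x => by rw [lp.norm_eq_tsum_rpow (by simp)]; simp
  have hsum' : ∀ (w : V) (x : E), Summable fun i => ‖x i * lam i w‖ := by
    intro w x
    obtain ⟨C, hC0, hC⟩ := hpt w
    refine Summable.of_nonneg_of_le (fun i => norm_nonneg _) (fun i => ?_) ((hsn x).mul_right C)
    rw [norm_mul]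
    exact mul_le_mul_of_nonneg_left (hC i) (norm_nonneg _)
  have hsum : ∀ (w : V) (x : E), Summable fun i => x i * lam i w := fun w x => (hsum' w x).of_norm
  have hle : ∀ (w : V) (C : ℝ), (∀ s, ‖lam s w‖ ≤ C) → ∀ x : E,
      ‖∑' i, x i * lam i w‖ ≤ C * ‖x‖ := by
    intro w C hC x
    refine (norm_tsum_le_tsum_norm (hsum' w x)).trans ?_
    rw [hnorm, ← tsum_mul_left]
    refine (hsum' w x).tsum_le_tsum (fun i => ?_) ((hsn x).mul_left C)
    rw [norm_mul, mul_comm]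
    exact mul_le_mul_of_nonneg_right (hC i) (norm_nonneg _)
  let gl : V → E →ₗ[L] L := fun w =>
    { toFun := fun x => ∑' i, x i * lam i w
      map_add' := fun x y => by
        rw [← (hsum w x).tsum_add (hsum w y)]
        exact tsum_congr fun i => by rw [lp.coeFn_add, Pi.add_apply, add_mul]
      map_smul' := fun a x => by
        rw [RingHom.id_apply, smul_eq_mul, ← tsum_mul_left]
        exact tsum_congr fun i => by rw [lp.coeFn_smul, Pi.smul_apply, smul_eq_mul, mul_assoc] }
  let g : {w // w ∈ Λ ∧ w ∈ V0} → E →L[L] L := fun w =>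
    (gl w.1).mkContinuous (hpt w.1).choose (hle w.1 _ (hpt w.1).choose_spec.2)
  obtain ⟨C', hC'⟩ := banach_steinhaus (g := g) (by
    intro x
    let mu : Dual L V :=
      { toFun := fun w => ∑' i, x i * lam i w
        map_add' := fun w w' => by
          rw [← (hsum w x).tsum_add (hsum w' x)]
          exact tsum_congr fun i => by rw [map_add, mul_add]
        map_smul' := fun a w => by
          rw [RingHom.id_apply, smul_eq_mul, ← tsum_mul_left]
          exact tsum_congr fun i => by rw [map_smul, smul_eq_mul, mul_left_comm] }
    obtain ⟨C, hC⟩ := hbd mu ⟨1 * ‖x‖, fun w hw => hle w 1 (fun s => hlΘ s w hw) x⟩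
    exact ⟨C, fun w => hC w.1 w.2.1 w.2.2⟩)
  obtain ⟨s, hs⟩ := pow_unbounded_of_one_lt C' hϖ
  have h1 := (g ⟨v s, hvΛ s, hvV s⟩).le_opNorm (lp.single 1 s (1 : L))
  have h2 : g ⟨v s, hvΛ s, hvV s⟩ (lp.single 1 s (1 : L)) = ϖ ^ s := by
    change ∑' i, (lp.single 1 s (1 : L) : E) i * lam i (v s) = _
    rw [tsum_eq_single s, lp.single_apply_self, one_mul, hlv]
    intro i hi
    rw [lp.single_apply_ne _ _ _ hi, zero_mul]
  rw [h2, norm_pow, lp.norm_single (by simp), norm_one, mul_one] at h1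
  exact absurd (h1.trans (hC' _)) (not_le.2 hs)

end BanachSteinhaus

section Main

variable [IsUltrametricDist L] [ProperSpace L] {V : Type*} [AddCommGroup V] [Module L V]
  {s t K : ℝ} {e : ℕ → L} {S : V →ₗ[L] V} {G : V ≃ₗ[L] V}
  {xa xb : Arr V} {Θ Λ : AddSubgroup V}

/-- A stable lattice containing `Θ` is contained, on the span, in a multiple of `Θ`. -/
lemma Sys.exists_subset_smul (h : Sys p m s t K e S G xa xb Θ)
    (hO : ∀ c : L, ‖c‖ ≤ 1 → ∀ y ∈ Θ, c • y ∈ Θ) (habs : ∀ v : V, ∃ c : L, c ≠ 0 ∧ c • v ∈ Θ)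
    (hOΛ : ∀ c : L, ‖c‖ ≤ 1 → ∀ y ∈ Λ, c • y ∈ Λ) (hΘ : Θ ≤ Λ)
    (hSΛ : ∀ y ∈ Λ, S y ∈ Λ) (hGΛ : ∀ y ∈ Λ, G y ∈ Λ) (hline : ∀ y, y ≠ 0 → ∃ c : L, c • y ∉ Λ) :
    ∃ c : L, c ≠ 0 ∧ ∀ v ∈ Λ, v ∈ spanPair L p m xa xb → ∃ x ∈ Θ, v = c • x := by
  refine PadicPi.exists_subset_smul hO habs fun lam hl => ?_
  have h1 := h.bddDual_le hΘ (fun v => (habs v).imp fun c hc => ⟨hc.1, hΘ hc.2⟩) hSΛ hGΛ (by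
    intro y hy
    obtain ⟨c, hc⟩ := hline y hy
    have hc0 : c ≠ 0 := by rintro rfl; rw [zero_smul] at hc; exact hc Λ.zero_mem
    obtain ⟨g, hg1, hg2⟩ := exists_functional_of_not_mem hOΛ (y := y) (inv_ne_zero hc0) (by
      rintro x hx rfl
      rw [smul_smul, mul_inv_cancel₀ hc0, one_smul] at hc
      exact hc hx)
    exact ⟨g, ⟨1, hg2⟩, by rw [hg1]; exact inv_ne_zero hc0⟩) hl
  obtain ⟨a, ⟨C, hC⟩, b, hb, rfl⟩ := Submodule.mem_sup.1 h1
  rw [mem_dualAnnihilator] at hb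
  refine ⟨C, fun v hv hv0 => ?_⟩
  rw [LinearMap.add_apply, hb v hv0, add_zero]
  exact hC v hv

end Main

lemma padic_p_ne_zero : 𝔭 ≠ 0 := Nat.cast_ne_zero.2 (Fact.out : p.Prime).ne_zero

lemma zpow_le_zpow_p {a b : ℤ} : (p : ℝ) ^ a ≤ (p : ℝ) ^ b ↔ a ≤ b :=
  zpow_le_zpow_iff_right₀ (one_lt_p p)

/-- The ball of center `a` and radius `p^{-n}`. -/
def InB (a : ℚ_[p]) (n : ℤ) (z : ℚ_[p]) : Prop := ‖z - a‖ ≤ (p : ℝ) ^ (-n)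

lemma InB.congr {a b z : ℚ_[p]} {n : ℤ} (h : InB a n b) : InB b n z ↔ InB a n z := by
  have key : ∀ x y w : ℚ_[p], ‖x - y‖ ≤ (p : ℝ) ^ (-n) → ‖y - w‖ ≤ (p : ℝ) ^ (-n) →
      ‖x - w‖ ≤ (p : ℝ) ^ (-n) := by
    intro x y w h1 h2
    have : x - w = (x - y) + (y - w) := by ring
    rw [this]
    exact (nonarchimedean _ _).trans (max_le h1 h2)
  unfold InB at *
  constructor
  · intro hz; exact key _ _ _ hz h
  · intro hz; rw [norm_sub_rev] at h; exact key _ _ _ hz h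

lemma InB.self (a : ℚ_[p]) (n : ℤ) : InB a n a := by
  unfold InB; rw [sub_self, norm_zero]; exact zpow_nonneg (p_pos p).le _

lemma InB.symm {a b : ℚ_[p]} {n : ℤ} (h : InB a n b) : InB b n a := h.congr.2 (InB.self a n)

lemma InB.mono {a z : ℚ_[p]} {n n' : ℤ} (hn : n' ≤ n) (h : InB a n z) : InB a n' z :=
  h.trans (zpow_le_zpow_p.2 (by omega))

lemma InB.trans {a b z : ℚ_[p]} {n : ℤ} (h : InB a n b) (h' : InB b n z) : InB a n z :=
  h.congr.1 h'

lemma inB_add_mul (a : ℚ_[p]) (n : ℤ) (i : ℕ) : InB a n (a + i * 𝔭 ^ n) := by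
  unfold InB
  rw [add_sub_cancel_left, norm_mul, norm_p_zpow]
  exact mul_le_of_le_one_left (zpow_nonneg (p_pos p).le _) (by
    have := norm_int_le_one (p := p) i; simpa using this)

lemma inB_add_mul_int (a : ℚ_[p]) (n : ℤ) (i : ℤ) : InB a n (a + i * 𝔭 ^ n) := by
  unfold InB
  rw [add_sub_cancel_left, norm_mul, norm_p_zpow]
  exact mul_le_of_le_one_left (zpow_nonneg (p_pos p).le _) (norm_int_le_one i)

lemma inB_child_iff {a z : ℚ_[p]} {n : ℤ} (x : ℤ_[p]) (hx : z = a + x * 𝔭 ^ n) (i : ℕ)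
    (hi : i < p) : InB (a + (i : ℚ_[p]) * 𝔭 ^ n) (n + 1) z ↔ i = PadicInt.zmodRepr x := by
  have h1 : InB (a + (i : ℚ_[p]) * 𝔭 ^ n) (n + 1) z ↔ ‖x - (i : ℤ_[p])‖ < 1 := by
    unfold InB
    have : z - (a + i * 𝔭 ^ n) = ((x - (i : ℤ_[p]) : ℤ_[p]) : ℚ_[p]) * 𝔭 ^ n := by
      rw [hx]; push_cast; ring
    rw [this, norm_mul, norm_p_zpow, neg_add, zpow_add₀ (p_pos p).ne', mul_comm,
      mul_le_mul_iff_right₀ (zpow_pos (p_pos p) _), norm_le_pow_iff_norm_lt_pow_add_one]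
    simp [PadicInt.norm_def]
  rw [h1]
  constructor
  · intro h
    exact (PadicInt.zmodRepr_unique x i hi (by
      rw [IsLocalRing.mem_maximalIdeal, PadicInt.mem_nonunits]; exact h)).symm
  · rintro rfl; exact PadicInt.norm_sub_zmodRepr_lt_one x

lemma InB.exists_padicInt {a z : ℚ_[p]} {n : ℤ} (h : InB a n z) :
    ∃ x : ℤ_[p], z = a + x * 𝔭 ^ n := by
  refine ⟨⟨(z - a) / 𝔭 ^ n, ?_⟩, ?_⟩
  · rw [norm_div, norm_p_zpow]
    exact (div_le_one (zpow_pos (p_pos p) _)).2 h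
  · show z = a + (z - a) / 𝔭 ^ n * 𝔭 ^ n
    rw [div_mul_cancel₀ _ (zpow_ne_zero _ padic_p_ne_zero)]; ring

/-- The valuation of a nonzero pair. -/
def nv (x y : ℚ_[p]) : ℤ := if ‖x‖ ≤ ‖y‖ then y.valuation else x.valuation

lemma nv_spec {x y : ℚ_[p]} (h : ¬(x = 0 ∧ y = 0)) : max ‖x‖ ‖y‖ = (p : ℝ) ^ (-nv x y) := by
  unfold nv
  split_ifs with h1
  · rw [max_eq_right h1]
    refine norm_eq_zpow_neg_valuation fun hy => h ⟨?_, hy⟩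
    rw [hy, norm_zero] at h1
    exact norm_le_zero_iff.1 h1
  · rw [max_eq_left (not_le.1 h1).le]
    refine norm_eq_zpow_neg_valuation fun hx => h1 ?_
    rw [hx, norm_zero]; exact norm_nonneg _

lemma nv_eq_of_max {x y : ℚ_[p]} {n : ℤ} (h : max ‖x‖ ‖y‖ = (p : ℝ) ^ (-n)) : nv x y = n := by
  have h0 : ¬(x = 0 ∧ y = 0) := by
    rintro ⟨rfl, rfl⟩
    simp only [norm_zero, max_self] at h
    exact (zpow_pos (p_pos p) (-n)).ne h
  rw [nv_spec h0] at h
  have := zpow_right_injective₀ (p_pos p) (one_lt_p p).ne' h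
  simpa using this

lemma nv_congr {x y x' y' : ℚ_[p]} (h0 : ¬(x = 0 ∧ y = 0))
    (h : max ‖x‖ ‖y‖ = max ‖x'‖ ‖y'‖) : nv x y = nv x' y' :=
  (nv_eq_of_max (h.symm.trans (nv_spec h0))).symm

lemma nv_comm {x y : ℚ_[p]} (h0 : ¬(x = 0 ∧ y = 0)) : nv x y = nv y x :=
  nv_congr h0 (max_comm _ _)

lemma nv_mul {x y c : ℚ_[p]} (h0 : ¬(x = 0 ∧ y = 0)) (hc : c ≠ 0) :
    nv (c * x) (c * y) = c.valuation + nv x y := by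
  apply nv_eq_of_max
  rw [norm_mul, norm_mul, ← mul_max_of_nonneg _ _ (norm_nonneg _), nv_spec h0,
    norm_eq_zpow_neg_valuation hc, ← zpow_add₀ (p_pos p).ne']
  congr 1; ring

lemma nv_of_inB {a z : ℚ_[p]} {n : ℤ} (h : InB a n z) : nv (z - a) (𝔭 ^ n) = n :=
  nv_eq_of_max (by rw [norm_p_zpow]; exact max_eq_right h)

lemma nv_of_not_inB {a z : ℚ_[p]} {n : ℤ} (h : ¬InB a n z) :
    nv (z - a) (𝔭 ^ n) = (z - a).valuation := by
  unfold nv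
  rw [norm_p_zpow]; exact if_neg h

section Functions

variable (p)

/-- The function `φ_{a,n}`, equal to `1` on `a + pⁿℤ_p` and to `q^{val(z-a)-n}` elsewhere. -/
def phi (q : L) (a : ℚ_[p]) (n : ℤ) : ℚ_[p] → L := fun z => q ^ (nv (z - a) (𝔭 ^ n) - n)

variable (L) in
/-- The indicator function of `a + pⁿℤ_p`. -/
def ind (a : ℚ_[p]) (n : ℤ) : ℚ_[p] → L :=
  fun z => if InB a n z then 1 else 0

/-- Multiplication of a function by a polynomial function. -/
def pev : L[X] →ₗ[L] (ℚ_[p] → L) →ₗ[L] (ℚ_[p] → L) :=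
  mk₂ L (fun P f z => P.eval (η z) * f z)
    (fun P P' f => by ext z; simp [add_mul]) (fun c P f => by ext z; simp [mul_assoc])
    (fun P f f' => by ext z; simp [mul_add]) (fun c P f => by ext z; simp [mul_left_comm])

variable {p}

lemma pev_apply (P : L[X]) (f : ℚ_[p] → L) (z : ℚ_[p]) : pev p P f z = P.eval (η z) * f z := rfl

lemma phi_of_inB {q : L} {a z : ℚ_[p]} {n : ℤ} (h : InB a n z) : phi p q a n z = 1 := by
  simp [phi, nv_of_inB h]

lemma phi_of_not_inB {q : L} {a z : ℚ_[p]} {n : ℤ} (h : ¬InB a n z) :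
    phi p q a n z = q ^ ((z - a).valuation - n) := by
  simp [phi, nv_of_not_inB h]

lemma ind_of_inB {a z : ℚ_[p]} {n : ℤ} (h : InB a n z) : ind p L a n z = 1 := if_pos h

lemma ind_of_not_inB {a z : ℚ_[p]} {n : ℤ} (h : ¬InB a n z) : ind p L a n z = 0 := if_neg h

lemma ind_congr {a b : ℚ_[p]} {n : ℤ} (h : InB a n b) : ind p L b n = ind p L a n := by
  ext z; unfold ind; simp only [h.congr]

lemma phi_congr {q : L} {a b : ℚ_[p]} {n : ℤ} (h : InB a n b) : phi p q b n = phi p q a n := by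
  ext z
  unfold phi
  congr 2
  refine nv_congr (fun h => zpow_ne_zero _ padic_p_ne_zero h.2) ?_
  rw [norm_p_zpow]
  have key : ∀ x y : ℚ_[p], ‖x - y‖ ≤ (p : ℝ) ^ (-n) →
      max ‖x‖ ((p : ℝ) ^ (-n)) ≤ max ‖y‖ ((p : ℝ) ^ (-n)) := by
    intro x y hxy
    refine max_le ?_ (le_max_right _ _)
    have : x = (x - y) + y := by ring
    rw [this]
    refine (nonarchimedean _ _).trans (max_le ?_ (le_max_left _ _))
    exact hxy.trans (le_max_right _ _)
  apply le_antisymm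
  · apply key; rw [show z - b - (z - a) = a - b by ring]; exact h.symm
  · apply key; rw [show z - a - (z - b) = b - a by ring]; exact h

lemma phi_sub_parent {q : L} (hq : q ≠ 0) (a : ℚ_[p]) (n : ℤ) :
    phi p q a n - q⁻¹ • phi p q a (n - 1) = (1 - q⁻¹) • ind p L a n := by
  ext z
  simp only [Pi.sub_apply, Pi.smul_apply, smul_eq_mul]
  by_cases h : InB a n z
  · rw [phi_of_inB h, phi_of_inB (h.mono (by omega)), ind_of_inB h, mul_one, mul_one]
  · rw [phi_of_not_inB h, ind_of_not_inB h, mul_zero]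
    by_cases h' : InB a (n - 1) z
    · have hne : z - a ≠ 0 := by
        intro h0; apply h; unfold InB; rw [h0, norm_zero]; exact zpow_nonneg (p_pos p).le _
      have : (z - a).valuation = n - 1 := by
        unfold InB at h h'
        rw [norm_eq_zpow_neg_valuation hne, zpow_le_zpow_p] at h h'
        omega
      rw [phi_of_inB h', this, show n - 1 - n = -1 by ring, zpow_neg_one]; ring
    · rw [phi_of_not_inB h', show (z - a).valuation - (n - 1) = ((z - a).valuation - n) + 1 by ring,
        zpow_add_one₀ hq]
      field_simp
      ring

lemma ind_eq_sum (a : ℚ_[p]) (n : ℤ) :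
    ind p L a n = ∑ i ∈ range p, ind p L (a + i * 𝔭 ^ n) (n + 1) := by
  ext z
  rw [Finset.sum_apply]
  by_cases h : InB a n z
  · obtain ⟨x, hx⟩ := h.exists_padicInt
    rw [ind_of_inB h]
    rw [sum_congr rfl (g := fun i => if i = PadicInt.zmodRepr x then (1 : L) else 0)]
    · rw [sum_ite_eq' , if_pos (mem_range.2 (PadicInt.zmodRepr_lt_p x))]
    · intro i hi
      unfold ind
      simp only [inB_child_iff x hx i (mem_range.1 hi)]
  · rw [ind_of_not_inB h, sum_eq_zero]
    intro i _
    refine ind_of_not_inB fun h' => h ?_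
    exact (inB_add_mul a n i).trans (h'.mono (by omega))

lemma phi_child {q : L} (hq : q ≠ 0) (a : ℚ_[p]) (n : ℤ) (i : ℕ) : phi p q (a + i * 𝔭 ^ n) (n + 1) =
      q⁻¹ • phi p q a n + (1 - q⁻¹) • ind p L (a + i * 𝔭 ^ n) (n + 1) := by
  rw [← phi_sub_parent hq, show n + 1 - 1 = n by ring, phi_congr (inB_add_mul a n i)]
  abel

lemma phi_sum_children {q : L} (hq : q ≠ 0) (a : ℚ_[p]) (n : ℤ) :
    ∑ i ∈ range p, phi p q (a + i * 𝔭 ^ n) (n + 1) + q⁻¹ • phi p q a (n - 1) =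
      (1 + p / q) • phi p q a n := by
  simp only [phi_child hq]
  rw [sum_add_distrib, ← smul_sum, ← smul_sum, ← ind_eq_sum, sum_const,
    card_range, ← phi_sub_parent hq, ← Nat.cast_smul_eq_nsmul L, smul_smul]
  ext z
  simp only [Pi.add_apply, Pi.smul_apply, Pi.sub_apply, smul_eq_mul]
  field_simp
  ring

end Functions

variable (p) in
/-- The representatives of `p^{-N}ℤ_p / p^Nℤ_p`. -/
def rep (N t : ℕ) : ℚ_[p] := t * 𝔭 ^ (-(N : ℤ))

lemma inB_rep (N t : ℕ) : InB (0 : ℚ_[p]) (-(N : ℤ)) (rep p N t) := by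
  simpa [rep] using inB_add_mul (0 : ℚ_[p]) (-(N : ℤ)) t

lemma exists_rep {N : ℕ} {a : ℚ_[p]} (h : InB 0 (-(N : ℤ)) a) :
    ∃ t : Fin (p ^ (2 * N)), InB (rep p N t) N a := by
  obtain ⟨x, hx⟩ := h.exists_padicInt
  refine ⟨⟨x.appr (2 * N), PadicInt.appr_lt x _⟩, ?_⟩
  unfold InB rep
  have h1 : a - (x.appr (2 * N) : ℚ_[p]) * 𝔭 ^ (-(N : ℤ)) =
      ((x - (x.appr (2 * N) : ℤ_[p]) : ℤ_[p]) : ℚ_[p]) * 𝔭 ^ (-(N : ℤ)) := by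
    rw [hx]; push_cast; ring
  have h2 := (PadicInt.norm_le_pow_iff_mem_span_pow _ _).2 (PadicInt.appr_spec (2 * N) x)
  rw [h1, norm_mul, norm_p_zpow, ← PadicInt.norm_def]
  calc _ ≤ (p : ℝ) ^ (-((2 * N : ℕ) : ℤ)) * (p : ℝ) ^ (-(-(N : ℤ))) :=
        mul_le_mul_of_nonneg_right h2 (zpow_nonneg (p_pos p).le _)
    _ = _ := by rw [← zpow_add₀ (p_pos p).ne']; congr 1; push_cast; ring

lemma rep_inj {N : ℕ} {t t' : Fin (p ^ (2 * N))} (h : InB (rep p N t) N (rep p N t')) : t = t' := by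
  unfold InB rep at h
  rw [← sub_mul, norm_mul, norm_p_zpow] at h
  have h1 : ‖((t' : ℕ) : ℚ_[p]) - ((t : ℕ) : ℚ_[p])‖ ≤ (p : ℝ) ^ (-((2 * N : ℕ) : ℤ)) := by
    have := mul_le_mul_of_nonneg_right h (zpow_nonneg (p_pos p).le (-(N : ℤ)))
    rw [mul_assoc, ← zpow_add₀ (p_pos p).ne', ← zpow_add₀ (p_pos p).ne'] at this
    simp only [neg_neg, add_neg_cancel, zpow_zero, mul_one] at this
    refine this.trans (le_of_eq ?_)
    congr 1; push_cast; ring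
  have h2 : ((t' : ℕ) : ℚ_[p]) - ((t : ℕ) : ℚ_[p]) = (((t' : ℕ) - (t : ℕ) : ℤ) : ℚ_[p]) := by
    push_cast; rfl
  rw [h2, norm_int_le_pow_iff_dvd] at h1
  obtain ⟨c, hc⟩ := h1
  have ht := t.2
  have ht' := t'.2
  ext
  have hlt : |((t' : ℕ) : ℤ) - ((t : ℕ) : ℤ)| < (p ^ (2 * N) : ℕ) := by
    rw [abs_lt]; constructor <;> omega
  have := Int.eq_zero_of_abs_lt_dvd (m := ((p ^ (2 * N) : ℕ) : ℤ)) ⟨c, by exact_mod_cast hc⟩ hlt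
  omega

section Expansion

variable {W Z Z' : Type*} [AddCommGroup W] [Module L W] [AddCommGroup Z] [Module L Z]
  [AddCommGroup Z'] [Module L Z']

variable (p) in
/-- The linear relations satisfied by the functions `φ_{a,n}`. -/
structure TreeRel (q : L) (Ψ : ℚ_[p] → ℤ → W →ₗ[L] Z) : Prop where
  ball : ∀ a b n, InB a n b → Ψ b n = Ψ a n
  rel : ∀ a n, ∑ i ∈ range p, Ψ (a + i * 𝔭 ^ n) (n + 1) + q⁻¹ • Ψ a (n - 1) =
    (1 + p / q) • Ψ a n

/-- The part of `Ψ` which is additive on balls. -/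
def stp (q : L) (Ψ : ℚ_[p] → ℤ → W →ₗ[L] Z) (a : ℚ_[p]) (n : ℤ) : W →ₗ[L] Z :=
  Ψ a n - q⁻¹ • Ψ a (n - 1)

/-- The parametrization of normal forms. -/
def normalForm (q : L) (Ψ : ℚ_[p] → ℤ → W →ₗ[L] Z) (N : ℕ) : W × (Fin (p ^ (2 * N)) → W) →ₗ[L] Z :=
  (Ψ 0 (-(N : ℤ))).coprod (LinearMap.lsum L (fun _ => W) L fun t => stp q Ψ (rep p N t) N)

lemma normalForm_apply (q : L) (Ψ : ℚ_[p] → ℤ → W →ₗ[L] Z) (N : ℕ)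
    (x : W × (Fin (p ^ (2 * N)) → W)) :
    normalForm q Ψ N x = Ψ 0 (-(N : ℤ)) x.1 + ∑ t : Fin (p ^ (2 * N)), stp q Ψ (rep p N t) N (x.2 t) := by
  simp [normalForm, LinearMap.lsum_apply]

variable {q : L} {Ψ : ℚ_[p] → ℤ → W →ₗ[L] Z}

lemma TreeRel.stp_ball (h : TreeRel p q Ψ) {a b : ℚ_[p]} {n : ℤ} (hb : InB a n b) :
    stp q Ψ b n = stp q Ψ a n := by
  unfold stp; rw [h.ball a b n hb, h.ball a b (n - 1) (hb.mono (by omega))]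

lemma TreeRel.stp_sum (h : TreeRel p q Ψ) (a : ℚ_[p]) (n : ℤ) :
    ∑ i ∈ range p, stp q Ψ (a + i * 𝔭 ^ n) (n + 1) = stp q Ψ a n := by
  have h1 := h.rel a n
  unfold stp
  rw [sum_sub_distrib, eq_sub_of_add_eq h1]
  rw [sum_congr rfl (g := fun _ => q⁻¹ • Ψ a n)]
  · rw [sum_const, card_range, ← Nat.cast_smul_eq_nsmul L, smul_smul, add_smul,
      one_smul, div_eq_mul_inv]
    abel
  · intro i _
    rw [show n + 1 - 1 = n by ring, h.ball a _ n (inB_add_mul a n i)]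

lemma TreeRel.stp_mem (h : TreeRel p q Ψ) (N : ℕ) (w : W) (d : ℕ) : ∀ (a : ℚ_[p]) (k : ℤ),
    k + d = N → -(N : ℤ) ≤ k → InB 0 (-(N : ℤ)) a →
      stp q Ψ a k w ∈ LinearMap.range (normalForm q Ψ N) := by
  induction d with
  | zero =>
    intro a k hk hk' ha
    obtain ⟨t, ht⟩ := exists_rep ha
    have : k = N := by simpa using hk
    subst this
    rw [h.stp_ball ht]
    refine ⟨(0, Pi.single t w), ?_⟩
    rw [normalForm_apply, sum_eq_single t]
    · simp
    · intro t' _ ht'; simp [ht']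
    · simp
  | succ d ih =>
    intro a k hk hk' ha
    rw [← h.stp_sum a k, LinearMap.sum_apply]
    refine Submodule.sum_mem _ fun i _ => ih _ _ (by push_cast at hk; omega) (by omega) ?_
    exact ha.trans ((inB_add_mul a k i).mono hk')

lemma TreeRel.mem_of_le (h : TreeRel p q Ψ) (N : ℕ) (w : W) (d : ℕ) : ∀ (a : ℚ_[p]) (k : ℤ),
    k = -(N : ℤ) + d → k ≤ N → InB 0 (-(N : ℤ)) a →
      Ψ a k w ∈ LinearMap.range (normalForm q Ψ N) := by
  induction d with
  | zero =>
    intro a k hk hk' ha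
    have : k = -(N : ℤ) := by simpa using hk
    subst this
    refine ⟨(w, 0), ?_⟩
    rw [normalForm_apply, h.ball 0 a _ ha]
    simp
  | succ d ih =>
    intro a k hk hk' ha
    have : Ψ a k w = stp q Ψ a k w + q⁻¹ • Ψ a (k - 1) w := by simp [stp]
    rw [this]
    refine add_mem ?_ (smul_mem _ _ (ih _ _ (by push_cast at hk; omega) (by omega) ha))
    exact h.stp_mem N w ((N : ℤ) - k).toNat a k (by omega) (by omega) ha

lemma exists_inB (a : ℚ_[p]) : ∃ N : ℕ, InB 0 (-(N : ℤ)) a := by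
  by_cases ha : a = 0
  · subst ha; exact ⟨0, InB.self _ _⟩
  · refine ⟨(-a.valuation).toNat, ?_⟩
    unfold InB
    rw [sub_zero, norm_eq_zpow_neg_valuation ha, zpow_le_zpow_p]
    omega

lemma TreeRel.eventually_mem (h : TreeRel p q Ψ) {y : Z}
    (hy : y ∈ span L {y | ∃ a n w, y = Ψ a n w}) :
    ∃ N₀ : ℕ, ∀ N ≥ N₀, y ∈ LinearMap.range (normalForm q Ψ N) := by
  induction hy using span_induction with
  | mem y hy =>
    obtain ⟨a, k, w, rfl⟩ := hy
    obtain ⟨M, hM⟩ := exists_inB a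
    refine ⟨max M k.natAbs, fun N hN => ?_⟩
    have h1 := le_of_max_le_left hN
    have h2 := le_of_max_le_right hN
    exact h.mem_of_le N w (k + N).toNat a k (by omega) (by omega) (hM.mono (by omega))
  | zero => exact ⟨0, fun N _ => Submodule.zero_mem _⟩
  | add x y _ _ hx hy =>
    obtain ⟨M, hM⟩ := hx
    obtain ⟨M', hM'⟩ := hy
    exact ⟨max M M', fun N hN =>
      add_mem (hM N (le_of_max_le_left hN)) (hM' N (le_of_max_le_right hN))⟩
  | smul c x _ hx =>
    obtain ⟨M, hM⟩ := hx
    exact ⟨M, fun N hN => smul_mem _ _ (hM N hN)⟩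

lemma TreeRel.prod {Ψ' : ℚ_[p] → ℤ → W →ₗ[L] Z'} (h : TreeRel p q Ψ) (h' : TreeRel p q Ψ') :
    TreeRel p q fun a n => (Ψ a n).prod (Ψ' a n) := by
  constructor
  · intro a b n hb; simp only [h.ball a b n hb, h'.ball a b n hb]
  · intro a n
    ext w
    · have := LinearMap.congr_fun (h.rel a n) w
      simpa [LinearMap.sum_apply, Prod.fst_sum] using this
    · have := LinearMap.congr_fun (h'.rel a n) w
      simpa [LinearMap.sum_apply, Prod.snd_sum] using this

lemma TreeRel.exists_lift {Ψ' : ℚ_[p] → ℤ → W →ₗ[L] Z'} (h : TreeRel p q Ψ)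
    (hinj : ∀ N, Function.Injective (normalForm q Ψ N)) (h' : TreeRel p q Ψ') :
    ∃ F : Z →ₗ[L] Z', ∀ a n w, F (Ψ a n w) = Ψ' a n w := by
  set S : Submodule L (Z × Z') :=
    span L {y | ∃ a n w, y = ((Ψ a n).prod (Ψ' a n)) w} with hS
  have hker : LinearMap.ker ((LinearMap.fst L Z Z').comp S.subtype) = ⊥ := by
    rw [LinearMap.ker_eq_bot']
    rintro ⟨y, hy⟩ hy0
    obtain ⟨N, hN⟩ := (h.prod h').eventually_mem hy
    obtain ⟨x, rfl⟩ := hN N le_rfl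
    have h1 : (normalForm q (fun a n => (Ψ a n).prod (Ψ' a n)) N x).1 = normalForm q Ψ N x := by
      simp [normalForm_apply, stp, Prod.fst_sum]
    have h2 : normalForm q Ψ N x = 0 := by rw [← h1]; exact hy0
    have h3 : x = 0 := hinj N (h2.trans (map_zero _).symm)
    ext1
    simp only [h3, map_zero, Submodule.coe_zero]
  obtain ⟨g, hg⟩ := LinearMap.exists_leftInverse_of_injective _ hker
  refine ⟨(LinearMap.snd L Z Z').comp (S.subtype.comp g), fun a n w => ?_⟩
  have hm : ((Ψ a n).prod (Ψ' a n)) w ∈ S := subset_span ⟨a, n, w, rfl⟩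
  have := LinearMap.congr_fun hg ⟨_, hm⟩
  have h1 : g (Ψ a n w) = ⟨_, hm⟩ := this
  simp [h1]

end Expansion

/-- Multiplication of `φ_{a,n}` by polynomials. -/
def phiMap (q : L) (a : ℚ_[p]) (n : ℤ) : L[X] →ₗ[L] (ℚ_[p] → L) := (pev p).flip (phi p q a n)

lemma treeRel_phiMap {q : L} (hq : q ≠ 0) : TreeRel p q (phiMap (p := p) q) := by
  constructor
  · intro a b n h; unfold phiMap; rw [phi_congr h]
  · intro a n
    unfold phiMap
    rw [← map_sum, ← map_smul, ← map_add, phi_sum_children hq, map_smul]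

lemma stp_phiMap {q : L} (hq : q ≠ 0) (a : ℚ_[p]) (n : ℤ) (P : L[X]) :
    stp q (phiMap (p := p) q) a n P = (1 - q⁻¹) • pev p P (ind p L a n) := by
  unfold stp phiMap
  rw [← map_smul, ← map_sub, phi_sub_parent hq, map_smul]
  rfl

lemma eq_zero_of_eval_ball {P : L[X]} {a : ℚ_[p]} {n : ℤ}
    (h : ∀ z, InB a n z → P.eval (η z) = 0) : P = 0 := by
  refine eq_zero_of_infinite_isRoot P ?_
  have : Function.Injective fun i : ℕ => η (a + i * 𝔭 ^ n) := by
    intro i j hij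
    have := (η).injective hij
    simpa [zpow_ne_zero n (padic_p_ne_zero (p := p))] using this
  refine (Set.infinite_range_of_injective this).mono ?_
  rintro _ ⟨i, rfl⟩
  exact h _ (inB_add_mul a n i)

lemma eq_zero_of_eval_not_ball {P : L[X]} {N : ℕ}
    (h : ∀ z : ℚ_[p], ¬InB 0 (-(N : ℤ)) z → P.eval (η z) = 0) : P = 0 := by
  refine eq_zero_of_eval_ball (a := 𝔭 ^ (-(N : ℤ) - 1)) (n := -(N : ℤ)) fun z hz =>
    h z fun h' => ?_
  have h1 := hz.trans ((h'.symm).trans (InB.self _ _))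
  have h2 : InB (0 : ℚ_[p]) (-(N : ℤ)) (𝔭 ^ (-(N : ℤ) - 1)) := h'.trans hz.symm
  unfold InB at h2
  rw [sub_zero, norm_p_zpow, zpow_le_zpow_p] at h2
  omega

lemma normalForm_phi_apply {q : L} (hq : q ≠ 0) (N : ℕ) (x : L[X] × (Fin (p ^ (2 * N)) → L[X])) :
    normalForm q (phiMap (p := p) q) N x = pev p x.1 (phi p q 0 (-(N : ℤ))) +
      ∑ t, (1 - q⁻¹) • pev p (x.2 t) (ind p L (rep p N t) N) := by
  rw [normalForm_apply]
  simp only [stp_phiMap hq, phiMap, LinearMap.flip_apply]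

lemma injective_normalForm {q : L} (hq : q ≠ 0) (hq1 : q ≠ 1) (N : ℕ) :
    Function.Injective (normalForm q (phiMap (p := p) q) N) := by
  rw [← LinearMap.ker_eq_bot, LinearMap.ker_eq_bot']
  rintro ⟨P, g⟩ h0
  rw [normalForm_phi_apply hq] at h0
  have hc : (1 - q⁻¹ : L) ≠ 0 := by
    rw [sub_ne_zero]; intro h; exact hq1 (by rw [← inv_inv q, ← h, inv_one])
  have hP : P = 0 := by
    refine eq_zero_of_eval_not_ball (p := p) (N := N) fun z hz => ?_
    have h1 := congrFun h0 z
    rw [Pi.add_apply, Finset.sum_apply, sum_eq_zero, add_zero, pev_apply,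
      phi_of_not_inB hz] at h1
    · exact (mul_eq_zero.1 h1).resolve_right (zpow_ne_zero _ hq)
    · intro t _
      rw [Pi.smul_apply, pev_apply, ind_of_not_inB, mul_zero, smul_zero]
      intro h
      exact hz ((inB_rep N t).trans (h.mono (by omega)))
  subst hP
  refine Prod.ext rfl (funext fun t => ?_)
  refine eq_zero_of_eval_ball (p := p) (a := rep p N t) (n := N) fun z hz => ?_
  have h1 := congrFun h0 z
  rw [Pi.add_apply, Finset.sum_apply, sum_eq_single t] at h1
  · simpa [pev_apply, ind_of_inB hz, hc] using h1
  · intro t' _ ht'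
    rw [Pi.smul_apply, pev_apply, ind_of_not_inB, mul_zero, smul_zero]
    intro h
    exact ht' (rep_inj (h.trans hz.symm))
  · simp

/-- A functional on the `φ_{a,n}` may be prescribed subject to the relations. -/
lemma exists_functional_of_treeRel {Z : Type*} [AddCommGroup Z] [Module L Z] {q : L} (hq : q ≠ 0)
    (hq1 : q ≠ 1) {Ψ : ℚ_[p] → ℤ → L[X] →ₗ[L] Z} (h : TreeRel p q Ψ) :
    ∃ F : (ℚ_[p] → L) →ₗ[L] Z, ∀ a n P, F (pev p P (phi p q a n)) = Ψ a n P :=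
  (treeRel_phiMap hq).exists_lift (injective_normalForm hq hq1) h

/-- The conditions on the parameters. -/
structure Par (p m : ℕ) [Fact p.Prime] (α β : L) : Prop where
  a_ne : α ≠ 0
  b_ne : β ≠ 0
  a_lt : ‖α‖ < 1
  b_lt : ‖β‖ < 1
  mul : ‖α‖ * ‖β‖ = ((p : ℝ) ^ (m + 1))⁻¹
  ne : α ≠ β
  q_ne : α * p ≠ β

/-- The number `κ = p^{m+1}/β`. -/
def kap (p m : ℕ) (β : L) : L := (p : L) ^ (m + 1) / β

lemma p_ne (p : ℕ) [Fact p.Prime] (L : Type) [NontriviallyNormedField L] [NormedAlgebra ℚ_[p] L] :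
    (p : L) ≠ 0 := by
  rw [← norm_pos_iff, norm_p p L]; exact inv_pos.2 (p_pos p)

variable (p L) in
lemma algebraMap_p : η 𝔭 = (p : L) := map_natCast _ _

lemma Par.qq_ne_zero (h : Par p m α β) : 𝔮 ≠ 0 :=
  div_ne_zero (mul_ne_zero h.a_ne (p_ne p L)) h.b_ne

lemma Par.qq_ne_one (h : Par p m α β) : 𝔮 ≠ 1 := fun h1 => h.q_ne (by
  rwa [qq, div_eq_one_iff_eq h.b_ne] at h1)

lemma Par.one_sub_ne (h : Par p m α β) : (1 - 𝔮⁻¹ : L) ≠ 0 := by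
  rw [sub_ne_zero]; intro h1; exact h.qq_ne_one (by rw [← inv_inv 𝔮, ← h1, inv_one])

lemma Par.kap_ne_zero (h : Par p m α β) : kap p m β ≠ 0 :=
  div_ne_zero (pow_ne_zero _ (p_ne p L)) h.b_ne

lemma Par.norm_pos (h : Par p m α β) : 0 < ‖α‖ := norm_pos_iff.2 h.a_ne

lemma Par.norm_b (h : Par p m α β) : ‖β‖ = ‖α‖⁻¹ * ((p : ℝ) ^ (m + 1))⁻¹ := by
  rw [← h.mul, inv_mul_cancel_left₀ h.norm_pos.ne']

lemma Par.norm_qq (h : Par p m α β) : ‖𝔮‖ = ‖α‖ ^ 2 * (p : ℝ) ^ m := by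
  have := h.norm_pos
  have := p_pos p
  rw [qq, norm_div, norm_mul, norm_p p L, h.norm_b]
  field_simp
  ring

lemma Par.norm_kap (h : Par p m α β) : ‖kap p m β‖ = ‖α‖ := by
  have := h.norm_pos
  have := p_pos p
  rw [kap, norm_div, norm_pow, norm_p p L, h.norm_b, inv_pow]
  field_simp

lemma Par.kap_eq (h : Par p m α β) : kap p m β = (p : L) ^ m * 𝔮 / α := by
  have := h.a_ne
  have := h.b_ne
  rw [kap, qq]; field_simp; ring

variable (p L) in
/-- The polynomial `(X - a)/pⁿ`. -/
def lin (a : ℚ_[p]) (n : ℤ) : L[X] :=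
  C ((p : L) ^ (-n)) * (X - C (η a))

lemma eval_lin (a : ℚ_[p]) (n : ℤ) (z : ℚ_[p]) :
    (lin p L a n).eval (η z) = η ((z - a) * 𝔭 ^ (-n)) := by
  simp [lin, mul_comm]

lemma natDegree_lin_pow (a : ℚ_[p]) (n : ℤ) (j : ℕ) : (lin p L a n ^ j).natDegree ≤ j := by
  refine (natDegree_pow_le).trans ?_
  have : (lin p L a n).natDegree ≤ 1 := by
    unfold lin
    refine (natDegree_C_mul_le _ _).trans ?_
    exact (natDegree_X_sub_C _).le
  calc _ ≤ j * 1 := Nat.mul_le_mul_left _ this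
    _ = j := mul_one _

variable (p m α β) in
/-- The normalized generators. -/
def gen (a : ℚ_[p]) (n : ℤ) (j : ℕ) : ℚ_[p] → L :=
  kap p m β ^ n • pev p (lin p L a n ^ j) (phi p 𝔮 a n)

lemma gen_apply (a : ℚ_[p]) (n : ℤ) (j : ℕ) (z : ℚ_[p]) :
    gen p m α β a n j z = kap p m β ^ n * (η ((z - a) * 𝔭 ^ (-n)) ^ j *
      𝔮 ^ (nv (z - a) (𝔭 ^ n) - n)) := by
  simp only [gen, Pi.smul_apply, smul_eq_mul, pev_apply, eval_pow, eval_lin, phi]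

variable (p m) in
/-- The functions `P φ_{a,n}` with `P` of degree at most `m` span this space. -/
def Vsp (q : L) : Submodule L (ℚ_[p] → L) :=
  span L {f | ∃ (P : L[X]) (a : ℚ_[p]) (n : ℤ), P.natDegree ≤ m ∧
    f = pev p P (phi p q a n)}

variable (p m α β) in
/-- The integral span of the normalized generators. -/
def Tht : AddSubgroup (ℚ_[p] → L) :=
  AddSubgroup.closure {f | ∃ (c : L) (a : ℚ_[p]) (n : ℤ) (j : ℕ), ‖c‖ ≤ 1 ∧ j ≤ m ∧
    f = c • gen p m α β a n j}

lemma gen_mem_Tht (a : ℚ_[p]) (n : ℤ) {j : ℕ} (hj : j ≤ m) : gen p m α β a n j ∈ Tht p m α β :=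
  AddSubgroup.subset_closure ⟨1, a, n, j, by simp, hj, (one_smul _ _).symm⟩

lemma smul_mem_Tht {c : L} (hc : ‖c‖ ≤ 1) {f : ℚ_[p] → L} (hf : f ∈ Tht p m α β) :
    c • f ∈ Tht p m α β := by
  induction hf using AddSubgroup.closure_induction with
  | mem f hf =>
    obtain ⟨c', a, n, j, hc', hj, rfl⟩ := hf
    refine AddSubgroup.subset_closure ⟨c * c', a, n, j, ?_, hj, smul_smul _ _ _⟩
    rw [norm_mul]; exact mul_le_one₀ hc (norm_nonneg _) hc'
  | zero => rw [smul_zero]; exact zero_mem _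
  | add f g _ _ hf hg => rw [smul_add]; exact add_mem hf hg
  | neg f _ hf => rw [smul_neg]; exact neg_mem hf

lemma pev_phi_mem {q : L} {P : L[X]} (hP : P.natDegree ≤ m) (a : ℚ_[p]) (n : ℤ) :
    pev p P (phi p q a n) ∈ Vsp p m q := subset_span ⟨P, a, n, hP, rfl⟩

lemma gen_mem_Vsp (a : ℚ_[p]) (n : ℤ) {j : ℕ} (hj : j ≤ m) : gen p m α β a n j ∈ Vsp p m 𝔮 :=
  smul_mem _ _ (pev_phi_mem ((natDegree_lin_pow a n j).trans hj) a n)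

lemma Tht_le_Vsp {f : ℚ_[p] → L} (hf : f ∈ Tht p m α β) : f ∈ Vsp p m 𝔮 := by
  induction hf using AddSubgroup.closure_induction with
  | mem f hf =>
    obtain ⟨c', a, n, j, hc', hj, rfl⟩ := hf
    exact smul_mem _ _ (gen_mem_Vsp a n hj)
  | zero => exact zero_mem _
  | add f g _ _ hf hg => exact add_mem hf hg
  | neg f _ hf => exact neg_mem hf

/-- The homogeneous function attached to two linear forms. -/
def EE (m : ℕ) (α q : L) (j : ℕ) (M : Matrix (Fin 2) (Fin 2) ℚ_[p]) : ℚ_[p] × ℚ_[p] → L := fun v =>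
  α ^ (-M.det.valuation) * (η (M 0 0 * v.1 + M 0 1 * v.2) ^ j *
    η (M 1 0 * v.1 + M 1 1 * v.2) ^ (m - j) *
    q ^ nv (M 0 0 * v.1 + M 0 1 * v.2) (M 1 0 * v.1 + M 1 1 * v.2))

variable (L) in
/-- Restriction of a function of two variables to the affine line. -/
def res : (ℚ_[p] × ℚ_[p] → L) →ₗ[L] (ℚ_[p] → L) :=
  funLeft L L fun z => (z, 1)

lemma res_apply (F : ℚ_[p] × ℚ_[p] → L) (z : ℚ_[p]) : res L F z = F (z, 1) := rfl

lemma max_norm_add_mul {u w t : ℚ_[p]} (ht : ‖t‖ ≤ 1) : max ‖u + t * w‖ ‖w‖ = max ‖u‖ ‖w‖ := by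
  have key : ∀ (u t : ℚ_[p]), ‖t‖ ≤ 1 → max ‖u + t * w‖ ‖w‖ ≤ max ‖u‖ ‖w‖ := by
    intro u t ht
    refine max_le ((nonarchimedean _ _).trans (max_le_max le_rfl ?_)) (le_max_right _ _)
    rw [norm_mul]; exact mul_le_of_le_one_left (norm_nonneg _) ht
  refine le_antisymm (key u t ht) ?_
  have := key (u + t * w) (-t) (by rwa [norm_neg])
  rwa [show u + t * w + -t * w = u by ring] at this

lemma algebraMap_norm (x : ℚ_[p]) : ‖η x‖ = ‖x‖ := norm_algebraMap' L x

lemma Par.monomial_mem_Tht (h : Par p m α β) {e w a : ℚ_[p]} (he : e ≠ 0) (hw : w ≠ 0) {l : ℕ}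
    (hl : l ≤ m) {c : L} (hc : ‖c‖ ≤ 1) : (fun z => c * (α ^ (-(e * w).valuation) * (η e ^ (m - l) *
      η (w * (z - a)) ^ l * 𝔮 ^ nv e (w * (z - a))))) ∈ Tht p m α β := by
  have hq := h.qq_ne_zero
  have hp := p_ne p L
  have hκ := h.kap_ne_zero
  have hα := h.a_ne
  set v := w.valuation with hv
  set n := e.valuation - v with hn
  have hew : (e * w).valuation = n + 2 * v := by rw [valuation_mul he hw]; omega
  set d : L := α ^ (-(n + 2 * v)) * (η e ^ (m - l) * η w ^ l *
    𝔮 ^ (v + n)) / (kap p m β ^ n * (p : L) ^ (-n * l)) with hd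
  have hdn : ‖d‖ = 1 := by
    have hα0 := h.norm_pos
    have hp0 := p_pos p
    have h1 : ‖e‖ = (p : ℝ) ^ (-(n + v)) := by rw [norm_eq_zpow_neg_valuation he]; congr 1; omega
    have h2 : ‖w‖ = (p : ℝ) ^ (-v) := norm_eq_zpow_neg_valuation hw
    obtain ⟨r, rfl⟩ := Nat.exists_eq_add_of_le hl
    rw [hd, norm_div, div_eq_one_iff_eq (norm_ne_zero_iff.2 (mul_ne_zero (zpow_ne_zero _ hκ)
      (zpow_ne_zero _ hp)))]
    simp only [norm_mul, norm_zpow, algebraMap_norm, h.norm_qq, h.norm_kap, norm_p p L, h1,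
      h2, Nat.add_sub_cancel_left, ← zpow_natCast, mul_zpow, ← zpow_mul, inv_zpow']
    rw [show ‖α‖ ^ (-(n + 2 * v)) * ((p : ℝ) ^ (-(n + v) * (r : ℤ)) * (p : ℝ) ^ (-v * (l : ℤ)) *
      (‖α‖ ^ (((2 : ℕ) : ℤ) * (v + n)) * (p : ℝ) ^ (((l + r : ℕ) : ℤ) * (v + n)))) =
      (‖α‖ ^ (-(n + 2 * v)) * ‖α‖ ^ (((2 : ℕ) : ℤ) * (v + n))) *
      ((p : ℝ) ^ (-(n + v) * (r : ℤ)) * (p : ℝ) ^ (-v * (l : ℤ)) *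
        (p : ℝ) ^ (((l + r : ℕ) : ℤ) * (v + n))) by ring]
    simp only [← zpow_add₀ hα0.ne', ← zpow_add₀ hp0.ne']
    congr 2
    · push_cast; ring
    · push_cast; ring
  have hmem : (c * d) • gen p m α β a n l ∈ Tht p m α β :=
    smul_mem_Tht (by rw [norm_mul, hdn, mul_one]; exact hc) (gen_mem_Tht a n hl)
  convert hmem using 1
  ext z
  simp only [Pi.smul_apply, smul_eq_mul, gen_apply]
  have hnv : nv e (w * (z - a)) = v + nv (z - a) (𝔭 ^ n) := by
    rw [← nv_mul (fun h => zpow_ne_zero n padic_p_ne_zero h.2) hw]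
    refine nv_congr (fun h => he h.1) ?_
    rw [max_comm]
    congr 1
    rw [norm_mul w, norm_p_zpow, norm_eq_zpow_neg_valuation hw,
      norm_eq_zpow_neg_valuation he, ← zpow_add₀ (p_pos p).ne']
    congr 1; omega
  clear_value d n v
  rw [hnv, hew, hd, map_mul, map_mul, map_zpow₀, algebraMap_p, mul_pow, mul_pow,
    zpow_add₀ hq, zpow_add₀ hq, zpow_sub₀ hq, ← zpow_natCast ((p : L) ^ (-n)), ← zpow_mul]
  field_simp

lemma det_eq (M : Matrix (Fin 2) (Fin 2) ℚ_[p]) : M.det = M 0 0 * M 1 1 - M 0 1 * M 1 0 :=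
  Matrix.det_fin_two M

lemma Par.res_EE_mem_of_le (h : Par p m α β) {u1 u2 w1 w2 : ℚ_[p]} (hd : u1 * w2 - u2 * w1 ≠ 0)
    (hle : ‖u1‖ ≤ ‖w1‖) {j : ℕ} (hj : j ≤ m) :
    (fun z => α ^ (-(u1 * w2 - u2 * w1).valuation) * (η (u1 * z + u2) ^ j *
      η (w1 * z + w2) ^ (m - j) * 𝔮 ^ nv (u1 * z + u2) (w1 * z + w2))) ∈ Tht p m α β := by
  have hw : w1 ≠ 0 := by
    rintro rfl
    rw [norm_zero] at hle
    have := norm_le_zero_iff.1 hle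
    subst this
    simp at hd
  set t := u1 / w1 with ht
  set e := u2 - t * w2 with he
  set a := -w2 / w1 with ha
  have ht1 : ‖t‖ ≤ 1 := by rw [ht, norm_div]; exact (div_le_one (norm_pos_iff.2 hw)).2 hle
  have hdet : u1 * w2 - u2 * w1 = -(e * w1) := by rw [he, ht]; field_simp; ring
  have he0 : e ≠ 0 := by rintro h0; apply hd; rw [hdet, h0]; ring
  have hval : (u1 * w2 - u2 * w1).valuation = (e * w1).valuation := by
    rw [hdet]
    have h0 : e * w1 ≠ 0 := mul_ne_zero he0 hw
    have h1 := norm_eq_zpow_neg_valuation (neg_ne_zero.2 h0)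
    rw [norm_neg, norm_eq_zpow_neg_valuation h0] at h1
    have := zpow_right_injective₀ (p_pos p) (one_lt_p p).ne' h1
    omega
  have hwz : ∀ z, w1 * z + w2 = w1 * (z - a) := by intro z; rw [ha]; field_simp; ring
  have huz : ∀ z, u1 * z + u2 = e + t * (w1 * (z - a)) := by
    intro z; rw [he, ha, ht]; field_simp; ring
  have hnv : ∀ z, nv (u1 * z + u2) (w1 * z + w2) = nv e (w1 * (z - a)) := by
    intro z
    symm
    refine nv_congr (fun h => he0 h.1) ?_
    rw [hwz, huz, max_norm_add_mul ht1]
  have hsum : (fun z => α ^ (-(u1 * w2 - u2 * w1).valuation) * (η (u1 * z + u2) ^ j *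
      η (w1 * z + w2) ^ (m - j) * 𝔮 ^ nv (u1 * z + u2) (w1 * z + w2))) =
      ∑ i ∈ range (j + 1), fun z => ((j.choose i : L) * η t ^ (j - i)) *
        (α ^ (-(e * w1).valuation) * (η e ^ (m - (m - i)) *
        η (w1 * (z - a)) ^ (m - i) * 𝔮 ^ nv e (w1 * (z - a)))) := by
    ext z
    rw [Finset.sum_apply, hval, hnv, hwz, huz, map_add, add_pow, map_mul _ t, sum_mul,
      sum_mul, mul_sum]
    refine sum_congr rfl fun i hi => ?_
    have hi' := mem_range_succ_iff.1 hi
    rw [show m - (m - i) = i by omega, show m - i = (m - j) + (j - i) by omega, pow_add, mul_pow]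
    ring
  rw [hsum]
  refine sum_mem fun i hi => ?_
  have hi' := mem_range_succ_iff.1 hi
  refine h.monomial_mem_Tht he0 hw (by omega) ?_
  rw [norm_mul, norm_pow, algebraMap_norm]
  refine mul_le_one₀ ?_ (by positivity) (pow_le_one₀ (norm_nonneg _) ht1)
  have h3 := norm_int_le_one (p := p) ((j.choose i : ℕ) : ℤ)
  rw [← algebraMap_norm (L := L)] at h3
  simpa using h3

lemma Par.res_EE_mem (h : Par p m α β) {M : Matrix (Fin 2) (Fin 2) ℚ_[p]} (hM : M.det ≠ 0) {j : ℕ}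
    (hj : j ≤ m) : res L (EE m α 𝔮 j M) ∈ Tht p m α β := by
  have hdet := det_eq M
  by_cases hle : ‖M 0 0‖ ≤ ‖M 1 0‖
  · convert h.res_EE_mem_of_le (u1 := M 0 0) (u2 := M 0 1) (w1 := M 1 0) (w2 := M 1 1)
      (by rwa [← hdet]) hle hj using 1
    ext z
    simp only [res_apply, EE, mul_one, hdet]
  · have hd' : M 1 0 * M 0 1 - M 1 1 * M 0 0 = -M.det := by rw [hdet]; ring
    convert h.res_EE_mem_of_le (u1 := M 1 0) (u2 := M 1 1) (w1 := M 0 0) (w2 := M 0 1) (j := m - j)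
      (by rw [hd']; exact neg_ne_zero.2 hM) (not_le.1 hle).le (by omega) using 1
    ext z
    simp only [res_apply, EE, mul_one]
    have hval : (-M.det).valuation = M.det.valuation := by
      have h1 := norm_eq_zpow_neg_valuation (neg_ne_zero.2 hM)
      rw [norm_neg, norm_eq_zpow_neg_valuation hM] at h1
      have := zpow_right_injective₀ (p_pos p) (one_lt_p p).ne' h1
      omega
    rw [hd', hval, show m - (m - j) = j by omega, nv_comm]
    · ring
    · rintro ⟨h1, h2⟩
      apply hM
      rw [hdet]
      have e1 : M 0 1 = -(M 0 0 * z) := by linear_combination h1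
      have e2 : M 1 1 = -(M 1 0 * z) := by linear_combination h2
      rw [e1, e2]; ring

/-- The matrix attached to the ball `a + pⁿℤ_p`. -/
def ballMat (a : ℚ_[p]) (n : ℤ) : Matrix (Fin 2) (Fin 2) ℚ_[p] := !![1, -a; 0, 𝔭 ^ n]

lemma det_ballMat (a : ℚ_[p]) (n : ℤ) : (ballMat a n).det = 𝔭 ^ n := by
  simp [ballMat, Matrix.det_fin_two]

lemma Par.res_EE_ballMat (h : Par p m α β) (a : ℚ_[p]) (n : ℤ) {j : ℕ} (hj : j ≤ m) :
    res L (EE m α 𝔮 j (ballMat a n)) = gen p m α β a n j := by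
  ext z
  have hq := h.qq_ne_zero
  have hp := p_ne p L
  have hα := h.a_ne
  rw [res_apply, gen_apply, EE, det_ballMat, h.kap_eq]
  obtain ⟨r, rfl⟩ := Nat.exists_eq_add_of_le hj
  have h1 : (𝔭 ^ n).valuation = n := by simp [valuation_zpow]
  simp only [ballMat, h1, Matrix.of_apply, Matrix.cons_val_zero, Matrix.cons_val_one,
    Matrix.cons_val', Matrix.cons_val_fin_one, one_mul, mul_one, zero_mul, zero_add,
    ← sub_eq_add_neg, map_mul, map_zpow₀, algebraMap_p, mul_pow, Nat.add_sub_cancel_left]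
  rw [zpow_sub₀ hq, div_zpow, mul_zpow, ← zpow_natCast ((p : L) ^ (-n)), ← zpow_mul,
    ← zpow_natCast ((p : L) ^ n), ← zpow_mul, ← zpow_natCast (p : L), ← zpow_mul]
  have h2 : (p : L) ^ (((j + r : ℕ) : ℤ) * n) * (p : L) ^ (-n * (j : ℤ)) = (p : L) ^ (n * (r : ℤ)) := by
    rw [← zpow_add₀ hp]; congr 1; push_cast; ring
  rw [← h2, zpow_neg]
  field_simp

section MahlerRegularity

open fwdDiff_aux

variable (p L) in
/-- The operator `Q(Δ)` attached to an integral polynomial `Q`. -/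
def diffOp : ℤ[X] →ₐ[ℤ] End ℤ (ℤ_[p] → L) := aeval (fwdDiffₗ ℤ_[p] L 1)

lemma diffOp_X_pow (n : ℕ) (f : ℤ_[p] → L) : diffOp p L (X ^ n) f = (fwdDiff 1)^[n] f := by
  rw [diffOp, map_pow, aeval_X, ← coe_fwdDiffₗ_pow]

lemma norm_intCast_le_one' (p : ℕ) [Fact p.Prime] (L : Type) [NontriviallyNormedField L]
    [NormedAlgebra ℚ_[p] L] (z : ℤ) : ‖(z : L)‖ ≤ 1 := by
  have h3 := norm_int_le_one (p := p) z
  rw [← algebraMap_norm (L := L)] at h3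
  simpa using h3

variable [IsUltrametricDist L]

lemma norm_diffOp_le (Q : ℤ[X]) {C : ℝ} {f : ℤ_[p] → L} (hf : ∀ y, ‖f y‖ ≤ C) (y : ℤ_[p]) :
    ‖diffOp p L Q f y‖ ≤ C := by
  have hC : 0 ≤ C := (norm_nonneg _).trans (hf 0)
  induction Q using Polynomial.induction_on' with
  | add P Q hP hQ =>
    rw [map_add, LinearMap.add_apply, Pi.add_apply]
    exact (norm_add_le_max _ _).trans (max_le hP hQ)
  | monomial n c =>
    rw [← C_mul_X_pow_eq_monomial, map_mul, End.mul_apply, diffOp_X_pow, diffOp, aeval_C,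
      algebraMap_int_eq, Int.coe_castRingHom, End.intCast_apply, Pi.smul_apply,
      zsmul_eq_mul, norm_mul]
    refine (mul_le_of_le_one_left (norm_nonneg _) (norm_intCast_le_one' p L c)).trans ?_
    rw [fwdDiff_iter_eq_sum_shift]
    refine norm_sum_le_of_forall_le_of_nonneg hC fun i _ => ?_
    rw [zsmul_eq_mul, norm_mul]
    exact (mul_le_of_le_one_left (norm_nonneg _) (norm_intCast_le_one' p L _)).trans (hf _)

lemma exists_pow_sub_one_eq (p N m : ℕ) [hp : Fact p.Prime] :
    ∃ R : ℤ[X], (((1 : ℤ[X]) + X) ^ p ^ N - 1) ^ (m + 1) = X ^ (p ^ N * (m + 1)) + (p : ℤ[X]) * R := by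
  obtain ⟨r, hr⟩ := exists_add_pow_prime_pow_eq hp.out (1 : ℤ[X]) X N
  obtain ⟨s, hs⟩ := sub_dvd_pow_sub_pow (((1 : ℤ[X]) + X) ^ p ^ N - 1) (X ^ p ^ N) (m + 1)
  refine ⟨X * r * s, ?_⟩
  rw [pow_mul, ← sub_eq_iff_eq_add', hs, hr]
  ring

lemma diffOp_kill {N m : ℕ} {f : ℤ_[p] → L} (hf : ∀ z, ∃ P : L[X], P.natDegree ≤ m ∧ ∀ x : ℤ_[p],
      f (z + (p : ℤ_[p]) ^ N * x) = P.eval (η x)) :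
    diffOp p L ((((1 : ℤ[X]) + X) ^ p ^ N - 1) ^ (m + 1)) f = 0 := by
  have h1 : diffOp p L (((1 : ℤ[X]) + X) ^ p ^ N - 1) = fwdDiffₗ ℤ_[p] L ((p : ℤ_[p]) ^ N) := by
    have h2 : diffOp p L ((1 : ℤ[X]) + X) = shiftₗ ℤ_[p] L 1 := by
      rw [diffOp, map_add, map_one, aeval_X, add_comm]; rfl
    rw [map_sub, map_pow, h2, map_one]
    ext g y
    rw [LinearMap.sub_apply, Pi.sub_apply, shiftₗ_pow_apply, coe_fwdDiffₗ, fwdDiff]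
    simp
  rw [map_pow, h1, coe_fwdDiffₗ_pow]
  ext z
  obtain ⟨P, hP, hPf⟩ := hf z
  have h3 := congrFun (fwdDiff_iter_eq_zero_of_degree_lt (n := m + 1)
    (Nat.lt_succ_of_le hP)) (0 : L)
  rw [fwdDiff_iter_eq_sum_shift] at h3 ⊢
  refine Eq.trans (sum_congr rfl fun i _ => ?_) h3
  congr 1
  have := hPf (i : ℤ_[p])
  rw [nsmul_eq_mul, mul_comm, this]
  simp

lemma norm_fwdDiff_iter_le_of_locPoly {N m : ℕ} {f : ℤ_[p] → L}
    (hf : ∀ z, ∃ P : L[X], P.natDegree ≤ m ∧ ∀ x : ℤ_[p],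
      f (z + (p : ℤ_[p]) ^ N * x) = P.eval (η x)) {C : ℝ} (hC : ∀ y, ‖f y‖ ≤ C)
    (n : ℕ) (y : ℤ_[p]) : ‖(fwdDiff 1)^[n] f y‖ ≤ ((p : ℝ)⁻¹) ^ (n / (p ^ N * (m + 1))) * C := by
  obtain ⟨R, hR⟩ := exists_pow_sub_one_eq p N m
  set D := p ^ N * (m + 1) with hD
  set s := n / D with hs
  obtain ⟨T, hT⟩ := sub_dvd_pow_sub_pow ((X : ℤ[X]) ^ D) (-((p : ℤ[X]) * R)) s
  have hX : (X : ℤ[X]) ^ n = X ^ (n % D) * T * (((1 : ℤ[X]) + X) ^ p ^ N - 1) ^ (m + 1) +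
      (p : ℤ[X]) ^ s * ((-R) ^ s * X ^ (n % D)) := by
    have h1 : (X : ℤ[X]) ^ n = X ^ (n % D) * (X ^ D) ^ s := by
      rw [← pow_mul, ← pow_add, hs, Nat.mod_add_div]
    rw [h1, ← sub_add_cancel ((X ^ D) ^ s) ((-((p : ℤ[X]) * R)) ^ s), hT, hR, neg_mul_eq_mul_neg,
      mul_pow]
    ring
  rw [← diffOp_X_pow, hX, map_add, map_mul, LinearMap.add_apply, End.mul_apply,
    diffOp_kill hf, map_zero, zero_add, map_mul, map_pow, map_natCast, End.mul_apply,
    ← Nat.cast_pow, End.natCast_apply, Pi.smul_apply, nsmul_eq_mul, norm_mul, Nat.cast_pow,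
    norm_pow, norm_p p L]
  exact mul_le_mul_of_nonneg_left (norm_diffOp_le _ hC y)
    (pow_nonneg (inv_nonneg.2 (p_pos p).le) _)

lemma continuous_of_locPoly {N m : ℕ} {f : ℤ_[p] → L}
    (hf : ∀ z, ∃ P : L[X], P.natDegree ≤ m ∧ ∀ x : ℤ_[p],
      f (z + (p : ℤ_[p]) ^ N * x) = P.eval (η x)) : Continuous f := by
  rw [continuous_iff_continuousAt]
  intro z
  obtain ⟨P, -, hP⟩ := hf z
  have h1 : ContinuousAt (fun y : ℤ_[p] => P.eval (η
      (((y : ℚ_[p]) - z) * (𝔭 ^ N)⁻¹))) z := by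
    refine Continuous.continuousAt ?_
    refine P.continuous.comp ((continuous_algebraMap ℚ_[p] L).comp ?_)
    exact (continuous_subtype_val.sub continuous_const).mul continuous_const
  refine h1.congr ?_
  have h2 : Metric.closedBall z ((p : ℝ) ^ (-N : ℤ)) ∈ 𝓝 z :=
    Metric.closedBall_mem_nhds _ (zpow_pos (p_pos p) _)
  filter_upwards [h2] with y hy
  rw [Metric.mem_closedBall, dist_eq_norm, PadicInt.norm_le_pow_iff_mem_span_pow,
    Ideal.mem_span_singleton] at hy
  obtain ⟨x, hx⟩ := hy
  rw [show y = z + (p : ℤ_[p]) ^ N * x by rw [← hx]; ring, hP]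
  congr 2
  push_cast
  have : 𝔭 ^ N ≠ 0 := pow_ne_zero _ padic_p_ne_zero
  field_simp
  ring

lemma tendsto_rpow_mul_pow_div (r : ℝ) {D : ℕ} (hD : 0 < D) {x : ℝ} (hx0 : 0 < x) (hx : x < 1) :
    Tendsto (fun n : ℕ => (n : ℝ) ^ r * x ^ (n / D)) atTop (𝓝 0) := by
  set y : ℝ := x ^ (1 / (D : ℝ)) with hy
  have hD' : (0 : ℝ) < D := by exact_mod_cast hD
  have hy0 : 0 < y := Real.rpow_pos_of_pos hx0 _
  have hy1 : y < 1 := Real.rpow_lt_one hx0.le hx (by positivity)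
  have hyD : y ^ D = x := by
    rw [hy, ← Real.rpow_natCast, ← Real.rpow_mul hx0.le, one_div_mul_cancel hD'.ne', Real.rpow_one]
  have h1 := tendsto_pow_const_mul_const_pow_of_abs_lt_one ⌈r⌉₊ (r := y) (by rwa [abs_of_pos hy0])
  have h2 := h1.const_mul (x⁻¹)
  rw [mul_zero] at h2
  refine squeeze_zero' (Eventually.of_forall fun n => by positivity) ?_ h2
  filter_upwards [eventually_ge_atTop 1] with n hn
  have hn1 : (1 : ℝ) ≤ n := by exact_mod_cast hn
  have h3 : (n : ℝ) ^ r ≤ (n : ℝ) ^ ⌈r⌉₊ := by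
    rw [← Real.rpow_natCast]
    exact Real.rpow_le_rpow_of_exponent_le hn1 (Nat.le_ceil r)
  have h4 : x ^ (n / D) ≤ x⁻¹ * y ^ n := by
    rw [inv_mul_eq_div, le_div_iff₀ hx0, ← pow_succ, ← hyD, ← pow_mul]
    refine pow_le_pow_of_le_one hy0.le hy1.le ?_
    have := Nat.lt_mul_div_succ n hD
    exact this.le
  calc _ ≤ (n : ℝ) ^ ⌈r⌉₊ * (x⁻¹ * y ^ n) := mul_le_mul h3 h4 (by positivity) (by positivity)
    _ = _ := by ring

lemma coe_choose (z : ℤ_[p]) (n : ℕ) : ((Ring.choose z n : ℤ_[p]) : ℚ_[p]) = binomQ p z n := by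
  have h := Ring.descPochhammer_eq_factorial_smul_choose z n
  rw [nsmul_eq_mul] at h
  have hf : (n.factorial : ℚ_[p]) ≠ 0 := by exact_mod_cast n.factorial_ne_zero
  rw [binomQ, eq_div_iff hf, mul_comm]
  have h2 := congrArg (fun x : ℤ_[p] => (x : ℚ_[p])) h
  simp only [PadicInt.coe_mul, PadicInt.coe_natCast] at h2
  rw [← h2]
  clear h h2
  have key : ∀ n : ℕ, (descPochhammer ℤ n).smeval z = ∏ i ∈ range n, (z - (i : ℤ_[p])) := by
    intro n
    induction n with
    | zero => simp
    | succ n ih =>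
      rw [prod_range_succ, ← ih, descPochhammer_succ_right, smeval_mul,
        smeval_sub, smeval_X, pow_one, smeval_natCast, pow_zero,
        nsmul_eq_mul, mul_one]
  rw [key]
  induction n with
  | zero => simp
  | succ n ih =>
    rw [prod_range_succ, prod_range_succ, PadicInt.coe_mul,
      ih (by exact_mod_cast n.factorial_ne_zero)]
    simp

lemma mahlerCoeff_eq (f : ℤ_[p] → L) (n : ℕ) : mahlerCoeff p L f n = (fwdDiff 1)^[n] f 0 := by
  rw [fwdDiff_iter_eq_sum_shift, mahlerCoeff, ← sum_range_reflect]
  refine sum_congr rfl fun i hi => ?_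
  have hi' := mem_range_succ_iff.1 hi
  rw [show n + 1 - 1 - i = n - i by omega, Nat.choose_symm hi', show n - (n - i) = i by omega]
  simp

lemma isCr_of_locPoly [CompleteSpace L] (r : ℝ) {N m : ℕ} {f : ℤ_[p] → L}
    (hf : ∀ z, ∃ P : L[X], P.natDegree ≤ m ∧ ∀ x : ℤ_[p],
      f (z + (p : ℤ_[p]) ^ N * x) = P.eval (η x)) : IsCr p L r f := by
  have hcont := continuous_of_locPoly hf
  set F : C(ℤ_[p], L) := ⟨f, hcont⟩ with hF
  have hb : ∀ y, ‖f y‖ ≤ ‖F‖ := fun y => F.norm_coe_le_norm y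
  constructor
  · have hD : 0 < p ^ N * (m + 1) := Nat.mul_pos (pow_pos (Nat.Prime.pos Fact.out) _) m.succ_pos
    have h1 := (tendsto_rpow_mul_pow_div r hD (inv_pos.2 (p_pos p))
      (inv_lt_one_of_one_lt₀ (one_lt_p p))).mul_const ‖F‖
    rw [zero_mul] at h1
    refine squeeze_zero (fun n => by positivity) (fun n => ?_) h1
    rw [mahlerCoeff_eq, mul_assoc]
    exact mul_le_mul_of_nonneg_left (norm_fwdDiff_iter_le_of_locPoly hf hb n 0) (by positivity)
  · intro z
    let _ : Module ℤ_[p] L := Module.compHom L (algebraMap ℤ_[p] ℚ_[p])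
    have hsm : ∀ (c : ℤ_[p]) (x : L), c • x = η (c : ℚ_[p]) * x := fun c x =>
      Algebra.smul_def (c : ℚ_[p]) x
    have : IsBoundedSMul ℤ_[p] L := IsBoundedSMul.of_norm_smul_le fun c x => by
      rw [hsm, norm_mul, algebraMap_norm, PadicInt.norm_def]
    have h1 := PadicInt.hasSum_mahler F
    have h2 : HasSum (fun n => (PadicInt.mahlerTerm ((fwdDiff 1)^[n] F 0) n : C(ℤ_[p], L)) z) (F z) :=
      h1.map (ContinuousMap.evalCLM ℤ_[p] z : C(ℤ_[p], L) →L[ℤ_[p]] L)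
        (ContinuousMap.evalCLM ℤ_[p] z : C(ℤ_[p], L) →L[ℤ_[p]] L).continuous
    refine h2.congr_fun ?_
    intro n
    rw [PadicInt.mahlerTerm_apply, hsm, mahler_apply, coe_choose, mahlerCoeff_eq, mul_comm]
    rfl

end MahlerRegularity

section Expansion

/-- The polynomial `P(a + pⁿX)`. -/
def recenter (a : ℚ_[p]) (n : ℤ) (P : L[X]) : L[X] :=
  P.comp (C ((p : L) ^ n) * X + C (η a))

lemma natDegree_recenter_le (a : ℚ_[p]) (n : ℤ) (P : L[X]) :
    (recenter a n P).natDegree ≤ P.natDegree := by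
  refine (natDegree_comp_le).trans ?_
  calc _ ≤ P.natDegree * 1 := Nat.mul_le_mul_left _ natDegree_linear_le
    _ = _ := mul_one _

lemma recenter_comp_lin (a : ℚ_[p]) (n : ℤ) (P : L[X]) :
    (recenter a n P).comp (lin p L a n) = P := by
  have hp := p_ne p L
  rw [recenter, comp_assoc]
  conv_rhs => rw [← comp_X (p := P)]
  congr 1
  rw [add_comp, mul_comp, C_comp, X_comp,
    C_comp, lin, ← mul_assoc, ← C_mul, ← zpow_add₀ hp, add_neg_cancel,
    zpow_zero, C_1, one_mul, sub_add_cancel]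

lemma eq_sum_lin_pow (a : ℚ_[p]) (n : ℤ) {P : L[X]} (hP : P.natDegree ≤ m) :
    P = ∑ j ∈ range (m + 1), (recenter a n P).coeff j • lin p L a n ^ j := by
  conv_lhs => rw [← recenter_comp_lin a n P]
  rw [Polynomial.comp, eval₂_eq_sum_range' _
    (Nat.lt_succ_of_le ((natDegree_recenter_le a n P).trans hP))]
  simp only [smul_eq_C_mul]

lemma pev_phi_eq_sum (h : Par p m α β) (a : ℚ_[p]) (n : ℤ) {P : L[X]}
    (hP : P.natDegree ≤ m) : pev p P (phi p 𝔮 a n) = ∑ j ∈ range (m + 1),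
      ((recenter a n P).coeff j * (kap p m β ^ n)⁻¹) • gen p m α β a n j := by
  conv_lhs => rw [eq_sum_lin_pow a n hP]
  rw [map_sum, LinearMap.sum_apply]
  refine sum_congr rfl fun j _ => ?_
  have hk : kap p m β ^ n ≠ 0 := zpow_ne_zero _ h.kap_ne_zero
  rw [gen, smul_smul, mul_assoc, inv_mul_cancel₀ hk, mul_one, map_smul, LinearMap.smul_apply]

end Expansion

section Action

variable (p m α) in
/-- The span of the homogeneous functions `EE`. -/
def HV (q : L) : Submodule L (ℚ_[p] × ℚ_[p] → L) :=
  span L {F | ∃ (M : Matrix (Fin 2) (Fin 2) ℚ_[p]) (j : ℕ), M.det ≠ 0 ∧ j ≤ m ∧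
    F = EE m α q j M}

/-- The action of a matrix on functions of two variables. -/
def tw (α : L) (g : Matrix (Fin 2) (Fin 2) ℚ_[p]) : (ℚ_[p] × ℚ_[p] → L) →ₗ[L] (ℚ_[p] × ℚ_[p] → L) :=
  α ^ (-g.det.valuation) • funLeft L L fun v =>
    (g 1 1 * v.1 - g 0 1 * v.2, -g 1 0 * v.1 + g 0 0 * v.2)

lemma tw_apply (g : Matrix (Fin 2) (Fin 2) ℚ_[p]) (F : ℚ_[p] × ℚ_[p] → L) (v : ℚ_[p] × ℚ_[p]) :
    tw α g F v = α ^ (-g.det.valuation) *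
      F (g 1 1 * v.1 - g 0 1 * v.2, -g 1 0 * v.1 + g 0 0 * v.2) := rfl

lemma tw_EE (hα : α ≠ 0) {q : L} {g M : Matrix (Fin 2) (Fin 2) ℚ_[p]} (hg : g.det ≠ 0)
    (hM : M.det ≠ 0) (j : ℕ) : tw α g (EE m α q j M) = EE m α q j (M * g.adjugate) := by
  have hdet : (M * g.adjugate).det = M.det * g.det := by
    rw [Matrix.det_mul, Matrix.det_adjugate]; simp
  ext v
  rw [tw_apply, EE, EE, hdet, valuation_mul hM hg, neg_add, zpow_add₀ hα, ← mul_assoc,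
    mul_comm (α ^ (-g.det.valuation))]
  simp only [Matrix.adjugate_fin_two, Matrix.mul_apply, Fin.sum_univ_two, Matrix.of_apply,
    Matrix.cons_val_zero, Matrix.cons_val_one, Matrix.cons_val', Matrix.cons_val_fin_one]
  have e1 : ∀ i : Fin 2, M i 0 * (g 1 1 * v.1 - g 0 1 * v.2) + M i 1 * (-g 1 0 * v.1 + g 0 0 * v.2) =
      (M i 0 * g 1 1 + M i 1 * -g 1 0) * v.1 + (M i 0 * -g 0 1 + M i 1 * g 0 0) * v.2 := by
    intro i; ring
  rw [e1, e1]

lemma tw_mem_HV (hα : α ≠ 0) {q : L} {g : Matrix (Fin 2) (Fin 2) ℚ_[p]} (hg : g.det ≠ 0)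
    {F : ℚ_[p] × ℚ_[p] → L} (hF : F ∈ HV p m α q) : tw α g F ∈ HV p m α q := by
  induction hF using span_induction with
  | mem F hF =>
    obtain ⟨M, j, hM, hj, rfl⟩ := hF
    rw [tw_EE hα hg hM]
    refine subset_span ⟨_, j, ?_, hj, rfl⟩
    rw [Matrix.det_mul, Matrix.det_adjugate]
    simpa using ⟨hM, hg⟩
  | zero => rw [map_zero]; exact zero_mem _
  | add F G _ _ hF hG => rw [map_add]; exact add_mem hF hG
  | smul c F _ hF => rw [map_smul]; exact smul_mem _ _ hF

lemma mat_mulVec_ne {M : Matrix (Fin 2) (Fin 2) ℚ_[p]} (hM : M.det ≠ 0) {v : ℚ_[p] × ℚ_[p]}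
    (hv : v ≠ 0) : ¬(M 0 0 * v.1 + M 0 1 * v.2 = 0 ∧ M 1 0 * v.1 + M 1 1 * v.2 = 0) := by
  rintro ⟨h1, h2⟩
  rw [det_eq] at hM
  apply hv
  have e1 : (M 0 0 * M 1 1 - M 0 1 * M 1 0) * v.1 = 0 := by
    linear_combination M 1 1 * h1 - M 0 1 * h2
  have e2 : (M 0 0 * M 1 1 - M 0 1 * M 1 0) * v.2 = 0 := by
    linear_combination M 0 0 * h2 - M 1 0 * h1
  exact Prod.ext ((mul_eq_zero.1 e1).resolve_left hM) ((mul_eq_zero.1 e2).resolve_left hM)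

lemma EE_smul {q : L} (hq : q ≠ 0) {M : Matrix (Fin 2) (Fin 2) ℚ_[p]} (hM : M.det ≠ 0) {j : ℕ}
    (hj : j ≤ m) {c : ℚ_[p]} (hc : c ≠ 0) {v : ℚ_[p] × ℚ_[p]} (hv : v ≠ 0) :
    EE m α q j M (c • v) = q ^ c.valuation * η c ^ m * EE m α q j M v := by
  have e1 : ∀ i : Fin 2, M i 0 * (c • v).1 + M i 1 * (c • v).2 =
      c * (M i 0 * v.1 + M i 1 * v.2) := by
    intro i; simp only [Prod.smul_fst, Prod.smul_snd, smul_eq_mul]; ring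
  rw [EE, EE, e1, e1, nv_mul (mat_mulVec_ne hM hv) hc, zpow_add₀ hq, map_mul, map_mul]
  obtain ⟨r, rfl⟩ := Nat.exists_eq_add_of_le hj
  rw [Nat.add_sub_cancel_left]
  ring

lemma mahlerCoeff_add (f g : ℤ_[p] → L) (n : ℕ) :
    mahlerCoeff p L (f + g) n = mahlerCoeff p L f n + mahlerCoeff p L g n := by
  simp [mahlerCoeff, mul_add, sum_add_distrib]

lemma mahlerCoeff_smul (c : L) (f : ℤ_[p] → L) (n : ℕ) :
    mahlerCoeff p L (c • f) n = c * mahlerCoeff p L f n := by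
  simp only [mahlerCoeff, Pi.smul_apply, smul_eq_mul, mul_sum]
  exact sum_congr rfl fun i _ => by ring

lemma isCr_add {r : ℝ} {f g : ℤ_[p] → L} (hf : IsCr p L r f) (hg : IsCr p L r g) :
    IsCr p L r (f + g) := by
  constructor
  · have := hf.1.add hg.1
    rw [add_zero] at this
    refine squeeze_zero (fun n => by positivity) (fun n => ?_) this
    rw [mahlerCoeff_add, ← mul_add]
    exact mul_le_mul_of_nonneg_left (norm_add_le _ _) (by positivity)
  · intro z
    simp only [mahlerCoeff_add, add_mul]
    exact (hf.2 z).add (hg.2 z)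

lemma isCr_smul {r : ℝ} (c : L) {f : ℤ_[p] → L} (hf : IsCr p L r f) : IsCr p L r (c • f) := by
  constructor
  · have := hf.1.const_mul ‖c‖
    rw [mul_zero] at this
    refine this.congr fun n => ?_
    rw [mahlerCoeff_smul, norm_mul]; ring
  · intro z
    simp only [mahlerCoeff_smul, mul_assoc]
    exact (hf.2 z).mul_left c

lemma isCr_zero (r : ℝ) : IsCr p L r (0 : ℤ_[p] → L) := by
  have h : ∀ n, mahlerCoeff p L (0 : ℤ_[p] → L) n = 0 := by intro n; simp [mahlerCoeff]
  constructor
  · simp [h]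
  · intro z; simp only [h, zero_mul]; exact hasSum_zero

lemma isCr_eq_of_eq_off_zero {r : ℝ} (hr : 0 < r) {f g : ℤ_[p] → L} (hf : IsCr p L r f)
    (hg : IsCr p L r g) (h : ∀ z, z ≠ 0 → f z = g z) : f 0 = g 0 := by
  set d : ℤ_[p] → L := f + (-1 : L) • g with hd
  have hdC : IsCr p L r d := isCr_add hf (isCr_smul _ hg)
  have hd0 : ∀ z, z ≠ 0 → d z = 0 := by intro z hz; rw [hd]; simp [h z hz]
  have hcoef : ∀ n, mahlerCoeff p L d n = (-1) ^ n * d 0 := by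
    intro n
    rw [mahlerCoeff, sum_range_succ, sum_eq_zero, zero_add]
    · simp
    · intro i hi
      have hi' := mem_range.1 hi
      rw [hd0, mul_zero]
      exact_mod_cast (by omega : n - i ≠ 0)
  have h0 : d 0 = 0 := by
    by_contra hne
    have h1 := hdC.1
    simp only [hcoef, norm_mul, norm_pow, norm_neg, norm_one, one_pow, one_mul] at h1
    have h2 : Tendsto (fun n : ℕ => (n : ℝ) ^ r * ‖d 0‖) atTop atTop :=
      ((tendsto_rpow_atTop hr).comp tendsto_natCast_atTop_atTop).atTop_mul_const
        (norm_pos_iff.2 hne)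
    exact not_tendsto_nhds_of_tendsto_atTop h2 0 h1
  have h3 : d 0 = f 0 - g 0 := by rw [hd]; simp; ring
  rw [h3] at h0
  exact sub_eq_zero.1 h0

lemma nv_add_eq {u w e e' : ℚ_[p]} (h0 : ¬(u = 0 ∧ w = 0)) (he : ‖e‖ < max ‖u‖ ‖w‖)
    (he' : ‖e'‖ < max ‖u‖ ‖w‖) : nv (u + e) (w + e') = nv u w := by
  symm
  refine nv_congr h0 (le_antisymm ?_ ?_)
  · by_contra hlt
    rw [not_le] at hlt
    have h1 : ‖u‖ ≤ max ‖u + e‖ ‖e‖ := by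
      have := nonarchimedean (u + e) (-e)
      rwa [norm_neg, add_neg_cancel_right] at this
    have h2 : ‖w‖ ≤ max ‖w + e'‖ ‖e'‖ := by
      have := nonarchimedean (w + e') (-e')
      rwa [norm_neg, add_neg_cancel_right] at this
    have h3 : ‖u‖ < max ‖u‖ ‖w‖ :=
      h1.trans_lt (max_lt ((le_max_left _ _).trans_lt hlt) he)
    have h4 : ‖w‖ < max ‖u‖ ‖w‖ :=
      h2.trans_lt (max_lt ((le_max_right _ _).trans_lt hlt) he')
    exact lt_irrefl _ (max_lt h3 h4)
  · exact max_le ((nonarchimedean _ _).trans (max_le (le_max_left _ _) he.le))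
      ((nonarchimedean _ _).trans (max_le (le_max_right _ _) he'.le))

lemma EE_locPoly {q : L} {M : Matrix (Fin 2) (Fin 2) ℚ_[p]} (hM : M.det ≠ 0) {j : ℕ} (hj : j ≤ m) :
    ∃ N : ℕ, ∀ z : ℤ_[p], ∃ P : L[X], P.natDegree ≤ m ∧ ∀ x : ℤ_[p],
      EE m α q j M (1, ((z + (p : ℤ_[p]) ^ N * x : ℤ_[p]) : ℚ_[p])) =
        P.eval (η x) := by
  set B := max ‖M 0 1‖ ‖M 1 1‖ with hB
  have hdet := det_eq M
  have hB0 : 0 < B := by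
    by_contra hle
    rw [not_lt] at hle
    have h1 : M 0 1 = 0 := norm_le_zero_iff.1 ((le_max_left _ _).trans hle)
    have h2 : M 1 1 = 0 := norm_le_zero_iff.1 ((le_max_right _ _).trans hle)
    rw [h1, h2] at hdet
    exact hM (by rw [hdet]; ring)
  have hpos : 0 < ‖M.det‖ / B / B := by
    have := norm_pos_iff.2 hM
    positivity
  obtain ⟨N, hN⟩ := exists_pow_lt_of_lt_one hpos (inv_lt_one_of_one_lt₀ (one_lt_p p))
  refine ⟨N, fun z => ?_⟩
  set u := M 0 0 * 1 + M 0 1 * (z : ℚ_[p]) with hu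
  set w := M 1 0 * 1 + M 1 1 * (z : ℚ_[p]) with hw
  have h0 : ¬(u = 0 ∧ w = 0) := mat_mulVec_ne hM (v := (1, (z : ℚ_[p])))
    (fun h => one_ne_zero (congrArg Prod.fst h))
  have hlow : ‖M.det‖ / B ≤ max ‖u‖ ‖w‖ := by
    rw [div_le_iff₀ hB0]
    have : M.det = M 1 1 * u + -(M 0 1 * w) := by rw [hdet, hu, hw]; ring
    rw [this]
    refine (nonarchimedean _ _).trans (max_le ?_ ?_)
    · rw [norm_mul, mul_comm]
      exact mul_le_mul (le_max_left _ _) (le_max_right _ _) (norm_nonneg _)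
        ((norm_nonneg _).trans (le_max_left _ _))
    · rw [norm_neg, norm_mul, mul_comm]
      exact mul_le_mul (le_max_right _ _) (le_max_left _ _) (norm_nonneg _)
        ((norm_nonneg _).trans (le_max_left _ _))
  have hsmall : ∀ (x : ℤ_[p]) (b : ℚ_[p]), ‖b‖ ≤ B →
      ‖b * (𝔭 ^ N * (x : ℚ_[p]))‖ < max ‖u‖ ‖w‖ := by
    intro x b hb
    refine lt_of_lt_of_le ?_ hlow
    rw [norm_mul, norm_mul, norm_pow, Padic.norm_p]
    rw [lt_div_iff₀ hB0] at hN
    calc ‖b‖ * ((p : ℝ)⁻¹ ^ N * ‖(x : ℚ_[p])‖) ≤ B * ((p : ℝ)⁻¹ ^ N * 1) := by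
          gcongr
          exact x.2
      _ = (p : ℝ)⁻¹ ^ N * B := by ring
      _ < _ := hN
  set lu : L[X] := C (η (M 0 1 * 𝔭 ^ N)) * X +
    C (η u) with hlu
  set lw : L[X] := C (η (M 1 1 * 𝔭 ^ N)) * X +
    C (η w) with hlw
  refine ⟨C (α ^ (-M.det.valuation) * q ^ nv u w) * (lu ^ j * lw ^ (m - j)), ?_, ?_⟩
  · refine (natDegree_C_mul_le _ _).trans (natDegree_mul_le.trans ?_)
    have h1 : (lu ^ j).natDegree ≤ j * 1 :=
      natDegree_pow_le.trans (Nat.mul_le_mul_left _ natDegree_linear_le)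
    have h2 : (lw ^ (m - j)).natDegree ≤ (m - j) * 1 :=
      natDegree_pow_le.trans (Nat.mul_le_mul_left _ natDegree_linear_le)
    omega
  · intro x
    have e1 : M 0 0 * 1 + M 0 1 * ((z + (p : ℤ_[p]) ^ N * x : ℤ_[p]) : ℚ_[p]) =
        u + M 0 1 * (𝔭 ^ N * x) := by rw [hu]; push_cast; ring
    have e2 : M 1 0 * 1 + M 1 1 * ((z + (p : ℤ_[p]) ^ N * x : ℤ_[p]) : ℚ_[p]) =
        w + M 1 1 * (𝔭 ^ N * x) := by rw [hw]; push_cast; ring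
    rw [EE]
    dsimp only
    rw [e1, e2, nv_add_eq h0 (hsmall x _ (le_max_left _ _)) (hsmall x _ (le_max_right _ _))]
    simp only [hlu, hlw, eval_mul, eval_C, eval_pow,
      eval_add, eval_X, map_add, map_mul]
    ring

variable [IsUltrametricDist L] [CompleteSpace L]

lemma HV_isCr {q : L} (r : ℝ) {F : ℚ_[p] × ℚ_[p] → L} (hF : F ∈ HV p m α q) :
    IsCr p L r fun z : ℤ_[p] => F (1, (z : ℚ_[p])) := by
  induction hF using span_induction with
  | mem F hF =>
    obtain ⟨M, j, hM, hj, rfl⟩ := hF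
    obtain ⟨N, hN⟩ := EE_locPoly (α := α) (q := q) hM hj
    exact isCr_of_locPoly r hN
  | zero => exact isCr_zero r
  | add F G _ _ hF hG => exact isCr_add hF hG
  | smul c F _ hF => exact isCr_smul c hF

lemma HV_smul {q : L} (hq : q ≠ 0) {F : ℚ_[p] × ℚ_[p] → L} (hF : F ∈ HV p m α q) {c : ℚ_[p]}
    (hc : c ≠ 0) {v : ℚ_[p] × ℚ_[p]} (hv : v ≠ 0) :
    F (c • v) = q ^ c.valuation * η c ^ m * F v := by
  induction hF using span_induction with
  | mem F hF =>
    obtain ⟨M, j, hM, hj, rfl⟩ := hF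
    exact EE_smul hq hM hj hc hv
  | zero => simp
  | add F G _ _ hF hG => rw [Pi.add_apply, Pi.add_apply, hF, hG]; ring
  | smul a F _ hF => rw [Pi.smul_apply, Pi.smul_apply, hF, smul_eq_mul, smul_eq_mul]; ring

lemma Par.valL_pos (h : Par p m α β) : 0 < valL p L α := by
  rw [valL, neg_pos]
  exact Real.logb_neg (one_lt_p p) h.norm_pos h.a_lt

lemma Par.ext2_res (h : Par p m α β) {k : ℕ} (hk : k - 2 = m) {F : ℚ_[p] × ℚ_[p] → L}
    (hF : F ∈ HV p m α 𝔮) : ext2 p L k α β (res L F) 0 = F (1, 0) := by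
  have hE : Ext2 p L k α β (res L F) (fun z : ℤ_[p] => F (1, (z : ℚ_[p]))) := by
    refine ⟨HV_isCr _ hF, fun z hz => ?_⟩
    have hz' : (z : ℚ_[p]) ≠ 0 := by simpa using hz
    have := HV_smul h.qq_ne_zero hF hz' (v := ((z : ℚ_[p])⁻¹, 1))
      (fun h => one_ne_zero (congrArg Prod.snd h))
    rw [Prod.smul_mk, smul_eq_mul, smul_eq_mul, mul_inv_cancel₀ hz', mul_one] at this
    rw [hk]
    exact this
  have hex : ∃ g, Ext2 p L k α β (res L F) g := ⟨_, hE⟩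
  rw [ext2, dif_pos hex]
  have hc := hex.choose_spec
  have := isCr_eq_of_eq_off_zero h.valL_pos hc.1 hE.1 fun z hz => (hc.2 z hz).trans (hE.2 z hz).symm
  rw [this]
  simp

lemma Par.gAct_res (h : Par p m α β) {k : ℕ} (hk : k - 2 = m) {F : ℚ_[p] × ℚ_[p] → L}
    (hF : F ∈ HV p m α 𝔮) {g : Matrix (Fin 2) (Fin 2) ℚ_[p]} (hg : g.det ≠ 0) :
    gAct p L k α β g (res L F) = res L (tw α g F) := by
  have hdet : det2 p g = g.det := (det_eq g).symm
  ext z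
  rw [res_apply, tw_apply, gAct, hdet]
  split_ifs with hz
  · have hc : g 1 0 ≠ 0 := by
      intro hc
      rw [hc] at hz
      have ha : g 0 0 = 0 := by linear_combination hz
      apply hg
      rw [det_eq, ha, hc]; ring
    have hu : g 1 1 * z - g 0 1 = g.det / g 1 0 := by
      rw [eq_div_iff hc, det_eq]; linear_combination -(g 1 1) * hz
    rw [h.ext2_res hk hF]
    dsimp only
    have hd : g.det / g 1 0 ≠ 0 := div_ne_zero hg hc
    have h1 := HV_smul h.qq_ne_zero hF hd (v := (1, 0))
      (fun h => one_ne_zero (congrArg Prod.fst h))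
    rw [Prod.smul_mk, smul_eq_mul, smul_eq_mul, mul_one, mul_zero] at h1
    rw [mul_one, mul_one, hz, hu, h1, hk]
    rw [show iotaL p L (g.det / g 1 0) = η (g.det / g 1 0) from rfl, qq]
    ring
  · have h1 := HV_smul h.qq_ne_zero hF hz (v := ((g 1 1 * z - g 0 1) / (-g 1 0 * z + g 0 0), 1))
      (fun h => one_ne_zero (congrArg Prod.snd h))
    rw [Prod.smul_mk, smul_eq_mul, smul_eq_mul, mul_div_cancel₀ _ hz, mul_one] at h1
    dsimp only
    rw [mul_one, mul_one, h1, hk, res_apply]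
    rw [show iotaL p L (-g 1 0 * z + g 0 0) = η (-g 1 0 * z + g 0 0) from rfl,
      qq]
    ring

lemma Par.exists_res (h : Par p m α β) {f : ℚ_[p] → L} (hf : f ∈ Vsp p m 𝔮) :
    ∃ F ∈ HV p m α 𝔮, res L F = f := by
  suffices Vsp p m 𝔮 ≤ (HV p m α 𝔮).map (res L) by
    obtain ⟨F, hF, rfl⟩ := this hf
    exact ⟨F, hF, rfl⟩
  refine span_le.2 ?_
  rintro f ⟨P, a, n, hP, rfl⟩
  rw [pev_phi_eq_sum h a n hP]
  refine sum_mem fun j hj => smul_mem _ _ ⟨_, subset_span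
    ⟨ballMat a n, j, ?_, mem_range_succ_iff.1 hj, rfl⟩,
    h.res_EE_ballMat a n (mem_range_succ_iff.1 hj)⟩
  rw [det_ballMat]
  exact zpow_ne_zero _ padic_p_ne_zero

lemma Par.res_mem (h : Par p m α β) {F : ℚ_[p] × ℚ_[p] → L} (hF : F ∈ HV p m α 𝔮) :
    res L F ∈ Vsp p m 𝔮 := by
  induction hF using span_induction with
  | mem F hF =>
    obtain ⟨M, j, hM, hj, rfl⟩ := hF
    exact Tht_le_Vsp (h.res_EE_mem hM hj)
  | zero => rw [map_zero]; exact zero_mem _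
  | add F G _ _ hF hG => rw [map_add]; exact add_mem hF hG
  | smul c F _ hF => rw [map_smul]; exact smul_mem _ _ hF

variable {k : ℕ} {g : Matrix (Fin 2) (Fin 2) ℚ_[p]}

lemma Par.gAct_mem_Vsp (h : Par p m α β) (hk : k - 2 = m) (hg : g.det ≠ 0) {f : ℚ_[p] → L}
    (hf : f ∈ Vsp p m 𝔮) : gAct p L k α β g f ∈ Vsp p m 𝔮 := by
  obtain ⟨F, hF, rfl⟩ := h.exists_res hf
  rw [h.gAct_res hk hF hg]
  exact h.res_mem (tw_mem_HV h.a_ne hg hF)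

lemma Par.gAct_add (h : Par p m α β) (hk : k - 2 = m) (hg : g.det ≠ 0) {f f' : ℚ_[p] → L}
    (hf : f ∈ Vsp p m 𝔮) (hf' : f' ∈ Vsp p m 𝔮) :
    gAct p L k α β g (f + f') = gAct p L k α β g f + gAct p L k α β g f' := by
  obtain ⟨F, hF, rfl⟩ := h.exists_res hf
  obtain ⟨F', hF', rfl⟩ := h.exists_res hf'
  rw [h.gAct_res hk hF hg, h.gAct_res hk hF' hg, ← map_add, h.gAct_res hk (add_mem hF hF') hg,
    map_add, map_add]

lemma Par.gAct_smul (h : Par p m α β) (hk : k - 2 = m) (hg : g.det ≠ 0) (c : L) {f : ℚ_[p] → L}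
    (hf : f ∈ Vsp p m 𝔮) : gAct p L k α β g (c • f) = c • gAct p L k α β g f := by
  obtain ⟨F, hF, rfl⟩ := h.exists_res hf
  rw [h.gAct_res hk hF hg, ← map_smul, h.gAct_res hk (smul_mem _ c hF) hg,
    map_smul, map_smul]

lemma Par.gAct_mem_Tht (h : Par p m α β) (hk : k - 2 = m) (hg : g.det ≠ 0) {f : ℚ_[p] → L}
    (hf : f ∈ Tht p m α β) : gAct p L k α β g f ∈ Tht p m α β := by
  have hneg : ∀ f ∈ Vsp p m 𝔮, gAct p L k α β g (-f) = -gAct p L k α β g f :=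
    fun f hf => by
      have := h.gAct_smul hk hg (-1) hf
      simpa only [neg_smul, one_smul] using this
  induction hf using AddSubgroup.closure_induction with
  | mem f hf =>
    obtain ⟨c, a, n, j, hc, hj, rfl⟩ := hf
    have hd : (ballMat a n).det ≠ 0 := by rw [det_ballMat]; exact zpow_ne_zero _ padic_p_ne_zero
    have hF : EE m α 𝔮 j (ballMat a n) ∈ HV p m α 𝔮 :=
      subset_span ⟨_, j, hd, hj, rfl⟩
    rw [h.gAct_smul hk hg c (gen_mem_Vsp a n hj), ← h.res_EE_ballMat a n hj, h.gAct_res hk hF hg,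
      tw_EE h.a_ne hg hd]
    refine smul_mem_Tht hc (h.res_EE_mem ?_ hj)
    rw [Matrix.det_mul, Matrix.det_adjugate]
    simpa using ⟨hd, hg⟩
  | zero =>
    have := h.gAct_smul hk hg 0 (f := 0) (zero_mem _)
    rw [zero_smul, zero_smul] at this
    rw [this]; exact zero_mem _
  | add f f' hf hf' ih ih' =>
    rw [h.gAct_add hk hg (Tht_le_Vsp hf) (Tht_le_Vsp hf')]; exact add_mem ih ih'
  | neg f hf ih => rw [hneg f (Tht_le_Vsp hf)]; exact neg_mem ih

end Action

lemma pev_ind_mem {q : L} (hq : q ≠ 0) (hq1 : (1 - q⁻¹ : L) ≠ 0) {P : L[X]}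
    (hP : P.natDegree ≤ m) (a : ℚ_[p]) (n : ℤ) : pev p P (ind p L a n) ∈ Vsp p m q := by
  have h1 : pev p P (ind p L a n) = (1 - q⁻¹ : L)⁻¹ •
      (pev p P (phi p q a n) - q⁻¹ • pev p P (phi p q a (n - 1))) := by
    rw [← map_smul, ← map_sub, phi_sub_parent hq, map_smul, smul_smul, inv_mul_cancel₀ hq1, one_smul]
  rw [h1]
  exact smul_mem _ _ (sub_mem (pev_phi_mem hP _ _)
    (smul_mem _ _ (pev_phi_mem hP _ _)))

lemma Vsp_normalForm {q : L} (hq : q ≠ 0) {f : ℚ_[p] → L} (hf : f ∈ Vsp p m q) :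
    ∃ N₀ : ℕ, ∀ N ≥ N₀, ∃ (P : L[X]) (Q : Fin (p ^ (2 * N)) → L[X]),
      P.natDegree ≤ m ∧ (∀ t, (Q t).natDegree ≤ m) ∧ f = pev p P (phi p q 0 (-(N : ℤ))) +
        ∑ t, pev p (Q t) (ind p L (rep p N t) N) := by
  have hdeg : ∀ P : L[X], P ∈ degreeLT L (m + 1) ↔ P.natDegree ≤ m := fun P => by
    rw [mem_degreeLT, degree_lt_iff_coeff_zero,
      natDegree_le_iff_coeff_eq_zero]
    exact ⟨fun h n hn => h n hn, fun h n hn => h n hn⟩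
  have hT := treeRel_phiMap (p := p) hq
  have hT' : TreeRel p q fun a n =>
      (phiMap (p := p) q a n).comp (degreeLT L (m + 1)).subtype := by
    constructor
    · intro a b n h; rw [hT.ball a b n h]
    · intro a n
      refine LinearMap.ext fun w => ?_
      have := LinearMap.congr_fun (hT.rel a n) w.1
      simpa only [LinearMap.add_apply, LinearMap.sum_apply, LinearMap.smul_apply,
        comp_apply, subtype_apply] using this
  have hspan : Vsp p m q ≤ span L {y | ∃ a n w, y =
      (phiMap (p := p) q a n).comp (degreeLT L (m + 1)).subtype w} := by
    refine span_le.2 ?_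
    rintro _ ⟨P, a, n, hP, rfl⟩
    exact subset_span ⟨a, n, ⟨P, (hdeg P).2 hP⟩, rfl⟩
  obtain ⟨N₀, hN⟩ := hT'.eventually_mem (hspan hf)
  refine ⟨N₀, fun N hN' => ?_⟩
  obtain ⟨⟨P, Q⟩, hx⟩ := hN N hN'
  refine ⟨P, fun t => (1 - q⁻¹) • (Q t : L[X]), (hdeg _).1 P.2, fun t =>
    (hdeg _).1 (smul_mem _ _ (Q t).2), ?_⟩
  rw [← hx, normalForm_apply]
  congr 1
  refine sum_congr rfl fun t _ => ?_
  have := stp_phiMap (p := p) hq (rep p N t) N (Q t : L[X])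
  rw [map_smul, LinearMap.smul_apply, ← this]
  rfl

/-- A locally constant function supported in a ball is a combination of indicator functions of
balls of a fixed radius. -/
lemma exists_eq_sum_ind {h : ℚ_[p] → L} (N₀ : ℕ)
    (hloc : ∀ x, ∃ n : ℕ, ∀ y, InB x n y → h y = h x) (hsupp : ∀ x, ¬InB 0 (-(N₀ : ℤ)) x → h x = 0) :
    ∃ N₁ : ℕ, ∀ N ≥ N₁, h = ∑ t : Fin (p ^ (2 * N)), h (rep p N t) • ind p L (rep p N t) N := by
  choose n hn using hloc
  have hc : IsCompact (Metric.closedBall (0 : ℚ_[p]) ((p : ℝ) ^ (N₀ : ℤ))) :=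
    isCompact_closedBall _ _
  obtain ⟨T, -, hT⟩ := hc.elim_nhds_subcover (fun x => Metric.closedBall x ((p : ℝ) ^ (-(n x : ℤ))))
    (fun x _ => Metric.closedBall_mem_nhds _ (zpow_pos (p_pos p) _))
  refine ⟨max N₀ (T.sup n), fun N hN => ?_⟩
  have hN0 : N₀ ≤ N := (le_max_left _ _).trans hN
  have key : ∀ x y, InB x N y → h x = h y := by
    intro x y hxy
    by_cases hx : InB 0 (-(N₀ : ℤ)) x
    · have hx' : x ∈ Metric.closedBall (0 : ℚ_[p]) ((p : ℝ) ^ (N₀ : ℤ)) := by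
        rw [mem_closedBall_iff_norm]
        simpa [InB] using hx
      obtain ⟨w, hw, hxw⟩ := Set.mem_iUnion₂.1 (hT hx')
      have hxw' : InB w (n w) x := by rwa [mem_closedBall_iff_norm] at hxw
      have hle : n w ≤ N := (le_sup hw).trans ((le_max_right _ _).trans hN)
      rw [hn w x hxw', hn w y (hxw'.trans (hxy.mono (by exact_mod_cast hle)))]
    · rw [hsupp x hx, hsupp y]
      intro hy
      exact hx (hy.trans (hxy.symm.mono (by omega)))
  ext x
  rw [Finset.sum_apply]
  by_cases hx : InB 0 (-(N : ℤ)) x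
  · obtain ⟨t, ht⟩ := exists_rep hx
    rw [sum_eq_single t]
    · rw [Pi.smul_apply, ind_of_inB ht, smul_eq_mul, mul_one, key _ _ ht]
    · intro t' _ hne
      rw [Pi.smul_apply, ind_of_not_inB, smul_zero]
      intro ht'
      exact hne (rep_inj (ht'.trans ht.symm))
    · simp
  · rw [hsupp x fun hx' => hx (hx'.mono (by omega)), sum_eq_zero]
    intro t _
    rw [Pi.smul_apply, ind_of_not_inB, smul_zero]
    intro ht
    exact hx ((inB_rep N t).trans (ht.mono (by omega)))

lemma locConst_zpow_nv (q : L) (e : ℤ) {u₁ u₂ w₁ w₂ : ℚ_[p]}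
    (h0 : ∀ z, ¬(u₁ + u₂ * z = 0 ∧ w₁ + w₂ * z = 0)) :
    LocConst p L fun z => q ^ (nv (u₁ + u₂ * z) (w₁ + w₂ * z) + e) := by
  intro x
  set B := max ‖u₂‖ ‖w₂‖ with hB
  set A := max ‖u₁ + u₂ * x‖ ‖w₁ + w₂ * x‖ with hA
  have hB0 : 0 ≤ B := (norm_nonneg _).trans (le_max_left _ _)
  have hA0 : 0 < A := by rw [hA, nv_spec (h0 x)]; exact zpow_pos (p_pos p) _
  obtain ⟨N, hN⟩ := exists_pow_lt_of_lt_one (div_pos hA0 (by linarith : 0 < B + 1))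
    (inv_lt_one_of_one_lt₀ (one_lt_p p))
  refine ⟨N, fun y hy => ?_⟩
  have hs : ∀ b : ℚ_[p], ‖b‖ ≤ B → ‖b * (y - x)‖ < A := by
    intro b hb
    rw [lt_div_iff₀ (by linarith)] at hN
    rw [zpow_neg, zpow_natCast, ← inv_pow] at hy
    have h1 : 0 < ((p : ℝ)⁻¹) ^ N := pow_pos (inv_pos.2 (p_pos p)) _
    rw [norm_mul]
    calc ‖b‖ * ‖y - x‖ ≤ B * ((p : ℝ)⁻¹) ^ N := mul_le_mul hb hy (norm_nonneg _) hB0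
      _ < A := by nlinarith
  have e1 : u₁ + u₂ * y = (u₁ + u₂ * x) + u₂ * (y - x) := by ring
  have e2 : w₁ + w₂ * y = (w₁ + w₂ * x) + w₂ * (y - x) := by ring
  dsimp only
  rw [e1, e2, nv_add_eq (h0 x) (hs _ (le_max_left _ _)) (hs _ (le_max_right _ _))]

lemma Par.indCond_phi (h : Par p m α β) (a : ℚ_[p]) (n : ℤ) : IndCond p L α β (phi p 𝔮 a n) := by
  have hq := h.qq_ne_zero
  have hpn : (𝔭 ^ n) ≠ 0 := zpow_ne_zero _ padic_p_ne_zero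
  constructor
  · have := locConst_zpow_nv 𝔮 (-n) (u₁ := -a) (u₂ := 1) (w₁ := 𝔭 ^ n) (w₂ := 0)
      (fun z hz => hpn (by simpa using hz.2))
    convert this using 2 with z
    rw [phi, one_mul, zero_mul, add_zero, neg_add_eq_sub, sub_eq_add_neg _ n]
  · refine ⟨_, locConst_zpow_nv 𝔮 (-n) (u₁ := 1) (u₂ := -a) (w₁ := 0)
      (w₂ := 𝔭 ^ n) (fun z hz => ?_), fun z hz => ?_⟩
    · have hz0 : z = 0 := by simpa [hpn] using hz.2
      rw [hz0] at hz
      simp at hz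
    · rw [phi, show α * (p : L) / β = 𝔮 from rfl, ← zpow_add₀ hq]
      congr 1
      have := nv_mul (x := z⁻¹ - a) (y := 𝔭 ^ n) (fun h => hpn h.2) hz
      rw [← add_sub_assoc, ← this, sub_eq_add_neg _ n]
      congr 2
      · field_simp; ring
      · ring

lemma Par.mem_span_phi_of_indCond (h : Par p m α β) {f : ℚ_[p] → L} (hf : IndCond p L α β f) :
    f ∈ span L {f | ∃ (a : ℚ_[p]) (n : ℤ), f = phi p 𝔮 a n} := by
  have hq := h.qq_ne_zero
  have hq1 := h.one_sub_ne
  obtain ⟨hloc, h', hloc', hh'⟩ := hf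
  obtain ⟨n₀, hn₀⟩ := hloc' 0
  set c := h' 0 with hc
  set f₁ := f - (c * 𝔮 ^ (-(n₀ : ℤ))) • phi p 𝔮 0 (-(n₀ : ℤ)) with hf₁
  have hsupp : ∀ x, ¬InB 0 (-(n₀ : ℤ)) x → f₁ x = 0 := by
    intro x hx
    have hx0 : x ≠ 0 := by rintro rfl; exact hx (InB.self _ _)
    have hlt : (p : ℝ) ^ (n₀ : ℤ) < ‖x‖ := by simpa [InB] using hx
    have hle : ‖x⁻¹ - 0‖ ≤ (p : ℝ) ^ (-(n₀ : ℤ)) := by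
      rw [sub_zero, norm_inv, zpow_neg]
      exact inv_anti₀ (zpow_pos (p_pos p) _) hlt.le
    have h1 := hh' x⁻¹ (inv_ne_zero hx0)
    rw [hn₀ _ hle, inv_inv, valuation_inv, show α * (p : L) / β = 𝔮 from rfl] at h1
    rw [hf₁, Pi.sub_apply, Pi.smul_apply, phi_of_not_inB hx, sub_zero, smul_eq_mul, h1,
      sub_neg_eq_add, zpow_add₀ hq, zpow_neg, zpow_neg]
    have := zpow_ne_zero x.valuation hq
    have := zpow_ne_zero (n₀ : ℤ) hq
    field_simp
    ring
  have hloc₁ : ∀ x, ∃ n : ℕ, ∀ y, InB x n y → f₁ y = f₁ x := by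
    intro x
    obtain ⟨n, hn⟩ := hloc x
    obtain ⟨n', hn'⟩ := (h.indCond_phi 0 (-(n₀ : ℤ))).1 x
    refine ⟨max n n', fun y hy => ?_⟩
    rw [hf₁, Pi.sub_apply, Pi.sub_apply, Pi.smul_apply, Pi.smul_apply,
      hn y (hy.mono (n' := n) (by simp)), hn' y (hy.mono (n' := n') (by simp))]
  obtain ⟨N, hN⟩ := exists_eq_sum_ind n₀ hloc₁ hsupp
  have hfe : f = f₁ + (c * 𝔮 ^ (-(n₀ : ℤ))) • phi p 𝔮 0 (-(n₀ : ℤ)) := by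
    rw [hf₁, sub_add_cancel]
  rw [hfe, hN N le_rfl]
  refine add_mem (sum_mem fun t _ => smul_mem _ _ ?_)
    (smul_mem _ _ (subset_span ⟨_, _, rfl⟩))
  have h2 : ∀ (a : ℚ_[p]) (n : ℤ), ind p L a n = (1 - 𝔮⁻¹ : L)⁻¹ •
      (phi p 𝔮 a n - 𝔮⁻¹ • phi p 𝔮 a (n - 1)) := by
    intro a n
    rw [phi_sub_parent hq, smul_smul, inv_mul_cancel₀ hq1, one_smul]
  rw [h2]
  exact smul_mem _ _ (sub_mem (subset_span ⟨_, _, rfl⟩)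
    (smul_mem _ _ (subset_span ⟨_, _, rfl⟩)))

lemma Par.piRep_eq (h : Par p m α β) {k : ℕ} (hk : k - 2 = m) : piRep p L k α β = Vsp p m 𝔮 := by
  refine le_antisymm (span_le.2 ?_) (span_le.2 ?_)
  · rintro _ ⟨P, f, hP, hf, rfl⟩
    rw [hk] at hP
    have h1 : span L {f | ∃ (a : ℚ_[p]) (n : ℤ), f = phi p 𝔮 a n} ≤
        (Vsp p m 𝔮).comap (pev p P) := by
      refine span_le.2 ?_
      rintro _ ⟨a, n, rfl⟩
      exact pev_phi_mem hP a n
    exact h1 (h.mem_span_phi_of_indCond hf)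
  · rintro _ ⟨P, a, n, hP, rfl⟩
    exact subset_span ⟨P, _, by rwa [hk], h.indCond_phi a n, rfl⟩

section Binomial

variable (L : Type) [Field L]

/-- The binomial polynomial `X(X-1)⋯(X-j+1)/j!`. -/
def bp (j : ℕ) : L[X] := C ((j.factorial : L)⁻¹) * descPochhammer L j

lemma natDegree_bp_le (j : ℕ) : (bp L j).natDegree ≤ j :=
  (natDegree_C_mul_le _ _).trans (descPochhammer_natDegree L j).le

lemma bp_zero : bp L 0 = 1 := by simp [bp]

variable [CharZero L]

lemma eval_bp_natCast (j t : ℕ) : (bp L j).eval (t : L) = (t.choose j : L) := by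
  rw [bp, eval_mul, eval_C, descPochhammer_eval_eq_descFactorial,
    Nat.descFactorial_eq_factorial_mul_choose, Nat.cast_mul, inv_mul_cancel_left₀]
  exact Nat.cast_ne_zero.2 (Nat.factorial_ne_zero j)

lemma poly_ext_natCast {P Q : L[X]} (h : ∀ t : ℕ, P.eval (t : L) = Q.eval (t : L)) : P = Q :=
  eq_of_infinite_eval_eq P Q
    (Set.infinite_of_injective_forall_mem (f := fun t : ℕ => (t : L)) Nat.cast_injective h)

lemma bp_succ_comp (j : ℕ) : (bp L (j + 1)).comp (X + 1) = bp L (j + 1) + bp L j := by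
  refine poly_ext_natCast L fun t => ?_
  rw [eval_comp, eval_add, eval_add, eval_X,
    eval_one, ← Nat.cast_succ, eval_bp_natCast, eval_bp_natCast, eval_bp_natCast,
    Nat.choose_succ_succ, Nat.cast_add, add_comm]

end Binomial

lemma cc_eq_zero {p i j l : ℕ} (h : j < l) : cc p i j l = 0 := by
  have h1 : (X : Polynomial ℤ) ^ l ∣
      (1 + X) ^ i * ((1 + X) ^ p - 1) ^ l := by
    refine Dvd.dvd.mul_left (pow_dvd_pow_of_dvd ?_ l) _
    have := sub_dvd_pow_sub_pow (1 + X : Polynomial ℤ) 1 p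
    rwa [one_pow, add_sub_cancel_left] at this
  exact (X_pow_dvd_iff.1 h1) j h

lemma choose_add_mul (p i t j : ℕ) (hj : j ≤ m) :
    ((i + p * t).choose j : ℤ) = ∑ l ∈ range (m + 1), cc p i j l * (t.choose l : ℤ) := by
  have h1 : ((i + p * t).choose j : ℤ) =
      ∑ l ∈ range (t + 1), cc p i j l * (t.choose l : ℤ) := by
    rw [← Int.cast_natCast, ← coeff_one_add_X_pow ℤ (i + p * t) j, pow_add, pow_mul]
    conv_lhs => rw [show ((1 + X) ^ p : Polynomial ℤ) =
      ((1 + X) ^ p - 1) + 1 by ring]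
    rw [add_pow _ _ t, mul_sum, finsetSum_coeff]
    refine sum_congr rfl fun l _ => ?_
    rw [one_pow, mul_one, ← mul_assoc, coeff_mul_natCast, cc]
  have h2 : ∀ N, t ≤ N → ∑ l ∈ range (t + 1), cc p i j l * (t.choose l : ℤ) =
      ∑ l ∈ range (N + 1), cc p i j l * (t.choose l : ℤ) := fun N hN =>
    sum_subset (range_subset_range.2 (by omega)) fun l _ hl => by
      rw [Nat.choose_eq_zero_of_lt (by simpa using hl)]; simp
  have h3 : ∀ N, m ≤ N → ∑ l ∈ range (m + 1), cc p i j l * (t.choose l : ℤ) =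
      ∑ l ∈ range (N + 1), cc p i j l * (t.choose l : ℤ) := fun N hN =>
    sum_subset (range_subset_range.2 (by omega)) fun l _ hl => by
      rw [cc_eq_zero (by rw [mem_range] at hl; omega), zero_mul]
  rw [h1, h2 _ (le_max_left t m), h3 _ (le_max_right t m)]

lemma bp_comp_add_mul (L : Type) [Field L] [CharZero L] (p i j : ℕ) (hj : j ≤ m) :
    (bp L j).comp (C (i : L) + C (p : L) * X) =
      ∑ l ∈ range (m + 1), (cc p i j l : L) • bp L l := by
  refine poly_ext_natCast L fun t => ?_
  rw [eval_comp, eval_finsetSum]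
  simp only [eval_add, eval_mul, eval_C, eval_X,
    eval_smul, eval_bp_natCast, smul_eq_mul]
  rw [← Nat.cast_mul, ← Nat.cast_add, eval_bp_natCast]
  have := congrArg (Int.cast : ℤ → L) (choose_add_mul p i t j hj)
  push_cast at this
  exact this

section Shift

variable (L) in
/-- Translation of functions. -/
def tr (b : ℚ_[p]) : (ℚ_[p] → L) →ₗ[L] (ℚ_[p] → L) :=
  funLeft L L fun z => z + b

lemma tr_apply (b : ℚ_[p]) (f : ℚ_[p] → L) (z : ℚ_[p]) : tr L b f z = f (z + b) := rfl

lemma tr_pev (b : ℚ_[p]) (P : L[X]) (f : ℚ_[p] → L) :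
    tr L b (pev p P f) = pev p (taylor (η b) P) (tr L b f) := by
  ext z
  simp [tr_apply, pev_apply, taylor_eval]

lemma degree_taylor_sub_lt {K : Type*} [Field K] {P : Polynomial K} (hP : P ≠ 0) (r : K) :
    (taylor r P - P).degree < P.degree := by
  have h0 : taylor r P ≠ 0 := fun h => hP (taylor_injective r (by simpa using h))
  have := degree_sub_lt_left (p := taylor r P) (q := P)
    (degree_taylor P r) h0 (leadingCoeff_taylor _ _)
  rwa [degree_taylor] at this

lemma tr_sub_pow_pev (b : ℚ_[p]) {f : ℚ_[p] → L} (hf : tr L b f = f) (d : ℕ) (P : L[X])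
    (hP : P.degree < d) : ((tr L b - 1) ^ d) (pev p P f) = 0 := by
  induction d generalizing P with
  | zero =>
    have : P = 0 := by rw [← degree_eq_bot]; simpa using hP
    simp [this]
  | succ d ih =>
    rw [pow_succ, End.mul_apply]
    have h1 : (tr L b - 1) (pev p P f) =
        pev p (taylor (η b) P - P) f := by
      rw [LinearMap.sub_apply, tr_pev, hf, map_sub, LinearMap.sub_apply]; rfl
    rw [h1]
    apply ih
    by_cases h0 : P = 0
    · simp [h0]
    · refine (degree_taylor_sub_lt h0 _).trans_le ?_
      rw [degree_eq_natDegree h0] at hP ⊢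
      exact_mod_cast Nat.lt_succ_iff.1 (by exact_mod_cast hP)

lemma tr_phi (q : L) (a b : ℚ_[p]) (n : ℤ) : tr L b (phi p q a n) = phi p q (a - b) n := by
  ext z
  rw [tr_apply, phi, phi, show z + b - a = z - (a - b) by ring]

lemma tr_ind (a b : ℚ_[p]) (n : ℤ) : tr L b (ind p L a n) = ind p L (a - b) n := by
  ext z
  rw [tr_apply, ind, ind]
  have : InB a n (z + b) ↔ InB (a - b) n z := by rw [InB, InB, show z + b - a = z - (a - b) by ring]
  simp only [this]

end Shift

section Link

variable {V : Type*} [AddCommGroup V] [Module L V]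

variable (p m) in
/-- The difference of the polynomials attached to two families, as a function of the functional. -/
def diffApol (e : L) (xa xb : Arr V) (n : ℕ) : Dual L V →ₗ[L] L[X] where
  toFun lam := Apol p m (arr xb lam) n - C e * Apol p m (arr xa lam) n
  map_add' lam mu := by
    have h : ∀ x : Arr V, arr x (lam + mu) = arr x lam + arr x mu := fun x => rfl
    rw [h, h, Apol_add, Apol_add]; ring
  map_smul' c lam := by
    have h : ∀ x : Arr V, arr x (c • lam) = c • arr x lam := fun x => rfl
    rw [h, h, Apol_smul, Apol_smul, RingHom.id_apply, smul_eq_C_mul]; ring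

variable (p m) in
lemma diffApol_apply (e : L) (xa xb : Arr V) (n : ℕ) (lam : Dual L V) : diffApol p m e xa xb n lam =
      Apol p m (arr xb lam) n - C e * Apol p m (arr xa lam) n := rfl

lemma Om_pow_dvd_of_kill {e : L} {xa xb : Arr V} {S : V →ₗ[L] V}
    (ha : ∀ lam : Dual L V, ShiftRel p m (arr xa (lam ∘ₗ S)) (arr xa lam))
    (hb : ∀ lam : Dual L V, ShiftRel p m (arr xb (lam ∘ₗ S)) (arr xb lam)) (n : ℕ)
    (hkill : ∀ a j, a < p ^ (n + 1) → j ≤ m →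
      ((S ^ p ^ n - 1) ^ (m + 1)) (xb (n + 1) a j - e • xa (n + 1) a j) = 0)
    (lam : Dual L V) : Om p L n ^ (m + 1) ∣
      Apol p m (arr xb lam) (n + 1) - C e * Apol p m (arr xa lam) (n + 1) := by
  set D := diffApol p m e xa xb (n + 1) with hD
  have h1 : ∀ (k : ℕ) (lam : Dual L V), om p L (n + 1) ^ (m + 1) ∣
      D (lam ∘ₗ (S ^ k)) - (1 + X) ^ k * D lam := by
    intro k
    induction k with
    | zero =>
      intro lam
      rw [pow_zero, pow_zero, one_mul, one_eq_id, comp_id, sub_self]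
      exact dvd_zero _
    | succ k ih =>
      intro lam
      have e1 : lam ∘ₗ (S ^ (k + 1)) = (lam ∘ₗ (S ^ k)) ∘ₗ S := by
        rw [pow_succ, End.mul_eq_comp, LinearMap.comp_assoc]
      have e2 : D ((lam ∘ₗ (S ^ k)) ∘ₗ S) - (1 + X) * D (lam ∘ₗ (S ^ k)) =
          om p L (n + 1) ^ (m + 1) *
            (C e * C (arr xa (lam ∘ₗ (S ^ k)) (n + 1) (p ^ (n + 1) - 1) m) -
            C (arr xb (lam ∘ₗ (S ^ k)) (n + 1) (p ^ (n + 1) - 1) m)) := by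
        rw [hD, diffApol_apply, diffApol_apply, Apol_shift (ha _), Apol_shift (hb _)]; ring
      have e3 := dvd_add (Dvd.intro _ e2.symm) ((ih lam).mul_left (1 + X))
      rw [e1]
      convert e3 using 1
      rw [pow_succ]; ring
  have h2 : ∀ (d : ℕ) (lam : Dual L V), om p L (n + 1) ^ (m + 1) ∣
      D (lam ∘ₗ ((S ^ p ^ n - 1) ^ d)) - om p L n ^ d * D lam := by
    intro d
    induction d with
    | zero =>
      intro lam
      rw [pow_zero, pow_zero, one_mul, one_eq_id, comp_id, sub_self]
      exact dvd_zero _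
    | succ d ih =>
      intro lam
      set mu := lam ∘ₗ ((S ^ p ^ n - 1) ^ d) with hmu
      have e1 : lam ∘ₗ ((S ^ p ^ n - 1) ^ (d + 1)) = mu ∘ₗ (S ^ p ^ n) - mu := by
        rw [pow_succ, End.mul_eq_comp, ← LinearMap.comp_assoc, ← hmu, LinearMap.comp_sub,
          one_eq_id, comp_id]
      have e3 := dvd_add (h1 (p ^ n) mu) ((ih lam).mul_left (om p L n))
      rw [e1, map_sub]
      convert e3 using 1
      rw [om]; ring
  have h3 : D (lam ∘ₗ ((S ^ p ^ n - 1) ^ (m + 1))) = 0 := by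
    rw [hD, diffApol_apply, Apol, Apol, mul_sum, ← sum_sub_distrib]
    refine sum_eq_zero fun a ha' => ?_
    rw [mul_sum, ← sum_sub_distrib]
    refine sum_eq_zero fun j hj => ?_
    have := congrArg lam (hkill a j (mem_range.1 ha') (by
      have := mem_range.1 hj; omega))
    rw [map_sub, map_smul, map_sub, map_smul, map_zero, smul_eq_mul, sub_eq_zero] at this
    have e1 : arr xb (lam ∘ₗ (S ^ p ^ n - 1) ^ (m + 1)) (n + 1) a j =
        e * arr xa (lam ∘ₗ (S ^ p ^ n - 1) ^ (m + 1)) (n + 1) a j := this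
    rw [e1, C_mul]; ring
  have h4 := h2 (m + 1) lam
  rw [h3, zero_sub, dvd_neg, om_succ, mul_pow] at h4
  exact (mul_dvd_mul_iff_left (pow_ne_zero _ (om_monic p L n).ne_zero)).1 h4

end Link

section Family

variable (p m) in
/-- An additive, translation invariant family of functions indexed by balls. -/
structure AddFam (q : L) (χ : ℚ_[p] → ℤ → ℚ_[p] → L) : Prop where
  congr : ∀ a b n, InB a n b → χ b n = χ a n
  sum : ∀ a n, χ a n = ∑ i ∈ range p, χ (a + i * 𝔭 ^ n) (n + 1)
  translate : ∀ a b n, tr L b (χ a n) = χ (a - b) n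
  mem : ∀ (P : L[X]) a n, P.natDegree ≤ m → pev p P (χ a n) ∈ Vsp p m q

/-- The function `binom((z-a)/pⁿ, j) χ_{a,n}`. -/
def bfam (χ : ℚ_[p] → ℤ → ℚ_[p] → L) (n a j : ℕ) : ℚ_[p] → L :=
  pev p ((bp L j).comp (lin p L (a : ℚ_[p]) n)) (χ a n)

lemma natDegree_comp_lin_le {R : L[X]} (hR : R.natDegree ≤ m) (a : ℚ_[p]) (n : ℤ) :
    (R.comp (lin p L a n)).natDegree ≤ m := by
  refine natDegree_comp_le.trans ?_
  have := natDegree_lin_pow (L := L) a n 1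
  rw [pow_one] at this
  calc _ ≤ R.natDegree * 1 := Nat.mul_le_mul_left _ this
    _ ≤ m := by rwa [mul_one]

lemma eval_comp_lin (R : L[X]) (a : ℚ_[p]) (n : ℤ) (z : ℚ_[p]) : (R.comp (lin p L a n)).eval (η z) =
      R.eval (η ((z - a) * 𝔭 ^ (-n))) := by
  rw [eval_comp, eval_lin]

variable {q : L} {χ : ℚ_[p] → ℤ → ℚ_[p] → L}

lemma AddFam.bfam_mem (h : AddFam p m q χ) (n a : ℕ) {j : ℕ} (hj : j ≤ m) :
    bfam χ n a j ∈ Vsp p m q :=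
  h.mem _ _ _ (natDegree_comp_lin_le ((natDegree_bp_le L j).trans hj) _ _)

lemma AddFam.bfam_eq_sum (h : AddFam p m q χ) (n a : ℕ) {j : ℕ} (hj : j ≤ m) :
    bfam χ n a j = ∑ i ∈ range p, ∑ l ∈ range (m + 1),
      (cc p i j l : L) • bfam χ (n + 1) (a + i * p ^ n) l := by
  have := charZero_of_padic p L
  rw [bfam, h.sum, map_sum]
  refine sum_congr rfl fun i _ => ?_
  have hcast : (((a + i * p ^ n : ℕ) : ℕ) : ℚ_[p]) = (a : ℚ_[p]) + i * 𝔭 ^ (n : ℤ) := by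
    push_cast; rw [zpow_natCast]
  ext z
  rw [Finset.sum_apply, pev_apply, eval_comp_lin]
  simp only [Pi.smul_apply, smul_eq_mul, bfam, pev_apply, eval_comp_lin, hcast]
  have hn : ((n + 1 : ℕ) : ℤ) = (n : ℤ) + 1 := by push_cast; ring
  rw [hn]
  simp only [← mul_assoc]
  rw [← sum_mul]
  congr 1
  set y := (z - (a + i * 𝔭 ^ (n : ℤ))) * 𝔭 ^ (-((n : ℤ) + 1)) with hy
  have hyz : (z - a) * 𝔭 ^ (-(n : ℤ)) = i + p * y := by
    have := padic_p_ne_zero (p := p)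
    rw [hy, neg_add, zpow_add₀ this, zpow_neg, zpow_neg, zpow_one]
    have := zpow_ne_zero (n : ℤ) this
    field_simp
    ring
  have := congrArg (eval (η y)) (bp_comp_add_mul L p i j hj)
  rw [eval_comp, eval_finsetSum] at this
  simp only [eval_add, eval_mul, eval_C, eval_X,
    eval_smul, smul_eq_mul] at this
  rw [hyz, map_add, map_mul, map_natCast, map_natCast, this]

lemma AddFam.tr_bfam_succ (h : AddFam p m q χ) (n a j : ℕ) :
    tr L (1 : ℚ_[p]) (bfam χ n (a + 1) j) = bfam χ n a j := by
  have h1 := h.translate ((a + 1 : ℕ) : ℚ_[p]) 1 n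
  have h2 : ((a + 1 : ℕ) : ℚ_[p]) - 1 = a := by push_cast; ring
  rw [h2] at h1
  ext z
  rw [tr_apply, bfam, bfam, pev_apply, pev_apply, eval_comp_lin, eval_comp_lin, ← h1,
    tr_apply]
  congr 4
  push_cast; ring

lemma AddFam.chi_last (h : AddFam p m q χ) (n : ℕ) :
    tr L (1 : ℚ_[p]) (χ ((0 : ℕ) : ℚ_[p]) n) = χ ((p ^ n - 1 : ℕ) : ℚ_[p]) n := by
  rw [h.translate]
  refine h.congr _ _ _ ?_
  have := inB_add_mul (((p ^ n - 1 : ℕ)) : ℚ_[p]) n 1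
  refine (InB.symm ?_).symm
  convert (inB_add_mul_int (((p ^ n - 1 : ℕ)) : ℚ_[p]) n (-1)) using 1
  rw [Nat.cast_sub (Nat.one_le_pow _ _ (Fact.out : p.Prime).pos)]
  push_cast
  rw [zpow_natCast]; ring

lemma last_arg (n : ℕ) (z : ℚ_[p]) : (z + 1 - ((0 : ℕ) : ℚ_[p])) * 𝔭 ^ (-(n : ℤ)) =
    (z - ((p ^ n - 1 : ℕ) : ℚ_[p])) * 𝔭 ^ (-(n : ℤ)) + 1 := by
  have := padic_p_ne_zero (p := p)
  rw [Nat.cast_sub (Nat.one_le_pow _ _ (Fact.out : p.Prime).pos)]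
  push_cast
  rw [zpow_neg, zpow_natCast]
  have := pow_ne_zero n this
  field_simp
  ring

lemma AddFam.tr_bfam_zero_zero (h : AddFam p m q χ) (n : ℕ) :
    tr L (1 : ℚ_[p]) (bfam χ n 0 0) = bfam χ n (p ^ n - 1) 0 := by
  ext z
  rw [tr_apply, bfam, bfam, bp_zero, one_comp, one_comp, pev_apply, pev_apply,
    ← h.chi_last, tr_apply, eval_one, eval_one]

lemma AddFam.tr_bfam_zero_succ (h : AddFam p m q χ) (n j : ℕ) :
    tr L (1 : ℚ_[p]) (bfam χ n 0 (j + 1)) = bfam χ n (p ^ n - 1) (j + 1) + bfam χ n (p ^ n - 1) j := by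
  have := charZero_of_padic p L
  ext z
  rw [Pi.add_apply, tr_apply, bfam, bfam, bfam, pev_apply, pev_apply, pev_apply, eval_comp_lin,
    eval_comp_lin, eval_comp_lin, ← h.chi_last, tr_apply, last_arg, ← add_mul]
  congr 1
  have := congrArg (eval (η
    ((z - ((p ^ n - 1 : ℕ) : ℚ_[p])) * 𝔭 ^ (-(n : ℤ))))) (bp_succ_comp L j)
  rw [eval_comp] at this
  simp only [eval_add, eval_X, eval_one] at this
  rw [map_add, map_one, this]

lemma tr_mem_Vsp (b : ℚ_[p]) {f : ℚ_[p] → L} (hf : f ∈ Vsp p m q) : tr L b f ∈ Vsp p m q := by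
  induction hf using span_induction with
  | mem f hf =>
    obtain ⟨P, a, n, hP, rfl⟩ := hf
    rw [tr_pev, tr_phi]
    exact pev_phi_mem (by rwa [natDegree_taylor]) _ _
  | zero => rw [map_zero]; exact zero_mem _
  | add f g _ _ h1 h2 => rw [map_add]; exact add_mem h1 h2
  | smul c f _ h1 => rw [map_smul]; exact smul_mem _ _ h1

variable (m q) in
/-- An element of `Vsp` given by its underlying function. -/
def mkV (f : ℚ_[p] → L) : Vsp p m q := if h : f ∈ Vsp p m q then ⟨f, h⟩ else 0

lemma coe_mkV {f : ℚ_[p] → L} (h : f ∈ Vsp p m q) : (mkV m q f : ℚ_[p] → L) = f := by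
  rw [mkV, dif_pos h]

variable (p m q) in
/-- Translation by `1` on `Vsp`. -/
def trV : Vsp p m q →ₗ[L] Vsp p m q := (tr L (1 : ℚ_[p])).restrict fun _ h => tr_mem_Vsp 1 h

lemma coe_trV (v : Vsp p m q) : (trV p m q v : ℚ_[p] → L) = tr L (1 : ℚ_[p]) v := rfl

lemma coe_trV_pow (v : Vsp p m q) (n : ℕ) :
    (((trV p m q) ^ n) v : ℚ_[p] → L) = tr L (n : ℚ_[p]) v := by
  induction n generalizing v with
  | zero => ext z; simp [tr_apply]
  | succ n ih =>
    rw [pow_succ, End.mul_apply, ih, coe_trV]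
    ext z
    simp only [tr_apply]
    push_cast; ring_nf

/-- The family with values in `Vsp`. -/
def bfamV (m : ℕ) (q : L) (χ : ℚ_[p] → ℤ → ℚ_[p] → L) (n a j : ℕ) : Vsp p m q :=
  mkV m q (bfam χ n a j)

lemma AddFam.coe_bfamV (h : AddFam p m q χ) (n a : ℕ) {j : ℕ} (hj : j ≤ m) :
    (bfamV m q χ n a j : ℚ_[p] → L) = bfam χ n a j := coe_mkV (h.bfam_mem n a hj)

lemma AddFam.refines (h : AddFam p m q χ) (lam : Dual L (Vsp p m q)) :
    Refines p m (arr (bfamV m q χ) lam) := by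
  intro n a j _ hj
  have : bfamV m q χ n a j = ∑ i ∈ range p, ∑ l ∈ range (m + 1),
      (cc p i j l : L) • bfamV m q χ (n + 1) (a + i * p ^ n) l := by
    refine Subtype.ext ?_
    rw [h.coe_bfamV n a hj, h.bfam_eq_sum n a hj]
    push_cast
    refine sum_congr rfl fun i _ => sum_congr rfl fun l hl => ?_
    rw [h.coe_bfamV]
    have := mem_range.1 hl; omega
  simp only [arr]
  rw [this]
  simp only [map_sum, map_smul, smul_eq_mul]

lemma AddFam.trV_bfamV (h : AddFam p m q χ) (n : ℕ) :
    (∀ a j, j ≤ m → trV p m q (bfamV m q χ n (a + 1) j) = bfamV m q χ n a j) ∧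
    trV p m q (bfamV m q χ n 0 0) = bfamV m q χ n (p ^ n - 1) 0 ∧
    ∀ j, j < m → trV p m q (bfamV m q χ n 0 (j + 1)) =
      bfamV m q χ n (p ^ n - 1) (j + 1) + bfamV m q χ n (p ^ n - 1) j := by
  refine ⟨fun a j hj => Subtype.ext ?_, Subtype.ext ?_, fun j hj => Subtype.ext ?_⟩
  · rw [coe_trV, h.coe_bfamV _ _ hj, h.coe_bfamV _ _ hj, h.tr_bfam_succ]
  · rw [coe_trV, h.coe_bfamV _ _ (Nat.zero_le m), h.coe_bfamV _ _ (Nat.zero_le m),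
      h.tr_bfam_zero_zero]
  · rw [coe_trV, Submodule.coe_add, h.coe_bfamV _ _ hj, h.coe_bfamV _ _ hj, h.coe_bfamV _ _ hj.le,
      h.tr_bfam_zero_succ]

lemma AddFam.shift (h : AddFam p m q χ) (lam : Dual L (Vsp p m q)) :
    ShiftRel p m (arr (bfamV m q χ) (lam ∘ₗ trV p m q)) (arr (bfamV m q χ) lam) := by
  intro n
  obtain ⟨h1, h2, h3⟩ := h.trV_bfamV n
  refine ⟨fun a j _ hj => ?_, ?_, fun j hj => ?_⟩
  · simp only [arr, comp_apply, h1 a j hj]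
  · simp only [arr, comp_apply, h2]
  · simp only [arr, comp_apply, h3 j hj, map_add]

end Family

lemma Par.addFam_ind (h : Par p m α β) : AddFam p m 𝔮 (ind p L) where
  congr _ _ _ hb := ind_congr hb
  sum a n := ind_eq_sum a n
  translate a b n := tr_ind a b n
  mem _ a n hP := pev_ind_mem h.qq_ne_zero h.one_sub_ne hP a n

variable (p α β) in
/-- The second additive family. -/
def psi (a : ℚ_[p]) (n : ℤ) : ℚ_[p] → L :=
  (α / β) ^ n • (phi p 𝔮 a n - (p : L)⁻¹ • phi p 𝔮 a (n - 1))

lemma Par.addFam_psi (h : Par p m α β) : AddFam p m 𝔮 (psi p α β) where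
  congr a b n hb := by rw [psi, psi, phi_congr hb, phi_congr (hb.mono (by omega))]
  sum a n := by
    have hq := h.qq_ne_zero
    have ha := h.a_ne
    have hb := h.b_ne
    have hp := p_ne p L
    have h1 := phi_sum_children hq a n
    have h2 : ∀ i : ℕ, phi p 𝔮 (a + i * 𝔭 ^ n) (n + 1 - 1) =
        phi p 𝔮 a n := fun i => by
      rw [add_sub_cancel_right]; exact phi_congr (inB_add_mul a n i)
    simp only [psi, h2]
    rw [← smul_sum, sum_sub_distrib, sum_const, card_range,
      eq_sub_of_add_eq h1, zpow_add_one₀ (div_ne_zero ha hb), mul_smul]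
    congr 1
    ext z
    simp only [Pi.sub_apply, Pi.smul_apply, smul_eq_mul, nsmul_eq_mul, Pi.mul_apply, Pi.natCast_apply,
      qq]
    field_simp
    ring
  translate a b n := by rw [psi, psi, map_smul, map_sub, map_smul, tr_phi, tr_phi]
  mem P a n hP := by
    rw [psi, map_smul, map_sub, map_smul]
    exact smul_mem _ _ (sub_mem (pev_phi_mem hP _ _)
      (smul_mem _ _ (pev_phi_mem hP _ _)))

lemma Par.qq_ne_p (h : Par p m α β) : 𝔮 ≠ p := by
  intro h1
  rw [qq, div_eq_iff h.b_ne, mul_comm] at h1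
  exact h.ne (mul_left_cancel₀ (p_ne p L) h1)

lemma Par.psi_sub (h : Par p m α β) (a : ℚ_[p]) (n : ℤ) :
    psi p α β a n - ((α / β) ^ n * (1 - 𝔮⁻¹)) • ind p L a n =
      ((α / β) ^ n * (𝔮⁻¹ - (p : L)⁻¹)) • phi p 𝔮 a (n - 1) := by
  rw [psi, mul_smul, mul_smul, ← phi_sub_parent h.qq_ne_zero, ← smul_sub]
  congr 1
  module

variable (p m α β) in
/-- The lattice `Tht` inside `Vsp`. -/
def ThtV : AddSubgroup (Vsp p m 𝔮) :=
  (Tht p m α β).comap (Vsp p m 𝔮).subtype.toAddMonoidHom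

lemma mem_ThtV {v : Vsp p m 𝔮} : v ∈ ThtV p m α β ↔ (v : ℚ_[p] → L) ∈ Tht p m α β := Iff.rfl

lemma pev_comp_lin_eq_sum (h : Par p m α β) (a : ℚ_[p]) (n : ℤ) {R : L[X]}
    (hR : R.natDegree ≤ m) : pev p (R.comp (lin p L a n)) (phi p 𝔮 a n) =
      ∑ j ∈ range (m + 1), (R.coeff j * (kap p m β ^ n)⁻¹) • gen p m α β a n j := by
  rw [Polynomial.comp, eval₂_eq_sum_range' _ (Nat.lt_succ_of_le hR), map_sum,
    LinearMap.sum_apply]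
  refine sum_congr rfl fun j _ => ?_
  rw [gen, smul_smul, mul_assoc, inv_mul_cancel₀ (zpow_ne_zero _ h.kap_ne_zero), mul_one,
    ← smul_eq_C_mul, map_smul, LinearMap.smul_apply]

lemma Par.norm_functional_le (h : Par p m α β) {R : L[X]} (hR : R.natDegree ≤ m)
    {lam : Dual L (Vsp p m 𝔮)} {c : ℝ} (hlam : BddOn (ThtV p m α β) c lam) (a : ℚ_[p]) (n : ℤ) :
    ‖lam (mkV m 𝔮 (pev p (R.comp (lin p L a n)) (phi p 𝔮 a n)))‖ ≤
      (∑ j ∈ range (m + 1), ‖R.coeff j‖) * c * ‖α‖ ^ (-n) := by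
  have h1 : mkV m 𝔮 (pev p (R.comp (lin p L a n)) (phi p 𝔮 a n)) =
      ∑ j ∈ range (m + 1), (R.coeff j * (kap p m β ^ n)⁻¹) •
        mkV m 𝔮 (gen p m α β a n j) := by
    refine Subtype.ext ?_
    rw [coe_mkV (pev_phi_mem (natDegree_comp_lin_le hR _ _) _ _), pev_comp_lin_eq_sum h a n hR]
    push_cast
    refine sum_congr rfl fun j hj => ?_
    rw [coe_mkV (gen_mem_Vsp a n (by have := mem_range.1 hj; omega))]
  rw [h1, map_sum, sum_mul, sum_mul]
  refine (norm_sum_le _ _).trans (sum_le_sum fun j hj => ?_)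
  have hj' : j ≤ m := by have := mem_range.1 hj; omega
  rw [map_smul, norm_smul, norm_mul, norm_inv, norm_zpow, h.norm_kap, zpow_neg, mul_assoc, mul_assoc]
  refine mul_le_mul_of_nonneg_left ?_ (norm_nonneg _)
  rw [mul_comm]
  refine mul_le_mul_of_nonneg_right (hlam _ ?_) (inv_nonneg.2 (zpow_nonneg (norm_nonneg _) _))
  rw [mem_ThtV, coe_mkV (gen_mem_Vsp a n hj')]
  exact gen_mem_Tht a n hj'

lemma comp_lin_parent (R : L[X]) (a : ℚ_[p]) (n : ℤ) :
    R.comp (lin p L a n) = (R.comp (C (p : L)⁻¹ * X)).comp (lin p L a (n - 1)) := by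
  have hp := p_ne p L
  rw [comp_assoc]
  congr 1
  rw [mul_comp, C_comp, X_comp, lin, lin, ← mul_assoc,
    ← C_mul]
  congr 2
  rw [neg_sub, sub_eq_add_neg, zpow_add₀ hp, zpow_one, inv_mul_cancel_left₀ hp]

variable (p m) in
/-- A bound for the coefficients of the binomial polynomials. -/
lemma exists_bound_bp : ∃ K : ℝ, 0 ≤ K ∧
    ∀ j ≤ m, (∑ i ∈ range (m + 1), ‖(bp L j).coeff i‖) ≤ K ∧
      (∑ i ∈ range (m + 1),
        ‖((bp L j).comp (C (p : L)⁻¹ * X)).coeff i‖) ≤ K := by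
  set F : ℕ → ℝ := fun j => (∑ i ∈ range (m + 1), ‖(bp L j).coeff i‖) +
    (∑ i ∈ range (m + 1),
      ‖((bp L j).comp (C (p : L)⁻¹ * X)).coeff i‖) with hF
  have h0 : ∀ j, 0 ≤ F j := fun j => by positivity
  refine ⟨∑ j ∈ range (m + 1), F j, sum_nonneg fun j _ => h0 j, fun j hj => ?_⟩
  have h1 := single_le_sum (f := F) (fun i _ => h0 i)
    (mem_range.2 (Nat.lt_succ_of_le hj))
  have h2 : 0 ≤ ∑ i ∈ range (m + 1), ‖(bp L j).coeff i‖ := by positivity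
  have h3 : 0 ≤ ∑ i ∈ range (m + 1),
    ‖((bp L j).comp (C (p : L)⁻¹ * X)).coeff i‖ := by positivity
  rw [hF] at h1
  constructor <;> linarith

lemma Par.exists_grow (h : Par p m α β) : ∃ K : ℝ, 0 ≤ K ∧
    ∀ (lam : Dual L (Vsp p m 𝔮)) (c : ℝ), BddOn (ThtV p m α β) c lam →
      Grow p m ‖α‖⁻¹ (K * c) (arr (bfamV m 𝔮 (ind p L)) lam) ∧
      Grow p m ‖β‖⁻¹ (K * c) (arr (bfamV m 𝔮 (psi p α β)) lam) := by
  obtain ⟨K₀, hK₀, hK⟩ := exists_bound_bp (L := L) p m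
  set q := 𝔮 with hq
  have hna := h.norm_pos
  have hnb : 0 < ‖β‖ := norm_pos_iff.2 h.b_ne
  set K₁ := K₀ + K₀ * ‖α‖ with hK₁
  set A := ‖(1 - q⁻¹)⁻¹‖ * (1 + ‖q⁻¹‖) with hA
  have hA0 : 0 ≤ A := by positivity
  have hK₁0 : 0 ≤ K₁ := by positivity
  refine ⟨K₁ * (A + (1 + p)), by positivity, fun lam c hlam => ?_⟩
  have hc : 0 ≤ c := (norm_nonneg _).trans (hlam 0 (zero_mem _))
  have hb : ∀ j ≤ m, (bp L j).natDegree ≤ m := fun j hj => (natDegree_bp_le L j).trans hj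
  set Y : Arr (Vsp p m q) := fun n a j =>
    mkV m q (pev p ((bp L j).comp (lin p L (a : ℚ_[p]) n)) (phi p q a n)) with hY
  set Z : Arr (Vsp p m q) := fun n a j =>
    mkV m q (pev p ((bp L j).comp (lin p L (a : ℚ_[p]) n)) (phi p q a ((n : ℤ) - 1))) with hZ
  have hYb : ∀ n a j, j ≤ m → ‖lam (Y n a j)‖ ≤ K₁ * c * ‖α‖⁻¹ ^ n := by
    intro n a j hj
    refine (h.norm_functional_le (hb j hj) hlam a n).trans ?_
    rw [zpow_neg, zpow_natCast, inv_pow]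
    gcongr
    exact (hK j hj).1.trans (by rw [hK₁]; nlinarith)
  have hZb : ∀ n a j, j ≤ m → ‖lam (Z n a j)‖ ≤ K₁ * c * ‖α‖⁻¹ ^ n := by
    intro n a j hj
    have e1 : Z n a j = mkV m q (pev p (((bp L j).comp (C (p : L)⁻¹ * X)).comp
        (lin p L (a : ℚ_[p]) ((n : ℤ) - 1))) (phi p q a ((n : ℤ) - 1))) := by
      rw [hZ, ← comp_lin_parent]
    have hd : ((bp L j).comp (C (p : L)⁻¹ * X)).natDegree ≤ m := by
      refine natDegree_comp_le.trans ?_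
      calc _ ≤ (bp L j).natDegree * 1 := Nat.mul_le_mul_left _ ((natDegree_C_mul_le _ _).trans
          natDegree_X_le)
        _ ≤ m := by rw [mul_one]; exact hb j hj
    rw [e1]
    refine (h.norm_functional_le hd hlam a _).trans ?_
    rw [neg_sub, sub_eq_add_neg, zpow_add₀ hna.ne', zpow_one, zpow_neg, zpow_natCast, inv_pow]
    calc _ ≤ K₀ * c * (‖α‖ * (‖α‖ ^ n)⁻¹) := by gcongr; exact (hK j hj).2
      _ = K₀ * ‖α‖ * c * (‖α‖ ^ n)⁻¹ := by ring
      _ ≤ _ := by gcongr; rw [hK₁]; linarith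
  have hmY : ∀ n a j, j ≤ m → (Y n a j : ℚ_[p] → L) =
      pev p ((bp L j).comp (lin p L (a : ℚ_[p]) n)) (phi p q a n) := fun n a j hj =>
    coe_mkV (pev_phi_mem (natDegree_comp_lin_le (hb j hj) _ _) _ _)
  have hmZ : ∀ n a j, j ≤ m → (Z n a j : ℚ_[p] → L) =
      pev p ((bp L j).comp (lin p L (a : ℚ_[p]) n)) (phi p q a ((n : ℤ) - 1)) := fun n a j hj =>
    coe_mkV (pev_phi_mem (natDegree_comp_lin_le (hb j hj) _ _) _ _)
  constructor
  · intro n a j _ hj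
    have e1 : bfamV m q (ind p L) n a j = (1 - q⁻¹)⁻¹ • (Y n a j - q⁻¹ • Z n a j) := by
      refine Subtype.ext ?_
      rw [h.addFam_ind.coe_bfamV n a hj, bfam, Submodule.coe_smul, Submodule.coe_sub,
        Submodule.coe_smul, hmY n a j hj, hmZ n a j hj, ← map_smul, ← map_sub,
        phi_sub_parent h.qq_ne_zero, map_smul, smul_smul, inv_mul_cancel₀ h.one_sub_ne, one_smul]
    rw [arr, e1, map_smul, map_sub, map_smul, norm_smul]
    have e2 : ‖lam (Y n a j) - q⁻¹ • lam (Z n a j)‖ ≤ (1 + ‖q⁻¹‖) * (K₁ * c * ‖α‖⁻¹ ^ n) := by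
      refine (norm_sub_le _ _).trans ?_
      rw [norm_smul, add_mul, one_mul]
      exact add_le_add (hYb n a j hj) (mul_le_mul_of_nonneg_left (hZb n a j hj) (norm_nonneg _))
    calc _ ≤ ‖(1 - q⁻¹)⁻¹‖ * ((1 + ‖q⁻¹‖) * (K₁ * c * ‖α‖⁻¹ ^ n)) :=
          mul_le_mul_of_nonneg_left e2 (norm_nonneg _)
      _ = K₁ * A * c * ‖α‖⁻¹ ^ n := by rw [hA]; ring
      _ ≤ _ := by gcongr; linarith [p_pos p]
  · intro n a j _ hj
    have e1 : bfamV m q (psi p α β) n a j =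
        (α / β) ^ n • (Y n a j - (p : L)⁻¹ • Z n a j) := by
      refine Subtype.ext ?_
      rw [h.addFam_psi.coe_bfamV n a hj, bfam, Submodule.coe_smul, Submodule.coe_sub,
        Submodule.coe_smul, hmY n a j hj, hmZ n a j hj, psi, map_smul, map_sub, map_smul, zpow_natCast]
    rw [arr, e1, map_smul, map_sub, map_smul, norm_smul, norm_pow, norm_div]
    have e2 : ‖lam (Y n a j) - (p : L)⁻¹ • lam (Z n a j)‖ ≤ (1 + p) * (K₁ * c * ‖α‖⁻¹ ^ n) := by
      refine (norm_sub_le _ _).trans ?_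
      rw [norm_smul, norm_inv, norm_p p L, inv_inv, add_mul, one_mul]
      exact add_le_add (hYb n a j hj) (mul_le_mul_of_nonneg_left (hZb n a j hj) (p_pos p).le)
    calc _ ≤ (‖α‖ / ‖β‖) ^ n * ((1 + p) * (K₁ * c * ‖α‖⁻¹ ^ n)) :=
          mul_le_mul_of_nonneg_left e2 (by positivity)
      _ = K₁ * (1 + p) * c * ‖β‖⁻¹ ^ n := by rw [div_pow, inv_pow, inv_pow]; field_simp
      _ ≤ _ := by
          have : (1 + p : ℝ) ≤ A + (1 + p) := by linarith
          gcongr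

section Affine

variable (L) in
/-- Substitution of an affine function. -/
def aff (b d : ℚ_[p]) : (ℚ_[p] → L) →ₗ[L] (ℚ_[p] → L) :=
  funLeft L L fun z => d * z - b

lemma aff_apply (b d : ℚ_[p]) (f : ℚ_[p] → L) (z : ℚ_[p]) : aff L b d f z = f (d * z - b) := rfl

lemma tr_eq_aff (b : ℚ_[p]) : tr L b = aff L (-b) 1 := by
  ext f z
  rw [tr_apply, aff_apply, one_mul, sub_neg_eq_add]

lemma aff_aff (b d b' d' : ℚ_[p]) (f : ℚ_[p] → L) :
    aff L b d (aff L b' d' f) = aff L (d' * b + b') (d' * d) f := by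
  ext z
  simp only [aff_apply]
  congr 1; ring

lemma aff_arg (a b : ℚ_[p]) (e : ℤ) (z : ℚ_[p]) : 𝔭 ^ e * z - b - a =
    𝔭 ^ e * (z - (a + b) * 𝔭 ^ (-e)) := by
  have := zpow_ne_zero e (padic_p_ne_zero (p := p))
  rw [zpow_neg]; field_simp; ring

lemma aff_phi (q : L) (a b : ℚ_[p]) (n e : ℤ) : aff L b (𝔭 ^ e) (phi p q a n) =
    phi p q ((a + b) * 𝔭 ^ (-e)) (n - e) := by
  have hp := padic_p_ne_zero (p := p)
  ext z
  rw [aff_apply, phi, phi, aff_arg a b e z,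
    show 𝔭 ^ n = 𝔭 ^ e * 𝔭 ^ (n - e) by
      rw [← zpow_add₀ hp]; congr 1; ring,
    nv_mul (fun h => zpow_ne_zero _ hp h.2) (zpow_ne_zero _ hp), valuation_zpow,
    valuation_p]
  congr 1; ring

lemma aff_ind (a b : ℚ_[p]) (n e : ℤ) : aff L b (𝔭 ^ e) (ind p L a n) =
    ind p L ((a + b) * 𝔭 ^ (-e)) (n - e) := by
  have hp := p_pos p
  have key : ∀ z, InB a n (𝔭 ^ e * z - b) ↔
      InB ((a + b) * 𝔭 ^ (-e)) (n - e) z := by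
    intro z
    rw [InB, InB, aff_arg a b e z, norm_mul, norm_p_zpow,
      show -n = -e + -(n - e) by ring, zpow_add₀ hp.ne']
    exact mul_le_mul_iff_right₀ (zpow_pos hp _)
  ext z
  rw [aff_apply, ind, ind]
  simp only [key]

lemma aff_pev (b d : ℚ_[p]) (P : L[X]) (f : ℚ_[p] → L) :
    aff L b d (pev p P f) = pev p (P.comp (C (η d) * X - C (η b))) (aff L b d f) := by
  ext z
  simp [aff_apply, pev_apply]

lemma natDegree_comp_affine_le (P : L[X]) (b d : L) :
    (P.comp (C d * X - C b)).natDegree ≤ P.natDegree := by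
  refine natDegree_comp_le.trans ?_
  rw [sub_eq_add_neg, ← C_neg]
  calc _ ≤ P.natDegree * 1 := Nat.mul_le_mul_left _ natDegree_linear_le
    _ = _ := mul_one _

variable (m α β) in
lemma aff_gen (a : ℚ_[p]) (n : ℤ) (j : ℕ) : gen p m α β a n j = kap p m β ^ n •
      aff L (a * 𝔭 ^ (-n)) (𝔭 ^ (-n)) (gen p m α β 0 0 j) := by
  have hp := padic_p_ne_zero (p := p)
  ext z
  have h1 := congrFun (aff_phi 𝔮 0 (a * 𝔭 ^ (-n)) 0 (-n)) z
  rw [zero_add, mul_assoc, ← zpow_add₀ hp, neg_neg, neg_add_cancel, zpow_zero, mul_one, zero_sub,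
    neg_neg, aff_apply] at h1
  rw [gen, gen, Pi.smul_apply, Pi.smul_apply, aff_apply, Pi.smul_apply, pev_apply, pev_apply, h1,
    eval_pow, eval_pow, eval_lin, eval_lin, zpow_zero, one_smul, neg_zero,
    zpow_zero, mul_one, sub_zero]
  congr 4
  ring

variable (L) in
lemma mem_span_bp [CharZero L] (d : ℕ) (P : L[X]) (hP : P.degree < d) :
    P ∈ span L {Q | ∃ j < d, Q = bp L j} := by
  induction d generalizing P with
  | zero =>
    have : P = 0 := by rw [← degree_eq_bot]; simpa using hP
    rw [this]; exact zero_mem _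
  | succ d ih =>
    have hmono : span L {Q | ∃ j < d, Q = bp L j} ≤
        span L {Q | ∃ j < d + 1, Q = bp L j} :=
      span_mono fun Q ⟨j, hj, hQ⟩ => ⟨j, by omega, hQ⟩
    have hf : (d.factorial : L) ≠ 0 := Nat.cast_ne_zero.2 (Nat.factorial_ne_zero d)
    set c := P.coeff d * d.factorial with hc
    have hcoeff : (bp L d).coeff d = (d.factorial : L)⁻¹ := by
      have := (monic_descPochhammer L d).coeff_natDegree
      rw [descPochhammer_natDegree] at this
      rw [bp, coeff_C_mul, this, mul_one]
    have h1 : (P - c • bp L d).degree < d := by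
      rw [degree_lt_iff_coeff_zero] at hP ⊢
      intro i hi
      rw [coeff_sub, coeff_smul, smul_eq_mul]
      rcases eq_or_lt_of_le hi with rfl | hi
      · rw [hcoeff, hc, mul_assoc, mul_inv_cancel₀ hf, mul_one, sub_self]
      · rw [hP i hi, coeff_eq_zero_of_natDegree_lt ((natDegree_bp_le L d).trans_lt hi)]
        ring
    rw [← sub_add_cancel P (c • bp L d)]
    exact add_mem (hmono (ih _ h1)) (smul_mem _ _
      (subset_span ⟨d, by omega, rfl⟩))

end Affine

section System

lemma gAct_aff (k : ℕ) (b d : ℚ_[p]) (f : ℚ_[p] → L) :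
    gAct p L k α β !![1, b; 0, d] f = α ^ (-d.valuation) • aff L b d f := by
  ext z
  simp [gAct, det2, iotaL, aff_apply]

lemma det_affMat (b d : ℚ_[p]) : (!![1, b; 0, d] : Matrix (Fin 2) (Fin 2) ℚ_[p]).det = d := by
  simp [Matrix.det_fin_two]

lemma det2_affMat (b d : ℚ_[p]) : det2 p (!![1, b; 0, d] : Matrix (Fin 2) (Fin 2) ℚ_[p]) = d := by
  simp [det2]

variable [IsUltrametricDist L] [CompleteSpace L]

lemma Par.aff_mem_Tht (h : Par p m α β) (b : ℚ_[p]) {d : ℚ_[p]} (hd : d ≠ 0) {f : ℚ_[p] → L}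
    (hf : f ∈ Tht p m α β) : α ^ (-d.valuation) • aff L b d f ∈ Tht p m α β := by
  have := h.gAct_mem_Tht (k := m + 2) (by omega) (g := !![1, b; 0, d]) (by rwa [det_affMat]) hf
  rwa [gAct_aff] at this

lemma Par.aff_mem_Vsp (h : Par p m α β) (b : ℚ_[p]) {d : ℚ_[p]} (hd : d ≠ 0) {f : ℚ_[p] → L}
    (hf : f ∈ Vsp p m 𝔮) : aff L b d f ∈ Vsp p m 𝔮 := by
  have := h.gAct_mem_Vsp (k := m + 2) (by omega) (g := !![1, b; 0, d]) (by rwa [det_affMat]) hf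
  rw [gAct_aff] at this
  have h2 := smul_mem _ (α ^ d.valuation) this
  rwa [smul_smul, ← zpow_add₀ h.a_ne, add_neg_cancel, zpow_zero, one_smul] at h2

/-- The operator `f ↦ α f(z/p)`. -/
def Par.dilV (h : Par p m α β) : Vsp p m 𝔮 ≃ₗ[L] Vsp p m 𝔮 where
  toFun v := ⟨α • aff L 0 𝔭⁻¹ v,
    smul_mem _ _ (h.aff_mem_Vsp 0 (inv_ne_zero padic_p_ne_zero) v.2)⟩
  invFun v := ⟨α⁻¹ • aff L 0 𝔭 v,
    smul_mem _ _ (h.aff_mem_Vsp 0 padic_p_ne_zero v.2)⟩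
  map_add' v w := by
    refine Subtype.ext ?_
    simp
  map_smul' c v := by
    refine Subtype.ext ?_
    simp only [Submodule.coe_smul, map_smul, RingHom.id_apply]
    exact smul_comm _ _ _
  left_inv v := by
    refine Subtype.ext ?_
    ext z
    simp [aff_apply, h.a_ne]
    rw [inv_mul_cancel_left₀ padic_p_ne_zero]
  right_inv v := by
    refine Subtype.ext ?_
    ext z
    simp [aff_apply, h.a_ne]
    rw [mul_inv_cancel_left₀ padic_p_ne_zero]

lemma Par.coe_dilV (h : Par p m α β) (v : Vsp p m 𝔮) :
    (h.dilV v : ℚ_[p] → L) = α • aff L 0 𝔭⁻¹ v := rfl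

lemma Par.coe_dilV_pow (h : Par p m α β) (N : ℕ) (v : Vsp p m 𝔮) :
    ((h.dilV ^ N) v : ℚ_[p] → L) = α ^ N • aff L 0 (𝔭 ^ (-(N : ℤ))) v := by
  induction N with
  | zero => ext z; simp [aff_apply]
  | succ N ih =>
    rw [pow_succ', LinearEquiv.mul_apply, h.coe_dilV, ih, map_smul, smul_smul, aff_aff,
      pow_succ', mul_zero, zero_add]
    congr 2
    rw [← zpow_neg_one, ← zpow_add₀ padic_p_ne_zero]
    congr 1; push_cast; ring_nf

lemma aff_bfam {χ : ℚ_[p] → ℤ → ℚ_[p] → L} {c : L}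
    (hχ : ∀ a n, aff L 0 𝔭⁻¹ (χ a n) = c • χ (a * p) (n + 1)) (n a j : ℕ) :
    aff L 0 𝔭⁻¹ (bfam χ n a j) = c • bfam χ (n + 1) (a * p) j := by
  have hp := padic_p_ne_zero (p := p)
  ext z
  have h1 := congrFun (hχ a n) z
  rw [aff_apply, Pi.smul_apply, smul_eq_mul] at h1
  rw [aff_apply, Pi.smul_apply, bfam, bfam, pev_apply, pev_apply, eval_comp_lin, eval_comp_lin, h1,
    smul_eq_mul]
  have e1 : (𝔭⁻¹ * z - 0 - a) * 𝔭 ^ (-(n : ℤ)) =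
      (z - ((a * p : ℕ) : ℚ_[p])) * 𝔭 ^ (-((n + 1 : ℕ) : ℤ)) := by
    rw [zpow_neg, zpow_neg, zpow_natCast, zpow_natCast, pow_succ]
    push_cast
    have := pow_ne_zero n hp
    field_simp
    ring_nf
  rw [e1]
  push_cast
  ring

lemma aff_inv_ind (a : ℚ_[p]) (n : ℤ) :
    aff L 0 𝔭⁻¹ (ind p L a n) = (1 : L) • ind p L (a * p) (n + 1) := by
  have := aff_ind (L := L) a 0 n (-1)
  rw [zpow_neg_one, neg_neg, zpow_one, add_zero, sub_neg_eq_add] at this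
  rw [this, one_smul]

lemma Par.aff_inv_psi (h : Par p m α β) (a : ℚ_[p]) (n : ℤ) :
    aff L 0 𝔭⁻¹ (psi p α β a n) = (β / α) • psi p α β (a * p) (n + 1) := by
  have key := fun n => aff_phi 𝔮 a 0 n (-1)
  simp only [zpow_neg_one, neg_neg, zpow_one, add_zero, sub_neg_eq_add] at key
  have ha := h.a_ne
  have hb := h.b_ne
  rw [psi, psi, map_smul, map_sub, map_smul, key, key, smul_smul, zpow_add_one₀ (div_ne_zero ha hb),
    show n - 1 + 1 = n + 1 - 1 by ring]
  congr 1
  field_simp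

lemma coe_trV_sub_pow {q : L} (d N : ℕ) (v : Vsp p m q) :
    ((((trV p m q) ^ N - 1) ^ d) v : ℚ_[p] → L) = ((tr L (N : ℚ_[p]) - 1) ^ d) (v : ℚ_[p] → L) := by
  induction d generalizing v with
  | zero => simp
  | succ d ih =>
    rw [pow_succ, End.mul_apply, ih, pow_succ, End.mul_apply]
    congr 1
    rw [LinearMap.sub_apply, Submodule.coe_sub, coe_trV_pow]
    rfl

lemma Par.kill (h : Par p m α β) (n a : ℕ) {j : ℕ} (hj : j ≤ m) :
    ((trV p m 𝔮 ^ p ^ n - 1) ^ (m + 1)) (bfamV m 𝔮 (psi p α β) (n + 1) a j -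
        ((α / β) ^ (n + 1) * (1 - 𝔮⁻¹)) • bfamV m 𝔮 (ind p L) (n + 1) a j) = 0 := by
  refine Subtype.ext ?_
  rw [coe_trV_sub_pow, Submodule.coe_sub, Submodule.coe_smul, h.addFam_psi.coe_bfamV _ _ hj,
    h.addFam_ind.coe_bfamV _ _ hj, bfam, bfam, ← map_smul, ← map_sub]
  have h1 := h.psi_sub (a : ℚ_[p]) ((n + 1 : ℕ) : ℤ)
  rw [zpow_natCast] at h1
  rw [h1, map_smul, map_smul, tr_sub_pow_pev, smul_zero]
  · rfl
  · rw [tr_phi]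
    refine phi_congr ?_
    have := inB_add_mul_int (a : ℚ_[p]) n (-1)
    rw [show ((n + 1 : ℕ) : ℤ) - 1 = n by push_cast; ring]
    convert this using 1
    push_cast
    rw [zpow_natCast]; ring
  · refine degree_le_natDegree.trans_lt ?_
    exact_mod_cast Nat.lt_succ_of_le
      (natDegree_comp_lin_le ((natDegree_bp_le L j).trans hj) (a : ℚ_[p]) ((n + 1 : ℕ) : ℤ))

lemma Par.indep (h : Par p m α β) (a b : L)
    (hab : a • bfamV m 𝔮 (ind p L) 0 0 0 + b • bfamV m 𝔮 (psi p α β) 0 0 0 = 0) :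
    a = 0 ∧ b = 0 := by
  have hp := p_ne p L
  have hq := h.qq_ne_zero
  have h1 := congrArg (fun v : Vsp p m 𝔮 => (v : ℚ_[p] → L)) hab
  simp only [Submodule.coe_add, Submodule.coe_smul, h.addFam_psi.coe_bfamV _ _ (Nat.zero_le m),
    h.addFam_ind.coe_bfamV _ _ (Nat.zero_le m), Submodule.coe_zero] at h1
  have key : ∀ z, a * ind p L 0 0 z + b * psi p α β 0 0 z = 0 := by
    intro z
    have := congrFun h1 z
    simpa [bfam, bp_zero, pev_apply] using this
  have hnot : ∀ n : ℤ, -2 < n → ¬InB 0 n (𝔭 ^ (-2 : ℤ)) := by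
    intro n hn
    rw [InB, sub_zero, norm_p_zpow, zpow_le_zpow_p]; omega
  have hv : (𝔭 ^ (-2 : ℤ) - 0).valuation = -2 := by
    rw [sub_zero, valuation_zpow, valuation_p]; norm_num
  have k1 := key (𝔭 ^ (-2 : ℤ))
  rw [ind_of_not_inB (hnot 0 (by omega)), psi, Pi.smul_apply, Pi.sub_apply, Pi.smul_apply,
    phi_of_not_inB (hnot 0 (by omega)), phi_of_not_inB (hnot (0 - 1) (by omega)), hv,
    mul_zero, zero_add, zpow_zero, one_smul, smul_eq_mul] at k1
  have hne : 𝔮 ^ (-2 - 0 : ℤ) - (p : L)⁻¹ * 𝔮 ^ (-2 - (0 - 1) : ℤ) ≠ 0 := by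
    intro h0
    apply h.qq_ne_p
    have e1 : (-2 - 0 : ℤ) = -2 := by norm_num
    have e2 : (-2 - (0 - 1) : ℤ) = -1 := by norm_num
    rw [e1, e2, zpow_neg, zpow_neg, zpow_one, show ((2 : ℤ)) = ((2 : ℕ) : ℤ) from rfl,
      zpow_natCast] at h0
    field_simp at h0
    linear_combination -h0
  have hb : b = 0 := (mul_eq_zero.1 k1).resolve_right hne
  refine ⟨?_, hb⟩
  have k2 := key 0
  rw [hb, zero_mul, add_zero, ind_of_inB (InB.self _ _), mul_one] at k2
  exact k2

lemma Par.trV_mem (h : Par p m α β) {v : Vsp p m 𝔮} (hv : v ∈ ThtV p m α β) :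
    trV p m 𝔮 v ∈ ThtV p m α β := by
  rw [mem_ThtV] at hv ⊢
  have := h.aff_mem_Tht (-1) one_ne_zero hv
  rw [valuation_one, neg_zero, zpow_zero, one_smul, ← tr_eq_aff] at this
  exact this

lemma AddFam.trV_mem_span {q : L} {χ : ℚ_[p] → ℤ → ℚ_[p] → L} (h : AddFam p m q χ)
    {W : Submodule L (Vsp p m q)} (hW : ∀ n a j, a < p ^ n → j ≤ m → bfamV m q χ n a j ∈ W) (n a j : ℕ)
    (ha : a < p ^ n) (hj : j ≤ m) : trV p m q (bfamV m q χ n a j) ∈ W := by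
  obtain ⟨h1, h2, h3⟩ := h.trV_bfamV n
  have hlt : p ^ n - 1 < p ^ n := by omega
  cases a with
  | zero =>
    cases j with
    | zero => rw [h2]; exact hW _ _ _ hlt hj
    | succ j => rw [h3 j hj]; exact add_mem (hW _ _ _ hlt hj) (hW _ _ _ hlt (by omega))
  | succ a => rw [h1 a j hj]; exact hW _ _ _ (by omega) hj

lemma Par.sys (h : Par p m α β) : ∃ K : ℝ, Sys p m ‖α‖⁻¹ ‖β‖⁻¹ K
    (fun n => (α / β) ^ (n + 1) * (1 - 𝔮⁻¹)) (trV p m 𝔮) h.dilV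
    (bfamV m 𝔮 (ind p L)) (bfamV m 𝔮 (psi p α β)) (ThtV p m α β) := by
  obtain ⟨K, hK0, hK⟩ := h.exists_grow
  have hna := h.norm_pos
  have hnb : 0 < ‖β‖ := norm_pos_iff.2 h.b_ne
  have hpm : (0 : ℝ) < (p : ℝ) ^ (m + 1) := pow_pos (p_pos p) _
  have hmul : ‖α‖⁻¹ * ‖β‖⁻¹ = (p : ℝ) ^ (m + 1) := by rw [← mul_inv, h.mul, inv_inv]
  have h1a : 1 < ‖α‖⁻¹ := (one_lt_inv₀ hna).2 h.a_lt
  have h1b : 1 < ‖β‖⁻¹ := (one_lt_inv₀ hnb).2 h.b_lt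
  have hW : ∀ n a j, a < p ^ n → j ≤ m →
      bfamV m 𝔮 (ind p L) n a j ∈ spanPair L p m (bfamV m 𝔮 (ind p L))
        (bfamV m 𝔮 (psi p α β)) := fun n a j ha hj =>
    subset_span ⟨n, a, j, ha, hj, Or.inl rfl⟩
  have hW' : ∀ n a j, a < p ^ n → j ≤ m →
      bfamV m 𝔮 (psi p α β) n a j ∈ spanPair L p m (bfamV m 𝔮 (ind p L))
        (bfamV m 𝔮 (psi p α β)) := fun n a j ha hj =>
    subset_span ⟨n, a, j, ha, hj, Or.inr rfl⟩
  refine ⟨K, ⟨⟨h1a.le, ?_, hK0, fun y hy => h.trV_mem hy, h.addFam_ind.refines,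
    fun lam c hc => (hK lam c hc).1, h.addFam_ind.shift⟩, ⟨h1b.le, ?_, hK0, fun y hy => h.trV_mem hy,
    h.addFam_psi.refines, fun lam c hc => (hK lam c hc).2, h.addFam_psi.shift⟩, hmul,
    fun lam n => Om_pow_dvd_of_kill h.addFam_ind.shift h.addFam_psi.shift n
      (fun a j _ hj => h.kill n a hj) lam, h.indep, ?_, ?_, ?_, ?_, ?_⟩⟩
  · rw [← hmul]; exact lt_mul_of_one_lt_right (by positivity) h1b
  · rw [← hmul]; exact lt_mul_of_one_lt_left (by positivity) h1a
  · intro v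
    refine Subtype.ext ?_
    rw [h.coe_dilV, coe_trV, coe_trV_pow, h.coe_dilV]
    ext z
    simp only [Pi.smul_apply, aff_apply, tr_apply]
    congr 2
    have := padic_p_ne_zero (p := p)
    field_simp
    ring_nf
  · intro v hv
    have : spanPair L p m (bfamV m 𝔮 (ind p L)) (bfamV m 𝔮 (psi p α β)) ≤
        (spanPair L p m (bfamV m 𝔮 (ind p L)) (bfamV m 𝔮 (psi p α β))).comap
          (trV p m 𝔮) := by
      refine span_le.2 ?_
      rintro _ ⟨n, a, j, ha, hj, rfl | rfl⟩
      · exact h.addFam_ind.trV_mem_span hW n a j ha hj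
      · exact h.addFam_psi.trV_mem_span hW' n a j ha hj
    exact this hv
  · intro v hv
    have : spanPair L p m (bfamV m 𝔮 (ind p L)) (bfamV m 𝔮 (psi p α β)) ≤
        (spanPair L p m (bfamV m 𝔮 (ind p L)) (bfamV m 𝔮 (psi p α β))).comap
          (h.dilV : Vsp p m 𝔮 →ₗ[L] Vsp p m 𝔮) := by
      refine span_le.2 ?_
      have hlt : ∀ a n, a < p ^ n → a * p < p ^ (n + 1) := fun a n ha => by
        rw [pow_succ]; exact Nat.mul_lt_mul_of_pos_right ha (Fact.out : p.Prime).pos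
      rintro _ ⟨n, a, j, ha, hj, rfl | rfl⟩
      · have e1 : h.dilV (bfamV m 𝔮 (ind p L) n a j) =
            α • (1 : L) • bfamV m 𝔮 (ind p L) (n + 1) (a * p) j := by
          refine Subtype.ext ?_
          rw [h.coe_dilV, Submodule.coe_smul, Submodule.coe_smul, h.addFam_ind.coe_bfamV _ _ hj,
            h.addFam_ind.coe_bfamV _ _ hj, aff_bfam aff_inv_ind]
        rw [SetLike.mem_coe, Submodule.mem_comap, LinearEquiv.coe_coe, e1]
        exact smul_mem _ _ (smul_mem _ _ (hW _ _ _ (hlt a n ha) hj))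
      · have e1 : h.dilV (bfamV m 𝔮 (psi p α β) n a j) =
            α • (β / α) • bfamV m 𝔮 (psi p α β) (n + 1) (a * p) j := by
          refine Subtype.ext ?_
          rw [h.coe_dilV, Submodule.coe_smul, Submodule.coe_smul, h.addFam_psi.coe_bfamV _ _ hj,
            h.addFam_psi.coe_bfamV _ _ hj, aff_bfam h.aff_inv_psi]
        rw [SetLike.mem_coe, Submodule.mem_comap, LinearEquiv.coe_coe, e1]
        exact smul_mem _ _ (smul_mem _ _ (hW' _ _ _ (hlt a n ha) hj))
    exact this hv
  · intro v hv
    rw [mem_ThtV] at hv ⊢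
    have := h.aff_mem_Tht 0 (inv_ne_zero (padic_p_ne_zero (p := p))) hv
    rw [valuation_inv, valuation_p, neg_neg, zpow_one] at this
    exact this
  · intro v hv
    rw [mem_ThtV] at hv ⊢
    have := h.aff_mem_Tht 0 (padic_p_ne_zero (p := p)) hv
    rw [valuation_p, zpow_neg_one] at this
    exact this

end System

section Absorb

variable {V : Type*} [AddCommGroup V] [Module L V]
  {Λ : AddSubgroup V}

lemma smul_mem_of_norm_le (hO : ∀ c : L, ‖c‖ ≤ 1 → ∀ y ∈ Λ, c • y ∈ Λ) {c c' : L} (hc : ‖c‖ ≤ ‖c'‖)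
    {y : V} (hy : c' • y ∈ Λ) : c • y ∈ Λ := by
  rcases eq_or_ne c' 0 with rfl | h0
  · rw [norm_zero] at hc
    rw [norm_le_zero_iff.1 hc, zero_smul]; exact zero_mem _
  · have := hO (c / c') (by rw [norm_div]; exact div_le_one_of_le₀ hc (norm_nonneg _)) _ hy
    rwa [smul_smul, div_mul_cancel₀ _ h0] at this

lemma exists_ne_zero_pair {P Q : L → Prop} (hP : ∃ c : L, c ≠ 0 ∧ P c) (hQ : ∃ c : L, c ≠ 0 ∧ Q c)
    (hPm : ∀ c c' : L, ‖c‖ ≤ ‖c'‖ → P c' → P c) (hQm : ∀ c c' : L, ‖c‖ ≤ ‖c'‖ → Q c' → Q c) :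
    ∃ c : L, c ≠ 0 ∧ P c ∧ Q c := by
  obtain ⟨c, hc, h1⟩ := hP
  obtain ⟨d, hd, h2⟩ := hQ
  rcases le_total ‖c‖ ‖d‖ with h | h
  · exact ⟨c, hc, h1, hQm _ _ h h2⟩
  · exact ⟨d, hd, hPm _ _ h h1, h2⟩

lemma exists_smul_mem_of_mem_span (hO : ∀ c : L, ‖c‖ ≤ 1 → ∀ y ∈ Λ, c • y ∈ Λ) {S : Set V}
    (hS : ∀ s ∈ S, ∃ c : L, c ≠ 0 ∧ c • s ∈ Λ) {v : V} (hv : v ∈ span L S) :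
    ∃ c : L, c ≠ 0 ∧ c • v ∈ Λ := by
  induction hv using span_induction with
  | mem s hs => exact hS s hs
  | zero => exact ⟨1, one_ne_zero, by rw [smul_zero]; exact zero_mem _⟩
  | add x y _ _ hx hy =>
    obtain ⟨c, hc, h1, h2⟩ := exists_ne_zero_pair hx hy (fun _ _ h h' => smul_mem_of_norm_le hO h h')
      (fun _ _ h h' => smul_mem_of_norm_le hO h h')
    exact ⟨c, hc, by rw [smul_add]; exact add_mem h1 h2⟩
  | smul d x _ hx =>
    obtain ⟨c, hc, h1⟩ := hx
    rcases eq_or_ne d 0 with rfl | hd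
    · exact ⟨1, one_ne_zero, by rw [zero_smul, smul_zero]; exact zero_mem _⟩
    · refine ⟨c / d, div_ne_zero hc hd, ?_⟩
      rwa [smul_smul, div_mul_cancel₀ _ hd]

lemma exists_smul_mem_of_lt (hO : ∀ c : L, ‖c‖ ≤ 1 → ∀ y ∈ Λ, c • y ∈ Λ) (v : ℕ → V)
    (hv : ∀ j, ∃ c : L, c ≠ 0 ∧ c • v j ∈ Λ) (d : ℕ) : ∃ c : L, c ≠ 0 ∧ ∀ j < d, c • v j ∈ Λ := by
  induction d with
  | zero => exact ⟨1, one_ne_zero, fun j hj => absurd hj (by omega)⟩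
  | succ d ih =>
    obtain ⟨c, hc, h1, h2⟩ := exists_ne_zero_pair ih (hv d)
      (fun _ _ h h' j hj => smul_mem_of_norm_le hO h (h' j hj))
      (fun _ _ h h' => smul_mem_of_norm_le hO h h')
    refine ⟨c, hc, fun j hj => ?_⟩
    rcases Nat.lt_succ_iff_lt_or_eq.1 hj with h | rfl
    · exact h1 j h
    · exact h2

end Absorb

section Commensurable

lemma Par.Vsp_eq_span_gen (h : Par p m α β) {f : ℚ_[p] → L} (hf : f ∈ Vsp p m 𝔮) :
    f ∈ span L {f | ∃ (a : ℚ_[p]) (n : ℤ) (j : ℕ), j ≤ m ∧ f = gen p m α β a n j} := by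
  refine span_le.2 ?_ hf
  rintro _ ⟨P, a, n, hP, rfl⟩
  rw [pev_phi_eq_sum h a n hP]
  exact Submodule.sum_mem _ fun j hj => smul_mem _ _
    (subset_span ⟨a, n, j, by simpa [Nat.lt_succ_iff] using hj, rfl⟩)

lemma Par.exists_smul_mem_Tht (h : Par p m α β) {f : ℚ_[p] → L} (hf : f ∈ Vsp p m 𝔮) :
    ∃ c : L, c ≠ 0 ∧ c • f ∈ Tht p m α β := by
  refine exists_smul_mem_of_mem_span (fun c hc y hy => smul_mem_Tht hc hy) ?_ (h.Vsp_eq_span_gen hf)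
  rintro _ ⟨a, n, j, hj, rfl⟩
  exact ⟨1, one_ne_zero, by rw [one_smul]; exact gen_mem_Tht a n hj⟩

variable (p m α β) in
/-- Subgroups stable under scalars of norm at most one and the affine group. -/
structure AffStable (Λ : AddSubgroup (ℚ_[p] → L)) : Prop where
  smul : ∀ c : L, ‖c‖ ≤ 1 → ∀ f ∈ Λ, c • f ∈ Λ
  absorb : ∀ f ∈ Vsp p m 𝔮, ∃ c : L, c ≠ 0 ∧ c • f ∈ Λ
  aff : ∀ b d : ℚ_[p], d ≠ 0 → ∀ f ∈ Λ, α ^ (-d.valuation) • aff L b d f ∈ Λ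

lemma AffStable.exists_smul_Tht {Λ : AddSubgroup (ℚ_[p] → L)} (hΛ : AffStable p m α β Λ)
    (h : Par p m α β) : ∃ c : L, c ≠ 0 ∧ ∀ f ∈ Tht p m α β, c • f ∈ Λ := by
  have h0 : ∃ c : L, c ≠ 0 ∧ ∀ j < m + 1, c • gen p m α β 0 0 j ∈ Λ := by
    obtain ⟨c, hc, h1⟩ := exists_smul_mem_of_lt hΛ.smul
      (fun j => if j ≤ m then gen p m α β 0 0 j else 0) (fun j => by
        by_cases hj : j ≤ m
        · simp only [hj, if_true]; exact hΛ.absorb _ (gen_mem_Vsp 0 0 hj)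
        · simp only [hj, if_false]; exact ⟨1, one_ne_zero, by rw [smul_zero]; exact zero_mem _⟩) (m + 1)
    refine ⟨c, hc, fun j hj => ?_⟩
    have := h1 j hj
    rwa [if_pos (by omega)] at this
  obtain ⟨c, hc, h1⟩ := h0
  refine ⟨c, hc, fun f hf => ?_⟩
  induction hf using AddSubgroup.closure_induction with
  | mem f hf =>
    obtain ⟨c', a, n, j, hc', hj, rfl⟩ := hf
    rw [smul_comm]
    refine hΛ.smul _ hc' _ ?_
    have h2 := hΛ.aff (a * 𝔭 ^ (-n)) (𝔭 ^ (-n)) (zpow_ne_zero _ padic_p_ne_zero) _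
      (h1 j (by omega))
    rw [valuation_zpow, valuation_p, mul_one, neg_neg, map_smul] at h2
    have h3 := hΛ.smul (kap p m β ^ n / α ^ n)
      (by rw [norm_div, norm_zpow, norm_zpow, h.norm_kap, div_self (zpow_ne_zero _ h.norm_pos.ne')])
      _ h2
    rw [smul_smul, div_mul_cancel₀ _ (zpow_ne_zero _ h.a_ne), smul_comm, ← aff_gen] at h3
    exact h3
  | zero => rw [smul_zero]; exact zero_mem _
  | add f g _ _ hf hg => rw [smul_add]; exact add_mem hf hg
  | neg f _ hf => rw [smul_neg]; exact neg_mem hf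

lemma exists_nat_inB (n : ℕ) {a : ℚ_[p]} (ha : ‖a‖ ≤ 1) : ∃ t < p ^ n, InB (t : ℚ_[p]) n a := by
  obtain ⟨x, rfl⟩ : ∃ x : ℤ_[p], (x : ℚ_[p]) = a := ⟨⟨a, ha⟩, rfl⟩
  refine ⟨x.appr n, PadicInt.appr_lt _ _, ?_⟩
  have := (PadicInt.norm_le_pow_iff_mem_span_pow _ _).2 (PadicInt.appr_spec n x)
  rw [PadicInt.norm_def, PadicInt.coe_sub, PadicInt.coe_natCast] at this
  exact this

lemma Par.phi_eq (h : Par p m α β) (a : ℚ_[p]) (n : ℤ) :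
    ∃ x y : L, phi p 𝔮 a n = x • psi p α β a n + y • ind p L a n := by
  have hp := p_ne p L
  have hq := h.qq_ne_zero
  have hqp : 𝔮 ≠ p := h.qq_ne_p
  have ha := h.a_ne
  have hb := h.b_ne
  have hab : (α / β) ^ n ≠ 0 := zpow_ne_zero _ (div_ne_zero ha hb)
  have h1 := phi_sub_parent hq a n
  have h2 := sub_ne_zero.2 hqp
  have h3 := sub_ne_zero.2 hqp.symm
  refine ⟨p / ((p - 𝔮) * (α / β) ^ n), - (𝔮 - 1) / (p - 𝔮), ?_⟩
  rw [psi, smul_smul]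
  ext z
  have h1 := congrFun h1 z
  simp only [Pi.sub_apply, Pi.smul_apply, smul_eq_mul, Pi.add_apply] at h1 ⊢
  have h4 : (p : L) * phi p 𝔮 a n z - phi p 𝔮 a (n - 1) z +
      -(𝔮 - 1) * ind p L a n z = (p - 𝔮) * phi p 𝔮 a n z := by
    field_simp at h1
    linear_combination h1
  field_simp
  linear_combination -h4

lemma Par.mem_spanPair_of_pev_phi (h : Par p m α β) (n : ℕ) {a : ℚ_[p]} (ha : ‖a‖ ≤ 1)
    {P : L[X]} (hP : P.natDegree ≤ m) (v : Vsp p m 𝔮)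
    (hv : (v : ℚ_[p] → L) = pev p P (phi p 𝔮 a n)) :
    v ∈ spanPair L p m (bfamV m 𝔮 (ind p L)) (bfamV m 𝔮 (psi p α β)) := by
  have := charZero_of_padic p L
  obtain ⟨t, ht, hta⟩ := exists_nat_inB n ha
  obtain ⟨x, y, hxy⟩ := h.phi_eq (t : ℚ_[p]) n
  have key : ∀ {χ : ℚ_[p] → ℤ → ℚ_[p] → L}, AddFam p m 𝔮 χ →
      ∀ R ∈ span L {Q | ∃ j < m + 1, Q = bp L j},
        pev p (R.comp (lin p L (t : ℚ_[p]) n)) (χ t n) ∈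
          span L {f | ∃ j ≤ m, f = bfam χ n t j} := by
    intro χ _ R hR
    induction hR using span_induction with
    | mem R hR =>
      obtain ⟨j, hj, rfl⟩ := hR
      exact subset_span ⟨j, by omega, rfl⟩
    | zero => rw [zero_comp, map_zero]; exact zero_mem _
    | add R R' _ _ h1 h2 => rw [add_comp, map_add]; exact add_mem h1 h2
    | smul c R _ h1 => rw [smul_comp, map_smul]; exact smul_mem _ _ h1
  have hR : recenter (t : ℚ_[p]) n P ∈ span L {Q | ∃ j < m + 1, Q = bp L j} :=
    mem_span_bp L (m + 1) _ (degree_le_natDegree.trans_lt (by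
      exact_mod_cast Nat.lt_succ_of_le ((natDegree_recenter_le _ _ _).trans hP)))
  have hle : ∀ {χ : ℚ_[p] → ℤ → ℚ_[p] → L} (hχ : AddFam p m 𝔮 χ),
      (∀ j ≤ m, bfamV m 𝔮 χ n t j ∈
        spanPair L p m (bfamV m 𝔮 (ind p L)) (bfamV m 𝔮 (psi p α β))) →
      pev p P (χ t n) ∈ (spanPair L p m (bfamV m 𝔮 (ind p L))
        (bfamV m 𝔮 (psi p α β))).map (Vsp p m 𝔮).subtype := by
    intro χ hχ hj
    have h1 := key hχ _ hR
    rw [recenter_comp_lin] at h1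
    refine span_le.2 ?_ h1
    rintro _ ⟨j, hjm, rfl⟩
    exact ⟨_, hj j hjm, hχ.coe_bfamV n t hjm⟩
  have h1 := hle h.addFam_ind fun j hj => subset_span ⟨n, t, j, ht, hj, Or.inl rfl⟩
  have h2 := hle h.addFam_psi fun j hj => subset_span ⟨n, t, j, ht, hj, Or.inr rfl⟩
  have h3 := add_mem (smul_mem _ x h2) (smul_mem _ y h1)
  rw [← map_smul, ← map_smul, ← map_add, ← hxy, ← phi_congr hta, ← hv] at h3
  obtain ⟨w, hw, hwv⟩ := h3
  rwa [← Subtype.ext (show (w : ℚ_[p] → L) = v from hwv)]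

variable [IsUltrametricDist L] [CompleteSpace L]

lemma Par.eventually_dilV_mem (h : Par p m α β) (v : Vsp p m 𝔮) : ∀ᶠ N in atTop, (h.dilV ^ N) v ∈
      spanPair L p m (bfamV m 𝔮 (ind p L)) (bfamV m 𝔮 (psi p α β)) := by
  obtain ⟨v, hv⟩ := v
  induction hv using span_induction with
  | mem f hf =>
    obtain ⟨P, a, n, hP, rfl⟩ := hf
    obtain ⟨M, hM⟩ := exists_inB a
    filter_upwards [eventually_ge_atTop M, eventually_ge_atTop n.natAbs] with N hN hn
    obtain ⟨n', hn'⟩ : ∃ n' : ℕ, n + N = n' := ⟨(n + N).toNat, by omega⟩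
    have hmem := (natDegree_comp_affine_le P (η 0)
      (η (𝔭 ^ (-(N : ℤ))))).trans hP
    have e1 := h.coe_dilV_pow N ⟨_, pev_phi_mem hP a n⟩
    rw [aff_pev, aff_phi, add_zero, neg_neg, sub_neg_eq_add, hn'] at e1
    have hna : ‖a * 𝔭 ^ (N : ℤ)‖ ≤ 1 := by
      rw [norm_mul, norm_p_zpow]
      rw [InB, sub_zero, neg_neg] at hM
      calc _ ≤ (p : ℝ) ^ (M : ℤ) * (p : ℝ) ^ (-(N : ℤ)) := by gcongr
        _ = (p : ℝ) ^ ((M : ℤ) - N) := by rw [← zpow_add₀ (p_pos p).ne', sub_eq_add_neg]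
        _ ≤ (p : ℝ) ^ (0 : ℤ) := zpow_le_zpow_p.2 (by omega)
        _ = 1 := zpow_zero _
    have h2 := h.mem_spanPair_of_pev_phi n' hna hmem ⟨_, pev_phi_mem hmem _ _⟩ rfl
    have h3 := smul_mem _ (α ^ N) h2
    convert h3 using 1
    exact Subtype.ext e1
  | zero => 
    refine Eventually.of_forall fun N => ?_
    have := (h.dilV ^ N).map_zero
    exact this ▸ zero_mem _
  | add f g hf hg h1 h2 =>
    filter_upwards [h1, h2] with N h1 h2
    have := add_mem h1 h2
    rwa [← map_add] at this
  | smul c f hf h1 =>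
    filter_upwards [h1] with N h1
    have := smul_mem _ c h1
    rwa [← map_smul] at this

lemma AffStable.subset_smul_Tht [ProperSpace L] {Λ : AddSubgroup (ℚ_[p] → L)}
    (hΛ : AffStable p m α β Λ) (h : Par p m α β) (hV : ∀ f ∈ Λ, f ∈ Vsp p m 𝔮)
    (hline : ∀ f, f ≠ 0 → ∃ c : L, c • f ∉ Λ) :
    ∃ c : L, c ≠ 0 ∧ ∀ f ∈ Λ, ∃ g ∈ Tht p m α β, f = c • g := by
  obtain ⟨c₀, hc₀, h0⟩ := hΛ.exists_smul_Tht h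
  obtain ⟨K, hK⟩ := h.sys
  let Λ' : AddSubgroup (Vsp p m 𝔮) :=
    { carrier := {v | c₀ • (v : ℚ_[p] → L) ∈ Λ}
      zero_mem' := by simp
      add_mem' := fun {v w} hv hw => by
        simp only [Set.mem_ofPred_eq, Submodule.coe_add, smul_add] at *; exact add_mem hv hw
      neg_mem' := fun {v} hv => by
        simp only [Set.mem_ofPred_eq, Submodule.coe_neg, smul_neg] at *; exact neg_mem hv }
  have hmem : ∀ v : Vsp p m 𝔮, v ∈ Λ' ↔ c₀ • (v : ℚ_[p] → L) ∈ Λ := fun _ => Iff.rfl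
  have hGΛ : ∀ y ∈ Λ', h.dilV y ∈ Λ' := by
    intro y hy
    rw [hmem] at hy ⊢
    have := hΛ.aff 0 _ (inv_ne_zero (padic_p_ne_zero (p := p))) _ hy
    rw [valuation_inv, valuation_p, neg_neg, zpow_one, map_smul, smul_comm] at this
    exact this
  obtain ⟨c, hc, h1⟩ := hK.exists_subset_smul (Λ := Λ')
    (fun c hc y hy => smul_mem_Tht hc hy)
    (fun v => by
      obtain ⟨c, hc, h1⟩ := h.exists_smul_mem_Tht v.2
      exact ⟨c, hc, h1⟩)
    (fun c hc y hy => by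
      rw [hmem] at hy ⊢
      rw [Submodule.coe_smul, smul_comm]; exact hΛ.smul c hc _ hy)
    (fun y hy => h0 _ hy)
    (fun y hy => by
      rw [hmem] at hy ⊢
      have := hΛ.aff (-1) 1 one_ne_zero _ hy
      rwa [valuation_one, neg_zero, zpow_zero, one_smul, ← tr_eq_aff, map_smul] at this)
    hGΛ
    (fun y hy => by
      obtain ⟨c, hc⟩ := hline y (fun h => hy (Subtype.ext h))
      refine ⟨c / c₀, fun hn => hc ?_⟩
      rwa [hmem, Submodule.coe_smul, smul_smul, mul_div_cancel₀ _ hc₀] at hn)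
  have hGN : ∀ N : ℕ, ∀ y ∈ Λ', (h.dilV ^ N) y ∈ Λ' := by
    intro N y hy
    induction N with
    | zero => exact hy
    | succ N ih => rw [pow_succ', LinearEquiv.mul_apply]; exact hGΛ _ ih
  refine ⟨c₀ * c, mul_ne_zero hc₀ hc, fun f hf => ?_⟩
  obtain ⟨v, hv⟩ : ∃ v : Vsp p m 𝔮, (v : ℚ_[p] → L) = c₀⁻¹ • f :=
    ⟨⟨_, smul_mem _ _ (hV f hf)⟩, rfl⟩
  have hvf : c₀ • (v : ℚ_[p] → L) = f := by rw [hv, smul_smul, mul_inv_cancel₀ hc₀, one_smul]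
  obtain ⟨N, hN⟩ := (h.eventually_dilV_mem v).exists
  obtain ⟨x, hx, hxv⟩ := h1 _ (hGN N v (by rw [hmem, hvf]; exact hf)) hN
  have h2 : x = (h.dilV ^ N) (c⁻¹ • v) := by
    rw [map_smul, hxv, smul_smul, inv_mul_cancel₀ hc, one_smul]
  rw [mem_ThtV, h2, h.coe_dilV_pow] at hx
  have hp := padic_p_ne_zero (p := p)
  have h3 := h.aff_mem_Tht 0 (zpow_ne_zero (N : ℤ) hp) hx
  rw [map_smul, smul_smul, aff_aff, mul_zero, zero_add, ← zpow_add₀ hp, neg_add_cancel, zpow_zero,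
    valuation_zpow, valuation_p, mul_one, ← zpow_natCast, ← zpow_add₀ h.a_ne,
    neg_add_cancel, zpow_zero, one_smul] at h3
  refine ⟨_, h3, ?_⟩
  ext z
  rw [Pi.smul_apply, aff_apply, one_mul, sub_zero, Submodule.coe_smul, Pi.smul_apply, smul_smul,
    mul_inv_cancel_right₀ hc, ← hvf, Pi.smul_apply]

lemma AffStable.commensurable_Tht [ProperSpace L] {Λ : AddSubgroup (ℚ_[p] → L)}
    (hΛ : AffStable p m α β Λ) (h : Par p m α β) (hV : ∀ f ∈ Λ, f ∈ Vsp p m 𝔮)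
    (hline : ∀ f, f ≠ 0 → ∃ c : L, c • f ∉ Λ) :
    (∃ c : L, c ≠ 0 ∧ ∀ f ∈ Λ, ∃ g ∈ Tht p m α β, f = c • g) ∧
      ∃ c : L, c ≠ 0 ∧ ∀ f ∈ Tht p m α β, ∃ g ∈ Λ, f = c • g := by
  refine ⟨hΛ.subset_smul_Tht h hV hline, ?_⟩
  obtain ⟨c, hc, h1⟩ := hΛ.exists_smul_Tht h
  exact ⟨c⁻¹, inv_ne_zero hc, fun f hf => ⟨_, h1 f hf, by
    rw [smul_smul, inv_mul_cancel₀ hc, one_smul]⟩⟩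

/-- The additive group underlying a stable lattice. -/
def latticeGroup {k : ℕ} {Λ : Set (ℚ_[p] → L)} (hΛ : IsLatticeStable p L k α β Λ) :
    AddSubgroup (ℚ_[p] → L) where
  carrier := Λ
  zero_mem' := hΛ.2.1
  add_mem' := fun {f g} hf hg => hΛ.2.2.1 f hf g hg
  neg_mem' := fun {f} hf => by
    have := hΛ.2.2.2.1 (-1) (by simp) f hf
    rwa [neg_one_smul] at this

lemma Par.lattice_commensurable_Tht [ProperSpace L] (h : Par p m α β) {k : ℕ} (hk : k - 2 = m)
    {Λ : Set (ℚ_[p] → L)} (hΛ : IsLatticeStable p L k α β Λ) :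
    (∃ c : L, c ≠ 0 ∧ ∀ f ∈ Λ, ∃ g ∈ Tht p m α β, f = c • g) ∧
      ∃ c : L, c ≠ 0 ∧ ∀ f ∈ Tht p m α β, ∃ g ∈ Λ, f = c • g := by
  have hV := h.piRep_eq hk
  have hsub : ∀ f ∈ latticeGroup hΛ, f ∈ Vsp p m 𝔮 := fun f hf => by
    rw [← hV]; exact hΛ.1 f hf
  refine AffStable.commensurable_Tht (Λ := latticeGroup hΛ) ⟨?_, ?_, ?_⟩ h hsub ?_
  · exact hΛ.2.2.2.1
  · intro f hf
    exact hΛ.2.2.2.2.1 f (by rw [hV]; exact hf)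
  · intro b d hd f hf
    have := hΛ.2.2.2.2.2.2 !![1, b; 0, d] (by rwa [det2_affMat]) f hf
    rwa [gAct_aff] at this
  · intro f hf
    by_contra! hcon
    have h1 := hcon 1
    rw [one_smul] at h1
    exact hΛ.2.2.2.2.2.1 f (hΛ.1 f h1) hf hcon

lemma Par.commensurable [ProperSpace L] (h : Par p m α β) {k : ℕ} (hk : k - 2 = m)
    {Λ₁ Λ₂ : Set (ℚ_[p] → L)} (h1 : IsLatticeStable p L k α β Λ₁)
    (h2 : IsLatticeStable p L k α β Λ₂) : Commensurable' p L Λ₁ Λ₂ := by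
  have key : ∀ {Λ₁ Λ₂ : Set (ℚ_[p] → L)}, IsLatticeStable p L k α β Λ₁ →
      IsLatticeStable p L k α β Λ₂ → ∃ c : L, c ≠ 0 ∧ ∀ f ∈ Λ₁, ∃ g ∈ Λ₂, f = c • g := by
    intro Λ₁ Λ₂ h1 h2
    obtain ⟨c, hc, hc'⟩ := (h.lattice_commensurable_Tht hk h1).1
    obtain ⟨d, hd, hd'⟩ := (h.lattice_commensurable_Tht hk h2).2
    refine ⟨c * d, mul_ne_zero hc hd, fun f hf => ?_⟩
    obtain ⟨g, hg, rfl⟩ := hc' f hf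
    obtain ⟨g', hg', rfl⟩ := hd' g hg
    exact ⟨g', hg', smul_smul _ _ _⟩
  obtain ⟨c, hc, hc'⟩ := key h1 h2
  obtain ⟨d, hd, hd'⟩ := key h2 h1
  exact ⟨c, hc, hc', d, hd, hd'⟩

end Commensurable

section Pairing

variable {L : Type} [Field L]

/-- The alternating sum `∑ (-1)ⁱ P⁽ⁱ⁾ Q⁽ᵐ⁻ⁱ⁾`. -/
def wr (m : ℕ) (P Q : L[X]) : L[X] :=
  ∑ i ∈ range (m + 1), (-1) ^ i * (derivative^[i] P * derivative^[m - i] Q)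

lemma derivative_wr {P Q : L[X]} (hP : P.natDegree ≤ m) (hQ : Q.natDegree ≤ m) :
    derivative (wr m P Q) = 0 := by
  set u : ℕ → L[X] := fun i => (-1) ^ i * (derivative^[i] P * derivative^[m + 1 - i] Q) with hu
  have h1 : derivative (wr m P Q) = ∑ i ∈ range (m + 1), (u i - u (i + 1)) := by
    rw [wr, derivative_sum]
    refine sum_congr rfl fun i hi => ?_
    have hi : i ≤ m := by simpa [Nat.lt_succ_iff] using hi
    have e1 : m + 1 - i = (m - i) + 1 := by omega
    have e2 : m + 1 - (i + 1) = m - i := by omega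
    have e3 : ((-1 : L[X]) ^ i) = C ((-1) ^ i) := by simp
    rw [hu]
    simp only [e1, e2, Function.iterate_succ_apply', pow_succ]
    rw [e3, derivative_C_mul, derivative_mul]
    ring
  rw [h1, sum_range_sub', hu]
  simp only [Function.iterate_zero, id, pow_zero, one_mul, Nat.sub_zero, Nat.sub_self]
  rw [iterate_derivative_eq_zero (Nat.lt_succ_of_le hP), iterate_derivative_eq_zero (Nat.lt_succ_of_le hQ)]
  ring

lemma iterate_derivative_comp_of_derivative_eq_C {l : L[X]} {s : L} (hl : derivative l = C s) (P : L[X])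
    (i : ℕ) : derivative^[i] (P.comp l) = C (s ^ i) * (derivative^[i] P).comp l := by
  induction i with
  | zero => simp
  | succ i ih =>
    rw [Function.iterate_succ_apply', ih, derivative_C_mul, derivative_comp, hl,
      Function.iterate_succ_apply', pow_succ, C_mul]
    ring

lemma wr_comp {l : L[X]} {s : L} (hl : derivative l = C s) (m : ℕ) (P Q : L[X]) :
    wr m (P.comp l) (Q.comp l) = C (s ^ m) * (wr m P Q).comp l := by
  rw [wr, wr, Polynomial.sum_comp, mul_sum]
  refine sum_congr rfl fun i hi => ?_
  have hi : i ≤ m := by simpa [Nat.lt_succ_iff] using hi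
  rw [iterate_derivative_comp_of_derivative_eq_C hl, iterate_derivative_comp_of_derivative_eq_C hl,
    show s ^ m = s ^ i * s ^ (m - i) by rw [← pow_add]; congr 1; omega, C_mul, mul_comp, mul_comp,
    pow_comp, neg_comp, one_comp]
  ring

lemma coeff_zero_wr_X_pow (m : ℕ) {j : ℕ} (hj : j ≤ m) (R : L[X]) :
    (wr m (X ^ j) R).coeff 0 = (-1) ^ j * (j.factorial * ((m - j).factorial * R.coeff (m - j))) := by
  have hc : ∀ (k : ℕ) (P : L[X]), (derivative^[k] P).coeff 0 = k.factorial * P.coeff k := by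
    intro k P
    rw [coeff_iterate_derivative, zero_add, Nat.descFactorial_self, nsmul_eq_mul]
  rw [wr, finsetSum_coeff, sum_eq_single j]
  · rw [show ((-1 : L[X]) ^ j) = C ((-1) ^ j) by simp, coeff_C_mul, mul_coeff_zero, hc, hc, coeff_X_pow_self]
    ring
  · intro i _ hij
    rw [mul_coeff_zero, mul_coeff_zero, hc, coeff_X_pow, if_neg hij]
    ring
  · intro h
    exact absurd (mem_range.2 (by omega)) h

/-- The affine-invariant pairing of polynomials of degree at most `m`. -/
def prg (m : ℕ) : L[X] →ₗ[L] L[X] →ₗ[L] L :=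
  mk₂ L (fun P Q => (wr m P Q).coeff 0)
    (fun P P' Q => by simp only [wr, iterate_map_add, add_mul, mul_add, sum_add_distrib, coeff_add])
    (fun c P Q => by
      simp only [wr, iterate_derivative_smul, smul_mul_assoc, mul_smul_comm, ← smul_sum,
        coeff_smul])
    (fun P Q Q' => by simp only [wr, iterate_map_add, mul_add, sum_add_distrib, coeff_add])
    (fun c P Q => by simp only [wr, iterate_derivative_smul, mul_smul_comm, ← smul_sum, coeff_smul])

lemma prg_apply (m : ℕ) (P Q : L[X]) : prg m P Q = (wr m P Q).coeff 0 := rfl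

lemma prg_comp [CharZero L] {l : L[X]} {s : L} (hl : derivative l = C s) {P Q : L[X]}
    (hP : P.natDegree ≤ m) (hQ : Q.natDegree ≤ m) :
    prg m (P.comp l) (Q.comp l) = s ^ m * prg m P Q := by
  rw [prg_apply, prg_apply, wr_comp hl,
    eq_C_of_natDegree_eq_zero (derivative_eq_zero.1 (derivative_wr hP hQ)), C_comp, coeff_C_mul]

end Pairing

lemma prg_lin_pow (a : ℚ_[p]) (n : ℤ) {j : ℕ} (hj : j ≤ m) {Q : L[X]} (hQ : Q.natDegree ≤ m) :
    prg m (lin p L a n ^ j) Q = ((p : L) ^ (-n)) ^ m *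
      ((-1) ^ j * (j.factorial * ((m - j).factorial * (recenter a n Q).coeff (m - j)))) := by
  have := charZero_of_padic p L
  conv_lhs => rw [← recenter_comp_lin a n Q, ← X_pow_comp]
  rw [prg_comp (s := (p : L) ^ (-n)) (by
      simp [lin]) ((natDegree_X_pow_le j).trans hj)
    ((natDegree_recenter_le a n Q).trans hQ), prg_apply, coeff_zero_wr_X_pow m hj]

variable (p) in
/-- The operator adjoint to the tree relations. -/
def tau (q : L) : (ℚ_[p] → ℤ → L[X]) →ₗ[L] (ℚ_[p] → ℤ → L[X]) where
  toFun f a n := f a (n - 1) + q⁻¹ • ∑ i ∈ range p, f (a + i * 𝔭 ^ n) (n + 1) -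
    (1 + p / q) • f a n
  map_add' f g := by
    ext1 a; ext1 n
    simp only [Pi.add_apply, sum_add_distrib]
    module
  map_smul' c f := by
    ext1 a; ext1 n
    simp only [Pi.smul_apply, ← smul_sum, RingHom.id_apply]
    module

lemma tau_apply (q : L) (f : ℚ_[p] → ℤ → L[X]) (a : ℚ_[p]) (n : ℤ) :
    tau p q f a n = f a (n - 1) + q⁻¹ • ∑ i ∈ range p, f (a + i * 𝔭 ^ n) (n + 1) -
      (1 + p / q) • f a n := rfl

/-- Functions on the vertices of the tree with values in polynomials of degree at most `m`. -/
def TF (p m : ℕ) [Fact p.Prime] (L : Type) [NontriviallyNormedField L] :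
    Submodule L (ℚ_[p] → ℤ → L[X]) where
  carrier := {f | (∀ a b n, InB a n b → f b n = f a n) ∧ ∀ a n, (f a n).natDegree ≤ m}
  zero_mem' := ⟨fun _ _ _ _ => rfl, fun _ _ => by simp⟩
  add_mem' hf hg := ⟨fun a b n h => by simp only [Pi.add_apply, hf.1 a b n h, hg.1 a b n h],
    fun a n => (natDegree_add_le _ _).trans (max_le (hf.2 a n) (hg.2 a n))⟩
  smul_mem' c f hf := ⟨fun a b n h => by simp only [Pi.smul_apply, hf.1 a b n h],
    fun a n => (natDegree_smul_le _ _).trans (hf.2 a n)⟩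

variable (p α) in
/-- Boundedness of a function on the tree. -/
def TBd (c : ℝ) (f : ℚ_[p] → ℤ → L[X]) : Prop :=
  ∀ a n j, ‖(recenter a n (f a n)).coeff j‖ ≤ c * ‖α‖ ^ n

/-- The functional attached to a function on the tree killed by `tau`. -/
lemma treeRel_of_tau_eq_zero {q : L} (hq : q ≠ 0) {f : ℚ_[p] → ℤ → L[X]} (hf : f ∈ TF p m L)
    (h0 : tau p q f = 0) : TreeRel p q (fun a n => q ^ (-n) • (prg m).flip (f a n)) where
  ball a b n h := by rw [hf.1 a b n h]
  rel a n := by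
    have h1 := congrFun (congrFun h0 a) n
    rw [tau_apply] at h1
    simp only [Pi.zero_apply] at h1
    have h2 := congrArg (fun Q => q ^ (-n) • (prg m).flip Q) h1
    simp only [map_sub, map_add, map_smul, map_sum, map_zero, smul_zero] at h2
    rw [← smul_sum, smul_smul, neg_sub, show q⁻¹ * q ^ (1 - n) = q ^ (-n) by
      rw [← zpow_neg_one, ← zpow_add₀ hq]; congr 1; ring, neg_add, zpow_add₀ hq, zpow_neg_one,
      ← sub_eq_zero, ← h2]
    module

lemma Par.exists_functional (h : Par p m α β) [IsUltrametricDist L] {f : ℚ_[p] → ℤ → L[X]}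
    (hf : f ∈ TF p m L) {c : ℝ} (hc : TBd p α c f) (h0 : tau p 𝔮 f = 0) (hne : f ≠ 0) :
    ∃ F : (ℚ_[p] → L) →ₗ[L] L, (∃ v ∈ Vsp p m 𝔮, F v ≠ 0) ∧ ∀ v ∈ Tht p m α β, ‖F v‖ ≤ c := by
  have := charZero_of_padic p L
  obtain ⟨F, hF⟩ := exists_functional_of_treeRel h.qq_ne_zero h.qq_ne_one
    (treeRel_of_tau_eq_zero h.qq_ne_zero hf h0)
  have hp := p_pos p
  have hval : ∀ a n j, j ≤ m → F (pev p (lin p L a n ^ j) (phi p 𝔮 a n)) =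
      𝔮 ^ (-n) * (((p : L) ^ (-n)) ^ m *
      ((-1) ^ j * (j.factorial * ((m - j).factorial * (recenter a n (f a n)).coeff (m - j))))) := by
    intro a n j hj
    rw [hF, LinearMap.smul_apply, LinearMap.flip_apply, prg_lin_pow a n hj (hf.2 a n), smul_eq_mul]
  have hc0 : 0 ≤ c := by
    have := (norm_nonneg _).trans (hc 0 0 0)
    rwa [zpow_zero, mul_one] at this
  refine ⟨F, ?_, fun v hv => ?_⟩
  · by_contra! hcon
    apply hne
    ext1 a; ext1 n
    have h1 : recenter a n (f a n) = 0 := by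
      ext j
      rw [coeff_zero]
      by_cases hj : j ≤ m
      · have h2 := hval a n (m - j) (by omega)
        rw [hcon _ (pev_phi_mem ((natDegree_lin_pow a n _).trans (by omega)) a n),
          show m - (m - j) = j by omega] at h2
        have h3 := h2.symm
        simpa [h.qq_ne_zero, p_ne p L, zpow_ne_zero, Nat.factorial_ne_zero] using h3
      · exact coeff_eq_zero_of_natDegree_lt
          (((natDegree_recenter_le a n _).trans (hf.2 a n)).trans_lt (by omega))
    rw [← recenter_comp_lin a n (f a n), h1, zero_comp]
    rfl
  · induction hv using AddSubgroup.closure_induction with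
    | mem f hf =>
      obtain ⟨x, a, n, j, hx, hj, rfl⟩ := hf
      rw [gen, map_smul, map_smul, hval a n j hj]
      have hcc := hc a n (m - j)
      have hn : ∀ k : ℕ, ‖(k.factorial : L)‖ ≤ 1 := fun k => by
        have := norm_intCast_le_one' p L (k.factorial : ℤ)
        exact_mod_cast this
      have ha := h.norm_pos
      simp only [smul_eq_mul, norm_mul, norm_pow, norm_zpow, norm_neg, norm_one, one_pow, one_mul,
        h.norm_kap, h.norm_qq, norm_p p L]
      set y := ‖(recenter a n (f a n)).coeff (m - j)‖
      calc _ ≤ 1 * (‖α‖ ^ n * ((‖α‖ ^ 2 * (p : ℝ) ^ m) ^ (-n) * ((((p : ℝ)⁻¹) ^ (-n)) ^ m *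
            (1 * (1 * (c * ‖α‖ ^ n)))))) := by
            gcongr
            · exact hn j
            · exact hn _
        _ = c := by
            have h1 : (‖α‖ ^ 2) ^ (-n) = (‖α‖ ^ n)⁻¹ * (‖α‖ ^ n)⁻¹ := by
              rw [zpow_neg, pow_two, mul_zpow, mul_inv]
            have h2 : ((p : ℝ) ^ m) ^ (-n) = ((((p : ℝ)⁻¹) ^ (-n)) ^ m)⁻¹ := by
              rw [inv_zpow, inv_pow, inv_inv, ← zpow_natCast, ← zpow_natCast, zpow_comm]
            have h3 : (((p : ℝ)⁻¹) ^ (-n)) ^ m ≠ 0 := by positivity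
            have h4 : ‖α‖ ^ n ≠ 0 := by positivity
            rw [mul_zpow, h1, h2]
            field_simp
    | zero => rw [map_zero, norm_zero]; exact hc0
    | add f g _ _ hf hg =>
      rw [map_add]
      exact (norm_add_le_max _ _).trans (max_le hf hg)
    | neg f _ hf => rwa [map_neg, norm_neg]

lemma recenter_recenter (a a' : ℚ_[p]) (n n' : ℤ) (P : L[X]) :
    recenter a n (recenter a' n' P) = recenter (a' + 𝔭 ^ n' * a) (n' + n) P := by
  have hp := p_ne p L
  rw [recenter, recenter, recenter, comp_assoc]
  congr 1
  have h1 : η (a' + 𝔭 ^ n' * a) =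
      η a' + (p : L) ^ n' * η a := by
    rw [map_add, map_mul, map_zpow₀, algebraMap_p]
  rw [add_comp, mul_comp, C_comp, X_comp, C_comp, zpow_add₀ hp, h1, C_mul, C_add, C_mul]
  ring

lemma recenter_smul (a : ℚ_[p]) (n : ℤ) (c : L) (P : L[X]) :
    recenter a n (c • P) = c • recenter a n P := smul_comp ..

lemma recenter_add (a : ℚ_[p]) (n : ℤ) (P Q : L[X]) :
    recenter a n (P + Q) = recenter a n P + recenter a n Q := add_comp

lemma recenter_sub (a : ℚ_[p]) (n : ℤ) (P Q : L[X]) :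
    recenter a n (P - Q) = recenter a n P - recenter a n Q := sub_comp

lemma recenter_sum (a : ℚ_[p]) (n : ℤ) {ι : Type*} (s : Finset ι) (P : ι → L[X]) :
    recenter a n (∑ i ∈ s, P i) = ∑ i ∈ s, recenter a n (P i) := Polynomial.sum_comp ..

lemma TBd.add [IsUltrametricDist L] {c : ℝ} {f g : ℚ_[p] → ℤ → L[X]} (hf : TBd p α c f)
    (hg : TBd p α c g) : TBd p α c (f + g) := fun a n j => by
  rw [Pi.add_apply, Pi.add_apply, recenter_add, coeff_add]
  exact (norm_add_le_max _ _).trans (max_le (hf a n j) (hg a n j))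

lemma TBd.smul {c : ℝ} {f : ℚ_[p] → ℤ → L[X]} (hf : TBd p α c f) (x : L) :
    TBd p α (‖x‖ * c) (x • f) := fun a n j => by
  rw [Pi.smul_apply, Pi.smul_apply, recenter_smul, coeff_smul, norm_smul, mul_assoc]
  exact mul_le_mul_of_nonneg_left (hf a n j) (norm_nonneg _)

lemma TBd.mono {c c' : ℝ} {f : ℚ_[p] → ℤ → L[X]} (hf : TBd p α c f) (h : c ≤ c') :
    TBd p α c' f := fun a n j =>
  (hf a n j).trans (mul_le_mul_of_nonneg_right h (zpow_nonneg (norm_nonneg _) _))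

lemma TBd.neg {c : ℝ} {f : ℚ_[p] → ℤ → L[X]} (hf : TBd p α c f) : TBd p α c (-f) := by
  have := hf.smul (-1)
  rwa [norm_neg, norm_one, one_mul, neg_one_smul] at this

lemma TBd.nonneg {c : ℝ} {f : ℚ_[p] → ℤ → L[X]} (hf : TBd p α c f) : 0 ≤ c := by
  have := (norm_nonneg _).trans (hf 0 0 0)
  rwa [zpow_zero, mul_one] at this

/-- The affine translates of a function on the tree. -/
def trn (a₀ : ℚ_[p]) (n₀ : ℤ) (f : ℚ_[p] → ℤ → L[X]) : ℚ_[p] → ℤ → L[X] :=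
  fun a n => recenter a₀ n₀ (f (a₀ + 𝔭 ^ n₀ * a) (n₀ + n))

lemma trn_mem_TF (a₀ : ℚ_[p]) (n₀ : ℤ) {f : ℚ_[p] → ℤ → L[X]} (hf : f ∈ TF p m L) :
    trn a₀ n₀ f ∈ TF p m L := by
  refine ⟨fun a b n h => ?_, fun a n => (natDegree_recenter_le _ _ _).trans (hf.2 _ _)⟩
  unfold trn
  rw [hf.1 _ _ _ (?_ : InB (a₀ + 𝔭 ^ n₀ * a) (n₀ + n) (a₀ + 𝔭 ^ n₀ * b))]
  unfold InB at h ⊢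
  rw [show a₀ + 𝔭 ^ n₀ * b - (a₀ + 𝔭 ^ n₀ * a) = 𝔭 ^ n₀ * (b - a) by ring,
    norm_mul, norm_p_zpow, neg_add, zpow_add₀ (p_pos p).ne']
  exact mul_le_mul_of_nonneg_left h (zpow_nonneg (p_pos p).le _)

lemma TBd.trn (ha : α ≠ 0) {c : ℝ} {f : ℚ_[p] → ℤ → L[X]} (hf : TBd p α c f) (a₀ : ℚ_[p])
    (n₀ : ℤ) : TBd p α (c * ‖α‖ ^ n₀) (trn a₀ n₀ f) := fun a n j => by
  rw [PadicPi.trn, recenter_recenter, mul_assoc, ← zpow_add₀ (norm_ne_zero_iff.2 ha)]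
  exact hf _ _ _

lemma tau_trn (q : L) (a₀ : ℚ_[p]) (n₀ : ℤ) (f : ℚ_[p] → ℤ → L[X]) :
    tau p q (trn a₀ n₀ f) = trn a₀ n₀ (tau p q f) := by
  have hp := padic_p_ne_zero (p := p)
  ext1 a; ext1 n
  simp only [trn, tau_apply, recenter_sub, recenter_add, recenter_smul, recenter_sum]
  have h1 : ∀ i : ℕ, a₀ + 𝔭 ^ n₀ * (a + i * 𝔭 ^ n) =
      a₀ + 𝔭 ^ n₀ * a + i * 𝔭 ^ (n₀ + n) := fun i => by
    rw [zpow_add₀ hp]; ring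
  simp only [h1, add_sub_assoc, add_assoc]

lemma natDegree_tau_le {q : L} {f : ℚ_[p] → ℤ → L[X]} (hf : f ∈ TF p m L) (a : ℚ_[p]) (n : ℤ) :
    (tau p q f a n).natDegree ≤ m := by
  have h1 : ∀ a n, f a n ∈ degreeLE L m := fun a n =>
    mem_degreeLE.2 (natDegree_le_iff_degree_le.1 (hf.2 a n))
  rw [natDegree_le_iff_degree_le, ← mem_degreeLE, tau_apply]
  exact Submodule.sub_mem _ (Submodule.add_mem _ (h1 _ _) (smul_mem _ _
    (Submodule.sum_mem _ fun _ _ => h1 _ _))) (smul_mem _ _ (h1 _ _))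

/-- Coefficientwise convergence along a fixed ultrafilter. -/
def PTend (F : ℕ → L[X]) (P : L[X]) : Prop :=
  ∀ j, Tendsto (fun s => (F s).coeff j) (hyperfilter ℕ : Filter ℕ) (𝓝 (P.coeff j))

lemma PTend.comp {F : ℕ → L[X]} {P : L[X]} (h : PTend F P)
    (hF : ∀ s, (F s).natDegree ≤ m) (hP : P.natDegree ≤ m) (Q : L[X]) :
    PTend (fun s => (F s).comp Q) (P.comp Q) := fun j => by
  have key : ∀ R : L[X], R.natDegree ≤ m →
      (R.comp Q).coeff j = ∑ i ∈ range (m + 1), R.coeff i * (Q ^ i).coeff j := by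
    intro R hR
    rw [Polynomial.comp, eval₂_eq_sum_range' _ (Nat.lt_succ_of_le hR), finsetSum_coeff]
    simp only [coeff_C_mul]
  simp only [key _ (hF _), key _ hP]
  exact tendsto_finsetSum _ fun i _ => (h i).mul_const _

lemma PTend.unique {F : ℕ → L[X]} {P Q : L[X]} (h : PTend F P) (h' : PTend F Q) : P = Q := by
  ext j
  exact tendsto_nhds_unique (h j) (h' j)

lemma PTend.add {F G : ℕ → L[X]} {P Q : L[X]} (h : PTend F P) (h' : PTend G Q) :
    PTend (fun s => F s + G s) (P + Q) := fun j => by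
  simp only [coeff_add]
  exact (h j).add (h' j)

lemma PTend.smul {F : ℕ → L[X]} {P : L[X]} (h : PTend F P) (c : L) :
    PTend (fun s => c • F s) (c • P) := fun j => by
  simp only [coeff_smul]
  exact (h j).const_smul c

lemma PTend.sum {ι : Type*} {s : Finset ι} {F : ι → ℕ → L[X]} {P : ι → L[X]}
    (h : ∀ i ∈ s, PTend (F i) (P i)) : PTend (fun k => ∑ i ∈ s, F i k) (∑ i ∈ s, P i) := fun j => by
  simp only [finsetSum_coeff]
  exact tendsto_finsetSum _ fun i hi => h i hi j

lemma pTend_const (P : L[X]) : PTend (fun _ => P) P := fun _ => tendsto_const_nhds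

/-- Limits of uniformly bounded functions on the tree. -/
lemma exists_tree_limit [ProperSpace L] {F : ℕ → ℚ_[p] → ℤ → L[X]}
    (hF : ∀ s, F s ∈ TF p m L) {c : ℝ} (hc : ∀ s, TBd p α c (F s)) :
    ∃ f ∈ TF p m L, TBd p α c f ∧ ∀ a n, PTend (fun s => F s a n) (f a n) := by
  have h1 : ∀ a n, ∃ P : L[X], P.natDegree ≤ m ∧ PTend (fun s => recenter a n (F s a n)) P := by
    intro a n
    have h2 : ∀ j, ∃ x : L, Tendsto (fun s => (recenter a n (F s a n)).coeff j)
        (hyperfilter ℕ : Filter ℕ) (𝓝 x) := fun j =>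
      exists_tendsto_hyperfilter fun s => hc s a n j
    choose x hx using h2
    have hx0 : ∀ j, m < j → x j = 0 := by
      intro j hj
      refine tendsto_nhds_unique (hx j) ?_
      have : ∀ s, (recenter a n (F s a n)).coeff j = 0 := fun s =>
        coeff_eq_zero_of_natDegree_lt
          (((natDegree_recenter_le a n _).trans ((hF s).2 a n)).trans_lt hj)
      simp only [this]
      exact tendsto_const_nhds
    have hco : ∀ j, (∑ i ∈ range (m + 1), monomial i (x i)).coeff j = x j := by
      intro j
      rw [finsetSum_coeff]
      simp only [coeff_monomial]
      rw [sum_ite_eq']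
      split_ifs with h
      · rfl
      · exact (hx0 j (by simpa using h)).symm
    refine ⟨∑ i ∈ range (m + 1), monomial i (x i), ?_, fun j => ?_⟩
    · rw [natDegree_le_iff_coeff_eq_zero]
      intro N hN
      rw [hco, hx0 N hN]
    · rw [hco]; exact hx j
  choose P hPd hP using h1
  set f : ℚ_[p] → ℤ → L[X] := fun a n => (P a n).comp (lin p L a n) with hf
  have hlin : ∀ a n, (lin p L a n).natDegree ≤ 1 := fun a n => by
    simpa using natDegree_lin_pow (L := L) a n 1
  have hfd : ∀ a n, (f a n).natDegree ≤ m := fun a n => by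
    refine (natDegree_comp_le).trans ?_
    calc _ ≤ m * 1 := Nat.mul_le_mul (hPd a n) (hlin a n)
      _ = m := mul_one m
  have hlim : ∀ a n, PTend (fun s => F s a n) (f a n) := fun a n => by
    have h2 := (hP a n).comp (fun s => (natDegree_recenter_le a n _).trans ((hF s).2 a n)) (hPd a n)
      (lin p L a n)
    simpa only [recenter_comp_lin] using h2
  refine ⟨f, ⟨fun a b n h => ?_, hfd⟩, fun a n j => ?_, hlim⟩
  · refine (hlim b n).unique ?_
    have : (fun s => F s b n) = fun s => F s a n := by ext1 s; exact (hF s).1 a b n h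
    rw [this]; exact hlim a n
  · have h2 := (hlim a n).comp (fun s => (hF s).2 a n) (hfd a n)
      (C ((p : L) ^ n) * X + C (η a))
    exact le_of_tendsto (h2 j).norm (Eventually.of_forall fun s => hc s a n j)

lemma tau_limit {q : L} {F : ℕ → ℚ_[p] → ℤ → L[X]} {f u : ℚ_[p] → ℤ → L[X]}
    (hF : ∀ s, F s ∈ TF p m L) (hu : u ∈ TF p m L)
    (hlim : ∀ a n, PTend (fun s => F s a n) (f a n)) {ε : ℕ → ℝ} (hε : Tendsto ε atTop (𝓝 0))
    (he : ∀ s, TBd p α (ε s) (tau p q (F s) - u)) : tau p q f = u := by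
  ext1 a; ext1 n
  have h1 : PTend (fun s => tau p q (F s) a n) (tau p q f a n) := by
    simp only [tau_apply, sub_eq_add_neg, ← neg_smul]
    exact ((hlim _ _).add ((PTend.sum fun i _ => hlim _ _).smul _)).add ((hlim _ _).smul _)
  refine h1.unique ?_
  have hd : ∀ s, (tau p q (F s) a n - u a n).natDegree ≤ m := fun s =>
    (natDegree_sub_le _ _).trans (max_le (natDegree_tau_le (hF s) a n) (hu.2 a n))
  have h2 : PTend (fun s => recenter a n (tau p q (F s) a n - u a n)) 0 := fun j => by
    rw [coeff_zero]
    refine squeeze_zero_norm (fun s => he s a n j) ?_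
    have := (hε.mul_const (‖α‖ ^ n)).mono_left Nat.hyperfilter_le_atTop
    rwa [zero_mul] at this
  have h3 := h2.comp (m := m) (fun s => (natDegree_recenter_le a n _).trans (hd s)) (by simp)
    (lin p L a n)
  simp only [recenter_comp_lin, zero_comp] at h3
  have h4 := h3.add (pTend_const (u a n))
  simpa using h4

/-- If `tau` is injective on bounded functions, it is bounded below. -/
lemma Par.exists_tau_bound (h : Par p m α β) [ProperSpace L] [IsUltrametricDist L] {q : L}
    (hinj : ∀ f ∈ TF p m L, ∀ c, TBd p α c f → tau p q f = 0 → f = 0) :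
    ∃ C : ℝ, ∀ f ∈ TF p m L, ∀ B, TBd p α B f → TBd p α 1 (tau p q f) → TBd p α C f := by
  have ha := h.a_ne
  have hp1 := one_lt_p p
  have hp0 := p_pos p
  have key : ∃ s : ℕ, ∀ f ∈ TF p m L, ∀ B, TBd p α B f → TBd p α (((p : ℝ) ^ s)⁻¹ * B) (tau p q f) →
      TBd p α (B / 2) f := by
    by_contra! hcon
    choose f hf B hB hT hn using hcon
    simp only [TBd, not_forall, not_le] at hn
    choose a n j hn using hn
    set x : ℕ → L := fun s => (recenter (a s) (n s) (f s (a s) (n s))).coeff (j s) with hx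
    have hB0 : ∀ s, 0 ≤ B s := fun s => (hB s).nonneg
    have hx0 : ∀ s, x s ≠ 0 := fun s => by
      rw [← norm_pos_iff]
      refine lt_of_le_of_lt ?_ (hn s)
      have := hB0 s
      positivity
    have hBx : ∀ s, ‖(x s)⁻¹‖ * (B s * ‖α‖ ^ n s) ≤ 2 := fun s => by
      rw [norm_inv, inv_mul_le_iff₀ (norm_pos_iff.2 (hx0 s))]
      have := (hn s).le
      linarith
    set F : ℕ → ℚ_[p] → ℤ → L[X] := fun s => (x s)⁻¹ • trn (a s) (n s) (f s) with hFd
    have hF : ∀ s, F s ∈ TF p m L := fun s => smul_mem _ _ (trn_mem_TF _ _ (hf s))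
    have hFB : ∀ s, TBd p α 2 (F s) := fun s => (((hB s).trn ha _ _).smul _).mono (hBx s)
    obtain ⟨g, hg, hgB, hlim⟩ := exists_tree_limit hF hFB
    have hlim0 : Tendsto (fun s : ℕ => ((p : ℝ) ^ s)⁻¹ * 2) atTop (𝓝 0) := by
      have := (tendsto_inv_atTop_zero.comp (tendsto_pow_atTop_atTop_of_one_lt hp1)).mul_const 2
      rwa [zero_mul] at this
    have htau : tau p q g = 0 := by
      refine tau_limit (α := α) hF (Submodule.zero_mem _) hlim hlim0 fun s => ?_
      rw [sub_zero, hFd]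
      simp only [map_smul, tau_trn]
      refine (((hT s).trn ha (a s) (n s)).smul (x s)⁻¹).mono ?_
      calc _ = ((p : ℝ) ^ s)⁻¹ * (‖(x s)⁻¹‖ * (B s * ‖α‖ ^ n s)) := by ring
        _ ≤ _ := mul_le_mul_of_nonneg_left (hBx s) (by positivity)
    have hg0 := hinj g hg 2 hgB htau
    have hcoeff : ∀ s, (F s 0 0).coeff (j s) = 1 := fun s => by
      simp only [hFd, Pi.smul_apply, trn, mul_zero, add_zero, coeff_smul, smul_eq_mul]
      exact inv_mul_cancel₀ (hx0 s)
    have hjm : ∀ s, j s ∈ range (m + 1) := fun s => by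
      by_contra hj
      have := hcoeff s
      rw [coeff_eq_zero_of_natDegree_lt (((hF s).2 0 0).trans_lt (by simpa using hj))] at this
      exact zero_ne_one this
    have hev : ∀ᶠ s in (hyperfilter ℕ : Filter ℕ), ∀ i ∈ range (m + 1), ‖(F s 0 0).coeff i‖ < 1 := by
      rw [Filter.eventually_all_finset]
      intro i _
      have h1 := (hlim 0 0 i).norm
      rw [hg0] at h1
      simp only [Pi.zero_apply, coeff_zero, norm_zero] at h1
      exact h1.eventually_lt_const one_pos
    obtain ⟨s, hs⟩ := hev.exists
    have := hs _ (hjm s)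
    rw [hcoeff, norm_one] at this
    exact lt_irrefl _ this
  obtain ⟨s, hs⟩ := key
  refine ⟨(p : ℝ) ^ s, fun f hf B hB hT => ?_⟩
  have hiter : ∀ k : ℕ, TBd p α (max ((p : ℝ) ^ s) (B / 2 ^ k)) f := by
    intro k
    induction k with
    | zero => exact hB.mono (by simp)
    | succ k ih =>
      refine (hs f hf _ ih (hT.mono ?_)).mono ?_
      · rw [← div_eq_inv_mul, le_div_iff₀ (by positivity), one_mul]
        exact le_max_left _ _
      · have : 0 < (p : ℝ) ^ s := by positivity
        rw [div_le_iff₀ two_pos, pow_succ, ← div_div]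
        refine max_le ?_ ?_
        · linarith [le_max_left ((p : ℝ) ^ s) (B / 2 ^ k / 2)]
        · linarith [le_max_right ((p : ℝ) ^ s) (B / 2 ^ k / 2)]
  obtain ⟨k, hk⟩ := pow_unbounded_of_one_lt (B / (p : ℝ) ^ s) one_lt_two
  refine (hiter k).mono (max_le le_rfl ?_)
  rw [div_lt_iff₀ (by positivity)] at hk
  rw [div_le_iff₀ (by positivity)]
  linarith

variable (L) in
/-- The function on the tree supported at a vertex. -/
def del (a : ℚ_[p]) (n : ℤ) : L[X] →ₗ[L] (ℚ_[p] → ℤ → L[X]) where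
  toFun P b k := if k = n then ind p L a n b • P else 0
  map_add' P Q := by
    ext1 b; ext1 k
    simp only [Pi.add_apply]
    split_ifs <;> simp
  map_smul' c P := by
    ext1 b; ext1 k
    simp only [Pi.smul_apply, RingHom.id_apply]
    split_ifs
    · rw [smul_comm]
    · simp

lemma del_apply (a : ℚ_[p]) (n : ℤ) (P : L[X]) (b : ℚ_[p]) (k : ℤ) :
    del L a n P b k = if k = n then ind p L a n b • P else 0 := rfl

lemma ind_comm (a b : ℚ_[p]) (n : ℤ) : ind p L a n b = ind p L b n a := by
  by_cases h : InB a n b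
  · rw [ind_of_inB h, ind_of_inB h.symm]
  · rw [ind_of_not_inB h, ind_of_not_inB fun h' => h h'.symm]

lemma tau_del (q : L) (a : ℚ_[p]) (n : ℤ) (P : L[X]) :
    tau p q (del L a n P) = ∑ i ∈ range p, del L (a + (i : ℚ_[p]) * 𝔭 ^ n) (n + 1) P +
      q⁻¹ • del L a (n - 1) P - (1 + p / q) • del L a n P := by
  ext1 b; ext1 k
  rw [tau_apply]
  simp only [Pi.sub_apply, Pi.add_apply, Pi.smul_apply, Finset.sum_apply, del_apply]
  have h1 : (if k - 1 = n then ind p L a n b • P else 0) =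
      ∑ i ∈ range p, if k = n + 1 then ind p L (a + i * 𝔭 ^ n) (n + 1) b • P else 0 := by
    by_cases hk : k = n + 1
    · simp only [hk, add_sub_cancel_right, if_true]
      rw [ind_eq_sum, Finset.sum_apply, sum_smul]
    · rw [if_neg (by omega)]
      simp only [if_neg hk, sum_const_zero]
  have h2 : (∑ i ∈ range p, if k + 1 = n then ind p L a n (b + i * 𝔭 ^ k) • P else 0) =
      if k = n - 1 then ind p L a (n - 1) b • P else 0 := by
    by_cases hk : k = n - 1
    · have hk' : n = k + 1 := by omega
      subst hk'
      simp only [add_sub_cancel_right, if_true]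
      simp only [ind_comm a]
      rw [ind_eq_sum b k, Finset.sum_apply, sum_smul]
    · rw [if_neg hk]
      simp only [if_neg (show ¬ k + 1 = n by omega), sum_const_zero]
  rw [h1, h2]

lemma del_mem_TF (a : ℚ_[p]) (n : ℤ) {P : L[X]} (hP : P.natDegree ≤ m) :
    del L a n P ∈ TF p m L := by
  refine ⟨fun b c k h => ?_, fun b k => ?_⟩
  · rw [del_apply, del_apply]
    split_ifs with hk
    · subst hk
      rw [ind_comm, ind_congr h, ind_comm]
    · rfl
  · rw [del_apply]
    split_ifs
    · exact (natDegree_smul_le _ _).trans hP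
    · simp

lemma del_congr {a b : ℚ_[p]} {n : ℤ} (h : InB a n b) : del L b n = del L a n := by
  refine LinearMap.ext fun P => ?_
  ext1 c; ext1 k
  rw [del_apply, del_apply, ind_congr h]

lemma recenter_lin_pow_congr {a b : ℚ_[p]} {n : ℤ} (h : InB a n b) (j i : ℕ) [IsUltrametricDist L] :
    ‖(recenter b n (lin p L a n ^ j)).coeff i‖ ≤ 1 := by
  obtain ⟨x, hx⟩ := h.exists_padicInt
  have hp := p_ne p L
  have h1 : recenter b n (lin p L a n ^ j) =
      (X + C (η x)) ^ j := by
    rw [recenter, pow_comp, lin]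
    congr 1
    have h3 : η b = η a + η x * (p : L) ^ n := by
      rw [hx, map_add, map_mul, map_zpow₀, algebraMap_p]
    rw [mul_comp, C_comp, sub_comp, X_comp,
      C_comp, h3, C_add, C_mul]
    have h2 : (C ((p : L) ^ (-n)) * C ((p : L) ^ n)) = 1 := by
      rw [← C_mul, ← zpow_add₀ hp, neg_add_cancel, zpow_zero, C_1]
    linear_combination (X + C (η x)) * h2
  rw [h1, coeff_X_add_C_pow, norm_mul, norm_pow, norm_algebraMap']
  have h3 := norm_intCast_le_one' p L (j.choose i : ℤ)
  rw [Int.cast_natCast] at h3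
  exact mul_le_one₀ (pow_le_one₀ (norm_nonneg _) x.2) (norm_nonneg _) h3

lemma Par.tBd_del (h : Par p m α β) [IsUltrametricDist L] (a : ℚ_[p]) (n : ℤ) (j : ℕ) {c : L}
    (hc : ‖c‖ ≤ 1) : TBd p α 1 (c • kap p m β ^ n • del L a n (lin p L a n ^ j)) := by
  intro b k i
  simp only [Pi.smul_apply, del_apply]
  have ha := h.norm_pos
  have hz : (0 : ℝ) ≤ 1 * ‖α‖ ^ k := by positivity
  split_ifs with hk
  · subst hk
    by_cases hb : InB a k b
    · rw [ind_of_inB hb, one_smul, recenter_smul, recenter_smul, coeff_smul,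
        coeff_smul, norm_smul, norm_smul, norm_zpow, h.norm_kap]
      have := recenter_lin_pow_congr (L := L) hb j i
      calc _ ≤ 1 * (‖α‖ ^ k * 1) := by gcongr
        _ = _ := by ring
    · rw [ind_of_not_inB hb, zero_smul, smul_zero, smul_zero]
      simpa [recenter] using hz
  · rw [smul_zero, smul_zero]
    simpa [recenter] using hz

lemma Par.tau_injOn (h : Par p m α β) [IsUltrametricDist L]
    (hW : ∀ v ∈ Vsp p m 𝔮, ∀ c : L, c • v ∈ Tht p m α β) (f : ℚ_[p] → ℤ → L[X])
    (hf : f ∈ TF p m L) (c : ℝ) (hc : TBd p α c f) (h0 : tau p 𝔮 f = 0) : f = 0 := by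
  by_contra hne
  obtain ⟨F, ⟨v, hv, hFv⟩, hF⟩ := h.exists_functional hf hc h0 hne
  obtain ⟨x, hx⟩ := NormedField.exists_lt_norm L (c / ‖F v‖)
  have h1 := hF _ (hW v hv x)
  rw [map_smul, norm_smul] at h1
  rw [div_lt_iff₀ (norm_pos_iff.2 hFv)] at hx
  exact absurd h1 (not_le.2 hx)

lemma Par.exists_tau_eq (h : Par p m α β) [IsUltrametricDist L]
    (hW : ∀ v ∈ Vsp p m 𝔮, ∀ c : L, c • v ∈ Tht p m α β) (x : L) (hx : x ≠ 0) :
    ∃ f ∈ TF p m L, (∃ B, TBd p α B f) ∧ ∃ g, TBd p α 1 g ∧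
      tau p 𝔮 f = del L 0 0 1 + x • g := by
  set T : Submodule L (ℚ_[p] → ℤ → L[X]) :=
    { carrier := {f | f ∈ TF p m L ∧ ∃ B, TBd p α B f}
      zero_mem' := ⟨Submodule.zero_mem _, 0, fun a n j => by simp [recenter]⟩
      add_mem' := fun {f g} hf hg => by
        obtain ⟨hf, B, hB⟩ := hf
        obtain ⟨hg, B', hB'⟩ := hg
        exact ⟨Submodule.add_mem _ hf hg, max B B', (hB.mono (le_max_left _ _)).add
          (hB'.mono (le_max_right _ _))⟩
      smul_mem' := fun c f hf => by
        obtain ⟨hf, B, hB⟩ := hf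
        exact ⟨smul_mem _ _ hf, _, hB.smul c⟩ } with hT
  set N := T.map (tau p 𝔮)
  have hmon : (X ^ (m + 1) : L[X]).Monic := monic_X_pow _
  set tr : L[X] →ₗ[L] L[X] := modByMonicHom (X ^ (m + 1))
  have htr : ∀ P, (tr P).natDegree ≤ m := fun P => by
    have h1 := degree_modByMonic_lt P hmon
    rw [degree_X_pow] at h1
    exact natDegree_le_iff_degree_le.2 (Order.lt_succ_iff.1 (by exact_mod_cast h1))
  have htr' : ∀ P : L[X], P.natDegree ≤ m → tr P = P := fun P hP => by
    refine (modByMonic_eq_self_iff hmon).2 ?_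
    rw [degree_X_pow]
    exact degree_le_natDegree.trans_lt (by exact_mod_cast Nat.lt_succ_of_le hP)
  have hdelT : ∀ a n P, P.natDegree ≤ m → del L a n P ∈ T := by
    intro a n P hP
    have h1 := eq_sum_lin_pow a n hP
    rw [h1, map_sum]
    refine Submodule.sum_mem _ fun j hj => ?_
    have hk : kap p m β ^ n ≠ 0 := zpow_ne_zero _ h.kap_ne_zero
    have h2 : (1 : L) • kap p m β ^ n • del L a n (lin p L a n ^ j) ∈ T :=
      ⟨smul_mem _ _ (smul_mem _ _ (del_mem_TF _ _
        ((natDegree_lin_pow a n j).trans (by simpa [Nat.lt_succ_iff] using hj)))), 1,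
        h.tBd_del a n j (by simp)⟩
    rw [one_smul] at h2
    rw [map_smul]
    exact smul_mem _ _ ((smul_mem_iff _ hk).1 h2)
  have hrel : TreeRel p 𝔮 (fun a n => N.mkQ ∘ₗ del L a n ∘ₗ tr) :=
    { ball := fun a b n hab => by rw [del_congr hab]
      rel := fun a n => by
        refine LinearMap.ext fun P => ?_
        have h1 : tau p 𝔮 (del L a n (tr P)) ∈ N :=
          Submodule.mem_map_of_mem (hdelT a n _ (htr P))
        rw [← Submodule.Quotient.mk_eq_zero, tau_del] at h1
        have h2 : ∀ v, (Submodule.Quotient.mk v : _ ⧸ N) = N.mkQ v := fun v => rfl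
        rw [h2, map_sub, map_add, map_sum, map_smul, map_smul, sub_eq_zero] at h1
        simpa [LinearMap.sum_apply] using h1 }
  obtain ⟨F, hF⟩ := exists_functional_of_treeRel h.qq_ne_zero h.qq_ne_one hrel
  have hTht : ∀ v ∈ Tht p m α β, ∃ g, TBd p α 1 g ∧ F v = N.mkQ g := by
    intro v hv
    induction hv using AddSubgroup.closure_induction with
    | mem f hf =>
      obtain ⟨c, a, n, j, hc, hj, rfl⟩ := hf
      refine ⟨_, h.tBd_del a n j hc, ?_⟩
      rw [gen, map_smul, map_smul, hF, map_smul, map_smul]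
      simp only [comp_apply]
      rw [htr' _ ((natDegree_lin_pow a n j).trans hj)]
    | zero => exact ⟨0, fun a n j => by simp [recenter, zpow_nonneg], by simp⟩
    | add f g _ _ hf hg =>
      obtain ⟨f', hf', hf⟩ := hf
      obtain ⟨g', hg', hg⟩ := hg
      exact ⟨f' + g', hf'.add hg', by rw [map_add, map_add, hf, hg]⟩
    | neg f _ hf =>
      obtain ⟨f', hf', hf⟩ := hf
      exact ⟨-f', hf'.neg, by rw [map_neg, map_neg, hf]⟩
  set v := pev p 1 (phi p 𝔮 0 0)
  obtain ⟨g, hg, hFg⟩ := hTht _ (hW v (pev_phi_mem (by simp) 0 0) x⁻¹)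
  have h3 : F v = N.mkQ (del L 0 0 1) := by
    rw [hF]
    simp only [comp_apply]
    rw [htr' 1 (by simp)]
  rw [map_smul, h3] at hFg
  have h4 : N.mkQ (del L 0 0 1 - x • g) = 0 := by
    rw [map_sub, map_smul, ← hFg, smul_smul, mul_inv_cancel₀ hx, one_smul, sub_self]
  rw [mkQ_apply, Submodule.Quotient.mk_eq_zero] at h4
  obtain ⟨f, hf, hfe⟩ := h4
  exact ⟨f, hf.1, hf.2, -g, hg.neg, by rw [hfe, smul_neg, sub_eq_add_neg]⟩

lemma eq_zero_of_recurrence (h : Par p m α β) [IsUltrametricDist L] {d : ℕ → L}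
    (hd : ∀ n, d n + (p / 𝔮) * d (n + 2) = (1 + p / 𝔮) * d (n + 1)) {C : ℝ}
    (hC : ∀ n, ‖d n‖ ≤ C * ‖α‖ ^ n) (n : ℕ) : d n = 0 := by
  have ha := h.norm_pos
  have hb : 0 < ‖β‖ := norm_pos_iff.2 h.b_ne
  have hr : p / 𝔮 = β / α := by
    have := p_ne p L; have := h.a_ne; have := h.b_ne
    rw [qq]; field_simp
  have hC0 : 0 ≤ C := by
    have := (norm_nonneg _).trans (hC 0)
    rwa [pow_zero, mul_one] at this
  rw [hr] at hd
  have he : ∀ k n, d (n + 1) - d n = (β / α) ^ k * (d (n + k + 1) - d (n + k)) := by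
    intro k n
    induction k with
    | zero => simp
    | succ k ih =>
      rw [ih, pow_succ]
      have := hd (n + k)
      rw [show n + (k + 1) + 1 = n + k + 2 by ring, show n + (k + 1) = n + k + 1 by ring]
      linear_combination (-(β / α) ^ k) * this
  have hstep : ∀ n, d (n + 1) = d n := by
    intro n
    rw [← sub_eq_zero, ← norm_le_zero_iff]
    have hlim : Tendsto (fun k : ℕ => C * ‖α‖ ^ n * ‖β‖ ^ k) atTop (𝓝 0) := by
      have := (tendsto_pow_atTop_nhds_zero_of_lt_one hb.le h.b_lt).const_mul (C * ‖α‖ ^ n)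
      rwa [mul_zero] at this
    refine ge_of_tendsto' hlim fun k => ?_
    rw [he k n, norm_mul, norm_pow, norm_div, div_pow]
    have h1 : ‖d (n + k + 1) - d (n + k)‖ ≤ C * ‖α‖ ^ (n + k) := by
      rw [sub_eq_add_neg]
      refine (norm_add_le_max _ _).trans (max_le ((hC _).trans ?_) (by
        rw [norm_neg]; exact hC _))
      refine mul_le_mul_of_nonneg_left ?_ hC0
      exact pow_le_pow_of_le_one ha.le h.a_lt.le (by omega)
    calc _ ≤ ‖β‖ ^ k / ‖α‖ ^ k * (C * ‖α‖ ^ (n + k)) := by gcongr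
      _ = _ := by rw [pow_add]; field_simp
  have hconst : ∀ k, d (n + k) = d n := by
    intro k
    induction k with
    | zero => rfl
    | succ k ih => rw [← add_assoc, hstep, ih]
  rw [← norm_le_zero_iff]
  have hlim : Tendsto (fun k : ℕ => C * ‖α‖ ^ (n + k)) atTop (𝓝 0) := by
    have := (tendsto_pow_atTop_nhds_zero_of_lt_one ha.le h.a_lt).const_mul (C * ‖α‖ ^ n)
    rw [mul_zero] at this
    simpa only [pow_add, mul_assoc] using this
  refine ge_of_tendsto' hlim fun k => ?_
  rw [← hconst k]
  exact hC _

lemma eq_C_of_comp_X_add_C [CharZero L] {P : L[X]} {b : L} (hb : b ≠ 0)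
    (h : P.comp (X + C b) = P) : P = C (P.coeff 0) := by
  refine eq_of_infinite_eval_eq _ _ ?_
  refine Set.infinite_of_injective_forall_mem (f := fun n : ℕ => (n : L) * b) (fun i j hij => ?_) fun n => ?_
  · exact Nat.cast_injective (mul_right_cancel₀ hb hij)
  · rw [Set.mem_ofPred_eq, eval_C, coeff_zero_eq_eval_zero]
    induction n with
    | zero => simp
    | succ n ih =>
      rw [← ih]
      conv_rhs => rw [← h]
      rw [eval_comp]
      simp [add_mul]

lemma Par.exists_not_mem_Tht (h : Par p m α β) [ProperSpace L] [IsUltrametricDist L] :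
    ∃ v ∈ Vsp p m 𝔮, ∃ c : L, c • v ∉ Tht p m α β := by
  by_contra! hW
  have := charZero_of_padic p L
  have hp1 := one_lt_p p
  have hpL := p_ne p L
  set q := 𝔮 with hq
  have hinj := h.tau_injOn hW
  obtain ⟨K, hC⟩ := h.exists_tau_bound hinj
  have hδ : del (p := p) L 0 0 1 ∈ TF p m L := del_mem_TF 0 0 (by simp)
  have hδB : TBd p α 1 (del (p := p) L 0 0 1) := by
    have := h.tBd_del (p := p) 0 0 0 (c := 1) (by simp)
    simpa using this
  have hex : ∀ s : ℕ, ∃ f ∈ TF p m L, TBd p α K f ∧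
      TBd p α ((p : ℝ) ^ s)⁻¹ (tau p q f - del L 0 0 1) := by
    intro s
    obtain ⟨f, hf, ⟨B, hB⟩, g, hg, hfg⟩ := h.exists_tau_eq hW ((p : L) ^ s) (pow_ne_zero _ hpL)
    have hg' : TBd p α ((p : ℝ) ^ s)⁻¹ ((p : L) ^ s • g) := by
      have := hg.smul ((p : L) ^ s)
      rwa [norm_pow, norm_p p L, mul_one, inv_pow] at this
    refine ⟨f, hf, hC f hf B hB ?_, ?_⟩
    · rw [hfg]
      exact hδB.add (hg'.mono (inv_le_one_of_one_le₀ (one_le_pow₀ hp1.le)))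
    · rw [hfg, add_sub_cancel_left]; exact hg'
  choose F hF hFC hFt using hex
  obtain ⟨f, hf, hfC, hlim⟩ := exists_tree_limit hF hFC
  have htau : tau p q f = del L 0 0 1 :=
    tau_limit hF hδ hlim (tendsto_inv_atTop_zero.comp (tendsto_pow_atTop_atTop_of_one_lt hp1)) hFt
  have hinv : ∀ b : ℚ_[p], ‖b‖ ≤ 1 → trn b 0 f = f := by
    intro b hb
    rw [← sub_eq_zero]
    refine hinj _ (Submodule.sub_mem _ (trn_mem_TF _ _ hf) hf) K ?_ ?_
    · have h1 := hfC.trn h.a_ne b 0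
      rw [zpow_zero, mul_one] at h1
      rw [sub_eq_add_neg]
      exact h1.add hfC.neg
    · rw [map_sub, tau_trn, htau, sub_eq_zero]
      ext1 a; ext1 n
      rw [trn, del_apply, del_apply, zero_add, zpow_zero, one_mul]
      split_ifs
      · rw [recenter_smul, show ind p L 0 0 (b + a) = ind p L 0 0 a by
          rw [ind_comm, ind_comm 0 a, ind_congr (a := a) (b := b + a)]
          unfold InB; simpa using hb]
        simp [recenter]
      · simp [recenter]
  have hconst : ∀ a n, f a n = C ((f a n).coeff 0) := by
    intro a n
    set b : ℚ_[p] := 𝔭 ^ (max n 0) with hb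
    have hb0 : b ≠ 0 := zpow_ne_zero _ padic_p_ne_zero
    have hbn : ‖b‖ = (p : ℝ) ^ (-(max n 0)) := norm_p_zpow _
    have h1 : ‖b‖ ≤ 1 := by rw [hbn]; exact zpow_le_one_of_nonpos₀ hp1.le (by omega)
    have h2 := congrFun (congrFun (hinv b h1) a) n
    rw [trn, zpow_zero, one_mul, zero_add, hf.1 a (b + a) n (by
      unfold InB
      rw [add_sub_cancel_right, hbn]
      exact zpow_le_zpow_p.2 (by omega)), recenter, zpow_zero, C_1, one_mul] at h2
    refine eq_C_of_comp_X_add_C (b := η b) ?_ h2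
    simpa using hb0
  set c : ℚ_[p] → ℤ → L := fun a n => (f a n).coeff 0 with hc
  have hcinv : ∀ a b n, ‖b‖ ≤ 1 → c (a + b) n = c a n := by
    intro a b n hb
    have h2 := congrFun (congrFun (hinv b hb) a) n
    rw [trn, zpow_zero, one_mul, zero_add, add_comm, hconst (a + b)] at h2
    simp only [hc]
    rw [← h2]
    simp [recenter]
  have hcB : ∀ a n, ‖c a n‖ ≤ K * ‖α‖ ^ n := by
    intro a n
    have h2 := hfC a n 0
    rw [hconst] at h2
    simpa [recenter] using h2
  have hrec : ∀ a (n : ℤ), 0 ≤ n → c a (n - 1) + (p / q) * c a (n + 1) - (1 + p / q) * c a n =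
      if n = 0 then ind p L 0 0 a else 0 := by
    intro a n hn
    have h2 := congrArg (fun P => coeff P 0) (congrFun (congrFun htau a) n)
    simp only [tau_apply, del_apply] at h2
    rw [coeff_sub, coeff_add, coeff_smul, coeff_smul,
      finsetSum_coeff] at h2
    have h3 : ∀ i ∈ range p, (f (a + i * 𝔭 ^ n) (n + 1)).coeff 0 = c a (n + 1) := by
      intro i _
      refine hcinv a _ _ ?_
      have h4 := inB_add_mul (p := p) 0 n i
      unfold InB at h4
      rw [zero_add, sub_zero] at h4
      exact h4.trans (zpow_le_one_of_nonpos₀ hp1.le (by omega))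
    rw [sum_congr rfl h3, sum_const, card_range, nsmul_eq_mul, smul_eq_mul,
      smul_eq_mul] at h2
    have h5 : (if n = 0 then ind p L 0 0 a • (1 : L[X]) else 0).coeff 0 =
        if n = 0 then ind p L 0 0 a else 0 := by
      split_ifs <;> simp
    rw [h5] at h2
    rw [← h2, div_eq_mul_inv]
    ring
  have h1p : c 0 (-1) = 0 := by
    have hind : ind p L 0 0 (𝔭⁻¹) = 0 := by
      refine ind_of_not_inB ?_
      unfold InB
      rw [sub_zero, norm_inv, Padic.norm_p, inv_inv, neg_zero, zpow_zero, not_le]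
      exact hp1
    have h2 := eq_zero_of_recurrence h (d := fun n => c 𝔭⁻¹ ((n : ℤ) - 1))
      (C := K * ‖α‖⁻¹) (fun n => ?_) (fun n => ?_) 0
    · have h3 : c 𝔭⁻¹ (-1) = c 0 (-1) := by
        simp only [hc]
        rw [hf.1 0 _ (-1)]
        unfold InB
        rw [sub_zero, norm_inv, Padic.norm_p, inv_inv, neg_neg, zpow_one]
      rw [← h3]
      simpa using h2
    · have h3 := hrec 𝔭⁻¹ n (by positivity)
      rw [hind, ite_self] at h3
      push_cast
      rw [show (n : ℤ) + 2 - 1 = n + 1 by ring, show (n : ℤ) + 1 - 1 = n by ring]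
      linear_combination h3
    · refine (hcB _ _).trans (le_of_eq ?_)
      rw [zpow_sub_one₀ h.norm_pos.ne', zpow_natCast]
      ring
  have h0 : ∀ n : ℕ, c 0 n = 0 := by
    refine eq_zero_of_recurrence h (d := fun n => c 0 (n : ℤ)) (C := K) (fun n => ?_) fun n => ?_
    · have h3 := hrec 0 (n + 1) (by positivity)
      rw [if_neg (by omega), add_sub_cancel_right] at h3
      push_cast
      rw [show (n : ℤ) + 2 = n + 1 + 1 by ring]
      linear_combination h3
    · have := hcB 0 n
      rwa [zpow_natCast] at this
  have h3 := hrec 0 0 le_rfl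
  have h4 := h0 0
  have h5 := h0 1
  rw [Nat.cast_zero] at h4
  rw [Nat.cast_one] at h5
  rw [zero_sub, zero_add, h1p, h4, h5, if_pos rfl, ind_of_inB (InB.self 0 0)] at h3
  simp at h3

section PolynomialTools

variable {K : Type*} [Field K] [CharZero K]

lemma eq_C_of_eval_add_mul {Q : K[X]} {x t c : K} (ht : t ≠ 0)
    (h : ∀ i : ℕ, Q.eval (x + i * t) = c) : Q = C c := by
  refine eq_of_infinite_eval_eq _ _ (Set.infinite_of_injective_forall_mem
    (f := fun i : ℕ => x + i * t) (fun i j hij => ?_) fun i => by simp [h i])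
  exact Nat.cast_injective (mul_right_cancel₀ ht (add_left_cancel hij))

lemma coeff_taylor_sub {P : K[X]} {d : ℕ} (hP : P.natDegree ≤ d + 1) (b : K) :
    (taylor b P - P).coeff d = (d + 1) * b * P.coeff (d + 1) := by
  have h1 : P = C (P.coeff (d + 1)) * X ^ (d + 1) + P.erase (d + 1) := by
    rw [C_mul_X_pow_eq_monomial, monomial_add_erase]
  have h2 : (taylor b (P.erase (d + 1)) - P.erase (d + 1)).coeff d = 0 := by
    by_cases h0 : P.erase (d + 1) = 0
    · simp [h0]
    refine coeff_eq_zero_of_degree_lt ((degree_taylor_sub_lt h0 b).trans_le ?_)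
    rw [degree_le_iff_coeff_zero]
    intro n hn
    have hn : d < n := by exact_mod_cast hn
    rw [coeff_erase]
    split_ifs with h
    · rfl
    · exact coeff_eq_zero_of_natDegree_lt (by omega)
  have h3 : taylor b P - P = C (P.coeff (d + 1)) * ((X + C b) ^ (d + 1) - X ^ (d + 1)) +
      (taylor b (P.erase (d + 1)) - P.erase (d + 1)) := by
    conv_lhs => rw [h1]
    simp
    ring
  rw [h3, coeff_add, h2, coeff_C_mul, coeff_sub, coeff_X_add_C_pow, coeff_X_pow, if_neg (by omega)]
  simp
  ring

/-- A space of polynomials that is stable under a translation and contains `X ^ m` contains all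
polynomials of degree at most `m`. -/
lemma mem_of_taylor_mem {b : K} (hb : b ≠ 0) {M : Submodule K K[X]} (hX : X ^ m ∈ M)
    (hM : ∀ P ∈ M, taylor b P ∈ M) {P : K[X]} (hP : P.natDegree ≤ m) : P ∈ M := by
  have key : ∀ i ≤ m, ∃ Q ∈ M, Q.natDegree ≤ m - i ∧ Q.coeff (m - i) ≠ 0 := by
    intro i
    induction i with
    | zero => exact fun _ => ⟨_, hX, by simp, by simp⟩
    | succ i ih =>
      intro hi
      obtain ⟨Q, hQ, hQd, hQc⟩ := ih (by omega)
      obtain ⟨d, hd⟩ : ∃ d, m - i = d + 1 := ⟨m - i - 1, by omega⟩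
      rw [hd] at hQd hQc
      rw [show m - (i + 1) = d by omega]
      refine ⟨_, sub_mem (hM _ hQ) hQ, ?_, ?_⟩
      · have h0 : Q ≠ 0 := by rintro rfl; simp at hQc
        have h1 := degree_taylor_sub_lt h0 b
        by_cases h2 : taylor b Q - Q = 0
        · simp [h2]
        · have := (natDegree_lt_natDegree_iff h2).2 h1
          omega
      · rw [coeff_taylor_sub hQd]
        exact mul_ne_zero (mul_ne_zero (Nat.cast_add_one_ne_zero d) hb) hQc
  have main : ∀ d ≤ m + 1, ∀ P : K[X], P.degree < d → P ∈ M := by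
    intro d
    induction d with
    | zero =>
      intro _ P hP
      have : P = 0 := by simpa using hP
      rw [this]; exact zero_mem _
    | succ d ih =>
      intro hd P hP
      obtain ⟨Q, hQ, hQd, hQc⟩ := key (m - d) (by omega)
      rw [show m - (m - d) = d by omega] at hQd hQc
      have : P - (P.coeff d / Q.coeff d) • Q ∈ M := by
        refine ih (by omega) _ ?_
        rw [degree_lt_iff_coeff_zero] at hP ⊢
        intro n hn
        rw [coeff_sub, coeff_smul, smul_eq_mul]
        rcases hn.eq_or_lt with rfl | hn
        · field_simp; ring
        · rw [hP n hn, coeff_eq_zero_of_natDegree_lt (by omega : Q.natDegree < n)]; simp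
      simpa using add_mem this (M.smul_mem (P.coeff d / Q.coeff d) hQ)
  exact main (m + 1) le_rfl P (degree_lt_iff_coeff_zero _ _ |>.2 fun n hn =>
    coeff_eq_zero_of_natDegree_lt (by omega))

end PolynomialTools

section Generation

variable {q : L} {W : Submodule L (ℚ_[p] → L)}

lemma tr_phi_self (q : L) (a : ℚ_[p]) {b : ℚ_[p]} {n : ℤ} (hb : ‖b‖ ≤ (p : ℝ) ^ (-n)) :
    tr L b (phi p q a n) = phi p q a n := by
  rw [tr_phi]; exact phi_congr (by rw [InB]; simpa using hb)

lemma tr_ind_self (a : ℚ_[p]) {b : ℚ_[p]} {n : ℤ} (hb : ‖b‖ ≤ (p : ℝ) ^ (-n)) :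
    tr L b (ind p L a n) = ind p L a n := by
  rw [tr_ind]; exact ind_congr (by rw [InB]; simpa using hb)

/-- The elements of `Vsp` are uniformly locally polynomial, and of a simple form near infinity. -/
lemma exists_polynomial_of_mem_Vsp (hq : q ≠ 0) {f : ℚ_[p] → L} (hf : f ∈ Vsp p m q) :
    ∃ N : ℤ, (∃ P : L[X], P.natDegree ≤ m ∧ ∀ z, ¬InB 0 (-N) z →
      f z = P.eval (η z) * q ^ z.valuation) ∧
      ∀ a, ∃ Q : L[X], Q.natDegree ≤ m ∧ ∀ z, InB a N z → f z = Q.eval (η z) := by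
  obtain ⟨N, hN⟩ := Vsp_normalForm hq hf
  obtain ⟨P, Q, hP, hQ, rfl⟩ := hN N le_rfl
  refine ⟨N, ⟨q ^ (N : ℤ) • P, (natDegree_smul_le _ _).trans hP, fun z hz => ?_⟩, fun a =>
    ⟨phi p q 0 (-(N : ℤ)) a • P + ∑ t : Fin (p ^ (2 * N)), ind p L (rep p N t) N a • Q t, ?_, fun z hz => ?_⟩⟩
  · rw [Pi.add_apply, Finset.sum_apply, sum_eq_zero, add_zero, pev_apply, phi_of_not_inB hz]
    · rw [sub_zero, sub_neg_eq_add, zpow_add₀ hq, eval_smul, smul_eq_mul]; ring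
    · intro t _
      rw [pev_apply, ind_of_not_inB, mul_zero]
      intro h
      refine hz (InB.trans ?_ (h.mono (by omega)))
      exact inB_rep N t
  · refine (natDegree_add_le _ _).trans (max_le ((natDegree_smul_le _ _).trans hP) ?_)
    exact natDegree_sum_le_of_forall_le _ _ fun t _ => (natDegree_smul_le _ _).trans (hQ t)
  · have h1 : phi p q 0 (-(N : ℤ)) z = phi p q 0 (-(N : ℤ)) a := by
      have := congrFun (tr_phi_self q 0 (hz.mono (by omega : -(N : ℤ) ≤ N))) a
      rwa [tr_apply, add_sub_cancel] at this
    have h2 : ∀ c, ind p L c N z = ind p L c N a := fun c => by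
      have := congrFun (tr_ind_self (L := L) c hz) a
      rwa [tr_apply, add_sub_cancel] at this
    rw [Pi.add_apply, Finset.sum_apply, eval_add, eval_finsetSum]
    simp only [pev_apply, h1, h2, eval_smul, smul_eq_mul]
    congr 1
    · ring
    · exact sum_congr rfl fun _ _ => mul_comm _ _

lemma eq_of_mem_Vsp (hq : q ≠ 0) {f g : ℚ_[p] → L} (hf : f ∈ Vsp p m q) (hg : g ∈ Vsp p m q)
    (h : ∀ z, z ≠ 0 → f z = g z) : f = g := by
  have := charZero_of_padic p L
  have hpL := p_ne p L
  obtain ⟨N, -, hN⟩ := exists_polynomial_of_mem_Vsp hq (sub_mem hf hg)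
  obtain ⟨Q, -, hQ⟩ := hN 0
  have hpN : 𝔭 ^ N ≠ 0 := zpow_ne_zero _ padic_p_ne_zero
  have h1 : Q = C 0 := by
    refine eq_C_of_eval_add_mul (x := (p : L) ^ N) (zpow_ne_zero N hpL) fun i => ?_
    have h2 := hQ _ (inB_add_mul 0 N (i + 1))
    rw [Pi.sub_apply, h, sub_self] at h2
    · rw [h2]; congr 1; simp; ring
    · rw [zero_add]; exact mul_ne_zero (Nat.cast_ne_zero.2 (by omega)) hpN
  funext z
  by_cases hz : z = 0
  · subst hz
    have := hQ 0 (InB.self 0 N)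
    rw [h1] at this
    simpa [sub_eq_zero] using this
  · exact h z hz

/-- A space of functions that is stable under affine substitutions and the inversion. -/
structure Stab (m : ℕ) (q : L) (W : Submodule L (ℚ_[p] → L)) : Prop where
  q0 : q ≠ 0
  q1 : q ≠ 1
  le : W ≤ Vsp p m q
  aff_mem : ∀ b d : ℚ_[p], d ≠ 0 → ∀ f ∈ W, aff L b d f ∈ W
  inv_mem : ∀ f ∈ W, ∃ g ∈ W, ∀ z, z ≠ 0 → g z = q ^ z.valuation * η z ^ m * f z⁻¹

lemma Stab.tr_mem (h : Stab m q W) (b : ℚ_[p]) {f : ℚ_[p] → L} (hf : f ∈ W) : tr L b f ∈ W := by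
  rw [tr_eq_aff]; exact h.aff_mem _ _ one_ne_zero _ hf

lemma norm_eq_of_add {z b : ℚ_[p]} (h : ‖b‖ < ‖z‖) : ‖z + b‖ = ‖z‖ := by
  rw [norm_add_eq_max_of_norm_ne_norm h.ne', max_eq_left h.le]

lemma valuation_eq_of_norm_eq {x y : ℚ_[p]} (hy : y ≠ 0) (h : ‖x‖ = ‖y‖) :
    x.valuation = y.valuation := by
  have hx : x ≠ 0 := by rw [← norm_ne_zero_iff, h]; exact norm_ne_zero_iff.2 hy
  rw [norm_eq_zpow_neg_valuation hx, norm_eq_zpow_neg_valuation hy] at h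
  have := zpow_right_injective₀ (p_pos p) (one_lt_p p).ne' h
  omega

lemma not_inB_zero {z : ℚ_[p]} {n : ℤ} : ¬InB 0 n z ↔ (p : ℝ) ^ (-n) < ‖z‖ := by
  rw [InB, sub_zero, not_le]

lemma Stab.exists_compact (h : Stab m q W) (hW : W ≠ ⊥) :
    ∃ f ∈ W, f ≠ 0 ∧ ∃ A : ℤ, ∀ z, ¬InB 0 A z → f z = 0 := by
  have := charZero_of_padic p L
  have hpL := p_ne p L
  have hp1 := one_lt_p p
  obtain ⟨f₀, hf₀, hf₀'⟩ := exists_mem_ne_zero_of_ne_bot hW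
  have hex : ∃ d : ℕ, ∃ f ∈ W, f ≠ 0 ∧ ∃ (P : L[X]) (A : ℤ), P.degree < d ∧
      ∀ z, ¬InB 0 A z → f z = P.eval (η z) * q ^ z.valuation := by
    obtain ⟨N, ⟨P, hP, hP'⟩, -⟩ := exists_polynomial_of_mem_Vsp h.q0 (h.le hf₀)
    exact ⟨m + 1, f₀, hf₀, hf₀', P, _, degree_lt_iff_coeff_zero _ _ |>.2 fun n hn =>
      coeff_eq_zero_of_natDegree_lt (by omega), hP'⟩
  obtain ⟨f, hf, hf0, P, A, hPd, hPA⟩ := Nat.find_spec hex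
  refine ⟨f, hf, hf0, A, fun z hz => ?_⟩
  rw [hPA z hz]
  suffices P = 0 by simp [this]
  by_contra hP0
  have hinv : ∀ B < A, ∀ z, f (z + 𝔭 ^ B) = f z := by
    intro B hB
    by_contra! hne
    obtain ⟨z₀, hz₀⟩ := hne
    have hdpos : 0 < Nat.find hex := by
      rcases Nat.eq_zero_or_pos (Nat.find hex) with h0 | h0
      · rw [h0] at hPd; exact absurd (by simpa using hPd) hP0
      · exact h0
    refine Nat.find_min hex (m := Nat.find hex - 1) (by omega) ⟨_, sub_mem (h.tr_mem (𝔭 ^ B) hf) hf,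
      fun h0 => hz₀ (sub_eq_zero.1 (congrFun h0 z₀)), taylor (η (p ^ B)) P - P,
      B, ?_, fun z hz => ?_⟩
    · refine (degree_taylor_sub_lt hP0 _).trans_le ?_
      rw [degree_eq_natDegree hP0] at hPd ⊢
      have : P.natDegree < Nat.find hex := by exact_mod_cast hPd
      exact_mod_cast (by omega : P.natDegree ≤ Nat.find hex - 1)
    · have hz' := not_inB_zero.1 hz
      have hn : ‖z + 𝔭 ^ B‖ = ‖z‖ := norm_eq_of_add (by rwa [norm_p_zpow])
      have hz0 : z ≠ 0 := by rintro rfl; exact hz (InB.self _ _)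
      have hA : ¬InB 0 A z := fun h' => hz (h'.mono hB.le)
      have hA' : ¬InB 0 A (z + 𝔭 ^ B) := by rw [not_inB_zero, hn]; exact not_inB_zero.1 hA
      rw [Pi.sub_apply, tr_apply, hPA _ hA, hPA _ hA', valuation_eq_of_norm_eq hz0 hn,
        eval_sub, taylor_eval, map_add, sub_mul]
  have hout : ∀ B < A, ¬InB (0 : ℚ_[p]) A (𝔭 ^ B) := fun B hB => by
    rw [not_inB_zero, norm_p_zpow]; exact zpow_lt_zpow_right₀ hp1 (by omega)
  have hPC : P = C (P.eval (η (p ^ (A - 2)))) := by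
    refine eq_C_of_eval_add_mul (x := η (p ^ (A - 2)))
      (t := η (p ^ (A - 1))) ((_root_.map_ne_zero _).2 (zpow_ne_zero _ padic_p_ne_zero)) fun i => ?_
    have hz0 : 𝔭 ^ (A - 2) ≠ 0 := zpow_ne_zero _ padic_p_ne_zero
    have hn : ‖𝔭 ^ (A - 2) + i * 𝔭 ^ (A - 1)‖ = ‖𝔭 ^ (A - 2)‖ := by
      refine norm_eq_of_add ?_
      rw [norm_mul, norm_p_zpow, norm_p_zpow]
      refine (mul_le_of_le_one_left (zpow_nonneg (p_pos p).le _) (norm_int_le_one i)).trans_lt ?_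
      exact zpow_lt_zpow_right₀ hp1 (by omega)
    have hA : ¬InB (0 : ℚ_[p]) A (𝔭 ^ (A - 2) + (i : ℚ_[p]) * 𝔭 ^ (A - 1)) := by
      rw [not_inB_zero, hn]; exact not_inB_zero.1 (hout _ (by omega))
    have hi : f (𝔭 ^ (A - 2) + i * 𝔭 ^ (A - 1)) = f (𝔭 ^ (A - 2)) := by
      clear hn hA
      induction i with
      | zero => simp
      | succ i ih => rw [← ih, ← hinv (A - 1) (by omega) (_ + (i : ℚ_[p]) * _)]; congr 1; push_cast; ring
    rw [hPA _ hA, hPA _ (hout _ (by omega)), valuation_eq_of_norm_eq hz0 hn] at hi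
    have := mul_right_cancel₀ (zpow_ne_zero _ h.q0) hi
    rwa [map_add, map_mul, map_natCast] at this
  set c := P.eval (η (p ^ (A - 2)))
  have hc0 : c ≠ 0 := fun h0 => hP0 (by rw [hPC, h0, map_zero])
  have hval : ∀ B < A, c * q ^ B = f 0 := fun B hB => by
    rw [← hinv B hB 0, zero_add, hPA _ (hout B hB), hPC, eval_C, valuation_zpow,
      valuation_p, mul_one]
  have h2 := (hval (A - 2) (by omega)).trans (hval (A - 2 + 1) (by omega)).symm
  rw [zpow_add_one₀ h.q0] at h2
  have h3 := mul_left_cancel₀ hc0 h2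
  exact h.q1 (mul_left_cancel₀ (zpow_ne_zero (A - 2) h.q0) (by rw [mul_one]; exact h3.symm))

lemma Stab.exists_locConst (h : Stab m q W) (hW : W ≠ ⊥) :
    ∃ f ∈ W, f ≠ 0 ∧ ∃ A R : ℤ, (∀ z, ¬InB 0 A z → f z = 0) ∧ ∀ x y, InB x R y → f x = f y := by
  have := charZero_of_padic p L
  have hpL := p_ne p L
  obtain ⟨f₀, hf₀, hf₀', A₀, hA₀⟩ := h.exists_compact hW
  have hex : ∃ d : ℕ, ∃ f ∈ W, f ≠ 0 ∧ ∃ A N : ℤ, (∀ z, ¬InB 0 A z → f z = 0) ∧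
      ∀ a, ∃ Q : L[X], Q.degree < d ∧ ∀ z, InB a N z → f z = Q.eval (η z) := by
    obtain ⟨N, -, hN⟩ := exists_polynomial_of_mem_Vsp h.q0 (h.le hf₀)
    refine ⟨m + 1, f₀, hf₀, hf₀', A₀, N, hA₀, fun a => ?_⟩
    obtain ⟨Q, hQ, hQ'⟩ := hN a
    exact ⟨Q, degree_lt_iff_coeff_zero _ _ |>.2 fun n hn =>
      coeff_eq_zero_of_natDegree_lt (by omega), hQ'⟩
  obtain ⟨f, hf, hf0, A, N, hA, hQ⟩ := Nat.find_spec hex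
  have hdpos : 0 < Nat.find hex := by
    rcases Nat.eq_zero_or_pos (Nat.find hex) with h0 | h0
    · refine absurd (funext fun z => ?_) hf0
      obtain ⟨Q, hQd, hQz⟩ := hQ z
      rw [h0] at hQd
      have : Q = 0 := by simpa using hQd
      rw [hQz z (InB.self z N), this]; simp
    · exact h0
  have hb : ∀ a, InB a N (a + 𝔭 ^ N) := fun a => by simpa using inB_add_mul a N 1
  have hinv : ∀ z, f (z + 𝔭 ^ N) = f z := by
    by_contra! hne
    obtain ⟨z₀, hz₀⟩ := hne
    refine Nat.find_min hex (m := Nat.find hex - 1) (by omega) ⟨_, sub_mem (h.tr_mem (𝔭 ^ N) hf) hf,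
      fun h0 => hz₀ (sub_eq_zero.1 (congrFun h0 z₀)), min A N, N, fun z hz => ?_, fun a => ?_⟩
    · rw [Pi.sub_apply, tr_apply, hA z fun h' => hz (h'.mono (min_le_left _ _)), hA, sub_zero]
      intro h'
      exact hz ((h'.mono (min_le_left A N)).trans ((hb z).symm.mono (min_le_right A N)))
    · obtain ⟨Q, hQd, hQz⟩ := hQ a
      refine ⟨taylor (η (p ^ N)) Q - Q, ?_, fun z hz => ?_⟩
      · by_cases hQ0 : Q = 0
        · rw [hQ0, map_zero, sub_zero, degree_zero]; exact WithBot.bot_lt_coe _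
        refine (degree_taylor_sub_lt hQ0 _).trans_le ?_
        rw [degree_eq_natDegree hQ0] at hQd ⊢
        have : Q.natDegree < Nat.find hex := by exact_mod_cast hQd
        exact_mod_cast (by omega : Q.natDegree ≤ Nat.find hex - 1)
      · rw [Pi.sub_apply, tr_apply, hQz z hz, hQz _ (hz.trans (hb z)), eval_sub,
          taylor_eval, map_add]
  refine ⟨f, hf, hf0, A, N, hA, fun x y hxy => ?_⟩
  obtain ⟨Q, -, hQz⟩ := hQ x
  have hi : ∀ i : ℕ, f (x + i * 𝔭 ^ N) = f x := fun i => by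
    induction i with
    | zero => simp
    | succ i ih => rw [← ih, ← hinv (x + i * _)]; congr 1; push_cast; ring
  have hQC : Q = C (f x) := by
    refine eq_C_of_eval_add_mul (x := η x)
      (t := η (p ^ N)) ((_root_.map_ne_zero _).2 (zpow_ne_zero _ padic_p_ne_zero)) fun i => ?_
    rw [← hi i, hQz _ (inB_add_mul x N i), map_add, map_mul, map_natCast]
  rw [hQz y hxy, hQC, eval_C]

lemma inB_mul {u x y : ℚ_[p]} (hu : ‖u‖ ≤ 1) {R : ℤ} (h : InB x R y) : InB (u * x) R (u * y) := by
  rw [InB, ← mul_sub, norm_mul]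
  exact (mul_le_of_le_one_left (norm_nonneg _) hu).trans h

lemma sum_range_add_shift {f : ℚ_[p] → L} {R : ℤ} (hR : ∀ x y, InB x (R + 1) y → f x = f y)
    {t : ℚ_[p]} (ht : ‖t‖ = (p : ℝ) ^ (-R)) (x : ℚ_[p]) :
    ∑ i ∈ range p, f (x + 𝔭 ^ R + i * t) = ∑ i ∈ range p, f (x + i * t) := by
  have hp := p_pos p
  have ht0 : t ≠ 0 := by rw [← norm_ne_zero_iff, ht]; exact (zpow_pos hp _).ne'
  have h1 : ∀ x, ∑ i ∈ range p, f (x + t + i * t) = ∑ i ∈ range p, f (x + i * t) := by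
    intro x
    have h2 := (sum_range_succ (fun i : ℕ => f (x + i * t)) p).symm.trans
      (sum_range_succ' (fun i : ℕ => f (x + i * t)) p)
    rw [hR (x + (0 : ℕ) * t) (x + p * t)] at h2
    · rw [add_right_cancel h2]
      exact sum_congr rfl fun i _ => by congr 1; push_cast; ring
    · rw [InB, Nat.cast_zero, zero_mul, add_zero, add_sub_cancel_left, norm_mul, Padic.norm_p, ht,
        neg_add, zpow_add₀ hp.ne', zpow_neg_one, mul_comm]
  have h2 : ∀ j : ℕ, ∑ i ∈ range p, f (x + j * t + i * t) = ∑ i ∈ range p, f (x + i * t) := by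
    intro j
    induction j with
    | zero => simp
    | succ j ih =>
      rw [← ih, ← h1 (x + j * t)]
      exact sum_congr rfl fun i _ => by congr 1; push_cast; ring
  obtain ⟨j, -, hj⟩ := exists_nat_inB 1 (a := 𝔭 ^ R / t)
    (by rw [norm_div, norm_p_zpow, ht, div_self (zpow_pos hp _).ne'])
  rw [← h2 j]
  refine sum_congr rfl fun i _ => (hR _ _ ?_).symm
  rw [InB, show x + 𝔭 ^ R + i * t - (x + j * t + i * t) = t * (𝔭 ^ R / t - j) by
    field_simp; ring, norm_mul, ht, neg_add, zpow_add₀ hp.ne']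
  exact mul_le_mul_of_nonneg_left (by simpa [InB] using hj) (zpow_pos hp _).le

lemma norm_natCast_eq_one {i : ℕ} (h0 : 0 < i) (hi : i < p) : ‖(i : ℚ_[p])‖ = 1 := by
  refine le_antisymm (norm_int_le_one i) (not_lt.1 fun h => ?_)
  have := (norm_intCast_lt_one_iff (k := (i : ℤ))).1 (by exact_mod_cast h)
  exact absurd (Nat.le_of_dvd h0 (by exact_mod_cast this)) (by omega)

lemma norm_eq_of_inB {A : ℤ} {z : ℚ_[p]} (hzA : InB 0 A z) (hz : ¬InB 0 (A + 1) z) :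
    ‖z‖ = (p : ℝ) ^ (-A) := by
  refine le_antisymm (by simpa [InB] using hzA) ?_
  rw [not_inB_zero] at hz
  have hz0 : z ≠ 0 := by rintro rfl; rw [norm_zero] at hz; exact absurd hz (zpow_pos (p_pos p) _).not_gt
  rw [norm_eq_zpow_neg_valuation hz0] at hz ⊢
  have := (zpow_lt_zpow_iff_right₀ (one_lt_p p)).1 hz
  exact zpow_le_zpow_p.2 (by omega)

lemma Stab.exists_ball (h : Stab m q W) (D : ℕ) : ∀ (A : ℤ) (f : ℚ_[p] → L), f ∈ W → f ≠ 0 →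
    (∀ z, ¬InB 0 A z → f z = 0) → (∀ x y, InB x (A + D) y → f x = f y) →
    ∃ R : ℤ, (p : L) • ind p L 0 (R + 1) - ind p L 0 R ∈ W := by
  have := charZero_of_padic p L
  have hpL := p_ne p L
  have hp := p_pos p
  have hp1 := one_lt_p p
  have hpq := padic_p_ne_zero (p := p)
  induction D with
  | zero =>
    intro A f hf hf0 hA hR
    rw [Nat.cast_zero, add_zero] at hR
    have hfe : f = f 0 • ind p L 0 A := by
      funext z
      rw [Pi.smul_apply, smul_eq_mul]
      by_cases hz : InB 0 A z
      · rw [ind_of_inB hz, mul_one, hR 0 z hz]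
      · rw [ind_of_not_inB hz, mul_zero, hA z hz]
    have hf00 : f 0 ≠ 0 := fun h0 => hf0 (by rw [hfe, h0, zero_smul])
    have h1 : ind p L (0 : ℚ_[p]) A ∈ W := by
      have := W.smul_mem (f 0)⁻¹ hf
      rwa [hfe, Pi.smul_apply, ind_of_inB (InB.self 0 A), smul_eq_mul, mul_one, smul_smul,
        inv_mul_cancel₀ hf00, one_smul] at this
    have h2 := h.aff_mem 0 (𝔭 ^ (-1 : ℤ)) (zpow_ne_zero _ hpq) _ h1
    rw [aff_ind, add_zero, zero_mul, sub_neg_eq_add] at h2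
    exact ⟨A, sub_mem (W.smul_mem _ h2) h1⟩
  | succ D ih =>
    intro A f hf hf0 hA hR
    rw [Nat.cast_succ, ← add_assoc] at hR
    set s : ℚ_[p] := 𝔭 ^ (A + D) with hs
    by_cases hk : tr L s f - f = 0
    · refine ih A f hf hf0 hA fun x y hxy => ?_
      have hinv : ∀ (i : ℕ) x, f (x + i * s) = f x := fun i => by
        induction i with
        | zero => simp
        | succ i ih =>
          intro x
          rw [← ih x, ← sub_eq_zero.1 (congrFun hk (x + i * s)), tr_apply]
          congr 1; push_cast; ring
      obtain ⟨x', hx'⟩ := hxy.exists_padicInt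
      have := (inB_child_iff x' hx' _ (PadicInt.zmodRepr_lt_p x')).2 rfl
      rw [← hR _ _ this, hinv]
    obtain ⟨x₀, hx₀⟩ : ∃ x, (tr L s f - f) x ≠ 0 := by by_contra! h0; exact hk (funext h0)
    have hsA : ∀ x, InB x A (x + s) := fun x => by
      simpa using (inB_add_mul x (A + D) 1).mono (by omega : A ≤ A + D)
    have hx₀A : InB 0 A x₀ := by
      by_contra h0
      rw [Pi.sub_apply, tr_apply, hA _ h0, hA, sub_zero] at hx₀
      · exact hx₀ rfl
      · exact fun h' => h0 (h'.trans (hsA x₀).symm)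
    set g : ℚ_[p] → L := tr L x₀ (tr L s f - f) with hg
    have hgz : ∀ z, g z = f (z + x₀ + s) - f (z + x₀) := fun z => rfl
    have hgW : g ∈ W := h.tr_mem _ (sub_mem (h.tr_mem _ hf) hf)
    have hg0 : g 0 ≠ 0 := by rw [hg, tr_apply, zero_add]; exact hx₀
    have hgA : ∀ z, ¬InB 0 A z → g z = 0 := by
      intro z hz
      have h1 : ¬InB 0 A (z + x₀) := fun h' => hz (h'.trans (by
        rw [InB, norm_sub_rev, add_sub_cancel_left]; simpa [InB] using hx₀A))
      rw [hgz, hA _ h1, hA _ fun h' => h1 (h'.trans (hsA _).symm), sub_zero]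
    have hgR : ∀ x y, InB x (A + D + 1) y → g x = g y := by
      intro x y hxy
      rw [hgz, hgz, hR (x + x₀ + s) (y + x₀ + s), hR (x + x₀) (y + x₀)]
      · rw [InB, add_sub_add_right_eq_sub]; exact hxy
      · rw [InB, add_sub_add_right_eq_sub, add_sub_add_right_eq_sub]; exact hxy
    have hsum : ∀ z t : ℚ_[p], ‖t‖ = (p : ℝ) ^ (-(A + D)) → ∑ i ∈ range p, g (z + i * t) = 0 := by
      intro z t ht
      simp only [hgz, sum_sub_distrib]
      rw [sub_eq_zero]
      convert sum_range_add_shift hR ht (z + x₀) using 3 <;> ring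
    clear_value g
    clear hk hx₀ hf hf0 hA hR hgz
    rcases Nat.eq_zero_or_pos D with hD | hD
    · subst hD
      rw [Nat.cast_zero, add_zero] at hgR hsum
      have hF : ∑ i ∈ range (p - 1), aff L 0 ((i + 1 : ℕ) : ℚ_[p]) g ∈ W :=
        sum_mem fun i _ => h.aff_mem _ _ (Nat.cast_ne_zero.2 (by omega)) _ hgW
      refine ⟨A, ?_⟩
      convert W.smul_mem (g 0)⁻¹ hF using 1
      have hp2 := (Fact.out : p.Prime).two_le
      have hpp : p - 1 + 1 = p := by omega
      funext z
      simp only [Pi.sub_apply, Pi.smul_apply, Finset.sum_apply, aff_apply, sub_zero, smul_eq_mul]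
      by_cases hz : InB 0 (A + 1) z
      · rw [ind_of_inB hz, ind_of_inB (hz.mono (by omega)), sum_congr rfl (g := fun _ => g 0)]
        · rw [sum_const, card_range, nsmul_eq_mul, mul_left_comm, inv_mul_cancel₀ hg0]
          have := congrArg (Nat.cast : ℕ → L) hpp
          push_cast at this
          rw [← this]; ring
        · intro i _
          have h2 := inB_mul (u := ((i + 1 : ℕ) : ℚ_[p])) (norm_int_le_one ((i + 1 : ℕ) : ℤ)) hz
          rw [mul_zero] at h2
          exact (hgR _ _ h2).symm
      by_cases hzA : InB 0 A z
      · have hzn : ‖z‖ = (p : ℝ) ^ (-A) := norm_eq_of_inB hzA hz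
        have h3 := hsum 0 z hzn
        rw [show range p = range (p - 1 + 1) by rw [hpp], sum_range_succ'] at h3
        simp only [Nat.cast_zero, zero_mul, zero_add, add_zero] at h3
        rw [ind_of_not_inB hz, ind_of_inB hzA, eq_neg_of_add_eq_zero_left h3]
        field_simp
        ring
      · rw [ind_of_not_inB hz, ind_of_not_inB hzA, sum_eq_zero]
        · ring
        · intro i hi
          have hi := mem_range.1 hi
          refine hgA _ ?_
          rw [not_inB_zero] at hzA ⊢
          rwa [norm_mul, norm_natCast_eq_one (by omega) (by omega), one_mul]
    · have hu : ∀ i : ℕ, ‖(1 + i * 𝔭 ^ D : ℚ_[p])‖ = 1 := fun i => by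
        rw [norm_eq_of_add, norm_one]
        rw [norm_one, norm_mul, norm_pow, Padic.norm_p]
        refine (mul_le_of_le_one_left (by positivity) (norm_int_le_one (i : ℤ))).trans_lt ?_
        exact pow_lt_one₀ (by positivity) (inv_lt_one_of_one_lt₀ hp1) (by omega)
      have hF : ∑ i ∈ range p, aff L 0 (1 + i * 𝔭 ^ D : ℚ_[p]) g ∈ W :=
        sum_mem fun i _ => h.aff_mem _ _ (norm_ne_zero_iff.1 (by rw [hu i]; exact one_ne_zero)) _ hgW
      refine ih (A + 1) _ hF (fun h0 => ?_) (fun z hz => ?_) fun x y hxy => ?_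
      · have := congrFun h0 0
        simp only [Finset.sum_apply, aff_apply, mul_zero, sub_zero, sum_const, card_range,
          nsmul_eq_mul, Pi.zero_apply] at this
        exact mul_ne_zero hpL hg0 this
      · simp only [Finset.sum_apply, aff_apply, sub_zero]
        by_cases hzA : InB 0 A z
        · have hzn : ‖z‖ = (p : ℝ) ^ (-A) := norm_eq_of_inB hzA hz
          rw [← hsum z (𝔭 ^ D * z)]
          · exact sum_congr rfl fun i _ => by congr 1; ring
          · rw [norm_mul, hzn, norm_pow, Padic.norm_p, neg_add, zpow_add₀ hp.ne', mul_comm, zpow_neg _ (D : ℤ),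
              zpow_natCast, inv_pow]
        · refine sum_eq_zero fun i _ => hgA _ ?_
          rw [not_inB_zero] at hzA ⊢
          rwa [norm_mul, hu i, one_mul]
      · simp only [Finset.sum_apply, aff_apply, sub_zero]
        exact sum_congr rfl fun i _ => hgR _ _ (inB_mul (hu i).le (by
          rwa [show A + D + 1 = A + 1 + D by ring]))

lemma Stab.sibling (h : Stab m q W) (hW : W ≠ ⊥) {a b : ℚ_[p]} {n : ℤ} (hab : InB a n b) :
    ind p L a (n + 1) - ind p L b (n + 1) ∈ W := by
  have hpL := p_ne p L
  obtain ⟨f, hf, hf0, A, R, hA, hR⟩ := h.exists_locConst hW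
  obtain ⟨R', hR'⟩ := h.exists_ball (R - A).toNat A f hf hf0 hA fun x y hxy => hR x y (hxy.mono (by omega))
  have key : ∀ c, (p : L) • ind p L c (n + 1) - ind p L c n ∈ W := fun c => by
    have := h.aff_mem (c * 𝔭 ^ (R' - n)) (𝔭 ^ (R' - n)) (zpow_ne_zero _ padic_p_ne_zero) _ hR'
    rwa [map_sub, map_smul, aff_ind, aff_ind, zero_add, mul_assoc, ← zpow_add₀ padic_p_ne_zero,
      add_neg_cancel, zpow_zero, mul_one, show R' + 1 - (R' - n) = n + 1 by ring, sub_sub_cancel] at this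
  have := W.smul_mem (p : L)⁻¹ (sub_mem (key a) (key b))
  rwa [ind_congr hab, sub_sub_sub_cancel_right, ← smul_sub, smul_smul, inv_mul_cancel₀ hpL, one_smul] at this

lemma Stab.q1' (h : Stab m q W) : (1 - q⁻¹ : L) ≠ 0 := fun h0 =>
  h.q1 (inv_eq_one.1 (sub_eq_zero.1 h0).symm)

/-- It suffices to know the multiple of `χ` by the top power when `χ` is invariant. -/
lemma Stab.pev_mem (h : Stab m q W) {b : ℚ_[p]} (hb : b ≠ 0) {χ : ℚ_[p] → L} (hχ : tr L b χ = χ)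
    (hX : pev p (X ^ m) χ ∈ W) {P : L[X]} (hP : P.natDegree ≤ m) : pev p P χ ∈ W := by
  have := charZero_of_padic p L
  refine mem_of_taylor_mem (M := W.comap ((pev p).flip χ)) (b := η b)
    ((_root_.map_ne_zero _).2 hb) hX (fun P hP => ?_) hP
  have := h.tr_mem b hP
  rwa [LinearMap.flip_apply, tr_pev, hχ] at this

lemma inB_inv {u z : ℚ_[p]} (hu : ‖u‖ = 1) {n : ℤ} (hn : 0 < n) (h : InB u n z) :
    ‖z‖ = 1 ∧ InB u⁻¹ n z⁻¹ := by
  have hlt : ‖z - u‖ < ‖u‖ := by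
    rw [hu]; exact h.trans_lt (zpow_lt_one_of_neg₀ (one_lt_p p) (by omega))
  have hz : ‖z‖ = 1 := by
    have := norm_eq_of_add hlt
    rwa [add_sub_cancel, hu] at this
  refine ⟨hz, ?_⟩
  have hz0 : z ≠ 0 := by rw [← norm_ne_zero_iff, hz]; exact one_ne_zero
  have hu0 : u ≠ 0 := by rw [← norm_ne_zero_iff, hu]; exact one_ne_zero
  rw [InB, inv_sub_inv hz0 hu0, norm_div, norm_mul, hz, hu, mul_one, div_one, norm_sub_rev]
  exact h

lemma ind_inv {u z : ℚ_[p]} (hu : ‖u‖ = 1) {n : ℤ} (hn : 0 < n) :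
    q ^ z.valuation * η z ^ m * ind p L u⁻¹ n z⁻¹ =
      η z ^ m * ind p L u n z := by
  by_cases hz : InB u n z
  · obtain ⟨h1, h2⟩ := inB_inv hu hn hz
    rw [ind_of_inB hz, ind_of_inB h2, valuation_eq_of_norm_eq one_ne_zero (h1.trans norm_one.symm)]
    simp
  · rw [ind_of_not_inB hz, ind_of_not_inB]
    · ring
    · intro h'
      have := (inB_inv (by rw [norm_inv, hu, inv_one]) hn h').2
      rw [inv_inv, inv_inv] at this
      exact hz this

lemma Stab.pev_sibling_one (h : Stab m q W) (hW : W ≠ ⊥) {P : L[X]} (hP : P.natDegree ≤ m) :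
    pev p P (ind p L 1 2 - ind p L (1 + p : ℚ_[p]) 2) ∈ W := by
  have hp := p_pos p
  have hpq := padic_p_ne_zero (p := p)
  have hu : ‖(1 + p : ℚ_[p])‖ = 1 := by
    rw [norm_eq_of_add, norm_one]
    rw [norm_one, Padic.norm_p]; exact inv_lt_one_of_one_lt₀ (one_lt_p p)
  have h0 : InB (1 : ℚ_[p])⁻¹ 1 (1 + p : ℚ_[p])⁻¹ := by
    have hu0 : (1 + p : ℚ_[p]) ≠ 0 := by rw [← norm_ne_zero_iff, hu]; exact one_ne_zero
    refine (inB_inv norm_one one_pos ?_).2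
    rw [InB, add_sub_cancel_left, Padic.norm_p, zpow_neg_one]
  obtain ⟨g, hg, hgz⟩ := h.inv_mem _ (h.sibling hW h0)
  refine h.pev_mem (b := 𝔭 ^ (2 : ℤ)) (zpow_ne_zero _ hpq) ?_ ?_ hP
  · rw [map_sub, tr_ind_self, tr_ind_self] <;> rw [norm_p_zpow]
  · have hge := eq_of_mem_Vsp (g := pev p (X ^ m) (ind p L 1 2 - ind p L (1 + p : ℚ_[p]) 2))
      h.q0 (h.le hg) ?_ fun z hz => ?_
    · rwa [← hge]
    · have hX : (X ^ m : L[X]).natDegree ≤ m := natDegree_X_pow_le m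
      rw [map_sub]
      exact sub_mem (pev_ind_mem h.q0 h.q1' hX _ _) (pev_ind_mem h.q0 h.q1' hX _ _)
    · rw [hgz z hz, Pi.sub_apply, mul_sub, show (1 : ℤ) + 1 = 2 by norm_num, ind_inv norm_one two_pos,
        ind_inv hu two_pos, pev_apply, Pi.sub_apply, mul_sub, eval_pow, eval_X]

lemma Stab.pev_sibling (h : Stab m q W) (hW : W ≠ ⊥) {P : L[X]} (hP : P.natDegree ≤ m) {b : ℚ_[p]}
    {n : ℤ} (hb : ‖b‖ = (p : ℝ) ^ (-n)) : pev p P (ind p L 0 (n + 1) - ind p L b (n + 1)) ∈ W := by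
  have hp := p_pos p
  have hpq := padic_p_ne_zero (p := p)
  have hpL := p_ne p L
  have hb0 : b ≠ 0 := by rw [← norm_ne_zero_iff, hb]; exact (zpow_pos hp _).ne'
  have hbL : η b ≠ 0 := (_root_.map_ne_zero _).2 hb0
  have h1 := h.aff_mem (-1) (p / b) (div_ne_zero hpq hb0) _ (h.pev_sibling_one hW
    (P := P.comp (C (η (b / p)) * X - C (η (b / p))))
    ((natDegree_comp_affine_le _ _ _).trans hP))
  have key : ∀ c z : ℚ_[p], ind p L (1 + c * 𝔭 / b) 2 (𝔭 / b * z - -1) = ind p L c (n + 1) z := fun c z => by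
    have : InB (1 + c * 𝔭 / b) 2 (𝔭 / b * z - -1) ↔ InB c (n + 1) z := by
      rw [InB, InB, show 𝔭 / b * z - -1 - (1 + c * p / b) = p / b * (z - c) by ring, norm_mul,
        norm_div, Padic.norm_p, hb, show (p : ℝ)⁻¹ / p ^ (-n) = p ^ (n - 1) by
          rw [zpow_neg, div_inv_eq_mul, zpow_sub_one₀ hp.ne', mul_comm],
        show (-2 : ℤ) = (n - 1) + -(n + 1) by ring, zpow_add₀ hp.ne']
      exact mul_le_mul_iff_right₀ (zpow_pos hp _)
    rw [ind, ind]; simp only [this]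
  convert h1 using 1
  funext z
  have k0 := key 0 z
  have k1 := key b z
  rw [zero_mul, zero_div, add_zero] at k0
  rw [mul_div_cancel_left₀ _ hb0] at k1
  rw [aff_apply, pev_apply, pev_apply, Pi.sub_apply, Pi.sub_apply, k0, k1]
  congr 1
  simp only [eval_comp, eval_sub, eval_mul, eval_C, eval_X, map_sub, map_mul, map_div₀, map_natCast,
    map_neg, map_one]
  congr 1
  field_simp
  ring

lemma Stab.pev_ball (h : Stab m q W) (hW : W ≠ ⊥) {P : L[X]} (hP : P.natDegree ≤ m) (n : ℕ) :
    pev p P (ind p L 0 0) - (p : L) ^ n • pev p P (ind p L 0 n) ∈ W := by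
  induction n with
  | zero => simp
  | succ n ih =>
    have h1 : pev p P (ind p L 0 n) - (p : L) • pev p P (ind p L 0 (n + 1)) ∈ W := by
      rw [ind_eq_sum, map_sum, show ((p : L) • pev p P (ind p L (0 : ℚ_[p]) (n + 1))) =
        ∑ i ∈ range p, pev p P (ind p L (0 : ℚ_[p]) (n + 1)) by
          rw [sum_const, card_range, Nat.cast_smul_eq_nsmul], ← sum_sub_distrib]
      refine sum_mem fun i hi => ?_
      rcases Nat.eq_zero_or_pos i with rfl | hi0
      · simp
      rw [← neg_sub, ← map_sub, zero_add]
      refine neg_mem (h.pev_sibling hW hP ?_)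
      rw [norm_mul, norm_natCast_eq_one hi0 (mem_range.1 hi), one_mul, norm_p_zpow]
    have h2 := add_mem ih (W.smul_mem ((p : L) ^ n) h1)
    rwa [smul_sub, sub_add_sub_cancel, smul_smul, ← pow_succ, ← Nat.cast_succ] at h2

/-- A nonzero stable space containing `zᵐ` on the unit ball is everything. -/
lemma Stab.eq_Vsp (h : Stab m q W) (hX : pev p (X ^ m) (ind p L 0 0) ∈ W) : Vsp p m q ≤ W := by
  have hpq := padic_p_ne_zero (p := p)
  have h1 : ind p L (0 : ℚ_[p]) 1 ∈ W := by
    have h2 := h.pev_mem (b := 1) one_ne_zero (tr_ind_self 0 (by simp)) hX (P := 1) (by simp)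
    have h3 := h.aff_mem 0 (𝔭 ^ (-1 : ℤ)) (zpow_ne_zero _ hpq) _ h2
    rw [show pev p (1 : L[X]) (ind p L 0 0) = ind p L 0 0 by ext z; simp [pev_apply], aff_ind] at h3
    simpa using h3
  obtain ⟨g, hg, hgz⟩ := h.inv_mem _ h1
  have h2 : g = pev p (X ^ m) (phi p q 0 0) - pev p (X ^ m) (ind p L 0 0) := by
    refine eq_of_mem_Vsp h.q0 (h.le hg) (sub_mem (pev_phi_mem (natDegree_X_pow_le m) _ _)
      (pev_ind_mem h.q0 h.q1' (natDegree_X_pow_le m) _ _)) fun z hz => ?_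
    have hv := norm_eq_zpow_neg_valuation hz
    have hi : InB (0 : ℚ_[p]) 1 z⁻¹ ↔ ¬InB 0 0 z := by
      rw [InB, not_inB_zero, sub_zero, norm_inv, hv, neg_zero, ← zpow_neg, neg_neg, zpow_le_zpow_p,
        zpow_lt_zpow_iff_right₀ (one_lt_p p)]
      omega
    rw [hgz z hz, Pi.sub_apply, pev_apply, pev_apply, eval_pow, eval_X]
    by_cases hz1 : InB 0 0 z
    · rw [ind_of_not_inB (fun h' => hi.1 h' hz1), ind_of_inB hz1, phi_of_inB hz1]; ring
    · rw [ind_of_inB (hi.2 hz1), ind_of_not_inB hz1, phi_of_not_inB hz1, sub_zero, sub_zero]; ring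
  have h3 : pev p (X ^ m) (phi p q 0 0) ∈ W := by
    have := add_mem hg hX
    rwa [h2, sub_add_cancel] at this
  refine span_le.2 ?_
  rintro _ ⟨P, a, n, hP, rfl⟩
  have hpn : 𝔭 ^ n ≠ 0 := zpow_ne_zero _ hpq
  have h4 := h.pev_mem (b := 1) one_ne_zero (tr_phi_self q 0 (by simp)) h3
    (P := P.comp (C (η (p ^ n)) * X - C (η (-a))))
    ((natDegree_comp_affine_le _ _ _).trans hP)
  have h5 := h.aff_mem (a * p ^ (-n)) (𝔭 ^ (-n)) (zpow_ne_zero _ hpq) _ h4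
  rw [aff_pev, aff_phi, neg_neg, zero_add, mul_assoc, zpow_neg, inv_mul_cancel₀ hpn, mul_one,
    zero_sub, neg_neg] at h5
  rw [comp_assoc] at h5
  have hpL : η (p ^ n) ≠ 0 := (_root_.map_ne_zero _).2 hpn
  have hcomp : (C (η (𝔭 ^ n)) * X - C (η (-a)) : L[X]).comp
      (C (η (𝔭 ^ n)⁻¹) * X -
        C (η (a * (𝔭 ^ n)⁻¹))) = X := by
    simp only [sub_comp, mul_comp, C_comp, X_comp, map_neg, map_mul, map_inv₀]
    rw [mul_sub, ← mul_assoc, ← C_mul, mul_inv_cancel₀ hpL, mul_left_comm, ← C_mul,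
      mul_inv_cancel₀ hpL]
    simp
  rwa [hcomp, comp_X] at h5

end Generation

section NoLine

variable [IsUltrametricDist L] [ProperSpace L]

variable (p m α β) in
/-- The largest subspace contained in the lattice. -/
def linePart : Submodule L (ℚ_[p] → L) where
  carrier := {f | ∀ c : L, c • f ∈ Tht p m α β}
  add_mem' hf hg c := by rw [smul_add]; exact add_mem (hf c) (hg c)
  zero_mem' c := by rw [smul_zero]; exact zero_mem _
  smul_mem' d f hf c := by rw [smul_smul]; exact hf _

lemma linePart_le : linePart p m α β ≤ Vsp p m 𝔮 := fun f hf => by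
  have := Tht_le_Vsp (hf 1)
  rwa [one_smul] at this

lemma Par.stab_linePart (h : Par p m α β) : Stab m 𝔮 (linePart p m α β) where
  q0 := h.qq_ne_zero
  q1 := h.qq_ne_one
  le := linePart_le
  aff_mem b d hd f hf c := by
    have := h.aff_mem_Tht b hd (hf (α ^ d.valuation * c))
    rwa [map_smul, smul_smul, ← mul_assoc, ← zpow_add₀ h.a_ne, neg_add_cancel, zpow_zero, one_mul] at this
  inv_mem f hf := by
    have hk : m + 2 - 2 = m := by omega
    have hdet : (!![0, 1; 1, 0] : Matrix (Fin 2) (Fin 2) ℚ_[p]).det = -1 := by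
      rw [Matrix.det_fin_two_of]; ring
    have hd : (!![0, 1; 1, 0] : Matrix (Fin 2) (Fin 2) ℚ_[p]).det ≠ 0 := by
      rw [hdet]; exact neg_ne_zero.2 one_ne_zero
    refine ⟨(-1 : L) ^ m • gAct p L (m + 2) α β !![0, 1; 1, 0] f, smul_mem _ _ fun c => ?_,
      fun z hz => ?_⟩
    · rw [← h.gAct_smul hk hd c (linePart_le hf)]; exact h.gAct_mem_Tht hk hd (hf c)
    · have hv : (-z).valuation = z.valuation := valuation_eq_of_norm_eq hz (norm_neg z)
      have hv1 : (-1 : ℚ_[p]).valuation = 0 := by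
        rw [valuation_eq_of_norm_eq one_ne_zero (norm_neg 1)]; simp
      rw [Pi.smul_apply, smul_eq_mul, gAct]
      simp [det2, hz, hv, hv1, qq, iotaL]
      rw [show (-1 : L) ^ m * ((α * p / β) ^ z.valuation * (-η z) ^ m * f z⁻¹) =
        (α * p / β) ^ z.valuation * ((-1 : L) ^ m * (-η z) ^ m) * f z⁻¹ by ring,
        ← mul_pow, neg_one_mul, neg_neg]

lemma Par.linePart_eq_bot (h : Par p m α β) : linePart p m α β = ⊥ := by
  have hp := p_pos p
  have hpL := p_ne p L
  have hS := h.stab_linePart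
  by_contra hW
  obtain ⟨v, hv, c, hc⟩ := h.exists_not_mem_Tht
  refine hc (hS.eq_Vsp (fun c => ?_) hv c)
  have hX : (X ^ m : L[X]).natDegree ≤ m := natDegree_X_pow_le m
  set f := pev p (X ^ m) (ind p L 0 0) with hf
  obtain ⟨c₀, hc₀, hc₀f⟩ := h.exists_smul_mem_Tht (pev_ind_mem h.qq_ne_zero hS.q1' hX 0 0)
  have hx : ∀ n : ℕ, c • f ∈ Tht p m α β ∨ 1 < ‖c * c₀⁻¹‖ * ‖β‖ ^ n := by
    intro n
    by_contra! hn
    refine hn.1 ?_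
    have h1 := h.aff_mem_Tht 0 (d := 𝔭 ^ (-n : ℤ)) (zpow_ne_zero _ padic_p_ne_zero) hc₀f
    rw [map_smul, valuation_zpow, valuation_p, mul_one, neg_neg, zpow_natCast] at h1
    have h2 : (p : L) ^ n • pev p (X ^ m) (ind p L 0 n) =
        ((p : L) ^ (m + 1)) ^ n • aff L 0 (𝔭 ^ (-n : ℤ)) f := by
      rw [hf, aff_pev, aff_ind, add_zero, zero_mul, sub_neg_eq_add, zero_add]
      funext z
      simp only [Pi.smul_apply, pev_apply, smul_eq_mul, eval_pow, eval_comp,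
        eval_mul, eval_C, eval_X, map_zero,
        sub_zero, zpow_neg, zpow_natCast, map_inv₀, map_pow, map_natCast]
      rw [show ((p : L) ^ (m + 1)) ^ n = (p : L) ^ n * ((p : L) ^ n) ^ m by ring, mul_pow, inv_pow,
        mul_assoc, ← mul_assoc (((p : L) ^ n) ^ m), ← mul_assoc (((p : L) ^ n) ^ m),
        mul_inv_cancel₀ (pow_ne_zero _ (pow_ne_zero _ hpL)), one_mul]
    have h4 := smul_mem_Tht (c := c * ((p : L) ^ (m + 1)) ^ n * (α ^ n)⁻¹ * c₀⁻¹) ?_ h1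
    · have h5 := add_mem (hS.pev_ball hW hX n c) h4
      rw [← hf, h2] at h5
      convert h5 using 1
      simp only [smul_sub, smul_smul]
      have := pow_ne_zero n h.a_ne
      rw [show c * ((p : L) ^ (m + 1)) ^ n * (α ^ n)⁻¹ * c₀⁻¹ * (α ^ n * c₀) = c * ((p : L) ^ (m + 1)) ^ n by
        field_simp, sub_add_cancel]
    · have h6 : ‖((p : L) ^ (m + 1)) ^ n * (α ^ n)⁻¹‖ = ‖β‖ ^ n := by
        rw [← inv_pow, ← mul_pow, norm_pow, norm_mul, norm_pow, norm_inv, norm_p, inv_pow, ← h.mul]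
        have := norm_pos_iff.2 h.a_ne
        field_simp
      rw [mul_assoc c, mul_right_comm, norm_mul, h6]
      exact hn.2
  have hlim : Tendsto (fun n : ℕ => ‖c * c₀⁻¹‖ * ‖β‖ ^ n) atTop (𝓝 0) := by
    simpa using (tendsto_pow_atTop_nhds_zero_of_lt_one (norm_nonneg _) h.b_lt).const_mul ‖c * c₀⁻¹‖
  obtain ⟨n, hn⟩ := (hlim.eventually (gt_mem_nhds one_pos)).exists
  exact (hx n).resolve_right hn.not_gt

end NoLine

lemma Par.exists_lattice [IsUltrametricDist L] [ProperSpace L] (h : Par p m α β) {k : ℕ}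
    (hk : k - 2 = m) : ∃ Λ : Set (ℚ_[p] → L), IsLatticeStable p L k α β Λ := by
  refine ⟨Tht p m α β, ?_⟩
  simp only [IsLatticeStable, h.piRep_eq hk, SetLike.mem_coe]
  refine ⟨fun f hf => Tht_le_Vsp hf, zero_mem _, fun f hf g hg => add_mem hf hg,
    fun c hc f hf => smul_mem_Tht hc hf, fun f hf => h.exists_smul_mem_Tht hf, fun f _ hf0 hf => ?_,
    fun g hg f hf => ?_⟩
  · have h1 : f ∈ linePart p m α β := hf
    rw [h.linePart_eq_bot] at h1
    exact hf0 h1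
  · exact h.gAct_mem_Tht hk (by rw [det_eq]; exact hg) hf

lemma norm_lt_one_of_valL_pos {x : L} (hx : 0 < valL p L x) : x ≠ 0 ∧ ‖x‖ < 1 := by
  have hp := one_lt_p p
  have h0 : x ≠ 0 := by rintro rfl; simp [valL] at hx
  refine ⟨h0, ?_⟩
  rw [valL, neg_pos] at hx
  exact (Real.logb_neg_iff hp (norm_pos_iff.2 h0)).1 hx

lemma norm_mul_of_valL {x y : L} (hx : x ≠ 0) (hy : y ≠ 0)
    (h : valL p L x + valL p L y = (m : ℝ) + 1) : ‖x‖ * ‖y‖ = ((p : ℝ) ^ (m + 1))⁻¹ := by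
  have hp := one_lt_p p
  have hx' := norm_pos_iff.2 hx
  have hy' := norm_pos_iff.2 hy
  rw [valL, valL, ← neg_add, ← Real.logb_mul hx'.ne' hy'.ne', neg_eq_iff_eq_neg,
    Real.logb_eq_iff_rpow_eq (p_pos p) hp.ne' (mul_pos hx' hy')] at h
  rw [← h, Real.rpow_neg (p_pos p).le, ← Nat.cast_succ, Real.rpow_natCast]

lemma Par.of_hyps {k : ℕ} (h : Hyps p L k α β) : Par p (k - 2) α β := by
  obtain ⟨hk, hne, ha, hb, hab, hle⟩ := h
  obtain ⟨ha0, ha1⟩ := norm_lt_one_of_valL_pos ha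
  obtain ⟨hb0, hb1⟩ := norm_lt_one_of_valL_pos hb
  refine ⟨ha0, hb0, ha1, hb1, norm_mul_of_valL ha0 hb0 (hab.trans ?_), hne, fun hq => ?_⟩
  · rw [Nat.cast_sub hk]; push_cast; ring
  · have h1 : ‖α‖ ≤ ‖β‖ := by
      rw [valL, valL, neg_le_neg_iff] at hle
      exact (Real.logb_le_logb (one_lt_p p) (norm_pos_iff.2 ha0) (norm_pos_iff.2 hb0)).1 hle
    have h2 : ‖α‖ * (p : ℝ)⁻¹ = ‖β‖ := by rw [← hq, norm_mul, norm_p]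
    have h3 : (p : ℝ)⁻¹ < 1 := inv_lt_one_of_one_lt₀ (one_lt_p p)
    nlinarith [norm_pos_iff.2 ha0]

lemma Par.symm (h : Par p m α β) (hne : α ≠ p * β) : Par p m β α :=
  ⟨h.b_ne, h.a_ne, h.b_lt, h.a_lt, (mul_comm _ _).trans h.mul, h.ne.symm,
    fun hq => hne (hq.symm.trans (mul_comm _ _))⟩

end PadicPi

namespace Paper

/-- If `α ≠ pβ`, then `π(α)` (resp. `π(β)`) possesses `GL₂(ℚ_p)`-stable
`𝒪_L`-lattices and any two such lattices are commensurable; if `α = pβ` the same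
holds for `π(α)`. -/
theorem statement15 (p : ℕ) [Fact p.Prime] (L : Type) [NontriviallyNormedField L]
    [NormedAlgebra ℚ_[p] L] [FiniteDimensional ℚ_[p] L] [IsUltrametricDist L]
    (k : ℕ) (α β : L) (h : Hyps p L k α β) :
    (α ≠ (p : L) * β →
      ((∃ Λ : Set (ℚ_[p] → L), IsLatticeStable p L k α β Λ) ∧
        (∀ Λ₁ Λ₂ : Set (ℚ_[p] → L), IsLatticeStable p L k α β Λ₁ →
          IsLatticeStable p L k α β Λ₂ → Commensurable' p L Λ₁ Λ₂)) ∧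
      ((∃ Λ : Set (ℚ_[p] → L), IsLatticeStable p L k β α Λ) ∧
        (∀ Λ₁ Λ₂ : Set (ℚ_[p] → L), IsLatticeStable p L k β α Λ₁ →
          IsLatticeStable p L k β α Λ₂ → Commensurable' p L Λ₁ Λ₂))) ∧
    (α = (p : L) * β →
      (∃ Λ : Set (ℚ_[p] → L), IsLatticeStable p L k α β Λ) ∧
        (∀ Λ₁ Λ₂ : Set (ℚ_[p] → L), IsLatticeStable p L k α β Λ₁ →
          IsLatticeStable p L k α β Λ₂ → Commensurable' p L Λ₁ Λ₂)) := by
  have := FiniteDimensional.proper ℚ_[p] L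
  have hP := PadicPi.Par.of_hyps h
  refine ⟨fun hne => ⟨⟨hP.exists_lattice rfl, fun _ _ => hP.commensurable rfl⟩,
    (hP.symm hne).exists_lattice rfl, fun _ _ => (hP.symm hne).commensurable rfl⟩,
    fun _ => ⟨hP.exists_lattice rfl, fun _ _ => hP.commensurable rfl⟩⟩

end Paper

end
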